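/- (Corollary 4.3: multiplicative, scale-invariant transfer-of-regularity estimate.) Let p ∈ (Q/(Q−1), ∞) and define q ∈ (1,∞) by 1/q = 1/p + 1/Q. There exists a constant C = C(d,p) > 0 such that for every f ∈ 𝒮(ℝ^{1+2d}) satisfying (∂_t + v·∇_x) f = ∇_v · S_0 + S_1 pointwise on ℝ^{1+2d}, with S_0 ∈ 𝒮(ℝ^{1+2d}; ℝ^d) and S_1 ∈ 𝒮(ℝ^{1+2d}), one has ‖𝔇_x f‖_{L^p(ℝ^{1+2d})} ≤ C ( ‖∇_v f‖_{L^p}^{2/3} ‖S_0‖_{L^p}^{1/3} + ‖∇_v f‖_{L^p}^{(5d+1)/(3(3d+1))} ‖S_1‖_{L^q}^{2(2d+1)/(3(3d+1))} ). -/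

import Mathlib

open MeasureTheory Real ENNReal
open scoped RealInnerProductSpace

noncomputable section

/-- Euclidean space `ℝ^d`. -/
abbrev V (d : ℕ) : Type := EuclideanSpace ℝ (Fin d)

/-- The kinetic phase space `ℝ^{1+2d}`, with points `(t, x, v)`. -/
abbrev Pt (d : ℕ) : Type := ℝ × V d × V d

/-- Kinetic composition `(t,x,v) ∘ (s,y,w) = (t+s, x+y+s v, v+w)`. -/
def kmul {d : ℕ} (a b : Pt d) : Pt d :=
  (a.1 + b.1, a.2.1 + b.2.1 + b.1 • a.2.2, a.2.2 + b.2.2)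

/-- Kinetic inverse `(t,x,v)⁻¹ = (−t, −x+t v, −v)`. -/
def kinv {d : ℕ} (a : Pt d) : Pt d :=
  (-a.1, -a.2.1 + a.1 • a.2.2, -a.2.2)

/-- `g₁(r) = r³ sin(log r)`, extended by `0` at `r = 0`. -/
def g1 (r : ℝ) : ℝ := r ^ 3 * Real.sin (Real.log r)

/-- `g₂(r) = r³ cos(log r)`, extended by `0` at `r = 0`. -/
def g2 (r : ℝ) : ℝ := r ^ 3 * Real.cos (Real.log r)

/-- `ġ₁(r)/(2r) = (r/2)(3 sin(log r) + cos(log r))`, extended by `0` at `r = 0`. -/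
def h1 (r : ℝ) : ℝ := r / 2 * (3 * Real.sin (Real.log r) + Real.cos (Real.log r))

/-- `ġ₂(r)/(2r) = (r/2)(3 cos(log r) − sin(log r))`, extended by `0` at `r = 0`. -/
def h2 (r : ℝ) : ℝ := r / 2 * (3 * Real.cos (Real.log r) - Real.sin (Real.log r))

/-- The matrix `W(r)`, recorded through its scalar block entries as a `2×2` real matrix;
the full `2d×2d` matrix is the blockwise tensor with `Id_d`. -/
def Wm (r : ℝ) : Matrix (Fin 2) (Fin 2) ℝ := !![g1 r, g2 r; h1 r, h2 r]

/-- The matrix `D_δ` (scalar block entries). -/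
def Dm (δ : ℝ) : Matrix (Fin 2) (Fin 2) ℝ := !![δ, 0; 0, 1]

/-- The matrix `E_δ(r)` (scalar block entries). -/
def Em (δ r : ℝ) : Matrix (Fin 2) (Fin 2) ℝ := !![1, δ * r ^ 2; 0, 1]

/-- `A_{m₀}(r) = D_{m₀} W(r) D_{m₀}⁻¹` (scalar block entries). -/
def Am (m0 r : ℝ) : Matrix (Fin 2) (Fin 2) ℝ := Dm m0 * Wm r * (Dm m0)⁻¹

/-- The action on `ℝ^d × ℝ^d` of a `2×2` block matrix whose blocks are the scalar
multiples of `Id_d` given by the entries of `M`. -/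
def act {d : ℕ} (M : Matrix (Fin 2) (Fin 2) ℝ) (p : V d × V d) : V d × V d :=
  (M 0 0 • p.1 + M 0 1 • p.2, M 1 0 • p.1 + M 1 1 • p.2)

/-- The kinetic trajectory `γ^m(r; (t,x,v))`. -/
def gammaK {d : ℕ} (m : Pt d) (z : Pt d) (r : ℝ) : Pt d :=
  (z.1 + m.1 * r ^ 2,
   (act (Em m.1 r) (z.2.1, z.2.2) + act (Am m.1 r) (m.2.1, m.2.2)).1,
   (act (Em m.1 r) (z.2.1, z.2.2) + act (Am m.1 r) (m.2.1, m.2.2)).2)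

/-- Build a vector of `ℝ^d` from components. -/
def mkV {d : ℕ} (f : Fin d → ℝ) : V d := (EuclideanSpace.equiv (Fin d) ℝ).symm f

/-- The argument `(s/r², A_{s/r²}(r)⁻¹ (y,w)ᵀ)` fed into `ψ`. -/
def psiArg {d : ℕ} (r : ℝ) (m : Pt d) : Pt d :=
  (m.1 / r ^ 2,
   (act ((Am (m.1 / r ^ 2) r)⁻¹) (m.2.1, m.2.2)).1,
   (act ((Am (m.1 / r ^ 2) r)⁻¹) (m.2.1, m.2.2)).2)

/-- The mollification kernel `K_r(s,y,w) = 2^d r^{−Q} ψ(s/r², A_{s/r²}(r)⁻¹(y,w)ᵀ)`,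
with `Q = 4d+2`. -/
def Kker {d : ℕ} (ψ : Pt d → ℝ) (r : ℝ) (m : Pt d) : ℝ :=
  2 ^ d * r ^ (-(4 * (d : ℤ) + 2)) * ψ (psiArg r m)

/-- The kernel `K̃_r(s,y,w) = −2^{d+1} s r^{−Q−1} ψ(s/r², A_{s/r²}(r)⁻¹(y,w)ᵀ)`. -/
def Ktil {d : ℕ} (ψ : Pt d → ℝ) (r : ℝ) (m : Pt d) : ℝ :=
  -(2 ^ (d + 1)) * m.1 * r ^ (-(4 * (d : ℤ) + 2) - 1) * ψ (psiArg r m)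

/-- First coefficient of the forcing matrix `F_{m₀}(r)`: `(1/m₀) ∂_r (ġ₁(r)/(2r))`. -/
def F1 (m0 r : ℝ) : ℝ := (1 / m0) * deriv h1 r

/-- Second coefficient of the forcing matrix `F_{m₀}(r)`: `∂_r (ġ₂(r)/(2r))`. -/
def F2 (r : ℝ) : ℝ := deriv h2 r

/-- The kernel `K⃗_r(s,y,w) = −2^d r^{−Q} ψ(⋯) F_{s/r²}(r) A_{s/r²}(r)⁻¹ (y,w)ᵀ ∈ ℝ^d`. -/
def Kvec {d : ℕ} (ψ : Pt d → ℝ) (r : ℝ) (m : Pt d) : V d :=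
  (-(2 ^ d) * r ^ (-(4 * (d : ℤ) + 2)) * ψ (psiArg r m)) •
    (F1 (m.1 / r ^ 2) r • (act ((Am (m.1 / r ^ 2) r)⁻¹) (m.2.1, m.2.2)).1 +
      F2 r • (act ((Am (m.1 / r ^ 2) r)⁻¹) (m.2.1, m.2.2)).2)

/-- The gradient of `u : ℝ^{1+2d} → ℝ` in the `x`-variables (the `m₁` block). -/
def gradX {d : ℕ} (u : Pt d → ℝ) (z : Pt d) : V d :=
  mkV fun i => fderiv ℝ u z (0, EuclideanSpace.single i 1, 0)

/-- The gradient of `u : ℝ^{1+2d} → ℝ` in the `v`-variables (the `m₂` block). -/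
def gradV {d : ℕ} (u : Pt d → ℝ) (z : Pt d) : V d :=
  mkV fun i => fderiv ℝ u z (0, 0, EuclideanSpace.single i 1)

/-- The kernel `K⃗^π_r(s,y,w)
  = 2^{d+1} s r^{−Q−1} [(A_{s/r²}(r)⁻¹)_{·;2}]ᵀ [∇_{(m₁,m₂)}ψ](⋯) ∈ ℝ^d`. -/
def Kpi {d : ℕ} (ψ : Pt d → ℝ) (r : ℝ) (m : Pt d) : V d :=
  (2 ^ (d + 1) * m.1 * r ^ (-(4 * (d : ℤ) + 2) - 1)) •
    ((Am (m.1 / r ^ 2) r)⁻¹ 0 1 • gradX ψ (psiArg r m) +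
      (Am (m.1 / r ^ 2) r)⁻¹ 1 1 • gradV ψ (psiArg r m))

/-- Kinetic convolution operator for scalar kernels:
`[T_J f](z) = ∫ J(z⁻¹ ∘ m) f(m) dm`. -/
def Tsc {d : ℕ} (J : Pt d → ℝ) (f : Pt d → ℝ) (z : Pt d) : ℝ :=
  ∫ m, J (kmul (kinv z) m) * f m

/-- Kinetic convolution operator for `ℝ^d`-valued kernels:
`[T_J f](z) = ∫ J(z⁻¹ ∘ m) · f(m) dm`. -/
def Tvec {d : ℕ} (J : Pt d → V d) (f : Pt d → V d) (z : Pt d) : ℝ :=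
  ∫ m, ⟪J (kmul (kinv z) m), f m⟫

/-- The support and nonnegativity conditions on the bump function `ψ`:
smooth, nonnegative, unit mass, supported in `(−2,−1) × B₁(0) × B₁(0)`. -/
structure IsKineticBump {d : ℕ} (ψ : Pt d → ℝ) : Prop where
  smooth : ContDiff ℝ (⊤ : ℕ∞) ψ
  nonneg : ∀ m, 0 ≤ ψ m
  mass : ∫ m, ψ m = 1
  supp : ∀ m : Pt d, ψ m ≠ 0 →
    m.1 ∈ Set.Ioo (-2 : ℝ) (-1) ∧ ‖m.2.1‖ < 1 ∧ ‖m.2.2‖ < 1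

/-- The kinetic box `B_r^kin = {(s,y,w) : |s| < r², |y| < r³, |w| < r}`. -/
def kinBox (d : ℕ) (r : ℝ) : Set (Pt d) :=
  {m | |m.1| < r ^ 2 ∧ ‖m.2.1‖ < r ^ 3 ∧ ‖m.2.2‖ < r}

/-- The (unnormalised) fractional derivative of order `1/3` in the second (spatial)
variable: `[𝔇_x u](t,x,v) = ∫ (2u(t,x,v) − u(t,x+h,v) − u(t,x−h,v)) |h|^{−d−1/3} dh`.
Applied to a kernel `J(s,y,w)` this is the operator `𝔇_y` acting in the `y` variable. -/
def fracDx {d : ℕ} (u : Pt d → ℝ) (z : Pt d) : ℝ :=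
  ∫ h : V d, (2 * u z - u (z.1, z.2.1 + h, z.2.2) - u (z.1, z.2.1 - h, z.2.2)) *
    ‖h‖ ^ (-(d : ℝ) - 1 / 3)

set_option linter.unusedSectionVars false

section CotlarStein

variable {H : Type*} [NormedAddCommGroup H] [InnerProductSpace ℝ H] [CompleteSpace H] {ι : Type*}

/-- `T` or its adjoint, according to a Boolean. -/
def adjIf (b : Bool) (T : H →L[ℝ] H) : H →L[ℝ] H := if b then star T else T

lemma norm_adjIf (b : Bool) (T : H →L[ℝ] H) : ‖adjIf b T‖ = ‖T‖ := by
  cases b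
  · rfl
  · exact ContinuousLinearMap.adjoint.norm_map T

/-- The alternating product `T_{i₁}^* T_{i₂} T_{i₃}^* ⋯` along a word. -/
def altWord (T : ι → H →L[ℝ] H) : Bool → List ι → (H →L[ℝ] H)
  | _, [] => 1
  | b, i :: l => adjIf b (T i) * altWord T (!b) l

/-- The alternating product `⋯ S^* S S^* ` with `n` factors, ending with `adjIf b S`. -/
def altPow (S : H →L[ℝ] H) : ℕ → Bool → (H →L[ℝ] H)
  | 0, _ => 1
  | n + 1, b => altPow S n (!b) * adjIf b S

/-- Bound of an alternating word obtained by grouping its letters in pairs. -/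
def pairWeight (c : ι → ι → ℝ) (B : ℝ) : List ι → ℝ
  | [] => 1
  | [_] => B
  | i :: j :: l => c i j ^ 2 * pairWeight c B l

/-- Product of the weights of all pairs of neighbouring letters of a word. -/
def chainWeight (c : ι → ι → ℝ) : List ι → ℝ
  | [] => 1
  | [_] => 1
  | i :: j :: l => c i j * chainWeight c (j :: l)

lemma chainWeight_nonneg {c : ι → ι → ℝ} (hc : ∀ i j, 0 ≤ c i j) :
    ∀ l : List ι, 0 ≤ chainWeight c l
  | [] => zero_le_one
  | [_] => zero_le_one
  | i :: j :: l => mul_nonneg (hc i j) (chainWeight_nonneg hc (j :: l))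

lemma pairWeight_nonneg {c : ι → ι → ℝ} {B : ℝ} (hB : 0 ≤ B) :
    ∀ l : List ι, 0 ≤ pairWeight c B l
  | [] => zero_le_one
  | [_] => hB
  | _ :: _ :: l => mul_nonneg (sq_nonneg _) (pairWeight_nonneg hB l)

lemma pairWeight_cons_mul (c : ι → ι → ℝ) (B : ℝ) :
    ∀ (l : List ι) (i : ι), pairWeight c B (i :: l) * pairWeight c B l =
      B * chainWeight c (i :: l) ^ 2
  | [], i => by simp [pairWeight, chainWeight]
  | j :: l, i => by
    have := pairWeight_cons_mul c B l j
    rw [pairWeight, chainWeight, mul_assoc, mul_comm (pairWeight c B l), this]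
    ring

lemma norm_altWord_le {T : ι → H →L[ℝ] H} {c : ι → ι → ℝ} {B : ℝ} (hB : 0 ≤ B)
    (hT : ∀ i, ‖T i‖ ≤ B) (h : ∀ b i j, ‖adjIf b (T i) * adjIf (!b) (T j)‖ ≤ c i j ^ 2) :
    ∀ (l : List ι) (b : Bool), ‖altWord T b l‖ ≤ pairWeight c B l
  | [], b => ContinuousLinearMap.norm_id_le
  | [i], b => by
    simpa [altWord, pairWeight, norm_adjIf] using hT i
  | i :: j :: l, b => by
    have := norm_altWord_le hB hT h l b
    rw [altWord, altWord, Bool.not_not, ← mul_assoc, pairWeight]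
    exact (norm_mul_le _ _).trans (mul_le_mul (h b i j) this (norm_nonneg _) (sq_nonneg _))

lemma norm_altWord_cons_le {T : ι → H →L[ℝ] H} {c : ι → ι → ℝ} (hc : ∀ i j, 0 ≤ c i j)
    {B : ℝ} (hB : 0 ≤ B)
    (hT : ∀ i, ‖T i‖ ≤ B) (h : ∀ b i j, ‖adjIf b (T i) * adjIf (!b) (T j)‖ ≤ c i j ^ 2)
    (l : List ι) (i : ι) (b : Bool) :
    ‖altWord T b (i :: l)‖ ≤ B * chainWeight c (i :: l) := by
  have h1 := norm_altWord_le hB hT h (i :: l) b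
  have h2 : ‖altWord T b (i :: l)‖ ≤ B * pairWeight c B l := by
    rw [altWord]
    refine (norm_mul_le _ _).trans (mul_le_mul ?_ (norm_altWord_le hB hT h l _)
      (norm_nonneg _) hB)
    simpa [norm_adjIf] using hT i
  have h3 := mul_le_mul h1 h2 (norm_nonneg _) (pairWeight_nonneg hB _)
  refine le_of_sq_le_sq ?_ (mul_nonneg hB (chainWeight_nonneg hc _))
  calc _ = _ := pow_two _
    _ ≤ _ := h3
    _ = B * (pairWeight c B (i :: l) * pairWeight c B l) := by ring
    _ = _ := by rw [pairWeight_cons_mul]; ring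

lemma adjIf_sum (s : Finset ι) (T : ι → H →L[ℝ] H) (b : Bool) :
    adjIf b (∑ i ∈ s, T i) = ∑ i ∈ s, adjIf b (T i) := by
  cases b <;> simp [adjIf]

/-- The **Cotlar–Stein almost orthogonality lemma** for finite families. -/
theorem norm_sum_le_of_almost_orthogonal (s : Finset ι) (T : ι → H →L[ℝ] H) {c : ι → ι → ℝ}
    (hc : ∀ i j, 0 ≤ c i j) {A B : ℝ} (hA : 0 < A) (hT : ∀ i, ‖T i‖ ≤ B)
    (hcA : ∀ j, ∑ i ∈ s, c i j ≤ A)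
    (h1 : ∀ i j, ‖star (T i) * T j‖ ≤ c i j ^ 2) (h2 : ∀ i j, ‖T i * star (T j)‖ ≤ c i j ^ 2) :
    ‖∑ i ∈ s, T i‖ ≤ A := by
  rcases s.eq_empty_or_nonempty with rfl | ⟨i₀, -⟩
  · simpa using hA.le
  have hB : 0 ≤ B := (norm_nonneg _).trans (hT i₀)
  have h : ∀ b i j, ‖adjIf b (T i) * adjIf (!b) (T j)‖ ≤ c i j ^ 2 := by
    intro b i j; cases b
    · simpa [adjIf] using h2 i j
    · simpa [adjIf] using h1 i j
  set S := ∑ i ∈ s, T i with hS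
  have key : ∀ (n : ℕ) (b : Bool) (j : ι) (l : List ι),
      ‖altPow S n b * altWord T (!b) (j :: l)‖ ≤ B * chainWeight c (j :: l) * A ^ n := by
    intro n
    induction n with
    | zero => intro b j l; simpa [altPow] using norm_altWord_cons_le hc hB hT h l j (!b)
    | succ n ih =>
      intro b j l
      have : altPow S (n + 1) b * altWord T (!b) (j :: l) =
          ∑ i ∈ s, altPow S n (!b) * altWord T (!(!b)) (i :: j :: l) := by
        rw [altPow, hS, adjIf_sum, mul_assoc, Finset.sum_mul, Finset.mul_sum]
        simp [altWord]
      rw [this]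
      calc _ ≤ ∑ i ∈ s, B * chainWeight c (i :: j :: l) * A ^ n :=
            norm_sum_le_of_le _ fun i _ => ih (!b) i (j :: l)
        _ = B * chainWeight c (j :: l) * A ^ n * ∑ i ∈ s, c i j := by
            rw [Finset.mul_sum]; refine Finset.sum_congr rfl fun i _ => ?_
            rw [chainWeight]; ring
        _ ≤ B * chainWeight c (j :: l) * A ^ n * A :=
            mul_le_mul_of_nonneg_left (hcA j) (mul_nonneg (mul_nonneg hB
              (chainWeight_nonneg hc _)) (pow_nonneg hA.le _))
        _ = _ := by ring
  have key2 : ∀ n b, ‖altPow S (n + 1) b‖ ≤ s.card * B * A ^ n := by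
    intro n b
    have : altPow S (n + 1) b = ∑ i ∈ s, altPow S n (!b) * altWord T (!(!b)) [i] := by
      rw [altPow, hS, adjIf_sum, Finset.mul_sum]
      simp [altWord]
    rw [this]
    calc _ ≤ ∑ i ∈ s, B * A ^ n := norm_sum_le_of_le _ fun i _ => by
          simpa [chainWeight] using key n (!b) i []
      _ = _ := by simp; ring
  have key3 : ∀ m, altPow S (2 * m) false = (star S * S) ^ m := by
    intro m
    induction m with
    | zero => rfl
    | succ m ih =>
      rw [Nat.mul_succ, altPow, altPow, pow_succ]
      simp [adjIf, ih, mul_assoc]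
  by_contra! hlt
  obtain ⟨k, hk⟩ := pow_unbounded_of_one_lt (s.card * B / A) ((one_lt_div hA).2 hlt)
  have hk' : s.card * B / A < (‖S‖ / A) ^ (2 * 2 ^ k) := by
    refine hk.trans_le (pow_le_pow_right₀ ((one_lt_div hA).2 hlt).le ?_)
    have := k.lt_two_pow_self; omega
  have e1 : ‖(star S * S) ^ 2 ^ k‖ = ‖S‖ ^ (2 * 2 ^ k) := by
    have := congrArg NNReal.toReal ((IsSelfAdjoint.star_mul_self S).nnnorm_pow_two_pow k)
    simp only [coe_nnnorm, NNReal.coe_pow] at this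
    rw [this, CStarRing.norm_star_mul_self, ← pow_two, ← pow_mul]
  obtain ⟨m, hm⟩ : ∃ m, 2 * 2 ^ k = m + 1 := ⟨2 * 2 ^ k - 1, by have := Nat.two_pow_pos k; omega⟩
  have e2 := key2 m false
  rw [← hm, key3, e1] at e2
  rw [div_pow, hm, div_lt_div_iff₀ hA (by positivity), ← hm] at hk'
  have e3 : s.card * B * A ^ (2 * 2 ^ k) = s.card * B * A ^ m * A := by rw [hm]; ring
  rw [e3] at hk'
  exact absurd (mul_le_mul_of_nonneg_right e2 hA.le) (not_le.2 hk')

end CotlarStein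

section Maximal

open Metric Set

/-- The measure of a ball of radius `r` is `V r ^ Q`, at every centre. -/
structure BallGrowth {X : Type*} [PseudoMetricSpace X] [MeasurableSpace X] (μ : Measure X)
    (V : ℝ) (Q : ℕ) : Prop where
  pos : 0 < V
  one_le : 1 ≤ Q
  measure_ball : ∀ (z : X) (r : ℝ), 0 < r → μ (ball z r) = ENNReal.ofReal (V * r ^ Q)

/-- The uncentred Hardy–Littlewood maximal function. -/
def maxFn {X : Type*} [PseudoMetricSpace X] [MeasurableSpace X] (μ : Measure X)
    (F : X → ℝ≥0∞) (z : X) : ℝ≥0∞ :=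
  ⨆ (x : X) (r : ℝ) (_ : 0 < r ∧ z ∈ ball x r), (∫⁻ y in ball x r, F y ∂μ) / μ (ball x r)

variable {X : Type*} [PseudoMetricSpace X] [SecondCountableTopology X] [MeasurableSpace X]
  [BorelSpace X] {μ : Measure X} {V : ℝ} {Q : ℕ}


lemma BallGrowth.ball_pos (h : BallGrowth μ V Q) (z : X) {r : ℝ} (hr : 0 < r) : 0 < μ (Metric.ball z r) := by
  rw [h.measure_ball z r hr]; exact ENNReal.ofReal_pos.2 (mul_pos h.pos (pow_pos hr _))

lemma BallGrowth.ball_ne_top (h : BallGrowth μ V Q) (z : X) (r : ℝ) : μ (Metric.ball z r) ≠ ∞ := by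
  rcases le_or_gt r 0 with hr | hr
  · simp [Metric.ball_eq_empty.2 hr]
  · rw [h.measure_ball z r hr]; exact ENNReal.ofReal_ne_top

lemma BallGrowth.ball_mul (h : BallGrowth μ V Q) (z z' : X) {r c : ℝ} (hr : 0 < r) (hc : 0 < c) :
    μ (Metric.ball z (c * r)) = ENNReal.ofReal (c ^ Q) * μ (Metric.ball z' r) := by
  rw [h.measure_ball z _ (mul_pos hc hr), h.measure_ball z' r hr, ← ENNReal.ofReal_mul (by positivity)]
  congr 1; ring

lemma BallGrowth.lt_maxFn_iff (h : BallGrowth μ V Q) {F : X → ℝ≥0∞} {t : ℝ≥0∞} {z : X} :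
    t < maxFn μ F z ↔ ∃ x r, 0 < r ∧ z ∈ Metric.ball x r ∧
      t * μ (Metric.ball x r) < ∫⁻ y in Metric.ball x r, F y ∂μ := by
  simp only [maxFn, lt_iSup_iff, exists_prop]
  refine exists_congr fun x => exists_congr fun r => ?_
  constructor
  · rintro ⟨⟨hr, hz⟩, hlt⟩
    refine ⟨hr, hz, ?_⟩
    rwa [ENNReal.lt_div_iff_mul_lt (Or.inl (h.ball_pos x hr).ne') (Or.inl (h.ball_ne_top x r))]
      at hlt
  · rintro ⟨hr, hz, hlt⟩
    refine ⟨⟨hr, hz⟩, ?_⟩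
    rwa [ENNReal.lt_div_iff_mul_lt (Or.inl (h.ball_pos x hr).ne') (Or.inl (h.ball_ne_top x r))]

lemma BallGrowth.isOpen_lt_maxFn (h : BallGrowth μ V Q) (F : X → ℝ≥0∞) (t : ℝ≥0∞) :
    IsOpen {z | t < maxFn μ F z} := by
  have : {z | t < maxFn μ F z} = ⋃ (x : X) (r : ℝ) (_ : 0 < r ∧
      t * μ (Metric.ball x r) < ∫⁻ y in Metric.ball x r, F y ∂μ), Metric.ball x r := by
    ext z
    simp only [mem_ofPred_eq, h.lt_maxFn_iff, mem_iUnion, exists_prop]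
    exact exists_congr fun x => exists_congr fun r => by tauto
  rw [this]
  exact isOpen_iUnion fun x => isOpen_iUnion fun r => isOpen_iUnion fun _ => isOpen_ball

lemma BallGrowth.measurable_maxFn (h : BallGrowth μ V Q) (F : X → ℝ≥0∞) : Measurable (maxFn μ F) :=
  measurable_of_Ioi fun t => (h.isOpen_lt_maxFn F t).measurableSet

/-- Vitali selection: from a family of balls of bounded radii one extracts a countable disjoint
family whose five-fold enlargements cover the original balls. -/
lemma exists_disjoint_cover_balls {ι : Type*} (x : ι → X) (r : ι → ℝ) {R : ℝ}
    (hr : ∀ i, 0 < r i) (hR : ∀ i, r i ≤ R) :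
    ∃ u : Set ι, u.Countable ∧ u.PairwiseDisjoint (fun i => Metric.ball (x i) (r i)) ∧
      ∀ i, ∃ j ∈ u, Metric.ball (x i) (r i) ⊆ Metric.ball (x j) (5 * r j) := by
  obtain ⟨u, -, hu, hcov⟩ := Vitali.exists_disjoint_subfamily_covering_enlargement_closedBall
    (Set.univ : Set ι) x r R (fun i _ => hR i) 4 (by norm_num)
  have hu' : u.PairwiseDisjoint (fun i => Metric.ball (x i) (r i)) := fun i hi j hj hij =>
    (hu hi hj hij).mono ball_subset_closedBall ball_subset_closedBall
  refine ⟨u, hu'.countable_of_isOpen (fun i _ => isOpen_ball) fun i _ =>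
    ⟨x i, mem_ball_self (hr i)⟩, hu', fun i => ?_⟩
  obtain ⟨j, hj, hsub⟩ := hcov i (mem_univ _)
  exact ⟨j, hj, ball_subset_closedBall.trans (hsub.trans
    (closedBall_subset_ball (by linarith [hr j])))⟩

lemma BallGrowth.radius_le (h : BallGrowth μ V Q) {x : X} {r A : ℝ} (hr : 0 < r) (hA : 0 ≤ A)
    (hle : μ (Metric.ball x r) ≤ ENNReal.ofReal A) : r ≤ max 1 (A / V) := by
  rw [h.measure_ball x r hr, ENNReal.ofReal_le_ofReal_iff hA] at hle
  rcases le_or_gt r 1 with h1 | h1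
  · exact le_max_of_le_left h1
  · refine le_max_of_le_right ?_
    rw [le_div_iff₀ h.pos]
    have : r ≤ r ^ Q := le_self_pow₀ h1.le (by have := h.one_le; omega)
    nlinarith [h.pos]

lemma BallGrowth.weak_type (h : BallGrowth μ V Q) (F : X → ℝ≥0∞) {t : ℝ≥0∞} (ht : t ≠ 0) (ht' : t ≠ ∞) :
    t * μ {z | t < maxFn μ F z} ≤ ENNReal.ofReal (5 ^ Q) * ∫⁻ y, F y ∂μ := by
  by_cases hF : ∫⁻ y, F y ∂μ = ∞
  · rw [hF, ENNReal.mul_top (by positivity)]; exact le_top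
  let ι := {a : X × ℝ // 0 < a.2 ∧
    t * μ (Metric.ball a.1 a.2) < ∫⁻ y in Metric.ball a.1 a.2, F y ∂μ}
  have hb : ∀ i : ι, i.1.2 ≤ max 1 (((∫⁻ y, F y ∂μ) / t).toReal / V) := fun i => by
    refine h.radius_le (x := i.1.1) i.2.1 ENNReal.toReal_nonneg ?_
    rw [ENNReal.ofReal_toReal (ENNReal.div_ne_top hF ht)]
    rw [ENNReal.le_div_iff_mul_le (Or.inl ht) (Or.inl ht'), mul_comm]
    exact i.2.2.le.trans (setLIntegral_le_lintegral _ _)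
  obtain ⟨u, huc, hud, hcov⟩ := exists_disjoint_cover_balls (fun i : ι => i.1.1) (fun i => i.1.2)
    (fun i => i.2.1) hb
  have hsub : {z | t < maxFn μ F z} ⊆ ⋃ j ∈ u, Metric.ball j.1.1 (5 * j.1.2) := by
    intro z hz
    obtain ⟨x, r, hr, hzx, hlt⟩ := h.lt_maxFn_iff.1 hz
    obtain ⟨j, hj, hs⟩ := hcov ⟨(x, r), hr, hlt⟩
    exact mem_biUnion hj (hs hzx)
  have := huc.to_subtype
  calc t * μ {z | t < maxFn μ F z}
      ≤ t * ∑' j : u, μ (Metric.ball j.1.1.1 (5 * j.1.1.2)) := by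
        gcongr; exact (measure_mono hsub).trans (measure_biUnion_le μ huc _)
    _ = ∑' j : u, ENNReal.ofReal (5 ^ Q) * (t * μ (Metric.ball j.1.1.1 j.1.1.2)) := by
        rw [← ENNReal.tsum_mul_left]
        refine tsum_congr fun j => ?_
        rw [h.ball_mul _ j.1.1.1 j.1.2.1 (by norm_num : (0:ℝ) < 5)]; ring
    _ ≤ ∑' j : u, ENNReal.ofReal (5 ^ Q) * ∫⁻ y in Metric.ball j.1.1.1 j.1.1.2, F y ∂μ := by
        gcongr with j; exact j.1.2.2.le
    _ = ENNReal.ofReal (5 ^ Q) * ∫⁻ y in ⋃ j ∈ u, Metric.ball j.1.1 j.1.2, F y ∂μ := by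
        rw [ENNReal.tsum_mul_left, lintegral_biUnion huc (fun _ _ => measurableSet_ball) hud]
    _ ≤ _ := mul_le_mul_right (setLIntegral_le_lintegral _ _) _

lemma BallGrowth.weak_type_truncated (h : BallGrowth μ V Q) {f : X → ℝ} (hf : Measurable f) {t : ℝ}
    (ht : 0 < t) :
    μ {z | ENNReal.ofReal t < maxFn μ (fun y => ENNReal.ofReal (f y)) z} ≤
      ENNReal.ofReal (2 * 5 ^ Q / t) * ∫⁻ y in {y | t / 2 < f y}, ENNReal.ofReal (f y) ∂μ := by
  have hS : MeasurableSet {y | t / 2 < f y} := measurableSet_lt measurable_const hf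
  set F : X → ℝ≥0∞ := fun y => ENNReal.ofReal (f y) with hFdef
  have hF : Measurable F := hf.ennreal_ofReal
  have hsub : {z | ENNReal.ofReal t < maxFn μ F z} ⊆
      {z | ENNReal.ofReal (t / 2) < maxFn μ ({y | t / 2 < f y}.indicator F) z} := by
    intro z hz
    obtain ⟨x, r, hr, hzx, hlt⟩ := h.lt_maxFn_iff.1 hz
    refine h.lt_maxFn_iff.2 ⟨x, r, hr, hzx, ?_⟩
    have h1 : ∫⁻ y in Metric.ball x r, F y ∂μ ≤
        (∫⁻ y in Metric.ball x r, {y | t / 2 < f y}.indicator F y ∂μ) +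
          ENNReal.ofReal (t / 2) * μ (Metric.ball x r) := by
      rw [← setLIntegral_const, ← lintegral_add_left (hF.indicator hS)]
      refine lintegral_mono fun y => ?_
      by_cases hy : t / 2 < f y
      · simp [hFdef, indicator, hy]
      · simpa [hFdef, indicator, hy] using ENNReal.ofReal_le_ofReal (not_lt.1 hy)
    have h2 : ENNReal.ofReal t * μ (Metric.ball x r) =
        ENNReal.ofReal (t / 2) * μ (Metric.ball x r) +
          ENNReal.ofReal (t / 2) * μ (Metric.ball x r) := by
      rw [← add_mul, ← ENNReal.ofReal_add (by positivity) (by positivity)]; congr 2; ring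
    rw [h2] at hlt
    exact lt_of_add_lt_add_right (hlt.trans_le h1)
  have hw := h.weak_type ({y | t / 2 < f y}.indicator F)
    (ENNReal.ofReal_pos.2 (half_pos ht)).ne' ENNReal.ofReal_ne_top
  rw [lintegral_indicator hS] at hw
  calc _ ≤ μ {z | ENNReal.ofReal (t / 2) < maxFn μ ({y | t / 2 < f y}.indicator F) z} :=
        measure_mono hsub
    _ = ENNReal.ofReal (2 / t) * (ENNReal.ofReal (t / 2) *
        μ {z | ENNReal.ofReal (t / 2) < maxFn μ ({y | t / 2 < f y}.indicator F) z}) := by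
        rw [← mul_assoc, ← ENNReal.ofReal_mul (by positivity)]
        rw [show 2 / t * (t / 2) = 1 by field_simp]; simp
    _ ≤ ENNReal.ofReal (2 / t) * (ENNReal.ofReal (5 ^ Q) * ∫⁻ y in {y | t / 2 < f y}, F y ∂μ) := by
        gcongr
    _ = _ := by
        rw [← mul_assoc, ← ENNReal.ofReal_mul (by positivity)]; congr 2; ring


lemma lintegral_Ioo_rpow {p a : ℝ} (hp : 1 < p) (ha : 0 ≤ a) :
    ∫⁻ t in Ioo 0 a, ENNReal.ofReal (t ^ (p - 2)) = ENNReal.ofReal (a ^ (p - 1) / (p - 1)) := by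
  have hi : IntervalIntegrable (fun t : ℝ => t ^ (p - 2)) volume 0 a :=
    intervalIntegral.intervalIntegrable_rpow' (by linarith)
  rw [setLIntegral_congr Ioo_ae_eq_Ioc, ← ofReal_integral_eq_lintegral_ofReal]
  · rw [← intervalIntegral.integral_of_le ha, integral_rpow (Or.inl (by linarith))]
    congr 1
    rw [show p - 2 + 1 = p - 1 by ring, Real.zero_rpow (by linarith), sub_zero]
  · exact (intervalIntegrable_iff_integrableOn_Ioc_of_le ha).1 hi
  · filter_upwards [ae_restrict_mem measurableSet_Ioc] with t ht using Real.rpow_nonneg ht.1.le _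

/-- Layer-cake form of the strong-type maximal inequality. -/
lemma BallGrowth.lintegral_maxFn_layer [SFinite μ] (h : BallGrowth μ V Q) {f : X → ℝ}
    (hf : Measurable f) (hf0 : ∀ x, 0 ≤ f x) {p : ℝ} (hp : 1 < p) :
    ∫⁻ t in Ioi 0, μ {z | ENNReal.ofReal t < maxFn μ (fun y => ENNReal.ofReal (f y)) z} *
        ENNReal.ofReal (t ^ (p - 1)) ≤
      ENNReal.ofReal (2 ^ p * 5 ^ Q / (p - 1)) * ∫⁻ y, ENNReal.ofReal (f y ^ p) ∂μ := by
  have hp1 : 0 < p - 1 := by linarith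
  calc _ ≤ ∫⁻ t : ℝ in Ioi (0:ℝ), ∫⁻ y : X, ENNReal.ofReal (2 * 5 ^ Q * t ^ (p - 2)) *
        {a : ℝ × X | a.1 / 2 < f a.2}.indicator (fun a => ENNReal.ofReal (f a.2)) (t, y) ∂μ := by
        refine setLIntegral_mono' measurableSet_Ioi fun t ht => ?_
        have ht : 0 < t := ht
        rw [lintegral_const_mul' _ _ ENNReal.ofReal_ne_top]
        have : ∫⁻ y, {a : ℝ × X | a.1 / 2 < f a.2}.indicator
            (fun a => ENNReal.ofReal (f a.2)) (t, y) ∂μ =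
            ∫⁻ y in {y | t / 2 < f y}, ENNReal.ofReal (f y) ∂μ := by
          rw [← lintegral_indicator (measurableSet_lt measurable_const hf)]; rfl
        rw [this]
        calc _ ≤ ENNReal.ofReal (2 * 5 ^ Q / t) *
              (∫⁻ y in {y | t / 2 < f y}, ENNReal.ofReal (f y) ∂μ) *
                ENNReal.ofReal (t ^ (p - 1)) := by
              gcongr; exact h.weak_type_truncated hf ht
          _ = _ := by
              rw [mul_right_comm, ← ENNReal.ofReal_mul (by positivity)]
              congr 2
              rw [show p - 1 = (p - 2) + 1 by ring, Real.rpow_add_one ht.ne']; field_simp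
    _ = ∫⁻ y : X, (∫⁻ t : ℝ in Ioi (0:ℝ), ENNReal.ofReal (2 * 5 ^ Q * t ^ (p - 2)) *
        {a : ℝ × X | a.1 / 2 < f a.2}.indicator (fun a => ENNReal.ofReal (f a.2)) (t, y)) ∂μ := by
        rw [lintegral_lintegral_swap]
        refine Measurable.aemeasurable ?_
        refine Measurable.mul (by fun_prop) ?_
        exact Measurable.indicator (by fun_prop)
          (measurableSet_lt (by fun_prop) (by fun_prop))
    _ = ∫⁻ y, ENNReal.ofReal (2 ^ p * 5 ^ Q / (p - 1)) * ENNReal.ofReal (f y ^ p) ∂μ := by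
        refine lintegral_congr fun y => ?_
        have : ∀ t ∈ Ioi (0:ℝ), ENNReal.ofReal (2 * 5 ^ Q * t ^ (p - 2)) *
            {a : ℝ × X | a.1 / 2 < f a.2}.indicator (fun a => ENNReal.ofReal (f a.2)) (t, y) =
            (Iio (2 * f y)).indicator (fun t => ENNReal.ofReal (2 * 5 ^ Q * f y) *
              ENNReal.ofReal (t ^ (p - 2))) t := by
          intro t ht
          have ht : 0 < t := ht
          by_cases h1 : t / 2 < f y
          · have h2 : t < 2 * f y := by linarith
            rw [indicator_of_mem (by exact h1), indicator_of_mem (by exact h2),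
              ← ENNReal.ofReal_mul (by positivity),
              ← ENNReal.ofReal_mul (by have := hf0 y; positivity)]
            congr 1; ring
          · have h2 : ¬ t < 2 * f y := by linarith
            rw [indicator_of_notMem (by exact h1), indicator_of_notMem (by exact h2), mul_zero]
        rw [setLIntegral_congr_fun measurableSet_Ioi this, lintegral_indicator measurableSet_Iio,
          Measure.restrict_restrict measurableSet_Iio, Iio_inter_Ioi,
          lintegral_const_mul' _ _ ENNReal.ofReal_ne_top,
          lintegral_Ioo_rpow hp (by have := hf0 y; positivity),
          ← ENNReal.ofReal_mul (by have := hf0 y; positivity),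
          ← ENNReal.ofReal_mul (by positivity)]
        congr 1
        rcases (hf0 y).eq_or_lt with h0 | h0
        · rw [← h0, Real.zero_rpow (by linarith)]; ring
        · rw [Real.mul_rpow (by norm_num) h0.le, show (2:ℝ) ^ p = 2 ^ (p - 1) * 2 by
            rw [← Real.rpow_add_one (by norm_num)]; congr 1; ring,
            show f y ^ p = f y ^ (p - 1) * f y by
            rw [← Real.rpow_add_one h0.ne']; congr 1; ring]
          ring
    _ = _ := lintegral_const_mul' _ _ ENNReal.ofReal_ne_top

end Maximal

section CalderonZygmund

open Metric Set

/-- Bounded, integrable, measurable functions. -/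
structure BddInt {X : Type*} [MeasurableSpace X] (μ : Measure X) (f : X → ℝ) : Prop where
  meas : Measurable f
  int : Integrable f μ
  bdd : ∃ B, ∀ x, |f x| ≤ B

lemma exists_disjoint_refinement {X J : Type*} [MeasurableSpace X] {u : Set J} (hu : u.Countable)
    (E : J → Set X) (hE : ∀ j, MeasurableSet (E j)) :
    ∃ F : J → Set X, (∀ j, MeasurableSet (F j)) ∧ (∀ j, F j ⊆ E j) ∧ u.PairwiseDisjoint F ∧
      ⋃ j ∈ u, F j = ⋃ j ∈ u, E j := by
  obtain ⟨e, he⟩ := (Set.countable_iff_exists_injOn).1 hu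
  refine ⟨fun j => E j \ ⋃ i ∈ {i ∈ u | e i < e j}, E i, fun j => ?_, fun j => sdiff_subset, ?_, ?_⟩
  · exact (hE j).diff (MeasurableSet.biUnion (hu.mono fun i hi => hi.1) fun i _ => hE i)
  · have key : ∀ i ∈ u, ∀ j ∈ u, e i < e j → Disjoint (E i \ ⋃ k ∈ {k ∈ u | e k < e i}, E k)
        (E j \ ⋃ k ∈ {k ∈ u | e k < e j}, E k) := by
      intro i hi j hj hij
      rw [Set.disjoint_left]
      rintro z ⟨hz, -⟩ ⟨-, hz'⟩
      exact hz' (mem_biUnion (show i ∈ {k ∈ u | e k < e j} from ⟨hi, hij⟩) hz)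
    intro i hi j hj hij
    rcases lt_trichotomy (e i) (e j) with h | h | h
    · exact key i hi j hj h
    · exact absurd (he hi hj h) hij
    · exact (key j hj i hi h).symm
  · refine subset_antisymm (iUnion₂_mono fun j _ => sdiff_subset) ?_
    intro z hz
    obtain ⟨j0, hj0, hz0⟩ := mem_iUnion₂.1 hz
    have hne : {n | ∃ j ∈ u, z ∈ E j ∧ e j = n}.Nonempty := ⟨_, j0, hj0, hz0, rfl⟩
    obtain ⟨j, hj, hzj, hej⟩ := Nat.sInf_mem hne
    refine mem_biUnion hj ⟨hzj, ?_⟩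
    simp only [mem_iUnion, not_exists]
    rintro i ⟨hi, hij⟩ hzi
    have := Nat.sInf_le (show e i ∈ {n | ∃ j ∈ u, z ∈ E j ∧ e j = n} from ⟨i, hi, hzi, rfl⟩)
    omega

variable {X : Type*} [PseudoMetricSpace X] [SecondCountableTopology X] [MeasurableSpace X]
  [BorelSpace X] {μ : Measure X} {V : ℝ} {Q : ℕ}

lemma BallGrowth.measure_univ [Nonempty X] (h : BallGrowth μ V Q) : μ univ = ∞ := by
  by_contra hne
  obtain ⟨z⟩ := ‹Nonempty X›
  have := h.radius_le (x := z) (r := max 1 ((μ univ).toReal / V) + 1) (A := (μ univ).toReal)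
    (by positivity) ENNReal.toReal_nonneg
    (by rw [ENNReal.ofReal_toReal hne]; exact measure_mono (subset_univ _))
  linarith

lemma BallGrowth.exists_cz_decomposition (h : BallGrowth μ V Q) {f : X → ℝ} (hf : Integrable f μ)
    {t : ℝ} (ht : 0 < t) {Ω : Set X}
    (hΩ : Ω = {z | ENNReal.ofReal t < maxFn μ (fun y => ENNReal.ofReal |f y|) z}) :
    ∃ (u : Set X) (r : X → ℝ) (E : X → Set X), u.Countable ∧ (∀ x ∈ u, 0 < r x) ∧
      u.PairwiseDisjoint (fun x => ball x (r x)) ∧ (∀ x ∈ u, ball x (r x) ⊆ Ω) ∧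
      (∀ x, MeasurableSet (E x)) ∧ (∀ x, E x ⊆ ball x (5 * r x)) ∧ u.PairwiseDisjoint E ∧
      ⋃ x ∈ u, E x = Ω ∧ ∀ x ∈ u, ∫⁻ y in E x, ENNReal.ofReal |f y| ∂μ ≤
        ENNReal.ofReal (20 ^ Q * t) * μ (ball x (r x)) := by
  rcases isEmpty_or_nonempty X with hX | hX
  · exact ⟨∅, 0, fun _ => ∅, by simp, by simp, by simp, by simp, by simp, by simp, by simp,
      Subsingleton.elim _ _, by simp⟩
  have hopen : IsOpen Ω := hΩ ▸ h.isOpen_lt_maxFn _ _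
  have hfin : μ Ω ≠ ∞ := by
    have h1 := h.weak_type (fun y => ENNReal.ofReal |f y|) (ENNReal.ofReal_pos.2 ht).ne'
      ENNReal.ofReal_ne_top
    rw [← hΩ] at h1
    have h2 : ∫⁻ y, ENNReal.ofReal |f y| ∂μ ≠ ∞ := by
      have := hf.2
      simp only [HasFiniteIntegral, ← ofReal_norm, Real.norm_eq_abs] at this
      exact this.ne
    intro h3
    rw [h3, ENNReal.mul_top (ENNReal.ofReal_pos.2 ht).ne'] at h1
    exact ENNReal.mul_ne_top ENNReal.ofReal_ne_top h2 (top_le_iff.1 h1)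
  have hne : Ωᶜ.Nonempty := by
    rw [nonempty_compl]; intro h1; rw [h1] at hfin; exact hfin h.measure_univ
  have hcl : IsClosed Ωᶜ := hopen.isClosed_compl
  set r : X → ℝ := fun x => infDist x Ωᶜ / 10 with hr
  have hr0 : ∀ x ∈ Ω, 0 < r x := fun x hx => by
    have := (hcl.notMem_iff_infDist_pos hne).1 (show x ∉ Ωᶜ from fun h => h hx)
    simp only [hr]; positivity
  have hsub : ∀ x, ball x (10 * r x) ⊆ Ω := fun x y hy => by
    by_contra hy'
    have h1 := infDist_le_dist_of_mem (x := x) (show y ∈ Ωᶜ from hy')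
    rw [mem_ball, dist_comm] at hy
    simp only [hr] at hy
    linarith
  have hR : ∀ x : Ω, r x ≤ max 1 ((μ Ω).toReal / V) := fun x => by
    refine h.radius_le (x := x.1) (hr0 x x.2) ENNReal.toReal_nonneg ?_
    rw [ENNReal.ofReal_toReal hfin]
    exact measure_mono ((ball_subset_ball (by linarith [hr0 x x.2])).trans (hsub x))
  obtain ⟨u', huc, hud, hcov⟩ := exists_disjoint_cover_balls (fun x : Ω => x.1) (fun x => r x.1)
    (fun x => hr0 x x.2) hR
  have huΩ : ∀ x ∈ Subtype.val '' u', x ∈ Ω := by rintro _ ⟨x, -, rfl⟩; exact x.2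
  obtain ⟨E, hEm, hEs, hEd, hEu⟩ := exists_disjoint_refinement (huc.image Subtype.val)
    (fun x => ball x (5 * r x)) (fun x => measurableSet_ball)
  refine ⟨Subtype.val '' u', r, E, huc.image _, fun x hx => hr0 x (huΩ x hx), ?_, ?_, hEm, hEs,
    hEd, ?_, ?_⟩
  · rintro _ ⟨x, hx, rfl⟩ _ ⟨y, hy, rfl⟩ hxy
    exact hud hx hy (fun h => hxy (by rw [h]))
  · intro x hx
    exact (ball_subset_ball (by linarith [hr0 x (huΩ x hx)])).trans (hsub x)
  · rw [hEu]
    refine subset_antisymm (iUnion₂_subset fun x hx =>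
      (ball_subset_ball (by linarith [hr0 x (huΩ x hx)])).trans (hsub x)) fun z hz => ?_
    obtain ⟨j, hj, hs⟩ := hcov ⟨z, hz⟩
    exact mem_biUnion (mem_image_of_mem _ hj) (hs (mem_ball_self (hr0 z hz)))
  · intro x hx
    have hx0 := hr0 x (huΩ x hx)
    obtain ⟨y, hy, hxy⟩ := (infDist_lt_iff (x := x) (r := 20 * r x) hne).1 (by
      simp only [hr] at hx0 ⊢; linarith)
    have hy' : ¬ (ENNReal.ofReal t < maxFn μ (fun y => ENNReal.ofReal |f y|) y) := by
      intro h1; exact hy (by rw [hΩ]; exact h1)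
    have h2 : ∫⁻ y in ball x (20 * r x), ENNReal.ofReal |f y| ∂μ ≤
        ENNReal.ofReal t * μ (ball x (20 * r x)) := by
      by_contra h3
      exact hy' (h.lt_maxFn_iff.2 ⟨x, 20 * r x, by positivity, by rwa [mem_ball, dist_comm],
        not_le.1 h3⟩)
    calc _ ≤ ∫⁻ y in ball x (20 * r x), ENNReal.ofReal |f y| ∂μ :=
          lintegral_mono_set ((hEs x).trans (ball_subset_ball (by linarith)))
      _ ≤ _ := h2
      _ = _ := by
        rw [h.ball_mul x x hx0 (by norm_num : (0:ℝ) < 20), ← mul_assoc,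
          ← ENNReal.ofReal_mul ht.le, mul_comm t]

lemma BallGrowth.closedBall_le (h : BallGrowth μ V Q) (x : X) {r : ℝ} (hr : 0 < r)
    {F : X → ℝ≥0∞} {z : X} (hz : dist z x ≤ r) :
    ∫⁻ y in closedBall x r, F y ∂μ ≤ maxFn μ F z * μ (closedBall x r) := by
  have key : ∀ s, r < s → ∫⁻ y in closedBall x r, F y ∂μ ≤
      maxFn μ F z * ENNReal.ofReal (V * s ^ Q) := fun s hs => by
    rw [← h.measure_ball x s (hr.trans hs)]
    refine (lintegral_mono_set (closedBall_subset_ball hs)).trans ?_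
    by_contra h3
    push Not at h3
    have hne : maxFn μ F z ≠ ∞ := by
      intro h4
      rw [h4, ENNReal.top_mul (h.ball_pos x (hr.trans hs)).ne'] at h3
      exact not_top_lt h3
    exact lt_irrefl _ (h.lt_maxFn_iff.2 ⟨x, s, hr.trans hs, hz.trans_lt hs, h3⟩)
  by_cases htop : maxFn μ F z = ∞
  · rw [htop, ENNReal.top_mul]
    · exact le_top
    · exact ((h.ball_pos x hr).trans_le (measure_mono ball_subset_closedBall)).ne'
  have hlim : Filter.Tendsto (fun s : ℝ => maxFn μ F z * ENNReal.ofReal (V * s ^ Q))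
      (nhdsWithin r (Ioi r)) (nhds (maxFn μ F z * ENNReal.ofReal (V * r ^ Q))) := by
    refine ENNReal.Tendsto.const_mul ?_ (Or.inr htop)
    exact (ENNReal.continuous_ofReal.comp (by fun_prop : Continuous fun s : ℝ =>
      V * s ^ Q)).continuousWithinAt
  refine (ge_of_tendsto hlim (Filter.eventually_of_mem self_mem_nhdsWithin key)).trans ?_
  rw [← h.measure_ball x r hr]
  exact mul_le_mul_right (measure_mono ball_subset_closedBall) _

lemma BallGrowth.ae_le_maxFn [SFinite μ] (h : BallGrowth μ V Q) {f : X → ℝ}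
    (hf : Integrable f μ) :
    ∀ᵐ z ∂μ, ENNReal.ofReal |f z| ≤ maxFn μ (fun y => ENNReal.ofReal |f y|) z := by
  have : IsLocallyFiniteMeasure μ := ⟨fun x => ⟨ball x 1, ball_mem_nhds x one_pos,
    (h.ball_ne_top x 1).lt_top⟩⟩
  have : IsUnifLocDoublingMeasure μ := by
    refine ⟨⟨(3 ^ Q : ℝ).toNNReal, ?_⟩⟩
    filter_upwards [self_mem_nhdsWithin] with ε hε x
    have hε : 0 < ε := hε
    calc μ (closedBall x (2 * ε)) ≤ μ (ball x (3 * ε)) :=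
          measure_mono (closedBall_subset_ball (by linarith))
      _ = ENNReal.ofReal (3 ^ Q) * μ (ball x ε) := h.ball_mul x x hε (by norm_num)
      _ ≤ _ := mul_le_mul_right (measure_mono ball_subset_closedBall) _
  have hloc : LocallyIntegrable (fun y => |f y|) μ := hf.abs.locallyIntegrable
  filter_upwards [IsUnifLocDoublingMeasure.ae_tendsto_average μ hloc 1] with z hz
  have hlim := hz (fun _ : ℝ => z) id (l := nhdsWithin 0 (Ioi 0)) Filter.tendsto_id (by
    filter_upwards [self_mem_nhdsWithin] with ε hε
    have hε : 0 < ε := hε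
    simpa using hε.le)
  refine le_of_tendsto ((ENNReal.continuous_ofReal.tendsto _).comp hlim) ?_
  filter_upwards [self_mem_nhdsWithin] with ε hε
  have hε : 0 < ε := hε
  have hpos : 0 < μ (closedBall z ε) :=
    (h.ball_pos z hε).trans_le (measure_mono ball_subset_closedBall)
  have hfin : μ (closedBall z ε) ≠ ∞ :=
    ((measure_mono (closedBall_subset_ball (show ε < 2 * ε by linarith))).trans_lt
      (h.ball_ne_top z _).lt_top).ne
  have h1 := h.closedBall_le z hε (F := fun y => ENNReal.ofReal |f y|) (z := z) (by simp [hε.le])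
  rw [← ofReal_integral_eq_lintegral_ofReal hf.abs.integrableOn
    (Filter.Eventually.of_forall fun y => abs_nonneg _)] at h1
  simp only [Function.comp, id]
  rw [setAverage_eq, smul_eq_mul, ENNReal.ofReal_mul (by positivity), mul_comm]
  rw [measureReal_def, ← ENNReal.toReal_inv,
    ENNReal.ofReal_toReal (ENNReal.inv_ne_top.2 hpos.ne'), ← div_eq_mul_inv]
  exact ENNReal.div_le_of_le_mul h1

end CalderonZygmund

section CalderonZygmundOp

open Metric Set

lemma hasSum_indicator_disjoint {X J M : Type*} [AddCommMonoid M] [TopologicalSpace M]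
    {u : Set J} {s : J → Set X} (hd : u.PairwiseDisjoint s) (F : J → X → M) (m : X) :
    ∃ a, HasSum (fun x : u => (s x).indicator (F x) m) a ∧
      ((∃ x ∈ u, m ∈ s x ∧ a = F x m) ∨ ((∀ x ∈ u, m ∉ s x) ∧ a = 0)) := by
  by_cases hx : ∃ x ∈ u, m ∈ s x
  · obtain ⟨x, hxu, hxm⟩ := hx
    refine ⟨F x m, ?_, Or.inl ⟨x, hxu, hxm, rfl⟩⟩
    have := hasSum_single (f := fun x : u => (s x).indicator (F x) m) ⟨x, hxu⟩ (by
      rintro ⟨y, hyu⟩ hy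
      refine indicator_of_notMem (fun hym => hy ?_) _
      by_contra hne
      exact Set.disjoint_left.1 (hd hyu hxu fun h => hne (Subtype.ext h)) hym hxm)
    rwa [indicator_of_mem hxm] at this
  · push Not at hx
    refine ⟨0, ?_, Or.inr ⟨hx, rfl⟩⟩
    have : (fun x : u => (s x).indicator (F x) m) = fun _ => 0 :=
      funext fun x => indicator_of_notMem (hx x x.2) _
    rw [this]; exact hasSum_zero

/-- The integral operator with kernel `k`. -/
def kerOp {X : Type*} [MeasurableSpace X] (μ : Measure X) (k : X → X → ℝ) (g : X → ℝ) (z : X) : ℝ :=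
  ∫ m, k z m * g m ∂μ

/-- Measurable kernels that are uniformly integrable in each variable. -/
structure SchurKernel {X : Type*} [MeasurableSpace X] (μ : Measure X) (k : X → X → ℝ) : Prop where
  meas : Measurable (Function.uncurry k)
  right : ∃ B : ℝ, ∀ z, ∫⁻ m, ‖k z m‖ₑ ∂μ ≤ ENNReal.ofReal B
  left : ∃ B : ℝ, ∀ m, ∫⁻ z, ‖k z m‖ₑ ∂μ ≤ ENNReal.ofReal B

/-- A Schur kernel bounded on `L²` and satisfying Hörmander's condition, with constant `A`. -/
structure CZKernel {X : Type*} [PseudoMetricSpace X] [MeasurableSpace X] (μ : Measure X)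
    (k : X → X → ℝ) (A : ℝ) : Prop extends SchurKernel μ k where
  nonneg : 0 ≤ A
  l2 : ∀ g, BddInt μ g → ∫⁻ z, ENNReal.ofReal (kerOp μ k g z ^ 2) ∂μ ≤
    ENNReal.ofReal A * ∫⁻ z, ENNReal.ofReal (g z ^ 2) ∂μ
  hor : ∀ m m₀, ∫⁻ z in {z | 4 * dist m m₀ ≤ dist z m₀}, ‖k z m - k z m₀‖ₑ ∂μ ≤ ENNReal.ofReal A

section Schur

variable {X : Type*} [MeasurableSpace X] {μ : Measure X} {k : X → X → ℝ} {g : X → ℝ}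

lemma SchurKernel.swap (hk : SchurKernel μ k) : SchurKernel μ (fun z m => k m z) :=
  ⟨hk.meas.comp measurable_swap, hk.left, hk.right⟩

lemma SchurKernel.integrable (hk : SchurKernel μ k) (z : X) : Integrable (k z) μ := by
  obtain ⟨B, hB⟩ := hk.right
  exact ⟨(hk.meas.of_uncurry_left).aestronglyMeasurable, (hB z).trans_lt ENNReal.ofReal_lt_top⟩

lemma SchurKernel.integrable_mul (hk : SchurKernel μ k) (hg : BddInt μ g) (z : X) :
    Integrable (fun m => k z m * g m) μ := by
  obtain ⟨C, hC⟩ := hg.bdd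
  exact (hk.integrable z).mul_bdd hg.meas.aestronglyMeasurable (Filter.Eventually.of_forall hC)

lemma enorm_kerOp_le (k : X → X → ℝ) (g : X → ℝ) (z : X) :
    ‖kerOp μ k g z‖ₑ ≤ ∫⁻ m, ‖k z m‖ₑ * ‖g m‖ₑ ∂μ := by
  refine (enorm_integral_le_lintegral_enorm _).trans (le_of_eq ?_)
  simp only [enorm_mul]

lemma SchurKernel.lintegral_lintegral_lt_top [SFinite μ] (hk : SchurKernel μ k) (hg : BddInt μ g) :
    ∫⁻ z, ∫⁻ m, ‖k z m‖ₑ * ‖g m‖ₑ ∂μ ∂μ < ∞ := by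
  obtain ⟨B, hB⟩ := hk.left
  rw [lintegral_lintegral_swap]
  · calc ∫⁻ m, ∫⁻ z, ‖k z m‖ₑ * ‖g m‖ₑ ∂μ ∂μ
        ≤ ∫⁻ m, ENNReal.ofReal B * ‖g m‖ₑ ∂μ := by
          refine lintegral_mono fun m => ?_
          rw [lintegral_mul_const' _ _ enorm_ne_top]
          exact mul_le_mul_left (hB m) _
      _ = ENNReal.ofReal B * ∫⁻ m, ‖g m‖ₑ ∂μ := lintegral_const_mul' _ _ ENNReal.ofReal_ne_top
      _ < ∞ := ENNReal.mul_lt_top ENNReal.ofReal_lt_top hg.int.2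
  · exact (hk.meas.enorm.mul (hg.meas.comp measurable_snd).enorm).aemeasurable

lemma SchurKernel.bddInt_kerOp [SFinite μ] (hk : SchurKernel μ k) (hg : BddInt μ g) :
    BddInt μ (kerOp μ k g) := by
  have hm : Measurable (kerOp μ k g) := by
    have : StronglyMeasurable (Function.uncurry fun z m => k z m * g m) :=
      (hk.meas.mul (hg.meas.comp measurable_snd)).stronglyMeasurable
    exact this.integral_prod_right.measurable
  refine ⟨hm, ⟨hm.aestronglyMeasurable, ?_⟩, ?_⟩
  · exact (lintegral_mono fun z => enorm_kerOp_le k g z).trans_lt (hk.lintegral_lintegral_lt_top hg)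
  · obtain ⟨B, hB⟩ := hk.right
    obtain ⟨C, hC⟩ := hg.bdd
    refine ⟨(ENNReal.ofReal B * ENNReal.ofReal C).toReal, fun z => ?_⟩
    have : ‖kerOp μ k g z‖ₑ ≤ ENNReal.ofReal B * ENNReal.ofReal C := by
      refine (enorm_kerOp_le k g z).trans ?_
      calc ∫⁻ m, ‖k z m‖ₑ * ‖g m‖ₑ ∂μ ≤ ∫⁻ m, ‖k z m‖ₑ * ENNReal.ofReal C ∂μ := by
            refine lintegral_mono fun m => mul_le_mul_right ?_ _
            rw [← ofReal_norm]; exact ENNReal.ofReal_le_ofReal (hC m)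
        _ = (∫⁻ m, ‖k z m‖ₑ ∂μ) * ENNReal.ofReal C := lintegral_mul_const' _ _ ENNReal.ofReal_ne_top
        _ ≤ _ := mul_le_mul_left (hB z) _
    rw [← ofReal_norm] at this
    exact (ENNReal.ofReal_le_iff_le_toReal (by finiteness)).1 this

lemma SchurKernel.integral_kerOp_mul [SFinite μ] (hk : SchurKernel μ k) (hg : BddInt μ g)
    {h : X → ℝ} (hh : BddInt μ h) :
    ∫ z, kerOp μ k g z * h z ∂μ = ∫ m, g m * kerOp μ (fun z m => k m z) h m ∂μ := by
  simp only [kerOp, ← integral_mul_const, ← integral_const_mul]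
  rw [integral_integral_swap]
  · congr 1; ext m; congr 1; ext z; ring
  · have hm : Measurable (Function.uncurry fun z m => k z m * g m * h z) :=
      (hk.meas.mul (hg.meas.comp measurable_snd)).mul (hh.meas.comp measurable_fst)
    refine ⟨hm.aestronglyMeasurable, ?_⟩
    obtain ⟨C, hC⟩ := hh.bdd
    rw [HasFiniteIntegral, lintegral_prod _ hm.enorm.aemeasurable]
    calc _ ≤ ∫⁻ z, (∫⁻ m, ‖k z m‖ₑ * ‖g m‖ₑ ∂μ) * ENNReal.ofReal C ∂μ := by
          refine lintegral_mono fun z => ?_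
          rw [← lintegral_mul_const' _ _ ENNReal.ofReal_ne_top]
          refine lintegral_mono fun m => ?_
          simp only [Function.uncurry, enorm_mul]
          refine mul_le_mul_right ?_ _
          rw [← ofReal_norm]; exact ENNReal.ofReal_le_ofReal (hC z)
      _ < ∞ := by
          rw [lintegral_mul_const' _ _ ENNReal.ofReal_ne_top]
          exact ENNReal.mul_lt_top (hk.lintegral_lintegral_lt_top hg) ENNReal.ofReal_lt_top

end Schur

variable {X : Type*} [PseudoMetricSpace X] [SecondCountableTopology X] [MeasurableSpace X]
  [BorelSpace X] {μ : Measure X} [SFinite μ] {V : ℝ} {Q : ℕ} {k : X → X → ℝ} {A : ℝ}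

lemma CZKernel.lintegral_bad_le (hk : CZKernel μ k A) {b : X → ℝ} (hb : BddInt μ b)
    (hb0 : ∫ m, b m ∂μ = 0) {x : X} {r : ℝ} (hs : ∀ m, m ∉ ball x (5 * r) → b m = 0) :
    ∫⁻ z in (ball x (20 * r))ᶜ, ‖kerOp μ k b z‖ₑ ∂μ ≤ ENNReal.ofReal A * ∫⁻ m, ‖b m‖ₑ ∂μ := by
  have h1 : ∀ z, kerOp μ k b z = ∫ m, (k z m - k z x) * b m ∂μ := fun z => by
    simp only [sub_mul]
    rw [integral_sub (hk.integrable_mul hb z) (hb.int.const_mul _), integral_const_mul, hb0,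
      mul_zero, sub_zero]; rfl
  calc ∫⁻ z in (ball x (20 * r))ᶜ, ‖kerOp μ k b z‖ₑ ∂μ
      ≤ ∫⁻ z in (ball x (20 * r))ᶜ, ∫⁻ m, ‖k z m - k z x‖ₑ * ‖b m‖ₑ ∂μ ∂μ := by
        refine lintegral_mono fun z => ?_
        simp only [h1, ← enorm_mul]
        exact enorm_integral_le_lintegral_enorm _
    _ = ∫⁻ m, (∫⁻ z in (ball x (20 * r))ᶜ, ‖k z m - k z x‖ₑ ∂μ) * ‖b m‖ₑ ∂μ := by
        rw [lintegral_lintegral_swap]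
        · simp only [lintegral_mul_const' _ _ enorm_ne_top]
        · refine Measurable.aemeasurable ?_
          refine Measurable.mul (Measurable.enorm (Measurable.sub hk.meas ?_))
            (hb.meas.comp measurable_snd).enorm
          exact hk.meas.comp (measurable_fst.prodMk measurable_const)
    _ ≤ ∫⁻ m, ENNReal.ofReal A * ‖b m‖ₑ ∂μ := by
        refine lintegral_mono fun m => ?_
        by_cases hm : m ∈ ball x (5 * r)
        · refine mul_le_mul_left ((lintegral_mono_set ?_).trans (hk.hor m x)) _
          intro z hz
          simp only [mem_compl_iff, mem_ball, not_lt, mem_ofPred_eq] at hz hm ⊢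
          linarith
        · simp [hs m hm]
    _ = _ := lintegral_const_mul' _ _ ENNReal.ofReal_ne_top

end CalderonZygmundOp

section CalderonZygmundWeak

open Metric Set

variable {X : Type*} [PseudoMetricSpace X] [SecondCountableTopology X] [MeasurableSpace X]
  [BorelSpace X] {μ : Measure X} [SFinite μ] {V : ℝ} {Q : ℕ} {k : X → X → ℝ} {A : ℝ}

lemma BddInt.sub {f g : X → ℝ} (hf : BddInt μ f) (hg : BddInt μ g) : BddInt μ (f - g) := by
  obtain ⟨B, hB⟩ := hf.bdd
  obtain ⟨C, hC⟩ := hg.bdd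
  exact ⟨hf.meas.sub hg.meas, hf.int.sub hg.int, B + C, fun x =>
    (abs_sub _ _).trans (add_le_add (hB x) (hC x))⟩

lemma BddInt.indicator {f : X → ℝ} (hf : BddInt μ f) {s : Set X} (hs : MeasurableSet s) :
    BddInt μ (s.indicator f) := by
  obtain ⟨B, hB⟩ := hf.bdd
  refine ⟨hf.meas.indicator hs, hf.int.indicator hs, B, fun x => ?_⟩
  by_cases hx : x ∈ s
  · rw [indicator_of_mem hx]; exact hB x
  · rw [indicator_of_notMem hx, abs_zero]; exact (abs_nonneg _).trans (hB x)

lemma bddInt_indicator_const {s : Set X} (hs : MeasurableSet s) (hμ : μ s ≠ ∞) (c : ℝ) :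
    BddInt μ (s.indicator fun _ => c) := by
  refine ⟨measurable_const.indicator hs, (integrable_indicator_iff hs).2
    (integrableOn_const hμ), |c|, fun x => ?_⟩
  by_cases hx : x ∈ s
  · rw [indicator_of_mem hx]
  · rw [indicator_of_notMem hx, abs_zero]; exact abs_nonneg _

lemma SchurKernel.enorm_kerOp_tsum_le {ι : Type*} [Countable ι] (hk : SchurKernel μ k)
    {b : ι → X → ℝ} (hb : ∀ i, BddInt μ (b i)) {C : ℝ} (hC : ∀ m, ∑' i, ‖b i m‖ₑ ≤ ENNReal.ofReal C)
    (z : X) : ‖kerOp μ k (fun m => ∑' i, b i m) z‖ₑ ≤ ∑' i, ‖kerOp μ k (b i) z‖ₑ := by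
  obtain ⟨B, hB⟩ := hk.right
  have h1 : kerOp μ k (fun m => ∑' i, b i m) z = ∑' i, kerOp μ k (b i) z := by
    simp only [kerOp, ← tsum_mul_left]
    refine integral_tsum (fun i => (hk.integrable_mul (hb i) z).1) (ne_of_lt ?_)
    rw [← lintegral_tsum fun i => (hk.integrable_mul (hb i) z).1.enorm]
    calc _ ≤ ∫⁻ m, ‖k z m‖ₑ * ENNReal.ofReal C ∂μ := by
          refine lintegral_mono fun m => ?_
          simp only [enorm_mul, ENNReal.tsum_mul_left]
          exact mul_le_mul_right (hC m) _
      _ = (∫⁻ m, ‖k z m‖ₑ ∂μ) * ENNReal.ofReal C := lintegral_mul_const' _ _ ENNReal.ofReal_ne_top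
      _ < ∞ := ENNReal.mul_lt_top ((hB z).trans_lt ENNReal.ofReal_lt_top) ENNReal.ofReal_lt_top
  rw [h1]
  exact enorm_tsum_le_tsum_enorm

/-- The constant in the weak-type estimate. -/
def czConst (A : ℝ) (Q : ℕ) : ℝ := A * 20 ^ Q * 20 ^ Q + A + 20 ^ Q + 2 * A * 20 ^ Q

/-- Calderón–Zygmund weak-type estimate, with the good part kept in `L²` form. -/
lemma CZKernel.weak_type (h : BallGrowth μ V Q) (hk : CZKernel μ k A) {f : X → ℝ}
    (hf : BddInt μ f) {t : ℝ} (ht : 0 < t) :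
    μ {z | 2 * t < |kerOp μ k f z|} ≤ ENNReal.ofReal (czConst A Q) *
      (μ {z | ENNReal.ofReal t < maxFn μ (fun y => ENNReal.ofReal |f y|) z} +
        ENNReal.ofReal (1 / t ^ 2) * ∫⁻ y in {y | |f y| ≤ t}, ENNReal.ofReal (f y ^ 2) ∂μ) := by
  set Ω := {z | ENNReal.ofReal t < maxFn μ (fun y => ENNReal.ofReal |f y|) z} with hΩ
  have hA := hk.nonneg
  obtain ⟨u, r, E, huc, hr0, hBd, hBΩ, hEm, hEs, hEd, hEu, hEf⟩ :=
    h.exists_cz_decomposition hf.int ht hΩ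
  have := huc.to_subtype
  have hΩm : MeasurableSet Ω := (h.isOpen_lt_maxFn _ _).measurableSet
  set L : ℝ := 20 ^ Q * t with hL
  have hL0 : 0 < L := by positivity
  obtain ⟨C, hC⟩ := hf.bdd
  have hen : ∀ y : ℝ, ‖y‖ₑ = ENNReal.ofReal |y| := fun y => by
    rw [← ofReal_norm, Real.norm_eq_abs]
  set c : X → ℝ := fun x => (∫ y in E x, f y ∂μ) / μ.real (ball x (r x)) with hc
  have hBpos : ∀ x ∈ u, 0 < μ.real (ball x (r x)) := fun x hx =>
    ENNReal.toReal_pos (h.ball_pos x (hr0 x hx)).ne' (h.ball_ne_top _ _)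
  have hcL : ∀ x ∈ u, |c x| ≤ L := fun x hx => by
    rw [hc, abs_div, abs_of_pos (hBpos x hx), div_le_iff₀ (hBpos x hx)]
    have h1 : ENNReal.ofReal |∫ y in E x, f y ∂μ| ≤ ENNReal.ofReal L * μ (ball x (r x)) := by
      rw [← hen]
      refine (enorm_integral_le_lintegral_enorm _).trans ?_
      simp only [hen]
      exact hEf x hx
    rw [← ENNReal.ofReal_toReal (h.ball_ne_top x (r x)), ← ENNReal.ofReal_mul hL0.le] at h1
    exact (ENNReal.ofReal_le_ofReal_iff (by positivity)).1 h1
  set b : u → X → ℝ := fun x => (E x).indicator f - (ball x.1 (r x)).indicator fun _ => c x with hb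
  have hbB : ∀ x, BddInt μ (b x) := fun x => (hf.indicator (hEm x)).sub
    (bddInt_indicator_const measurableSet_ball (h.ball_ne_top _ _) _)
  have hb0 : ∀ x, ∫ m, b x m ∂μ = 0 := fun x => by
    have : ∫ m, b x m ∂μ = (∫ y in E x, f y ∂μ) - μ.real (ball x.1 (r x)) * c x := by
      simp only [hb, Pi.sub_apply]
      rw [integral_sub (hf.indicator (hEm x)).int
        (bddInt_indicator_const measurableSet_ball (h.ball_ne_top _ _) _).int,
        integral_indicator (hEm x), integral_indicator measurableSet_ball, setIntegral_const,
        smul_eq_mul]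
    rw [this, hc, mul_div_cancel₀ _ (hBpos x x.2).ne', sub_self]
  have hbs : ∀ x : u, ∀ m, m ∉ ball x.1 (5 * r x) → b x m = 0 := fun x m hm => by
    simp only [hb, Pi.sub_apply]
    rw [indicator_of_notMem fun hm' => hm (hEs x hm'), indicator_of_notMem fun hm' =>
      hm (ball_subset_ball (by linarith [hr0 x x.2]) hm'), sub_zero]
  -- the total mass of the bad part
  have hB1 : ∑' x : u, μ (ball x.1 (r x)) ≤ μ Ω := by
    rw [← measure_biUnion huc hBd fun _ _ => measurableSet_ball]
    exact measure_mono (iUnion₂_subset hBΩ)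
  have hb1 : ∀ x : u, ∫⁻ m, ‖b x m‖ₑ ∂μ ≤ ENNReal.ofReal (2 * L) * μ (ball x.1 (r x)) := fun x => by
    calc ∫⁻ m, ‖b x m‖ₑ ∂μ ≤ ∫⁻ m, ((E x).indicator (fun m => ENNReal.ofReal |f m|) m +
          (ball x.1 (r x)).indicator (fun _ => ENNReal.ofReal L) m) ∂μ := by
          refine lintegral_mono fun m => ?_
          simp only [hb, Pi.sub_apply]
          refine (enorm_sub_le).trans (add_le_add ?_ ?_)
          · by_cases hm : m ∈ E x <;> simp [hm, hen]
          · by_cases hm : m ∈ ball x.1 (r x)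
            · rw [indicator_of_mem hm, indicator_of_mem hm, hen]
              exact ENNReal.ofReal_le_ofReal (hcL x x.2)
            · rw [indicator_of_notMem hm, indicator_of_notMem hm]; simp
      _ = (∫⁻ m in E x, ENNReal.ofReal |f m| ∂μ) + ENNReal.ofReal L * μ (ball x.1 (r x)) := by
          rw [lintegral_add_right _ (measurable_const.indicator measurableSet_ball),
            lintegral_indicator (hEm x), lintegral_indicator measurableSet_ball, setLIntegral_const]
      _ ≤ ENNReal.ofReal L * μ (ball x.1 (r x)) + ENNReal.ofReal L * μ (ball x.1 (r x)) := by
          gcongr; exact hEf x x.2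
      _ = _ := by rw [← add_mul, ← ENNReal.ofReal_add hL0.le hL0.le]; congr 2; ring
  -- pointwise structure of the bad part
  have hsum : ∀ m, ∃ a e, HasSum (fun x : u => b x m) (a - e) ∧ (m ∈ Ω → a = f m) ∧
      (m ∉ Ω → a = 0 ∧ e = 0) ∧ |e| ≤ L := fun m => by
    obtain ⟨a, ha, ha'⟩ := hasSum_indicator_disjoint hEd (fun _ => f) m
    obtain ⟨e, he, he'⟩ := hasSum_indicator_disjoint hBd (fun x _ => c x) m
    refine ⟨a, e, ha.sub he, fun hm => ?_, fun hm => ⟨?_, ?_⟩, ?_⟩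
    · rcases ha' with ⟨_, _, _, h3⟩ | ⟨h1, _⟩
      · exact h3
      · rw [← hEu] at hm
        obtain ⟨x, hx, hxm⟩ := mem_iUnion₂.1 hm
        exact absurd hxm (h1 x hx)
    · rcases ha' with ⟨x, h1, h2, _⟩ | ⟨_, h2⟩
      · exact absurd (hEu ▸ mem_biUnion h1 h2) hm
      · exact h2
    · rcases he' with ⟨x, h1, h2, _⟩ | ⟨_, h2⟩
      · exact absurd (hBΩ x h1 h2) hm
      · exact h2
    · rcases he' with ⟨x, h1, _, h3⟩ | ⟨_, h2⟩
      · rw [h3]; exact hcL x h1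
      · rw [h2, abs_zero]; exact hL0.le
  have hbsum : ∀ m, ∑' x : u, ‖b x m‖ₑ ≤ ENNReal.ofReal (C + L) := fun m => by
    obtain ⟨a, ha, ha'⟩ := hasSum_indicator_disjoint hEd (fun _ y => ‖f y‖ₑ) m
    obtain ⟨e, he, he'⟩ := hasSum_indicator_disjoint hBd (fun x _ => ‖c x‖ₑ) m
    have h1 : ∑' x : u, ‖b x m‖ₑ ≤ a + e := by
      rw [← ha.tsum_eq, ← he.tsum_eq, ← ENNReal.tsum_add]
      refine ENNReal.tsum_le_tsum fun x => ?_
      simp only [hb, Pi.sub_apply]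
      refine (enorm_sub_le).trans (le_of_eq ?_)
      rw [enorm_indicator_eq_indicator_enorm, enorm_indicator_eq_indicator_enorm]
    have hC0 : 0 ≤ C := (abs_nonneg _).trans (hC m)
    rw [ENNReal.ofReal_add hC0 hL0.le]
    refine h1.trans (add_le_add ?_ ?_)
    · rcases ha' with ⟨x, _, _, h3⟩ | ⟨_, h2⟩
      · rw [h3, hen]; exact ENNReal.ofReal_le_ofReal (hC m)
      · simp [h2]
    · rcases he' with ⟨x, hx, _, h3⟩ | ⟨_, h2⟩
      · rw [h3, hen]; exact ENNReal.ofReal_le_ofReal (hcL x hx)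
      · simp [h2]
  set β : X → ℝ := fun m => ∑' x : u, b x m with hβ
  have hβm : Measurable β := Measurable.tsum fun x => (hbB x).meas
  have hβle : ∀ m, ‖β m‖ₑ ≤ ∑' x : u, ‖b x m‖ₑ := fun m => enorm_tsum_le_tsum_enorm
  have hΩfin : μ Ω ≠ ∞ := by
    intro hinf
    have h1 := h.weak_type (fun y => ENNReal.ofReal |f y|) (ENNReal.ofReal_pos.2 ht).ne'
      ENNReal.ofReal_ne_top
    rw [← hΩ, hinf, ENNReal.mul_top (ENNReal.ofReal_pos.2 ht).ne'] at h1
    have h2 := hf.int.2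
    simp only [HasFiniteIntegral, hen] at h2
    exact ENNReal.mul_ne_top ENNReal.ofReal_ne_top h2.ne (top_le_iff.1 h1)
  have hβB : BddInt μ β := by
    refine ⟨hβm, ⟨hβm.aestronglyMeasurable, ?_⟩, C + L, fun m => ?_⟩
    · calc ∫⁻ m, ‖β m‖ₑ ∂μ ≤ ∫⁻ m, ∑' x : u, ‖b x m‖ₑ ∂μ := lintegral_mono hβle
        _ = ∑' x : u, ∫⁻ m, ‖b x m‖ₑ ∂μ := lintegral_tsum fun x => (hbB x).meas.enorm.aemeasurable
        _ ≤ ∑' x : u, ENNReal.ofReal (2 * L) * μ (ball x.1 (r x)) := ENNReal.tsum_le_tsum hb1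
        _ ≤ ENNReal.ofReal (2 * L) * μ Ω := by
          rw [ENNReal.tsum_mul_left]; exact mul_le_mul_right hB1 _
        _ < ∞ := ENNReal.mul_lt_top ENNReal.ofReal_lt_top hΩfin.lt_top
    · have h1 := (hβle m).trans (hbsum m)
      rw [hen] at h1
      exact (ENNReal.ofReal_le_ofReal_iff (by linarith [(abs_nonneg _).trans (hC m)])).1 h1
  have hg : BddInt μ (f - β) := hf.sub hβB
  have hTf : ∀ z, kerOp μ k f z = kerOp μ k (f - β) z + kerOp μ k β z := fun z => by
    simp only [kerOp]
    rw [← integral_add (hk.integrable_mul hg z) (hk.integrable_mul hβB z)]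
    congr 1; ext m; simp only [Pi.sub_apply]; ring
  -- good part
  have hgood : μ {z | t < |kerOp μ k (f - β) z|} ≤ ENNReal.ofReal (1 / t ^ 2) *
      (ENNReal.ofReal A * ((∫⁻ y in {y | |f y| ≤ t}, ENNReal.ofReal (f y ^ 2) ∂μ) +
        ENNReal.ofReal (L ^ 2) * μ Ω)) := by
    have hSm : MeasurableSet {y | |f y| ≤ t} := measurableSet_le hf.meas.abs measurable_const
    have h1 : ∫⁻ z, ENNReal.ofReal ((f - β) z ^ 2) ∂μ ≤
        (∫⁻ y in {y | |f y| ≤ t}, ENNReal.ofReal (f y ^ 2) ∂μ) + ENNReal.ofReal (L ^ 2) * μ Ω := by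
      rw [← lintegral_indicator hSm, ← setLIntegral_const, ← lintegral_indicator hΩm,
        ← lintegral_add_left ((hf.meas.pow_const 2).ennreal_ofReal.indicator hSm)]
      refine lintegral_mono_ae ?_
      filter_upwards [h.ae_le_maxFn hf.int] with m hm
      obtain ⟨a, e, hs, hin, hout, he⟩ := hsum m
      have hβm : β m = a - e := hs.tsum_eq
      rw [Pi.sub_apply, hβm]
      by_cases hmΩ : m ∈ Ω
      · rw [hin hmΩ, _root_.sub_sub_cancel, indicator_of_mem hmΩ]
        refine le_add_left (ENNReal.ofReal_le_ofReal ?_)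
        exact sq_le_sq' (by linarith [neg_abs_le e]) ((le_abs_self e).trans he)
      · rw [(hout hmΩ).1, (hout hmΩ).2]
        have hft : |f m| ≤ t := by
          have : maxFn μ (fun y => ENNReal.ofReal |f y|) m ≤ ENNReal.ofReal t := not_lt.1 hmΩ
          exact (ENNReal.ofReal_le_ofReal_iff ht.le).1 (hm.trans this)
        rw [indicator_of_mem (show m ∈ {y | |f y| ≤ t} from hft)]
        simp
    have h2 := mul_meas_ge_le_lintegral (μ := μ) ((hk.bddInt_kerOp hg).meas.pow_const 2).ennreal_ofReal
      (ENNReal.ofReal (t ^ 2))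
    calc μ {z | t < |kerOp μ k (f - β) z|}
        ≤ μ {z | ENNReal.ofReal (t ^ 2) ≤ ENNReal.ofReal (kerOp μ k (f - β) z ^ 2)} := by
          refine measure_mono fun z hz => ENNReal.ofReal_le_ofReal ?_
          rw [← sq_abs (kerOp μ k (f - β) z)]
          exact pow_le_pow_left₀ ht.le (le_of_lt hz) 2
      _ = ENNReal.ofReal (1 / t ^ 2) * (ENNReal.ofReal (t ^ 2) *
          μ {z | ENNReal.ofReal (t ^ 2) ≤ ENNReal.ofReal (kerOp μ k (f - β) z ^ 2)}) := by
          rw [← mul_assoc, ← ENNReal.ofReal_mul (by positivity), one_div,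
            inv_mul_cancel₀ (by positivity), ENNReal.ofReal_one, one_mul]
      _ ≤ _ := mul_le_mul_right (h2.trans ((hk.l2 _ hg).trans (mul_le_mul_right h1 _))) _
  -- bad part
  set U : Set X := ⋃ x ∈ u, ball x (20 * r x) with hU
  have hUm : μ U ≤ ENNReal.ofReal (20 ^ Q) * μ Ω := by
    calc μ U ≤ ∑' x : u, μ (ball x.1 (20 * r x)) := measure_biUnion_le μ huc _
      _ = ENNReal.ofReal (20 ^ Q) * ∑' x : u, μ (ball x.1 (r x)) := by
        rw [← ENNReal.tsum_mul_left]
        exact tsum_congr fun x => h.ball_mul _ _ (hr0 x x.2) (by norm_num)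
      _ ≤ _ := mul_le_mul_right hB1 _
  have hbad1 : ∫⁻ z in Uᶜ, ‖kerOp μ k β z‖ₑ ∂μ ≤ ENNReal.ofReal (A * (2 * L)) * μ Ω := by
    calc ∫⁻ z in Uᶜ, ‖kerOp μ k β z‖ₑ ∂μ
        ≤ ∫⁻ z in Uᶜ, ∑' x : u, ‖kerOp μ k (b x) z‖ₑ ∂μ :=
          lintegral_mono fun z => hk.enorm_kerOp_tsum_le hbB hbsum z
      _ = ∑' x : u, ∫⁻ z in Uᶜ, ‖kerOp μ k (b x) z‖ₑ ∂μ :=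
          lintegral_tsum fun x => (hk.bddInt_kerOp (hbB x)).meas.enorm.aemeasurable
      _ ≤ ∑' x : u, ENNReal.ofReal A * (ENNReal.ofReal (2 * L) * μ (ball x.1 (r x))) := by
          refine ENNReal.tsum_le_tsum fun x => ?_
          refine (lintegral_mono_set (compl_subset_compl.2
            (subset_biUnion_of_mem (u := fun x => ball x (20 * r x)) x.2))).trans ?_
          exact (hk.lintegral_bad_le (hbB x) (hb0 x) (hbs x)).trans (mul_le_mul_right (hb1 x) _)
      _ ≤ _ := by
          rw [ENNReal.tsum_mul_left, ENNReal.tsum_mul_left, ENNReal.ofReal_mul hA, mul_assoc]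
          exact mul_le_mul_right (mul_le_mul_right hB1 _) _
  have hbad : μ {z | t < |kerOp μ k β z|} ≤ ENNReal.ofReal (20 ^ Q) * μ Ω +
      ENNReal.ofReal (1 / t) * (ENNReal.ofReal (A * (2 * L)) * μ Ω) := by
    have hUms : MeasurableSet U := MeasurableSet.biUnion huc fun _ _ => measurableSet_ball
    have h2 := mul_meas_ge_le_lintegral (μ := μ.restrict Uᶜ) (hk.bddInt_kerOp hβB).meas.enorm
      (ENNReal.ofReal t)
    have h3 : MeasurableSet {z | ENNReal.ofReal t ≤ ‖kerOp μ k β z‖ₑ} :=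
      measurableSet_le measurable_const (hk.bddInt_kerOp hβB).meas.enorm
    calc μ {z | t < |kerOp μ k β z|}
        ≤ μ (U ∪ ({z | ENNReal.ofReal t ≤ ‖kerOp μ k β z‖ₑ} ∩ Uᶜ)) := by
          refine measure_mono fun z hz => ?_
          by_cases hzU : z ∈ U
          · exact Or.inl hzU
          · refine Or.inr ⟨?_, hzU⟩
            simp only [mem_ofPred_eq, hen]
            exact ENNReal.ofReal_le_ofReal (le_of_lt hz)
      _ ≤ μ U + μ.restrict Uᶜ {z | ENNReal.ofReal t ≤ ‖kerOp μ k β z‖ₑ} := by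
          rw [Measure.restrict_apply h3]; exact measure_union_le _ _
      _ = μ U + ENNReal.ofReal (1 / t) * (ENNReal.ofReal t *
          μ.restrict Uᶜ {z | ENNReal.ofReal t ≤ ‖kerOp μ k β z‖ₑ}) := by
          rw [← mul_assoc, ← ENNReal.ofReal_mul (by positivity), one_div,
            inv_mul_cancel₀ ht.ne', ENNReal.ofReal_one, one_mul]
      _ ≤ _ := add_le_add hUm (mul_le_mul_right (h2.trans hbad1) _)
  -- conclusion
  set I := ∫⁻ y in {y | |f y| ≤ t}, ENNReal.ofReal (f y ^ 2) ∂μ with hI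
  calc μ {z | 2 * t < |kerOp μ k f z|}
      ≤ μ ({z | t < |kerOp μ k (f - β) z|} ∪ {z | t < |kerOp μ k β z|}) := by
        refine measure_mono fun z hz => ?_
        by_contra hcon
        simp only [mem_union, mem_ofPred_eq, not_or, not_lt] at hcon hz
        rw [hTf] at hz
        have := abs_add_le (kerOp μ k (f - β) z) (kerOp μ k β z)
        linarith [hcon.1, hcon.2]
    _ ≤ _ := (measure_union_le _ _).trans (add_le_add hgood hbad)
    _ = ENNReal.ofReal (A * 20 ^ Q * 20 ^ Q + 20 ^ Q + 2 * A * 20 ^ Q) * μ Ω +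
        ENNReal.ofReal A * (ENNReal.ofReal (1 / t ^ 2) * I) := by
        have e1 : ENNReal.ofReal (1 / t ^ 2) * (ENNReal.ofReal A * (I + ENNReal.ofReal (L ^ 2) * μ Ω))
            = ENNReal.ofReal (1 / t ^ 2 * A * L ^ 2) * μ Ω +
              ENNReal.ofReal A * (ENNReal.ofReal (1 / t ^ 2) * I) := by
          rw [ENNReal.ofReal_mul (by positivity), ENNReal.ofReal_mul (by positivity)]; ring
        have e2 : ENNReal.ofReal (1 / t) * (ENNReal.ofReal (A * (2 * L)) * μ Ω) =
            ENNReal.ofReal (1 / t * (A * (2 * L))) * μ Ω := by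
          rw [ENNReal.ofReal_mul (by positivity : 0 ≤ 1 / t), mul_assoc]
        have e3 : 1 / t ^ 2 * A * L ^ 2 = A * 20 ^ Q * 20 ^ Q := by rw [hL]; field_simp
        have e4 : 1 / t * (A * (2 * L)) = 2 * A * 20 ^ Q := by rw [hL]; field_simp
        rw [e1, e2, e3, e4, ENNReal.ofReal_add (by positivity) (by positivity),
          ENNReal.ofReal_add (by positivity) (by positivity)]
        ring
    _ ≤ _ := by
        rw [mul_add]
        refine add_le_add (mul_le_mul_left (ENNReal.ofReal_le_ofReal ?_) _)
          (mul_le_mul_left (ENNReal.ofReal_le_ofReal ?_) _)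
        · simp only [czConst]; linarith
        · simp only [czConst]
          have : 0 ≤ A * 20 ^ Q * 20 ^ Q + 20 ^ Q + 2 * A * 20 ^ Q := by positivity
          linarith

end CalderonZygmundWeak

section CalderonZygmundLp

open Metric Set

lemma lintegral_Ioi_rpow {p a : ℝ} (hp : p < 2) (ha : 0 < a) :
    ∫⁻ t in Ioi a, ENNReal.ofReal (t ^ (p - 3)) = ENNReal.ofReal (a ^ (p - 2) / (2 - p)) := by
  rw [← ofReal_integral_eq_lintegral_ofReal (integrableOn_Ioi_rpow_of_lt (by linarith) ha)]
  · rw [integral_Ioi_rpow_of_lt (by linarith) ha]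
    congr 1
    rw [show p - 3 + 1 = p - 2 by ring, show 2 - p = -(p - 2) by ring, div_neg, neg_div]
  · filter_upwards [ae_restrict_mem measurableSet_Ioi] with t ht
    exact Real.rpow_nonneg (ha.trans ht).le _

lemma lintegral_truncated_layer {X : Type*} [MeasurableSpace X] {μ : Measure X} [SFinite μ]
    {f : X → ℝ} (hf : Measurable f) {p : ℝ} (hp0 : 0 < p) (hp : p < 2) :
    ∫⁻ t in Ioi 0, (ENNReal.ofReal (1 / t ^ 2) * ∫⁻ y in {y | |f y| ≤ t},
      ENNReal.ofReal (f y ^ 2) ∂μ) * ENNReal.ofReal (t ^ (p - 1)) =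
      ENNReal.ofReal (1 / (2 - p)) * ∫⁻ y, ENNReal.ofReal (|f y| ^ p) ∂μ := by
  calc _ = ∫⁻ t : ℝ in Ioi (0:ℝ), ∫⁻ y : X, ENNReal.ofReal (t ^ (p - 3)) *
        {a : ℝ × X | |f a.2| ≤ a.1}.indicator (fun a => ENNReal.ofReal (f a.2 ^ 2)) (t, y) ∂μ := by
        refine setLIntegral_congr_fun measurableSet_Ioi fun t ht => ?_
        have ht : 0 < t := ht
        rw [lintegral_const_mul' _ _ ENNReal.ofReal_ne_top]
        have : ∫⁻ y, {a : ℝ × X | |f a.2| ≤ a.1}.indicator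
            (fun a => ENNReal.ofReal (f a.2 ^ 2)) (t, y) ∂μ =
            ∫⁻ y in {y | |f y| ≤ t}, ENNReal.ofReal (f y ^ 2) ∂μ := by
          rw [← lintegral_indicator (measurableSet_le hf.abs measurable_const)]; rfl
        rw [this, mul_right_comm, ← ENNReal.ofReal_mul (by positivity)]
        congr 2
        rw [show p - 1 = (p - 3) + (2 : ℕ) by push_cast; ring, Real.rpow_add_natCast ht.ne']
        field_simp
    _ = ∫⁻ y : X, (∫⁻ t : ℝ in Ioi (0:ℝ), ENNReal.ofReal (t ^ (p - 3)) *
        {a : ℝ × X | |f a.2| ≤ a.1}.indicator (fun a => ENNReal.ofReal (f a.2 ^ 2)) (t, y)) ∂μ := by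
        rw [lintegral_lintegral_swap]
        refine Measurable.aemeasurable ?_
        exact Measurable.mul (by fun_prop) (Measurable.indicator (by fun_prop)
          (measurableSet_le (by fun_prop) (by fun_prop)))
    _ = ∫⁻ y, ENNReal.ofReal (1 / (2 - p)) * ENNReal.ofReal (|f y| ^ p) ∂μ := by
        refine lintegral_congr fun y => ?_
        rcases eq_or_ne (f y) 0 with h0 | h0
        · have : ∀ t, {a : ℝ × X | |f a.2| ≤ a.1}.indicator
              (fun a => ENNReal.ofReal (f a.2 ^ 2)) (t, y) = 0 := fun t => by
            by_cases ht : |f y| ≤ t <;> simp [indicator, h0]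
          simp only [this, mul_zero, lintegral_zero]
          simp [h0, Real.zero_rpow hp0.ne']
        have ha : 0 < |f y| := abs_pos.2 h0
        have : ∀ t ∈ Ioi (0:ℝ), ENNReal.ofReal (t ^ (p - 3)) *
            {a : ℝ × X | |f a.2| ≤ a.1}.indicator (fun a => ENNReal.ofReal (f a.2 ^ 2)) (t, y) =
            (Ici |f y|).indicator (fun t => ENNReal.ofReal (f y ^ 2) *
              ENNReal.ofReal (t ^ (p - 3))) t := by
          intro t _
          by_cases h1 : |f y| ≤ t
          · rw [indicator_of_mem (by exact h1), indicator_of_mem (by exact h1), mul_comm]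
          · rw [indicator_of_notMem (by exact h1), indicator_of_notMem (by exact h1), mul_zero]
        have hI : Ici |f y| ∩ Ioi 0 = Ici |f y| := inter_eq_left.2 fun t ht => ha.trans_le ht
        rw [setLIntegral_congr_fun measurableSet_Ioi this, lintegral_indicator measurableSet_Ici,
          Measure.restrict_restrict measurableSet_Ici,
          hI,
          lintegral_const_mul' _ _ ENNReal.ofReal_ne_top, setLIntegral_congr Ioi_ae_eq_Ici.symm,
          lintegral_Ioi_rpow hp ha, ← ENNReal.ofReal_mul (by positivity),
          ← ENNReal.ofReal_mul (by have : 0 < 2 - p := by linarith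
                                   positivity)]
        congr 1
        rw [← sq_abs, show |f y| ^ p = |f y| ^ (p - 2) * |f y| ^ 2 by
          rw [← Real.rpow_add_natCast ha.ne']; congr 1; push_cast; ring]
        ring
    _ = _ := lintegral_const_mul' _ _ ENNReal.ofReal_ne_top

variable {X : Type*} [PseudoMetricSpace X] [SecondCountableTopology X] [MeasurableSpace X]
  [BorelSpace X] {μ : Measure X} [SFinite μ] {V : ℝ} {Q : ℕ}

lemma czConst_nonneg {A : ℝ} (hA : 0 ≤ A) (Q : ℕ) : 0 ≤ czConst A Q := by
  unfold czConst; positivity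

lemma CZKernel.lintegral_rpow_le_of_lt_two (h : BallGrowth μ V Q) {k : X → X → ℝ} {A : ℝ}
    (hk : CZKernel μ k A) {p : ℝ} (hp1 : 1 < p) (hp2 : p < 2) {f : X → ℝ} (hf : BddInt μ f) :
    ∫⁻ z, ENNReal.ofReal (|kerOp μ k f z| ^ p) ∂μ ≤
      ENNReal.ofReal (2 ^ p * p * czConst A Q * (2 ^ p * 5 ^ Q / (p - 1) + 1 / (2 - p))) *
        ∫⁻ z, ENNReal.ofReal (|f z| ^ p) ∂μ := by
  have hu := (hk.bddInt_kerOp hf).meas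
  have hc := czConst_nonneg hk.nonneg Q
  have hp1' : 0 < p - 1 := by linarith
  have hp2' : 0 < 2 - p := by linarith
  have h1 : ∫⁻ z, ENNReal.ofReal (|kerOp μ k f z| ^ p) ∂μ = ENNReal.ofReal (2 ^ p) *
      ∫⁻ z, ENNReal.ofReal ((|kerOp μ k f z| / 2) ^ p) ∂μ := by
    rw [← lintegral_const_mul' _ _ ENNReal.ofReal_ne_top]
    refine lintegral_congr fun z => ?_
    rw [← ENNReal.ofReal_mul (by positivity), ← Real.mul_rpow (by norm_num) (by positivity)]
    congr 2; ring
  rw [h1, lintegral_rpow_eq_lintegral_meas_lt_mul μ (Filter.Eventually.of_forall fun z => by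
    positivity) (by fun_prop) (by linarith)]
  have hmeas : Measurable fun t : ℝ =>
      μ {z | ENNReal.ofReal t < maxFn μ (fun y => ENNReal.ofReal |f y|) z} := by
    refine Antitone.measurable fun s t hst => measure_mono fun z hz => ?_
    exact (ENNReal.ofReal_le_ofReal hst).trans_lt hz
  have h2 : ∫⁻ t in Ioi (0:ℝ), μ {z | t < |kerOp μ k f z| / 2} * ENNReal.ofReal (t ^ (p - 1)) ≤
      ENNReal.ofReal (czConst A Q) * ((∫⁻ t in Ioi (0:ℝ),
        μ {z | ENNReal.ofReal t < maxFn μ (fun y => ENNReal.ofReal |f y|) z} *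
          ENNReal.ofReal (t ^ (p - 1))) +
        ∫⁻ t in Ioi (0:ℝ), (ENNReal.ofReal (1 / t ^ 2) * ∫⁻ y in {y | |f y| ≤ t},
          ENNReal.ofReal (f y ^ 2) ∂μ) * ENNReal.ofReal (t ^ (p - 1))) := by
    have hm : Measurable fun t : ℝ =>
        μ {z | ENNReal.ofReal t < maxFn μ (fun y => ENNReal.ofReal |f y|) z} *
          ENNReal.ofReal (t ^ (p - 1)) := hmeas.mul (by fun_prop)
    rw [← lintegral_add_left hm,
      ← lintegral_const_mul' _ _ ENNReal.ofReal_ne_top]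
    refine setLIntegral_mono' measurableSet_Ioi fun t ht => ?_
    have hset : {z | t < |kerOp μ k f z| / 2} = {z | 2 * t < |kerOp μ k f z|} := by
      ext z; simp only [mem_ofPred_eq, lt_div_iff₀ (zero_lt_two (α := ℝ)), mul_comm]
    rw [hset, ← add_mul, ← mul_assoc]
    exact mul_le_mul_left (hk.weak_type h hf ht) _
  calc _ ≤ ENNReal.ofReal (2 ^ p) * (ENNReal.ofReal p * (ENNReal.ofReal (czConst A Q) *
        (ENNReal.ofReal (2 ^ p * 5 ^ Q / (p - 1)) * (∫⁻ z, ENNReal.ofReal (|f z| ^ p) ∂μ) +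
          ENNReal.ofReal (1 / (2 - p)) * ∫⁻ z, ENNReal.ofReal (|f z| ^ p) ∂μ))) := by
        gcongr
        refine h2.trans ?_
        gcongr
        · exact h.lintegral_maxFn_layer hf.meas.abs (fun _ => abs_nonneg _) hp1
        · exact (lintegral_truncated_layer hf.meas (by linarith) hp2).le
    _ = _ := by
        rw [← add_mul, ← ENNReal.ofReal_add (by positivity) (by positivity), ← mul_assoc,
          ← mul_assoc, ← mul_assoc, ← ENNReal.ofReal_mul (by positivity),
          ← ENNReal.ofReal_mul (by positivity), ← ENNReal.ofReal_mul (by positivity)]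

lemma BddInt.integrable_rpow {f : X → ℝ} (hf : BddInt μ f) {p : ℝ} (hp : 1 ≤ p) :
    Integrable (fun x => |f x| ^ p) μ := by
  obtain ⟨B, hB⟩ := hf.bdd
  refine (hf.int.abs.const_mul (B ^ (p - 1))).mono' (by
    have := hf.meas; exact (by fun_prop : Measurable fun x => |f x| ^ p).aestronglyMeasurable) ?_
  refine Filter.Eventually.of_forall fun x => ?_
  rw [Real.norm_of_nonneg (by positivity)]
  rcases eq_or_ne (f x) 0 with h0 | h0
  · simp [h0, Real.zero_rpow (by linarith : p ≠ 0)]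
  · rw [show |f x| ^ p = |f x| ^ (p - 1) * |f x| by
      rw [← Real.rpow_add_one (abs_pos.2 h0).ne']; congr 1; ring]
    gcongr
    exact hB x

lemma BddInt.memLp {f : X → ℝ} (hf : BddInt μ f) {p : ℝ} (hp : 1 ≤ p) :
    MemLp f (ENNReal.ofReal p) μ := by
  rw [← integrable_norm_rpow_iff hf.meas.aestronglyMeasurable
    (ENNReal.ofReal_pos.2 (by linarith)).ne' ENNReal.ofReal_ne_top,
    ENNReal.toReal_ofReal (by linarith)]
  exact hf.integrable_rpow hp

lemma BddInt.dual {f : X → ℝ} (hf : BddInt μ f) {p : ℝ} (hp : 2 ≤ p) :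
    BddInt μ (fun x => |f x| ^ (p - 2) * f x) := by
  obtain ⟨B, hB⟩ := hf.bdd
  have := hf.meas
  have hm : Measurable (fun x => |f x| ^ (p - 2) * f x) := by fun_prop
  have hb : ∀ x, |(|f x| ^ (p - 2) * f x)| ≤ B ^ (p - 2) * |f x| := fun x => by
    rw [abs_mul, abs_of_nonneg (Real.rpow_nonneg (abs_nonneg _) _)]
    gcongr
    exact hB x
  refine ⟨hm, (hf.int.abs.const_mul (B ^ (p - 2))).mono' hm.aestronglyMeasurable
    (Filter.Eventually.of_forall hb), B ^ (p - 2) * B, fun x => (hb x).trans ?_⟩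
  have := hB x
  have hB0 : 0 ≤ B := (abs_nonneg _).trans this
  gcongr

lemma ofReal_integral_rpow {f : X → ℝ} (hf : BddInt μ f) {p : ℝ} (hp : 1 ≤ p) :
    ∫⁻ x, ENNReal.ofReal (|f x| ^ p) ∂μ = ENNReal.ofReal (∫ x, |f x| ^ p ∂μ) :=
  (ofReal_integral_eq_lintegral_ofReal (hf.integrable_rpow hp)
    (Filter.Eventually.of_forall fun _ => by positivity)).symm

lemma SchurKernel.integral_rpow_le_of_dual {k : X → X → ℝ} (hk : SchurKernel μ k) {p p' C : ℝ}
    (hpp : p.HolderConjugate p') (hp : 2 ≤ p) (hC : 0 ≤ C)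
    (hdual : ∀ g, BddInt μ g →
      ∫ z, |kerOp μ (fun z m => k m z) g z| ^ p' ∂μ ≤ C * ∫ z, |g z| ^ p' ∂μ)
    {f : X → ℝ} (hf : BddInt μ f) :
    ∫ z, |kerOp μ k f z| ^ p ∂μ ≤ C ^ (p - 1) * ∫ z, |f z| ^ p ∂μ := by
  set u := kerOp μ k f with hu
  have huB : BddInt μ u := hk.bddInt_kerOp hf
  set w : X → ℝ := fun x => |u x| ^ (p - 2) * u x with hw
  have hwB : BddInt μ w := huB.dual hp
  have hp1 := hpp.lt
  have hp1' := hpp.symm.lt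
  have huw : ∀ x, |u x| ^ p = u x * w x := fun x => by
    rcases eq_or_ne (u x) 0 with h0 | h0
    · simp [h0, Real.zero_rpow (by linarith : p ≠ 0)]
    · have : u x * w x = |u x| ^ (p - 2) * |u x| ^ 2 := by rw [sq_abs]; simp only [hw]; ring
      rw [this, ← Real.rpow_add_natCast (abs_pos.2 h0).ne']; congr 1; push_cast; ring
  have hwp : ∀ x, |w x| ^ p' = |u x| ^ p := fun x => by
    rcases eq_or_ne (u x) 0 with h0 | h0
    · simp [hw, h0, Real.zero_rpow (by linarith : p ≠ 0), Real.zero_rpow (by linarith : p' ≠ 0)]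
    · have h1 : |w x| = |u x| ^ (p - 1) := by
        simp only [hw]
        rw [abs_mul, abs_of_nonneg (Real.rpow_nonneg (abs_nonneg _) _),
          ← Real.rpow_add_one (abs_pos.2 h0).ne']; congr 1; ring
      rw [h1, ← Real.rpow_mul (abs_nonneg _), hpp.sub_one_mul_conj]
  set U := ∫ z, |u z| ^ p ∂μ with hU
  set F := ∫ z, |f z| ^ p ∂μ with hF
  have hU0 : 0 ≤ U := integral_nonneg fun _ => by positivity
  have hF0 : 0 ≤ F := integral_nonneg fun _ => by positivity
  have hTw := hk.swap.bddInt_kerOp hwB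
  have key : U ≤ F ^ (1 / p) * (C * U) ^ (1 / p') := by
    calc U = ∫ z, u z * w z ∂μ := integral_congr_ae (Filter.Eventually.of_forall huw)
      _ = ∫ m, f m * kerOp μ (fun z m => k m z) w m ∂μ := hk.integral_kerOp_mul hf hwB
      _ ≤ ∫ m, |f m| * |kerOp μ (fun z m => k m z) w m| ∂μ := by
          simp only [← abs_mul]
          exact (le_abs_self _).trans abs_integral_le_integral_abs
      _ ≤ F ^ (1 / p) * (∫ z, |kerOp μ (fun z m => k m z) w z| ^ p' ∂μ) ^ (1 / p') :=
          integral_mul_le_Lp_mul_Lq_of_nonneg hpp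
            (Filter.Eventually.of_forall fun _ => abs_nonneg _)
            (Filter.Eventually.of_forall fun _ => abs_nonneg _)
            (hf.memLp hp1.le).abs (hTw.memLp hp1'.le).abs
      _ ≤ _ := by
          have h1 := hdual w hwB
          simp only [hwp] at h1
          have h0 : 0 ≤ ∫ z, |kerOp μ (fun z m => k m z) w z| ^ p' ∂μ :=
            integral_nonneg fun _ => by positivity
          have := hpp.symm.pos
          gcongr
  rcases hU0.eq_or_lt with h0 | h0
  · rw [← h0]; positivity
  have h2 : U ^ (1 / p) ≤ F ^ (1 / p) * C ^ (1 / p') := by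
    rw [Real.mul_rpow hC hU0] at key
    have h3 : U = U ^ (1 / p) * U ^ (1 / p') := by
      rw [← Real.rpow_add h0, one_div, one_div, hpp.inv_add_inv_eq_one, Real.rpow_one]
    rw [← mul_assoc] at key
    nth_rewrite 1 [h3] at key
    exact le_of_mul_le_mul_right key (by positivity)
  have h3 := Real.rpow_le_rpow (by positivity) h2 hpp.pos.le
  rw [Real.mul_rpow (by positivity) (by positivity), ← Real.rpow_mul hU0, ← Real.rpow_mul hF0,
    ← Real.rpow_mul hC, one_div_mul_cancel hpp.pos.ne', Real.rpow_one, Real.rpow_one,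
    show 1 / p' * p = p - 1 by rw [one_div, mul_comm, ← div_eq_mul_inv, hpp.div_conj_eq_sub_one]] at h3
  linarith

lemma exists_integral_rpow_kerOp_le (h : BallGrowth μ V Q) {A p : ℝ} (hA : 0 ≤ A) (hp : 1 < p) :
    ∃ C, 0 ≤ C ∧ ∀ k : X → X → ℝ, CZKernel μ k A → CZKernel μ (fun z m => k m z) A →
      ∀ f, BddInt μ f → ∫ z, |kerOp μ k f z| ^ p ∂μ ≤ C * ∫ z, |f z| ^ p ∂μ := by
  have conv : ∀ {q C : ℝ}, 1 ≤ q → 0 ≤ C → ∀ {k : X → X → ℝ} {f : X → ℝ}, SchurKernel μ k →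
      BddInt μ f → ∫⁻ z, ENNReal.ofReal (|kerOp μ k f z| ^ q) ∂μ ≤
        ENNReal.ofReal C * ∫⁻ z, ENNReal.ofReal (|f z| ^ q) ∂μ →
      ∫ z, |kerOp μ k f z| ^ q ∂μ ≤ C * ∫ z, |f z| ^ q ∂μ := by
    intro q C hq hC k f hk hf hle
    rw [ofReal_integral_rpow (hk.bddInt_kerOp hf) hq, ofReal_integral_rpow hf hq,
      ← ENNReal.ofReal_mul hC] at hle
    exact (ENNReal.ofReal_le_ofReal_iff (mul_nonneg hC (integral_nonneg fun _ => by
      positivity))).1 hle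
  have small : ∀ q : ℝ, 1 < q → q < 2 → ∃ C, 0 ≤ C ∧ ∀ k : X → X → ℝ, CZKernel μ k A →
      ∀ f, BddInt μ f → ∫ z, |kerOp μ k f z| ^ q ∂μ ≤ C * ∫ z, |f z| ^ q ∂μ := by
    intro q hq1 hq2
    have h1 : 0 < q - 1 := by linarith
    have h2 : 0 < 2 - q := by linarith
    have hc := czConst_nonneg hA Q
    have hC : 0 ≤ 2 ^ q * q * czConst A Q * (2 ^ q * 5 ^ Q / (q - 1) + 1 / (2 - q)) := by
      positivity
    exact ⟨_, hC, fun k hk f hf => conv hq1.le hC hk.toSchurKernel hf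
      (hk.lintegral_rpow_le_of_lt_two h hq1 hq2 hf)⟩
  rcases lt_trichotomy p 2 with h2 | h2 | h2
  · obtain ⟨C, hC, hb⟩ := small p hp h2
    exact ⟨C, hC, fun k hk _ f hf => hb k hk f hf⟩
  · refine ⟨A, hA, fun k hk _ f hf => conv hp.le hA hk.toSchurKernel hf ?_⟩
    subst h2
    simpa only [Real.rpow_two, sq_abs] using hk.l2 f hf
  · have hpp := Real.HolderConjugate.conjExponent hp
    obtain ⟨C, hC, hb⟩ := small p.conjExponent hpp.symm.lt (by
      rw [Real.conjExponent, div_lt_iff₀ (by linarith)]; linarith)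
    exact ⟨C ^ (p - 1), by positivity, fun k hk hk' f hf =>
      hk.toSchurKernel.integral_rpow_le_of_dual hpp h2.le hC (fun g hg => hb _ hk' g hg) hf⟩

end CalderonZygmundLp

section ConvolutionRepresentation

variable {G : Type*} [Group G] [TopologicalSpace G] [IsTopologicalGroup G]
  [SecondCountableTopology G] [MeasurableSpace G] [BorelSpace G] {μ : Measure G}
  [μ.IsMulLeftInvariant] [μ.IsInvInvariant]
  {H : Type*} [NormedAddCommGroup H] [InnerProductSpace ℝ H] [CompleteSpace H]
  {U : G →* (H →L[ℝ] H)}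

/-- Strongly continuous isometric representations on a real Hilbert space. -/
structure IsometricRep (U : G →* (H →L[ℝ] H)) : Prop where
  norm_map : ∀ m f, ‖U m f‖ = ‖f‖
  cont : ∀ f, Continuous fun m => U m f

lemma IsometricRep.inner_map (hU : IsometricRep U) (m : G) (f g : H) :
    ⟪U m f, g⟫ = ⟪f, U m⁻¹ g⟫ := by
  have h1 : g = U m (U m⁻¹ g) := by
    rw [← mul_apply_eq_comp, ← map_mul, mul_inv_cancel, map_one]; rfl
  have h2 := LinearMap.norm_map_iff_inner_map_map (𝕜 := ℝ) (U m)
  conv_lhs => rw [h1]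
  exact (h2.1 (hU.norm_map m)) f _

lemma IsometricRep.integrable (hU : IsometricRep U) {k : G → ℝ} (hk : Integrable k μ) (f : H) :
    Integrable (fun m => k m • U m f) μ := by
  refine (hk.norm.mul_const ‖f‖).mono'
    (hk.aestronglyMeasurable.smul (hU.cont f).aestronglyMeasurable) ?_
  exact Filter.Eventually.of_forall fun m => by rw [norm_smul, hU.norm_map]

/-- The operator `∫ k(m) U(m) dm`. -/
def IsometricRep.convOp (hU : IsometricRep U) {k : G → ℝ} (hk : Integrable k μ) : H →L[ℝ] H :=
  LinearMap.mkContinuous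
    { toFun := fun f => ∫ m, k m • U m f ∂μ
      map_add' := fun f g => by
        simp only [map_add, smul_add]
        exact integral_add (hU.integrable hk f) (hU.integrable hk g)
      map_smul' := fun c f => by
        simp only [map_smul, smul_comm _ c]
        exact integral_smul _ _ }
    (∫ m, ‖k m‖ ∂μ) fun f => by
      refine (norm_integral_le_integral_norm _).trans (le_of_eq ?_)
      simp only [norm_smul, hU.norm_map]
      exact integral_mul_const _ _

lemma IsometricRep.convOp_apply (hU : IsometricRep U) {k : G → ℝ} (hk : Integrable k μ) (f : H) :
    hU.convOp hk f = ∫ m, k m • U m f ∂μ := rfl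

lemma IsometricRep.norm_convOp_le (hU : IsometricRep U) {k : G → ℝ} (hk : Integrable k μ) :
    ‖hU.convOp hk‖ ≤ ∫ m, ‖k m‖ ∂μ :=
  LinearMap.mkContinuous_norm_le _ (integral_nonneg fun _ => norm_nonneg _) _

lemma IsometricRep.star_convOp (hU : IsometricRep U) {k : G → ℝ} (hk : Integrable k μ) :
    star (hU.convOp hk) = hU.convOp hk.comp_inv := by
  symm
  rw [ContinuousLinearMap.star_eq_adjoint, ContinuousLinearMap.eq_adjoint_iff]
  intro f g
  rw [hU.convOp_apply, hU.convOp_apply, real_inner_comm, ← integral_inner (hU.integrable hk.comp_inv f),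
    ← integral_inner (hU.integrable hk g), ← integral_inv_eq_self]
  refine integral_congr_ae (Filter.Eventually.of_forall fun m => ?_)
  simp only [inv_inv, inner_smul_right]
  rw [real_inner_comm, hU.inner_map, inv_inv]

lemma IsometricRep.norm_convOp_mul_convOp_le (hU : IsometricRep U) {k l : G → ℝ}
    (hk : Integrable k μ) (hl : Integrable l μ) (hk0 : ∫ m, k m ∂μ = 0) {ω : G → ℝ}
    (hω : ∀ m, ∫ n, ‖l (m * n) - l n‖ ∂μ ≤ ω m⁻¹) (hkω : Integrable (fun m => ‖k m‖ * ω m) μ) :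
    ‖hU.convOp hk * hU.convOp hl‖ ≤ ∫ m, ‖k m‖ * ω m ∂μ := by
  have hω0 : ∀ m, 0 ≤ ω m := fun m => by
    have := (integral_nonneg fun _ => norm_nonneg _).trans (hω m⁻¹)
    rwa [inv_inv] at this
  refine ContinuousLinearMap.opNorm_le_bound _
    (integral_nonneg fun m => mul_nonneg (norm_nonneg _) (hω0 m)) fun f => ?_
  set g := hU.convOp hl f with hg
  have h1 : ∀ m, ‖U m g - g‖ ≤ ω m * ‖f‖ := fun m => by
    have hl' : Integrable (fun n => l (m⁻¹ * n)) μ := hl.comp_mul_left m⁻¹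
    have : U m g = ∫ n, l (m⁻¹ * n) • U n f ∂μ := by
      rw [hg, hU.convOp_apply, ← ContinuousLinearMap.integral_comp_comm _ (hU.integrable hl f),
        ← integral_mul_left_eq_self (fun n => l (m⁻¹ * n) • U n f) m]
      refine integral_congr_ae (Filter.Eventually.of_forall fun n => ?_)
      simp only [map_smul, inv_mul_cancel_left, map_mul, mul_apply_eq_comp]
    rw [this, hg, hU.convOp_apply, ← integral_sub (hU.integrable hl' f) (hU.integrable hl f)]
    simp only [← sub_smul]
    refine (norm_integral_le_integral_norm _).trans ?_
    simp only [norm_smul, hU.norm_map]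
    rw [integral_mul_const]
    have := hω m⁻¹
    rw [inv_inv] at this
    gcongr
  have h2 : (hU.convOp hk * hU.convOp hl) f = ∫ m, k m • (U m g - g) ∂μ := by
    simp only [smul_sub]
    rw [integral_sub (hU.integrable hk g) (hk.smul_const g), integral_smul_const, hk0, zero_smul,
      sub_zero]; rfl
  rw [h2, ← integral_mul_const]
  refine norm_integral_le_of_norm_le (hkω.mul_const _) (Filter.Eventually.of_forall fun m => ?_)
  rw [norm_smul, mul_assoc]
  exact mul_le_mul_of_nonneg_left (h1 m) (norm_nonneg _)

end ConvolutionRepresentation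

section RightRegular

open DomMulAct MulOpposite

variable {G : Type*} [Group G] [TopologicalSpace G] [IsTopologicalGroup G] [R1Space G]
  [LocallyCompactSpace G]
  [SecondCountableTopology G] [MeasurableSpace G] [BorelSpace G] {μ : Measure G}
  [μ.IsMulLeftInvariant] [μ.IsInvInvariant] [μ.IsMulRightInvariant] [IsLocallyFiniteMeasure μ] [μ.InnerRegularCompactLTTop]

instance : OpensMeasurableSpace Gᵐᵒᵖ := by
  refine ⟨MeasurableSpace.generateFrom_le fun s hs => ?_⟩
  exact (hs.preimage (continuous_op (M := G))).measurableSet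

instance : SMulInvariantMeasure Gᵐᵒᵖ G μ :=
  ⟨fun c s _ => measure_preimage_mul_right μ c.unop s⟩

lemma isometricRep_exists : ∃ U : G →* (Lp ℝ 2 μ →L[ℝ] Lp ℝ 2 μ), IsometricRep U ∧
    ∀ m (f : G → ℝ) (hf : MemLp f 2 μ), U m (hf.toLp f) =ᵐ[μ] fun z => f (z * m) := by
  let U : G →* (Lp ℝ 2 μ →L[ℝ] Lp ℝ 2 μ) :=
    { toFun := fun m => LinearMap.mkContinuous
        { toFun := fun f => (mk (op m)) • f
          map_add' := fun f g => smul_add _ _ _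
          map_smul' := fun c f => smul_comm _ _ _ } 1 fun f => by
            simp
      map_one' := by ext1 f; exact one_smul Gᵐᵒᵖᵈᵐᵃ f
      map_mul' := fun m n => by
        ext1 f
        have : (mk (op (m * n)) : Gᵐᵒᵖᵈᵐᵃ) • f =
            (mk (op m) : Gᵐᵒᵖᵈᵐᵃ) • (mk (op n) : Gᵐᵒᵖᵈᵐᵃ) • f := by
          rw [smul_smul]; rfl
        exact this }
  refine ⟨U, ⟨fun m f => norm_smul_Lp _ f, fun f => ?_⟩, fun m f hf => ?_⟩
  · have : Fact ((2 : ℝ≥0∞) ≠ ∞) := ⟨by simp⟩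
    have hc : Continuous fun m : G => (mk (op m) : Gᵐᵒᵖᵈᵐᵃ) := by fun_prop
    exact hc.smul continuous_const
  · have : U m (hf.toLp f) = (mk (op m) : Gᵐᵒᵖᵈᵐᵃ) • hf.toLp f := rfl
    rw [this, mk_smul_toLp]
    exact MemLp.coeFn_toLp _

end RightRegular

lemma sum_pow_natAbs_le {r : ℝ} (hr0 : 0 ≤ r) (hr1 : r < 1) (s : Finset ℤ) (j : ℤ) :
    ∑ i ∈ s, r ^ (i - j).natAbs ≤ 2 * (1 - r)⁻¹ := by
  have key : ∀ u : Finset ℤ, Set.InjOn (fun i : ℤ => (i - j).natAbs) u →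
      ∑ i ∈ u, r ^ (i - j).natAbs ≤ (1 - r)⁻¹ := by
    intro u hu
    rw [← Finset.sum_image (f := fun n : ℕ => r ^ n) hu]
    exact ((summable_geometric_of_lt_one hr0 hr1).sum_le_tsum _ fun _ _ => by positivity).trans_eq
      (tsum_geometric_of_lt_one hr0 hr1)
  rw [← Finset.sum_filter_add_sum_filter_not s (fun i => j ≤ i)]
  have h1 := key (s.filter fun i => j ≤ i) (by
    intro a ha b hb hab
    simp only [Finset.coe_filter, Set.mem_ofPred_eq] at ha hb hab
    omega)
  have h2 := key (s.filter fun i => ¬ j ≤ i) (by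
    intro a ha b hb hab
    simp only [Finset.coe_filter, Set.mem_ofPred_eq] at ha hb hab
    omega)
  linarith

lemma sum_half_pow_natAbs_le (s : Finset ℤ) (j : ℤ) :
    ∑ i ∈ s, (1 / 2 : ℝ) ^ (i - j).natAbs ≤ 4 :=
  (sum_pow_natAbs_le (by norm_num) (by norm_num) s j).trans_eq (by norm_num)

lemma dist_inv_one {G : Type*} [Group G] [PseudoMetricSpace G] [IsIsometricSMul G G] (m : G) :
    dist m⁻¹ 1 = dist m 1 := by
  rw [← dist_mul_left m, mul_inv_cancel, mul_one, dist_comm]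

section GroupKernel

variable {G : Type*} [Group G] [PseudoMetricSpace G] [IsIsometricSMul G G] [IsTopologicalGroup G]
  [LocallyCompactSpace G] [SecondCountableTopology G] [MeasurableSpace G] [BorelSpace G]
  {μ : Measure G} [μ.IsMulLeftInvariant] [μ.IsInvInvariant] [μ.IsMulRightInvariant]
  [IsLocallyFiniteMeasure μ] [μ.InnerRegularCompactLTTop] [SFinite μ]

/-- Kernels adapted to the dyadic scale `16 ^ j`: cancellation, size, and `L¹` moduli of
continuity under both translations. -/
structure DyadicKernel (μ : Measure G) (A : ℝ) (j : ℤ) (κ : G → ℝ) : Prop where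
  meas : Measurable κ
  int : Integrable κ μ
  zero : ∫ m, κ m ∂μ = 0
  l1 : ∫ m, ‖κ m‖ ∂μ ≤ A
  int_moment : Integrable (fun m => ‖κ m‖ * √(dist m 1)) μ
  moment : ∫ m, ‖κ m‖ * √(dist m 1) ∂μ ≤ A * 4 ^ j
  left : ∀ h, ∫ m, ‖κ (h * m) - κ m‖ ∂μ ≤ A * √(dist h 1) / 4 ^ j
  right : ∀ h, ∫ m, ‖κ (m * h) - κ m‖ ∂μ ≤ A * √(dist h 1) / 4 ^ j

variable {A : ℝ} {i j : ℤ} {κ l : G → ℝ}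

lemma DyadicKernel.inv (h : DyadicKernel μ A j κ) : DyadicKernel μ A j (fun m => κ m⁻¹) where
  meas := h.meas.comp measurable_inv
  int := h.int.comp_inv
  zero := by rw [integral_inv_eq_self (fun m => κ m) μ, h.zero]
  l1 := by rw [integral_inv_eq_self (fun m => ‖κ m‖) μ]; exact h.l1
  int_moment := by simpa only [dist_inv_one] using h.int_moment.comp_inv
  moment := by
    have := integral_inv_eq_self (fun m => ‖κ m‖ * √(dist m 1)) μ
    simp only [dist_inv_one] at this
    rw [this]; exact h.moment
  left a := by
    have h1 := integral_inv_eq_self (fun m => ‖κ (m * a⁻¹) - κ m‖) μ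
    simp only [mul_inv_rev]
    rw [h1, ← dist_inv_one]
    exact h.right a⁻¹
  right a := by
    have h1 := integral_inv_eq_self (fun m => ‖κ (a⁻¹ * m) - κ m‖) μ
    simp only [mul_inv_rev]
    rw [h1, ← dist_inv_one]
    exact h.left a⁻¹

variable {H : Type*} [NormedAddCommGroup H] [InnerProductSpace ℝ H] [CompleteSpace H]
  {U : G →* (H →L[ℝ] H)}

lemma DyadicKernel.norm_mul_le_aux (hU : IsometricRep U) (hk : DyadicKernel μ A i κ)
    (hl : DyadicKernel μ A j l) (hA : 0 ≤ A) :
    ‖hU.convOp hk.int * hU.convOp hl.int‖ ≤ A ^ 2 * (4 ^ i / 4 ^ j) := by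
  have h4 : (0:ℝ) < 4 ^ j := by positivity
  refine (hU.norm_convOp_mul_convOp_le hk.int hl.int hk.zero
    (ω := fun m => √(dist m 1) * (A / 4 ^ j)) (fun m => ?_) ?_).trans ?_
  · rw [dist_inv_one]
    refine (hl.left m).trans (le_of_eq ?_)
    ring
  · simpa only [mul_assoc] using hk.int_moment.mul_const (A / 4 ^ j)
  · simp only [← mul_assoc]
    rw [integral_mul_const]
    calc _ ≤ (A * 4 ^ i) * (A / 4 ^ j) := by gcongr; exact hk.moment
      _ = _ := by ring

lemma DyadicKernel.norm_mul_le (hU : IsometricRep U) (hk : DyadicKernel μ A i κ)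
    (hl : DyadicKernel μ A j l) (hA : 0 ≤ A) :
    ‖hU.convOp hk.int * hU.convOp hl.int‖ ≤ (A * (1 / 2) ^ (i - j).natAbs) ^ 2 := by
  have e : (A * (1 / 2) ^ (i - j).natAbs) ^ 2 = A ^ 2 * (4:ℝ) ^ (-((i - j).natAbs : ℤ)) := by
    rw [mul_pow, ← pow_mul, mul_comm _ 2, pow_mul, zpow_neg, zpow_natCast, ← inv_pow]
    norm_num
  rw [e]
  rcases le_total i j with hij | hij
  · refine (hk.norm_mul_le_aux hU hl hA).trans (le_of_eq ?_)
    rw [← zpow_sub₀ (by norm_num)]; congr 2; omega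
  · rw [← norm_star, star_mul, hU.star_convOp, hU.star_convOp]
    refine (hl.inv.norm_mul_le_aux hU hk.inv hA).trans (le_of_eq ?_)
    rw [← zpow_sub₀ (by norm_num)]; congr 2; omega

lemma norm_sum_convOp_le (hU : IsometricRep U) (hA : 0 < A) {κ : ℤ → G → ℝ}
    (hk : ∀ j, DyadicKernel μ A j (κ j)) (s : Finset ℤ) :
    ‖∑ j ∈ s, hU.convOp (hk j).int‖ ≤ 4 * A := by
  refine norm_sum_le_of_almost_orthogonal s _ (c := fun i j => A * (1 / 2) ^ (i - j).natAbs)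
    (B := A) (fun i j => by positivity) (by positivity)
    (fun j => (hU.norm_convOp_le _).trans (hk j).l1) (fun j => ?_) (fun i j => ?_) (fun i j => ?_)
  · rw [← Finset.mul_sum, mul_comm]
    have := sum_half_pow_natAbs_le s j
    gcongr
  · rw [hU.star_convOp]
    exact (hk i).inv.norm_mul_le hU (hk j) hA.le
  · rw [hU.star_convOp]
    exact (hk i).norm_mul_le hU (hk j).inv hA.le

lemma schurKernel_group {K : G → ℝ} (hm : Measurable K) (hK : Integrable K μ) :
    SchurKernel μ (fun z m => K (z⁻¹ * m)) := by
  refine ⟨hm.comp (by fun_prop), ⟨∫ m, ‖K m‖ ∂μ, fun z => ?_⟩, ⟨∫ m, ‖K m‖ ∂μ, fun m => ?_⟩⟩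
  · rw [lintegral_mul_left_eq_self (fun m => ‖K m‖ₑ) z⁻¹, ← ofReal_integral_norm_eq_lintegral_enorm hK]
  · rw [← lintegral_inv_eq_self, ofReal_integral_norm_eq_lintegral_enorm hK]
    simp only [inv_inv]
    rw [lintegral_mul_right_eq_self (fun m => ‖K m‖ₑ) m]

lemma kerOp_group (K g : G → ℝ) (z : G) :
    kerOp μ (fun z m => K (z⁻¹ * m)) g z = ∫ m, K m * g (z * m) ∂μ := by
  rw [kerOp, ← integral_mul_left_eq_self _ z]
  simp

lemma integral_kerOp_group_sq_le {K : G → ℝ} (hm : Measurable K) (hK : Integrable K μ) {B : ℝ}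
    (hB : 0 ≤ B)
    (hn : ∀ U : G →* (Lp ℝ 2 μ →L[ℝ] Lp ℝ 2 μ), ∀ hU : IsometricRep U, ‖hU.convOp hK‖ ≤ B)
    {g : G → ℝ} (hg : BddInt μ g) :
    ∫ z, kerOp μ (fun z m => K (z⁻¹ * m)) g z ^ 2 ∂μ ≤ B ^ 2 * ∫ z, g z ^ 2 ∂μ := by
  obtain ⟨U, hU, hUf⟩ := isometricRep_exists (μ := μ)
  set u := kerOp μ (fun z m => K (z⁻¹ * m)) g with hu
  have hS := schurKernel_group hm hK
  have huB : BddInt μ u := hS.bddInt_kerOp hg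
  have hg2 : MemLp g 2 μ := by simpa using hg.memLp (p := 2) (by norm_num)
  have hu2 : MemLp u 2 μ := by simpa using huB.memLp (p := 2) (by norm_num)
  have hnorm : ∀ {f : G → ℝ} (hf : MemLp f 2 μ), ‖hf.toLp f‖ ^ 2 = ∫ z, f z ^ 2 ∂μ := fun hf => by
    rw [← real_inner_self_eq_norm_sq, L2.inner_def]
    refine integral_congr_ae ?_
    filter_upwards [hf.coeFn_toLp] with z hz
    rw [hz]; simp
  have e : ∫ z, u z ^ 2 ∂μ = ⟪hU.convOp hK (hg2.toLp g), hu2.toLp u⟫ := by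
    rw [hU.convOp_apply, real_inner_comm, ← integral_inner (hU.integrable hK _)]
    have h1 : ∀ m, ⟪hu2.toLp u, K m • U m (hg2.toLp g)⟫ = ∫ z, K m * g (z * m) * u z ∂μ := by
      intro m
      rw [inner_smul_right, L2.inner_def, ← integral_const_mul]
      refine integral_congr_ae ?_
      filter_upwards [hu2.coeFn_toLp, hUf m g hg2] with z h1 h2
      rw [h1, h2]; simp [mul_assoc]
    simp only [h1]
    rw [integral_integral_swap]
    · refine integral_congr_ae (Filter.Eventually.of_forall fun z => ?_)
      simp only
      rw [integral_mul_const, ← kerOp_group, sq]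
    · obtain ⟨C, hC⟩ := hg.bdd
      have h2 : Integrable (fun a : G × G => K a.1 * u a.2) (μ.prod μ) := hK.mul_prod huB.int
      have hgm := hg.meas
      have h3 : AEStronglyMeasurable (fun a : G × G => g (a.2 * a.1)) (μ.prod μ) :=
        (hgm.comp (by fun_prop)).aestronglyMeasurable
      refine (h2.mul_bdd h3 (Filter.Eventually.of_forall fun a => hC _)).congr
        (Filter.Eventually.of_forall fun a => ?_)
      simp only [Function.uncurry]; ring
  have h1 : ‖hu2.toLp u‖ ^ 2 ≤ B * ‖hg2.toLp g‖ * ‖hu2.toLp u‖ := by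
    rw [hnorm, e]
    refine (real_inner_le_norm _ _).trans ?_
    gcongr
    exact (hU.convOp hK).le_of_opNorm_le (hn U hU) _
  have h2 : ‖hu2.toLp u‖ ≤ B * ‖hg2.toLp g‖ := by
    rcases (norm_nonneg (hu2.toLp u)).eq_or_lt with h0 | h0
    · rw [← h0]; positivity
    · rw [sq] at h1; exact le_of_mul_le_mul_right h1 h0
  rw [← hnorm hg2, ← hnorm hu2, ← mul_pow]
  gcongr

end GroupKernel

section GroupHormander

variable {G : Type*} [Group G] [PseudoMetricSpace G] [IsIsometricSMul G G] [IsTopologicalGroup G]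
  [LocallyCompactSpace G] [SecondCountableTopology G] [MeasurableSpace G] [BorelSpace G]
  {μ : Measure G} [μ.IsMulLeftInvariant] [μ.IsInvInvariant] [μ.IsMulRightInvariant]
  [IsLocallyFiniteMeasure μ] [μ.InnerRegularCompactLTTop] [SFinite μ]
  {A : ℝ} {j : ℤ} {κ : G → ℝ}

lemma lintegral_inv_mul_eq (F : G → ℝ≥0∞) (m : G) :
    ∫⁻ z, F (z⁻¹ * m) ∂μ = ∫⁻ u, F u ∂μ := by
  rw [← lintegral_inv_eq_self]
  simp only [inv_inv]
  rw [lintegral_mul_right_eq_self F m]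

lemma DyadicKernel.lintegral_sub_le (hk : DyadicKernel μ A j κ) (m m₀ : G) :
    ∫⁻ z, ‖κ (z⁻¹ * m) - κ (z⁻¹ * m₀)‖ₑ ∂μ ≤ ENNReal.ofReal (A * √(dist m m₀) / 4 ^ j) := by
  have h1 : dist m m₀ = dist (m₀⁻¹ * m) 1 := by rw [← dist_mul_left m₀⁻¹, inv_mul_cancel]
  have h2 : ∫⁻ z, ‖κ (z⁻¹ * m) - κ (z⁻¹ * m₀)‖ₑ ∂μ =
      ∫⁻ u, ‖κ (u * (m₀⁻¹ * m)) - κ u‖ₑ ∂μ := by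
    rw [← lintegral_inv_mul_eq (fun u => ‖κ (u * (m₀⁻¹ * m)) - κ u‖ₑ) m₀]
    simp [mul_assoc]
  have h3 := ofReal_integral_norm_eq_lintegral_enorm
    ((hk.int.comp_mul_right (m₀⁻¹ * m)).sub hk.int)
  simp only [Pi.sub_apply] at h3
  rw [h2, h1, ← h3]
  exact ENNReal.ofReal_le_ofReal (hk.right _)

lemma DyadicKernel.lintegral_tail_le (hk : DyadicKernel μ A j κ) {r : ℝ} (hr : 0 < r) (m : G) :
    ∫⁻ z in {z | r ≤ dist z m}, ‖κ (z⁻¹ * m)‖ₑ ∂μ ≤ ENNReal.ofReal (A * 4 ^ j / √r) := by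
  have hr' : 0 < √r := Real.sqrt_pos.2 hr
  calc ∫⁻ z in {z | r ≤ dist z m}, ‖κ (z⁻¹ * m)‖ₑ ∂μ
      ≤ ∫⁻ z in {z | r ≤ dist z m}, ‖‖κ (z⁻¹ * m)‖ * √(dist (z⁻¹ * m) 1) / √r‖ₑ ∂μ := by
        refine setLIntegral_mono' (measurableSet_le measurable_const (by fun_prop)) fun z hz => ?_
        have h1 : dist (z⁻¹ * m) 1 = dist z m := by
          rw [← dist_mul_left z, mul_inv_cancel_left, mul_one, dist_comm]
        have hz : r ≤ dist z m := hz
        rw [← ofReal_norm, ← ofReal_norm, h1]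
        refine ENNReal.ofReal_le_ofReal ?_
        rw [Real.norm_of_nonneg (by positivity : 0 ≤ ‖κ (z⁻¹ * m)‖ * √(dist z m) / √r),
          le_div_iff₀ hr']
        gcongr
    _ ≤ ∫⁻ z, ‖‖κ (z⁻¹ * m)‖ * √(dist (z⁻¹ * m) 1) / √r‖ₑ ∂μ := setLIntegral_le_lintegral _ _
    _ = ∫⁻ u, ‖‖κ u‖ * √(dist u 1) / √r‖ₑ ∂μ :=
        lintegral_inv_mul_eq (fun u => ‖‖κ u‖ * √(dist u 1) / √r‖ₑ) m
    _ = ENNReal.ofReal (∫ u, ‖κ u‖ * √(dist u 1) / √r ∂μ) := by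
        rw [← ofReal_integral_norm_eq_lintegral_enorm (hk.int_moment.div_const _)]
        congr 1
        exact integral_congr_ae (Filter.Eventually.of_forall fun u =>
          Real.norm_of_nonneg (by positivity))
    _ ≤ _ := by
        refine ENNReal.ofReal_le_ofReal ?_
        rw [integral_div]
        have := hk.moment
        gcongr

lemma exists_zpow_four_le {x : ℝ} (hx : 0 < x) : ∃ n : ℤ, (4:ℝ) ^ n ≤ x ∧ x < 4 ^ (n + 1) :=
  exists_mem_Ico_zpow hx (by norm_num)

lemma DyadicKernel.lintegral_hor_le (hk : DyadicKernel μ A j κ) (hA : 0 ≤ A) {m m₀ : G} {n : ℤ}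
    (h1 : (4:ℝ) ^ n ≤ √(dist m m₀)) (h2 : √(dist m m₀) < 4 ^ (n + 1)) :
    ∫⁻ z in {z | 4 * dist m m₀ ≤ dist z m₀}, ‖κ (z⁻¹ * m) - κ (z⁻¹ * m₀)‖ₑ ∂μ ≤
      ENNReal.ofReal (4 * A * (1 / 2) ^ (j - n).natAbs) := by
  have h4 : (1 / 4 : ℝ) ^ (j - n).natAbs ≤ (1 / 2) ^ (j - n).natAbs := by gcongr; norm_num
  have e4 : (1 / 4 : ℝ) ^ (j - n).natAbs = 4 ^ (-((j - n).natAbs : ℤ)) := by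
    rw [zpow_neg, zpow_natCast, ← inv_pow, one_div]
  have hd : 0 < dist m m₀ := Real.sqrt_pos.1 (lt_of_lt_of_le (by positivity) h1)
  rcases le_or_gt j n with hj | hj
  · have hms : MeasurableSet {z | 4 * dist m m₀ ≤ dist z m₀} :=
      measurableSet_le measurable_const (by fun_prop)
    have hm' : Measurable fun z => ‖κ (z⁻¹ * m)‖ₑ :=
      (hk.meas.comp (by fun_prop : Measurable fun z : G => z⁻¹ * m)).enorm
    calc _ ≤ ∫⁻ z in {z | 4 * dist m m₀ ≤ dist z m₀}, (‖κ (z⁻¹ * m)‖ₑ + ‖κ (z⁻¹ * m₀)‖ₑ) ∂μ :=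
          lintegral_mono fun z => enorm_sub_le
      _ = (∫⁻ z in {z | 4 * dist m m₀ ≤ dist z m₀}, ‖κ (z⁻¹ * m)‖ₑ ∂μ) +
          ∫⁻ z in {z | 4 * dist m m₀ ≤ dist z m₀}, ‖κ (z⁻¹ * m₀)‖ₑ ∂μ := lintegral_add_left hm' _
      _ ≤ (∫⁻ z in {z | dist m m₀ ≤ dist z m}, ‖κ (z⁻¹ * m)‖ₑ ∂μ) +
          ∫⁻ z in {z | dist m m₀ ≤ dist z m₀}, ‖κ (z⁻¹ * m₀)‖ₑ ∂μ := by
          refine add_le_add (lintegral_mono_set fun z hz => ?_) (lintegral_mono_set fun z hz => ?_)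
          · have hz : 4 * dist m m₀ ≤ dist z m₀ := hz
            have := dist_triangle z m m₀
            show dist m m₀ ≤ dist z m
            linarith
          · have hz : 4 * dist m m₀ ≤ dist z m₀ := hz
            show dist m m₀ ≤ dist z m₀
            linarith
      _ ≤ ENNReal.ofReal (A * 4 ^ j / √(dist m m₀)) + ENNReal.ofReal (A * 4 ^ j / √(dist m m₀)) :=
          add_le_add (hk.lintegral_tail_le hd m) (hk.lintegral_tail_le hd m₀)
      _ ≤ _ := by
          rw [← ENNReal.ofReal_add (by positivity) (by positivity)]
          refine ENNReal.ofReal_le_ofReal ?_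
          have h5 : A * 4 ^ j / √(dist m m₀) ≤ A * (1 / 2) ^ (j - n).natAbs := by
            calc A * 4 ^ j / √(dist m m₀) ≤ A * 4 ^ j / 4 ^ n := by gcongr
              _ = A * (1 / 4) ^ (j - n).natAbs := by
                  rw [e4, mul_div_assoc, ← zpow_sub₀ (by norm_num)]; congr 2; omega
              _ ≤ _ := by gcongr
          have : 0 ≤ A * (1 / 2) ^ (j - n).natAbs := by positivity
          linarith
  · refine (setLIntegral_le_lintegral _ _).trans ((hk.lintegral_sub_le m m₀).trans ?_)
    refine ENNReal.ofReal_le_ofReal ?_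
    calc A * √(dist m m₀) / 4 ^ j ≤ A * 4 ^ (n + 1) / 4 ^ j := by gcongr
      _ = 4 * A * (1 / 4) ^ (j - n).natAbs := by
          rw [e4, mul_div_assoc, ← zpow_sub₀ (by norm_num), show n + 1 - j = 1 + (n - j) by ring,
            zpow_add₀ (by norm_num), zpow_one, show -((j - n).natAbs : ℤ) = n - j by omega]
          ring
      _ ≤ _ := by gcongr

lemma lintegral_hor_sum_le {κ : ℤ → G → ℝ} (hk : ∀ j, DyadicKernel μ A j (κ j)) (hA : 0 ≤ A)
    (s : Finset ℤ) (m m₀ : G) :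
    ∫⁻ z in {z | 4 * dist m m₀ ≤ dist z m₀},
      ‖∑ j ∈ s, κ j (z⁻¹ * m) - ∑ j ∈ s, κ j (z⁻¹ * m₀)‖ₑ ∂μ ≤ ENNReal.ofReal (16 * A) := by
  have h0 : ∫⁻ z in {z | 4 * dist m m₀ ≤ dist z m₀},
      ‖∑ j ∈ s, κ j (z⁻¹ * m) - ∑ j ∈ s, κ j (z⁻¹ * m₀)‖ₑ ∂μ ≤
      ∑ j ∈ s, ∫⁻ z in {z | 4 * dist m m₀ ≤ dist z m₀},
        ‖κ j (z⁻¹ * m) - κ j (z⁻¹ * m₀)‖ₑ ∂μ := by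
    rw [← lintegral_finsetSum]
    · refine lintegral_mono fun z => ?_
      rw [← Finset.sum_sub_distrib]
      exact enorm_sum_le _ _
    · intro j _
      exact (((hk j).meas.comp (by fun_prop : Measurable fun z : G => z⁻¹ * m)).sub
        ((hk j).meas.comp (by fun_prop : Measurable fun z : G => z⁻¹ * m₀))).enorm
  refine h0.trans ?_
  rcases (dist_nonneg (x := m) (y := m₀)).eq_or_lt with hd | hd
  · refine (Finset.sum_le_sum fun j _ => (setLIntegral_le_lintegral _ _).trans
      ((hk j).lintegral_sub_le m m₀)).trans ?_
    simp [← hd]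
  · obtain ⟨n, h1, h2⟩ := exists_zpow_four_le (Real.sqrt_pos.2 hd)
    refine (Finset.sum_le_sum fun j _ => (hk j).lintegral_hor_le hA h1 h2).trans ?_
    rw [← ENNReal.ofReal_sum_of_nonneg fun j _ => by positivity, ← Finset.mul_sum]
    refine ENNReal.ofReal_le_ofReal ?_
    calc _ ≤ 4 * A * 4 := by gcongr; exact sum_half_pow_natAbs_le s n
      _ = _ := by ring

lemma czKernel_sum_dyadic {κ : ℤ → G → ℝ} (hk : ∀ j, DyadicKernel μ A j (κ j)) (hA : 0 < A)
    (s : Finset ℤ) :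
    CZKernel μ (fun z m => ∑ j ∈ s, κ j (z⁻¹ * m)) ((4 * A) ^ 2 + 16 * A) := by
  have hm : Measurable fun m => ∑ j ∈ s, κ j m := Finset.measurable_sum _ fun j _ => (hk j).meas
  have hK : Integrable (fun m => ∑ j ∈ s, κ j m) μ := integrable_finsetSum _ fun j _ => (hk j).int
  refine { toSchurKernel := schurKernel_group hm hK, nonneg := by positivity, l2 := fun g hg => ?_,
           hor := fun m m₀ => (lintegral_hor_sum_le hk hA.le s m m₀).trans
             (ENNReal.ofReal_le_ofReal (by nlinarith)) }
  have h1 := integral_kerOp_group_sq_le hm hK (B := 4 * A) (by positivity) (fun U hU => by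
    have : hU.convOp hK = ∑ j ∈ s, hU.convOp (hk j).int := by
      ext1 f
      rw [sum_apply]
      simp only [hU.convOp_apply, Finset.sum_smul]
      exact integral_finsetSum _ fun j _ => hU.integrable (hk j).int f
    rw [this]
    exact norm_sum_convOp_le hU hA hk s) hg
  have hu := (schurKernel_group hm hK).bddInt_kerOp hg
  have h2 := ofReal_integral_rpow hu (p := 2) (by norm_num)
  have h3 := ofReal_integral_rpow hg (p := 2) (by norm_num)
  simp only [Real.rpow_two, sq_abs] at h2 h3
  rw [h2, h3, ← ENNReal.ofReal_mul (by positivity)]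
  refine ENNReal.ofReal_le_ofReal (h1.trans ?_)
  have : 0 ≤ ∫ z, g z ^ 2 ∂μ := integral_nonneg fun _ => sq_nonneg _
  gcongr
  linarith

theorem exists_integral_rpow_sum_dyadic_le {V : ℝ} {Q : ℕ} (h : BallGrowth μ V Q) (hA : 0 < A)
    {p : ℝ} (hp : 1 < p) :
    ∃ C, 0 ≤ C ∧ ∀ κ : ℤ → G → ℝ, (∀ j, DyadicKernel μ A j (κ j)) → ∀ (s : Finset ℤ) (f : G → ℝ),
      BddInt μ f →
      ∫ z, |∑ j ∈ s, ∫ m, κ j m * f (z * m) ∂μ| ^ p ∂μ ≤ C * ∫ z, |f z| ^ p ∂μ := by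
  obtain ⟨C, hC, hb⟩ := exists_integral_rpow_kerOp_le h (A := (4 * A) ^ 2 + 16 * A)
    (by positivity) hp
  refine ⟨C, hC, fun κ hk s f hf => ?_⟩
  have h1 := czKernel_sum_dyadic hk hA s
  have h2 := czKernel_sum_dyadic (fun j => (hk j).inv) hA s
  simp only [mul_inv_rev, inv_inv] at h2
  refine le_of_eq_of_le (integral_congr_ae (Filter.Eventually.of_forall fun z => ?_)) (hb _ h1 h2 f hf)
  simp only
  rw [kerOp_group (fun m => ∑ j ∈ s, κ j m) f z]
  simp only [Finset.sum_mul]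
  obtain ⟨B, hB⟩ := hf.bdd
  rw [integral_finsetSum]
  intro j _
  refine (hk j).int.mul_bdd (c := B) ?_ (Filter.Eventually.of_forall fun m => hB (z * m))
  exact (hf.meas.comp (by fun_prop : Measurable fun m : G => z * m)).aestronglyMeasurable

end GroupHormander

/-- The constant in Hedberg's pointwise inequality. -/
def hedbergConst (θ : ℝ) : ℝ :=
  16 ^ (1 / θ - 1) * (2 * (1 - (16:ℝ) ^ (-min 1 (1 / θ - 1)))⁻¹)

lemma hedbergConst_nonneg {θ : ℝ} (h0 : 0 < θ) (h1 : θ < 1) : 0 ≤ hedbergConst θ := by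
  have he : 0 < 1 / θ - 1 := by rw [sub_pos]; exact (one_lt_div h0).2 h1
  have : (16:ℝ) ^ (-min 1 (1 / θ - 1)) < 1 :=
    Real.rpow_lt_one_of_one_lt_of_neg (by norm_num) (neg_lt_zero.2 (lt_min one_pos he))
  have : 0 < 1 - (16:ℝ) ^ (-min 1 (1 / θ - 1)) := by linarith
  unfold hedbergConst; positivity

lemma sum_min_rpow_le {ε y : ℝ} (hε : 0 < ε) (hy : 0 < y) (s : Finset ℤ) :
    ∑ j ∈ s, min (16 ^ j * y) ((16 ^ j * y) ^ (-ε)) ≤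
      16 ^ ε * (2 * (1 - (16:ℝ) ^ (-min 1 ε))⁻¹) := by
  obtain ⟨n, h1, h2⟩ := exists_mem_Ico_zpow (inv_pos.2 hy) (by norm_num : (1:ℝ) < 16)
  have hmin : 0 < min 1 ε := by simp [hε]
  have hr1 : (16:ℝ) ^ (-min 1 ε) < 1 :=
    Real.rpow_lt_one_of_one_lt_of_neg (by norm_num) (by linarith)
  refine le_trans ?_ (mul_le_mul_of_nonneg_left
    (sum_pow_natAbs_le (by positivity) hr1 s n) (by positivity))
  rw [Finset.mul_sum]
  refine Finset.sum_le_sum fun j _ => ?_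
  have hr : ((16:ℝ) ^ (-min 1 ε)) ^ (j - n).natAbs =
      (16:ℝ) ^ (-min 1 ε * ((j - n).natAbs : ℝ)) := by
    rw [Real.rpow_mul (by norm_num), Real.rpow_natCast]
  rw [hr, ← Real.rpow_add (by norm_num)]
  rcases le_or_gt j n with hj | hj
  · refine (min_le_left _ _).trans ?_
    have hy' : y ≤ ((16:ℝ) ^ n)⁻¹ := by
      rw [le_inv_comm₀ hy (by positivity)]; exact h1
    calc (16:ℝ) ^ j * y ≤ 16 ^ j * ((16:ℝ) ^ n)⁻¹ := by gcongr
      _ = (16:ℝ) ^ (((j - n : ℤ) : ℝ)) := by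
          rw [Real.rpow_intCast, zpow_sub₀ (by norm_num), div_eq_mul_inv]
      _ ≤ _ := by
          refine Real.rpow_le_rpow_of_exponent_le (by norm_num) ?_
          have : (((j - n).natAbs : ℤ) : ℝ) = ((n - j : ℤ) : ℝ) := by
            congr 1; omega
          rw [Int.cast_natCast] at this
          rw [this]
          push_cast
          have hjn : (0:ℝ) ≤ n - j := by rw [sub_nonneg]; exact_mod_cast hj
          nlinarith [min_le_left 1 ε]
  · refine (min_le_right _ _).trans ?_
    have hy' : ((16:ℝ) ^ (n + 1))⁻¹ ≤ y := by
      rw [inv_le_comm₀ (by positivity) hy]; exact h2.le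
    calc ((16:ℝ) ^ j * y) ^ (-ε) ≤ (16 ^ j * ((16:ℝ) ^ (n + 1))⁻¹) ^ (-ε) :=
          Real.rpow_le_rpow_of_nonpos (by positivity) (by gcongr) (by linarith)
      _ = (16:ℝ) ^ (((j - (n + 1) : ℤ) : ℝ) * (-ε)) := by
          rw [Real.rpow_mul (by norm_num), Real.rpow_intCast, zpow_sub₀ (by norm_num),
            div_eq_mul_inv]
      _ ≤ _ := by
          refine Real.rpow_le_rpow_of_exponent_le (by norm_num) ?_
          have : (((j - n).natAbs : ℤ) : ℝ) = ((j - n : ℤ) : ℝ) := by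
            congr 1; omega
          rw [Int.cast_natCast] at this
          rw [this]
          push_cast
          have hjn : (0:ℝ) ≤ j - n := by rw [sub_nonneg]; exact_mod_cast hj.le
          nlinarith [min_le_right 1 ε]

lemma sum_hedberg_le {θ m b ρ : ℝ} (h0 : 0 < θ) (h1 : θ < 1) (hρ : 0 < ρ) (hm : 0 ≤ m) (hb : 0 ≤ b)
    (a : ℤ → ℝ) (ha : ∀ j, 0 ≤ a j) (ham : ∀ j, a j ≤ m)
    (hab : ∀ j, a j ≤ b * (ρ * 16 ^ j) ^ (-(1 / θ))) (s : Finset ℤ) :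
    ∑ j ∈ s, ρ * 16 ^ j * a j ≤ hedbergConst θ * (m ^ (1 - θ) * b ^ θ) := by
  have hC := hedbergConst_nonneg h0 h1
  have hzero : (∀ j, a j ≤ 0) → ∑ j ∈ s, ρ * 16 ^ j * a j ≤
      hedbergConst θ * (m ^ (1 - θ) * b ^ θ) := fun h => by
    have : ∀ j, a j = 0 := fun j => le_antisymm (h j) (ha j)
    simp only [this, mul_zero, Finset.sum_const_zero]
    positivity
  rcases hm.eq_or_lt with rfl | hm
  · exact hzero ham
  rcases hb.eq_or_lt with rfl | hb
  · exact hzero fun j => by simpa using hab j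
  set δ := (b / m) ^ θ with hδ
  have hδ0 : 0 < δ := by positivity
  have hbm : m ^ (1 - θ) * b ^ θ = m * δ := by
    rw [hδ, Real.div_rpow hb.le hm.le, Real.rpow_sub hm, Real.rpow_one]; ring
  have hbδ : b = m * δ ^ (1 / θ) := by
    rw [hδ, ← Real.rpow_mul (by positivity), mul_one_div_cancel h0.ne', Real.rpow_one]
    field_simp
  have he : 0 < 1 / θ - 1 := by rw [sub_pos]; exact (one_lt_div h0).2 h1
  rw [hbm, hedbergConst]
  calc ∑ j ∈ s, ρ * 16 ^ j * a j
      ≤ ∑ j ∈ s, m * δ * min (16 ^ j * (ρ / δ)) ((16 ^ j * (ρ / δ)) ^ (-(1 / θ - 1))) := by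
        refine Finset.sum_le_sum fun j _ => ?_
        have hR : (0:ℝ) < ρ * 16 ^ j := by positivity
        rw [mul_min_of_nonneg _ _ (by positivity), le_min_iff]
        constructor
        · calc ρ * 16 ^ j * a j ≤ ρ * 16 ^ j * m := by gcongr; exact ham j
            _ = _ := by field_simp
        · calc ρ * 16 ^ j * a j ≤ ρ * 16 ^ j * (m * δ ^ (1 / θ) * (ρ * 16 ^ j) ^ (-(1 / θ))) := by
                have := hab j
                rw [hbδ] at this
                gcongr
            _ = _ := by
                rw [show (16:ℝ) ^ j * (ρ / δ) = (ρ * 16 ^ j) / δ by ring,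
                  Real.div_rpow hR.le hδ0.le, neg_sub, Real.rpow_sub hR, Real.rpow_sub hδ0,
                  Real.rpow_one, Real.rpow_one, Real.rpow_neg hR.le]
                field_simp
    _ ≤ _ := by
        rw [← Finset.mul_sum, mul_comm _ (m * δ)]
        exact mul_le_mul_of_nonneg_left (sum_min_rpow_le he (by positivity) s) (by positivity)

section FractionalIntegration

open Metric Set

variable {X : Type*} [PseudoMetricSpace X] [SecondCountableTopology X] [MeasurableSpace X]
  [BorelSpace X] {μ : Measure X} [SFinite μ] {V : ℝ} {Q : ℕ}

lemma maxFn_le {F : X → ℝ≥0∞} {B : ℝ≥0∞} (hF : ∀ x, F x ≤ B) (z : X) : maxFn μ F z ≤ B := by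
  refine iSup_le fun x => iSup_le fun r => iSup_le fun _ => ENNReal.div_le_of_le_mul ?_
  exact (lintegral_mono hF).trans_eq (by simp)

lemma BallGrowth.lintegral_maxFn_rpow_le (h : BallGrowth μ V Q) {f : X → ℝ} (hf : BddInt μ f)
    (hf0 : ∀ x, 0 ≤ f x) {q : ℝ} (hq : 1 < q) :
    ∫⁻ z, ENNReal.ofReal ((maxFn μ (fun y => ENNReal.ofReal (f y)) z).toReal ^ q) ∂μ ≤
      ENNReal.ofReal (q * (2 ^ q * 5 ^ Q / (q - 1))) * ∫⁻ y, ENNReal.ofReal (f y ^ q) ∂μ := by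
  obtain ⟨B, hB⟩ := hf.bdd
  have hfin : ∀ z, maxFn μ (fun y => ENNReal.ofReal (f y)) z ≠ ∞ := fun z =>
    ((maxFn_le (fun x => ENNReal.ofReal_le_ofReal ((le_abs_self _).trans (hB x))) z).trans_lt
      ENNReal.ofReal_lt_top).ne
  rw [lintegral_rpow_eq_lintegral_meas_lt_mul μ (Filter.Eventually.of_forall fun z =>
    ENNReal.toReal_nonneg) (h.measurable_maxFn _).ennreal_toReal.aemeasurable (by linarith),
    ENNReal.ofReal_mul (by linarith), mul_assoc]
  refine mul_le_mul_right (le_of_eq_of_le (setLIntegral_congr_fun measurableSet_Ioi fun t ht => ?_)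
    (h.lintegral_maxFn_layer hf.meas hf0 hq)) _
  have ht : 0 < t := ht
  simp only [ENNReal.ofReal_lt_iff_lt_toReal ht.le (hfin _)]

/-- The constant in the Hardy–Littlewood–Sobolev inequality. -/
def hlsConst (p q : ℝ) (Q : ℕ) : ℝ :=
  hedbergConst (q / Q) ^ p * (q * (2 ^ q * 5 ^ Q / (q - 1)))

lemma BallGrowth.setIntegral_ball_le (h : BallGrowth μ V Q) {f : X → ℝ} (hf : BddInt μ f)
    (hf0 : ∀ x, 0 ≤ f x) {q : ℝ} (hq : 1 < q) (z : X) {r : ℝ} (hr : 0 < r) :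
    (∫ y in ball z r, f y ∂μ) / (V * r ^ Q) ≤
      (V ^ (-(1 / q)) * (∫ y, f y ^ q ∂μ) ^ (1 / q)) * r ^ (-(1 / (q / Q))) := by
  have hpp := (Real.HolderConjugate.conjExponent hq)
  set q' := q.conjExponent with hq'
  have hV := h.pos
  have hvol : μ.real (ball z r) = V * r ^ Q := by
    rw [measureReal_def, h.measure_ball z r hr, ENNReal.toReal_ofReal (by positivity)]
  have hm : MemLp f (ENNReal.ofReal q) (μ.restrict (ball z r)) := (hf.memLp hq.le).restrict _
  have : IsFiniteMeasure (μ.restrict (ball z r)) :=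
    ⟨by rw [Measure.restrict_apply_univ]; exact (h.ball_ne_top z r).lt_top⟩
  have h1 := integral_mul_le_Lp_mul_Lq_of_nonneg (μ := μ.restrict (ball z r)) hpp
    (Filter.Eventually.of_forall hf0) (g := fun _ => (1:ℝ))
    (Filter.Eventually.of_forall fun _ => zero_le_one) hm (memLp_const 1)
  simp only [mul_one, Real.one_rpow, integral_const, smul_eq_mul, measureReal_restrict_apply_univ,
    hvol] at h1
  have hint := hf.integrable_rpow hq.le
  simp only [abs_of_nonneg (hf0 _)] at hint
  have h2 : ∫ y in ball z r, f y ^ q ∂μ ≤ ∫ y, f y ^ q ∂μ :=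
    setIntegral_le_integral hint (Filter.Eventually.of_forall fun y => Real.rpow_nonneg (hf0 y) _)
  have h3 : (V * r ^ Q) ^ (1 / q') = (V * r ^ Q) * (V ^ (-(1 / q)) * r ^ (-(1 / (q / Q)))) := by
    have e1 : 1 / q' = 1 + -(1 / q) := by
      have := hpp.inv_add_inv_eq_one
      rw [one_div, one_div]; linarith
    rw [e1, Real.rpow_add (by positivity), Real.rpow_one, Real.mul_rpow hV.le (by positivity),
      ← Real.rpow_natCast r Q, ← Real.rpow_mul hr.le]
    congr 3
    rw [one_div_div]; ring
  rw [div_le_iff₀ (by positivity)]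
  refine h1.trans ?_
  rw [h3]
  have h0 : 0 ≤ ∫ y in ball z r, f y ^ q ∂μ := integral_nonneg fun y => Real.rpow_nonneg (hf0 y) _
  calc _ ≤ (∫ y, f y ^ q ∂μ) ^ (1 / q) *
        (V * r ^ Q * (V ^ (-(1 / q)) * r ^ (-(1 / (q / Q))))) := by gcongr
    _ = _ := by ring

lemma BallGrowth.sum_average_le (h : BallGrowth μ V Q) {f : X → ℝ} (hf : BddInt μ f)
    (hf0 : ∀ x, 0 ≤ f x) {q ρ : ℝ} (hq : 1 < q) (hqQ : q < Q) (hρ : 0 < ρ) (s : Finset ℤ) (z : X) :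
    ∑ j ∈ s, ρ * 16 ^ j * ((∫ y in ball z (ρ * 16 ^ j), f y ∂μ) / (V * (ρ * 16 ^ j) ^ Q)) ≤
      hedbergConst (q / Q) * ((maxFn μ (fun y => ENNReal.ofReal (f y)) z).toReal ^ (1 - q / Q) *
        (V ^ (-(1 / q)) * (∫ y, f y ^ q ∂μ) ^ (1 / q)) ^ (q / Q)) := by
  have hV := h.pos
  have hQ : (0:ℝ) < Q := by linarith
  obtain ⟨B, hB⟩ := hf.bdd
  have hfin : maxFn μ (fun y => ENNReal.ofReal (f y)) z ≠ ∞ :=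
    ((maxFn_le (fun x => ENNReal.ofReal_le_ofReal ((le_abs_self _).trans (hB x))) z).trans_lt
      ENNReal.ofReal_lt_top).ne
  have h0 : ∀ r, 0 ≤ ∫ y in ball z r, f y ∂μ := fun r => integral_nonneg fun y => hf0 y
  refine sum_hedberg_le (by positivity) ((div_lt_one hQ).2 hqQ) hρ ENNReal.toReal_nonneg
    (mul_nonneg (by positivity) (Real.rpow_nonneg (integral_nonneg fun y =>
      Real.rpow_nonneg (hf0 y) _) _)) _ (fun j => div_nonneg (h0 _) (by positivity))
    (fun j => ?_) (fun j => h.setIntegral_ball_le hf hf0 hq z (by positivity)) s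
  have hr : (0:ℝ) < ρ * 16 ^ j := by positivity
  rw [← ENNReal.ofReal_le_iff_le_toReal hfin, ENNReal.ofReal_div_of_pos (by positivity),
    ofReal_integral_eq_lintegral_ofReal hf.int.integrableOn (Filter.Eventually.of_forall hf0),
    ← h.measure_ball z _ hr]
  exact le_iSup_of_le z (le_iSup_of_le (ρ * 16 ^ j) (le_iSup_of_le ⟨hr, mem_ball_self hr⟩ le_rfl))

theorem BallGrowth.hardy_littlewood_sobolev (h : BallGrowth μ V Q) {f : X → ℝ} (hf : BddInt μ f)
    (hf0 : ∀ x, 0 ≤ f x) {p q ρ : ℝ} (hq : 1 < q) (hqQ : q < Q) (hpq : 1 / q = 1 / p + 1 / Q)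
    (hp : 0 < p) (hρ : 0 < ρ) (s : Finset ℤ) :
    ∫⁻ z, ENNReal.ofReal ((∑ j ∈ s, ρ * 16 ^ j * ((∫ y in ball z (ρ * 16 ^ j), f y ∂μ) /
        (V * (ρ * 16 ^ j) ^ Q))) ^ p) ∂μ ≤
      ENNReal.ofReal (hlsConst p q Q * V ^ (-(p / Q)) * (∫ y, f y ^ q ∂μ) ^ (p / q)) := by
  have hV := h.pos
  have hQ : (0:ℝ) < Q := by linarith
  have hq1 : 0 < q - 1 := by linarith
  have hN0 : 0 ≤ ∫ y, f y ^ q ∂μ := integral_nonneg fun y => Real.rpow_nonneg (hf0 y) _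
  have hH := hedbergConst_nonneg (θ := q / Q) (by positivity) ((div_lt_one hQ).2 hqQ)
  have e1 : (1 - q / Q) * p = q := by
    field_simp at hpq ⊢; linarith
  have e2 : 1 / q * (q / Q) * p = p / Q := by field_simp
  have e3 : p / q = p / Q + 1 := by
    have : p * (1 / q) = p * (1 / p + 1 / Q) := by rw [hpq]
    rw [mul_add, mul_one_div_cancel hp.ne'] at this
    rw [div_eq_mul_one_div, this]; ring
  set N := ∫ y, f y ^ q ∂μ with hN
  set M := fun z => (maxFn μ (fun y => ENNReal.ofReal (f y)) z).toReal with hM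
  have hM0 : ∀ z, 0 ≤ M z := fun z => ENNReal.toReal_nonneg
  have h0 : ∀ z r, 0 ≤ ∫ y in ball z r, f y ∂μ := fun z r => integral_nonneg fun y => hf0 y
  have hint := hf.integrable_rpow hq.le
  simp only [abs_of_nonneg (hf0 _)] at hint
  calc _ ≤ ∫⁻ z, ENNReal.ofReal (hedbergConst (q / Q) ^ p * (V ^ (-(p / Q)) * N ^ (p / Q))) *
        ENNReal.ofReal (M z ^ q) ∂μ := by
        refine lintegral_mono fun z => ?_
        rw [← ENNReal.ofReal_mul (by positivity)]
        refine ENNReal.ofReal_le_ofReal ?_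
        refine (Real.rpow_le_rpow (Finset.sum_nonneg fun j _ => mul_nonneg (by positivity)
          (div_nonneg (h0 _ _) (by positivity))) (h.sum_average_le hf hf0 hq hqQ hρ s z) hp.le).trans
          (le_of_eq ?_)
        rw [Real.mul_rpow hH (mul_nonneg (Real.rpow_nonneg (hM0 z) _) (by positivity)),
          Real.mul_rpow (Real.rpow_nonneg (hM0 z) _) (by positivity), ← Real.rpow_mul (hM0 z), e1,
          ← Real.rpow_mul (by positivity), Real.mul_rpow (by positivity) (by positivity),
          ← Real.rpow_mul hV.le, ← Real.rpow_mul hN0, ← mul_assoc (1 / q), e2, ← mul_assoc (-(1 / q)), neg_mul,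
          neg_mul, e2]
        ring
    _ = ENNReal.ofReal (hedbergConst (q / Q) ^ p * (V ^ (-(p / Q)) * N ^ (p / Q))) *
        ∫⁻ z, ENNReal.ofReal (M z ^ q) ∂μ := lintegral_const_mul' _ _ ENNReal.ofReal_ne_top
    _ ≤ ENNReal.ofReal (hedbergConst (q / Q) ^ p * (V ^ (-(p / Q)) * N ^ (p / Q))) *
        (ENNReal.ofReal (q * (2 ^ q * 5 ^ Q / (q - 1))) * ENNReal.ofReal N) := by
        gcongr
        rw [hN, ofReal_integral_eq_lintegral_ofReal hint (Filter.Eventually.of_forall fun y =>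
          Real.rpow_nonneg (hf0 y) _)]
        exact h.lintegral_maxFn_rpow_le hf hf0 hq
    _ = _ := by
        rw [← ENNReal.ofReal_mul (by positivity), ← ENNReal.ofReal_mul (by positivity)]
        congr 1
        rw [e3, Real.rpow_add_one' hN0 (by positivity), hlsConst]
        ring

end FractionalIntegration

section Kinetic

variable {d : ℕ}

lemma measurePreserving_shear {f g c : V d → V d} (hf : MeasurePreserving f)
    (hg : MeasurePreserving g) (hc : Measurable c) :
    MeasurePreserving (fun m : V d × V d => (f m.1 + c m.2, g m.2)) := by
  have h1 : MeasurePreserving (fun m : V d × V d => (g m.1, f m.2 + c m.1)) := by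
    refine MeasurePreserving.skew_product (g := fun w y => f y + c w) hg
      ((hf.measurable.comp measurable_snd).add (hc.comp measurable_fst)) (.of_forall fun w => ?_)
    exact ((measurePreserving_add_right volume (c w)).comp hf).map_eq
  exact Measure.measurePreserving_swap.comp (h1.comp Measure.measurePreserving_swap)

lemma measurePreserving_kinetic {τ : ℝ → ℝ} {f g : V d → V d} {c : ℝ → V d → V d}
    (hτ : MeasurePreserving τ) (hf : MeasurePreserving f) (hg : MeasurePreserving g)
    (hc : Continuous (Function.uncurry c)) :
    MeasurePreserving (fun m : Pt d => (τ m.1, f m.2.1 + c m.1 m.2.2, g m.2.2)) := by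
  refine MeasurePreserving.skew_product (g := fun s (m : V d × V d) => (f m.1 + c s m.2, g m.2)) hτ
    ?_ (.of_forall fun s => (measurePreserving_shear hf hg
      (hc.comp (Continuous.prodMk_right s)).measurable).map_eq)
  refine Measurable.prodMk ?_ (hg.measurable.comp (measurable_snd.comp measurable_snd))
  exact (hf.measurable.comp (measurable_fst.comp measurable_snd)).add
    (hc.measurable.comp (measurable_fst.prodMk (measurable_snd.comp measurable_snd)))

lemma measurePreserving_kmul_left (a : Pt d) : MeasurePreserving (kmul a) :=
  measurePreserving_kinetic (d := d) (c := fun s _ => s • a.2.2)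
    (measurePreserving_add_left volume a.1) (measurePreserving_add_left volume a.2.1)
    (measurePreserving_add_left volume a.2.2) (by fun_prop)

lemma measurePreserving_kmul_right (b : Pt d) : MeasurePreserving (fun m => kmul m b) :=
  measurePreserving_kinetic (d := d) (c := fun _ w => b.1 • w)
    (measurePreserving_add_right volume b.1) (measurePreserving_add_right volume b.2.1)
    (measurePreserving_add_right volume b.2.2) (by fun_prop)

lemma measurePreserving_kinv : MeasurePreserving (kinv : Pt d → Pt d) :=
  measurePreserving_kinetic (d := d) (c := fun s w => s • w)
    (Measure.measurePreserving_neg volume) (Measure.measurePreserving_neg volume)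
    (Measure.measurePreserving_neg volume) (by fun_prop)

/-- The kinetic dilation `(s,y,w) ↦ (r²s, r³y, rw)`. -/
def dil (r : ℝ) (m : Pt d) : Pt d := (r ^ 2 * m.1, r ^ 3 • m.2.1, r • m.2.2)

@[fun_prop]
lemma continuous_dil (r : ℝ) : Continuous (dil r : Pt d → Pt d) := by
  unfold dil; fun_prop

@[fun_prop]
lemma continuous_kmul : Continuous (fun m : Pt d × Pt d => kmul m.1 m.2) := by
  unfold kmul; fun_prop

@[fun_prop]
lemma continuous_kinv : Continuous (kinv : Pt d → Pt d) := by
  unfold kinv; fun_prop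

lemma dil_dil (r r' : ℝ) (m : Pt d) : dil r (dil r' m) = dil (r * r') m := by
  simp only [dil, smul_smul, Prod.mk.injEq, mul_pow]
  exact ⟨by ring, trivial⟩

lemma dil_one (m : Pt d) : dil 1 m = m := by simp [dil]

lemma dil_inv_dil {r : ℝ} (hr : 0 < r) (m : Pt d) : dil r⁻¹ (dil r m) = m := by
  rw [dil_dil, inv_mul_cancel₀ hr.ne', dil_one]

lemma dil_kmul (r : ℝ) (a b : Pt d) : dil r (kmul a b) = kmul (dil r a) (dil r b) := by
  simp only [dil, kmul, smul_add, smul_smul, Prod.mk.injEq]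
  refine ⟨by ring, ?_, trivial⟩
  congr 2; ring

lemma dil_kinv (r : ℝ) (a : Pt d) : dil r (kinv a) = kinv (dil r a) := by
  simp only [dil, kinv, smul_add, smul_smul, Prod.mk.injEq, smul_neg]
  refine ⟨by ring, ?_, trivial⟩
  congr 2; ring

lemma map_stretch {α β γ : ℝ} (hα : 0 < α) (hβ : 0 < β) (hγ : 0 < γ) :
    Measure.map (fun m : Pt d => (α * m.1, β • m.2.1, γ • m.2.2)) volume =
      ENNReal.ofReal (α * β ^ d * γ ^ d)⁻¹ • volume := by
  have e1 : Measure.map (fun x : ℝ => α * x) volume = ENNReal.ofReal α⁻¹ • volume := by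
    have := Measure.map_addHaar_smul (volume : Measure ℝ) hα.ne'
    simpa [abs_of_pos (inv_pos.2 hα)] using this
  have e2 : ∀ {r : ℝ}, 0 < r → Measure.map (fun x : V d => r • x) volume =
      ENNReal.ofReal (r ^ d)⁻¹ • volume := fun {r} hr => by
    have := Measure.map_addHaar_smul (volume : Measure (V d)) hr.ne'
    simpa [abs_of_pos (inv_pos.2 (pow_pos hr d)), abs_of_pos hr] using this
  have e3 : Measure.map (Prod.map (fun x : V d => β • x) (fun x : V d => γ • x)) volume =
      (ENNReal.ofReal (β ^ d)⁻¹ * ENNReal.ofReal (γ ^ d)⁻¹) • volume := by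
    rw [Measure.volume_eq_prod, ← Measure.map_prod_map _ _ (by fun_prop) (by fun_prop), e2 hβ,
      e2 hγ, Measure.prod_smul_left, Measure.prod_smul_right, smul_smul]
  have e4 : Measure.map (Prod.map (fun x : ℝ => α * x)
      (Prod.map (fun x : V d => β • x) (fun x : V d => γ • x))) volume =
      (ENNReal.ofReal α⁻¹ * (ENNReal.ofReal (β ^ d)⁻¹ * ENNReal.ofReal (γ ^ d)⁻¹)) • volume := by
    rw [Measure.volume_eq_prod, ← Measure.map_prod_map _ _ (by fun_prop) (by fun_prop), e1,
      e3, Measure.prod_smul_left, Measure.prod_smul_right, smul_smul]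
  refine e4.trans ?_
  rw [← ENNReal.ofReal_mul (by positivity), ← ENNReal.ofReal_mul (by positivity)]
  congr 2
  field_simp

lemma map_dil {r : ℝ} (hr : 0 < r) : Measure.map (dil r : Pt d → Pt d) volume =
    ENNReal.ofReal (r ^ (4 * d + 2))⁻¹ • volume := by
  refine (map_stretch (pow_pos hr 2) (pow_pos hr 3) hr).trans ?_
  congr 3
  ring

/-- The kinetic dilation as a homeomorphism. -/
def dilHomeo (r : ℝ) (hr : 0 < r) : Pt d ≃ₜ Pt d where
  toFun := dil r
  invFun := dil r⁻¹
  left_inv m := dil_inv_dil hr m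
  right_inv m := by rw [dil_dil, mul_inv_cancel₀ hr.ne', dil_one]
  continuous_toFun := continuous_dil r
  continuous_invFun := continuous_dil r⁻¹

lemma integral_comp_dil {r : ℝ} (hr : 0 < r) (g : Pt d → ℝ) :
    ∫ m, g (dil r m) = (r ^ (4 * d + 2))⁻¹ * ∫ m, g m := by
  have := (dilHomeo (d := d) r hr).measurableEmbedding.integral_map (μ := volume) g
  refine this.symm.trans ?_
  change ∫ m, g m ∂(Measure.map (dil r) volume) = _
  rw [map_dil hr, integral_smul_measure, ENNReal.toReal_ofReal (by positivity), smul_eq_mul]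

lemma integrable_comp_dil {r : ℝ} (hr : 0 < r) {g : Pt d → ℝ} (hg : Integrable g) :
    Integrable (fun m => g (dil r m)) := by
  refine ((dilHomeo (d := d) r hr).measurableEmbedding.integrable_map_iff (μ := volume)).1 ?_
  change Integrable g (Measure.map (dil r) volume)
  rw [map_dil hr]
  exact hg.smul_measure ENNReal.ofReal_ne_top

/-- The one-sided kinetic gauge `max(|s|^{1/2}, (|y|/L)^{1/3}, |w|)`. -/
def gauge1 (L : ℝ) (m : Pt d) : ℝ :=
  max (|m.1| ^ (1 / 2 : ℝ)) (max ((‖m.2.1‖ / L) ^ (1 / 3 : ℝ)) ‖m.2.2‖)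

lemma rpow_inv_nat_le_iff {x r : ℝ} (hx : 0 ≤ x) (hr : 0 ≤ r) {n : ℕ} (hn : n ≠ 0) :
    x ^ (1 / n : ℝ) ≤ r ↔ x ≤ r ^ n := by
  have hn' : (0:ℝ) < n := by positivity
  rw [one_div, Real.rpow_inv_le_iff_of_pos hx hr hn', Real.rpow_natCast]

lemma rpow_inv_nat_lt_iff {x r : ℝ} (hx : 0 ≤ x) (hr : 0 ≤ r) {n : ℕ} (hn : n ≠ 0) :
    x ^ (1 / n : ℝ) < r ↔ x < r ^ n := by
  have hn' : (0:ℝ) < n := by positivity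
  rw [one_div, Real.rpow_inv_lt_iff_of_pos hx hr hn', Real.rpow_natCast]

lemma gauge1_le_iff {L r : ℝ} (hL : 0 < L) (hr : 0 ≤ r) (m : Pt d) :
    gauge1 L m ≤ r ↔ |m.1| ≤ r ^ 2 ∧ ‖m.2.1‖ ≤ L * r ^ 3 ∧ ‖m.2.2‖ ≤ r := by
  have h2 := rpow_inv_nat_le_iff (abs_nonneg m.1) hr two_ne_zero
  have h3 := rpow_inv_nat_le_iff (div_nonneg (norm_nonneg m.2.1) hL.le) hr three_ne_zero
  push_cast at h2 h3
  rw [gauge1, max_le_iff, max_le_iff, h2, h3, div_le_iff₀' hL]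

lemma gauge1_lt_iff {L r : ℝ} (hL : 0 < L) (hr : 0 ≤ r) (m : Pt d) :
    gauge1 L m < r ↔ |m.1| < r ^ 2 ∧ ‖m.2.1‖ < L * r ^ 3 ∧ ‖m.2.2‖ < r := by
  have h2 := rpow_inv_nat_lt_iff (abs_nonneg m.1) hr two_ne_zero
  have h3 := rpow_inv_nat_lt_iff (div_nonneg (norm_nonneg m.2.1) hL.le) hr three_ne_zero
  push_cast at h2 h3
  rw [gauge1, max_lt_iff, max_lt_iff, h2, h3, div_lt_iff₀' hL]

lemma gauge1_nonneg (L : ℝ) (m : Pt d) : 0 ≤ gauge1 L m :=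
  le_max_of_le_left (by positivity)

lemma continuous_gauge1 (L : ℝ) : Continuous (gauge1 L : Pt d → ℝ) := by
  unfold gauge1
  refine Continuous.max (Continuous.rpow_const (by fun_prop) fun _ => .inr (by norm_num))
    (Continuous.max (Continuous.rpow_const (by fun_prop) fun _ => .inr (by norm_num))
    (by fun_prop))

lemma gauge1_kmul_le {L : ℝ} (hL : 1 ≤ L) (a b : Pt d) :
    gauge1 L (kmul a b) ≤ gauge1 L a + gauge1 L b := by
  have hL0 : 0 < L := by linarith
  have ha0 := gauge1_nonneg L a
  have hb0 := gauge1_nonneg L b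
  obtain ⟨a1, a2, a3⟩ := (gauge1_le_iff hL0 ha0 a).1 le_rfl
  obtain ⟨b1, b2, b3⟩ := (gauge1_le_iff hL0 hb0 b).1 le_rfl
  set α := gauge1 L a
  set β := gauge1 L b
  refine (gauge1_le_iff hL0 (by positivity) _).2 ⟨?_, ?_, ?_⟩
  · refine (abs_add_le _ _).trans ?_
    nlinarith [mul_nonneg ha0 hb0]
  · change ‖a.2.1 + b.2.1 + b.1 • a.2.2‖ ≤ _
    have h3 : ‖b.1 • a.2.2‖ ≤ β ^ 2 * α := by
      rw [norm_smul, Real.norm_eq_abs]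
      exact mul_le_mul b1 a3 (norm_nonneg _) (by positivity)
    have h4 : β ^ 2 * α ≤ L * (β ^ 2 * α) := le_mul_of_one_le_left (by positivity) hL
    calc _ ≤ ‖a.2.1‖ + ‖b.2.1‖ + ‖b.1 • a.2.2‖ := norm_add₃_le
      _ ≤ L * α ^ 3 + L * β ^ 3 + L * (β ^ 2 * α) := by linarith
      _ ≤ L * (α + β) ^ 3 := by
        have : 0 ≤ L * (3 * α ^ 2 * β + 2 * α * β ^ 2) := by positivity
        nlinarith
  · exact (norm_add_le _ _).trans (by linarith)

lemma kinv_kmul (a b : Pt d) : kinv (kmul a b) = kmul (kinv b) (kinv a) := by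
  simp only [kinv, kmul, Prod.mk.injEq, smul_add, smul_neg, add_smul, neg_smul]
  refine ⟨by ring, ?_, ?_⟩ <;> abel

lemma kinv_kinv (a : Pt d) : kinv (kinv a) = a := by
  simp [kinv]

lemma kmul_assoc (a b c : Pt d) : kmul (kmul a b) c = kmul a (kmul b c) := by
  simp only [kmul, Prod.mk.injEq, smul_add, add_smul]
  refine ⟨by ring, ?_, ?_⟩ <;> abel

lemma kinv_kmul_self (a : Pt d) : kmul (kinv a) a = 0 := by
  simp [kinv, kmul]

lemma zero_kmul (a : Pt d) : kmul 0 a = a := by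
  simp [kmul]

lemma kmul_kinv_self (a : Pt d) : kmul a (kinv a) = 0 := by
  simpa [kinv_kinv] using kinv_kmul_self (kinv a)

/-- The symmetric kinetic gauge. -/
def kgauge (L : ℝ) (m : Pt d) : ℝ := max (gauge1 L m) (gauge1 L (kinv m))

lemma continuous_kgauge (L : ℝ) : Continuous (kgauge L : Pt d → ℝ) :=
  (continuous_gauge1 L).max ((continuous_gauge1 L).comp continuous_kinv)

lemma kgauge_nonneg (L : ℝ) (m : Pt d) : 0 ≤ kgauge L m :=
  le_max_of_le_left (gauge1_nonneg L m)

lemma kgauge_kinv (L : ℝ) (m : Pt d) : kgauge L (kinv m) = kgauge L m := by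
  rw [kgauge, kgauge, kinv_kinv, max_comm]

lemma kgauge_kmul_le {L : ℝ} (hL : 1 ≤ L) (a b : Pt d) :
    kgauge L (kmul a b) ≤ kgauge L a + kgauge L b := by
  refine max_le ((gauge1_kmul_le hL a b).trans (add_le_add (le_max_left _ _) (le_max_left _ _))) ?_
  rw [kinv_kmul]
  refine (gauge1_kmul_le hL _ _).trans ?_
  rw [add_comm]
  exact add_le_add (le_max_right _ _) (le_max_right _ _)

lemma gauge1_zero (L : ℝ) : gauge1 L (0 : Pt d) = 0 := by
  simp [gauge1]

lemma kinv_zero : kinv (0 : Pt d) = 0 := by simp [kinv]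

lemma kgauge_zero (L : ℝ) : kgauge L (0 : Pt d) = 0 := by
  simp [kgauge, gauge1_zero, kinv_zero]

lemma gauge1_dil {L r : ℝ} (hL : 0 < L) (hr : 0 < r) (m : Pt d) :
    gauge1 L (dil r m) = r * gauge1 L m := by
  have key : ∀ {r : ℝ}, 0 < r → ∀ m : Pt d, gauge1 L (dil r m) ≤ r * gauge1 L m := by
    intro r hr m
    obtain ⟨a1, a2, a3⟩ := (gauge1_le_iff hL (gauge1_nonneg L m) m).1 le_rfl
    refine (gauge1_le_iff hL (mul_nonneg hr.le (gauge1_nonneg L m)) _).2 ⟨?_, ?_, ?_⟩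
    · rw [dil, abs_mul, abs_of_pos (by positivity), mul_pow]; gcongr
    · simp only [dil, norm_smul, Real.norm_eq_abs, abs_of_pos (pow_pos hr 3), mul_pow]
      calc _ ≤ r ^ 3 * (L * gauge1 L m ^ 3) := by gcongr
        _ = _ := by ring
    · simp only [dil, norm_smul, Real.norm_eq_abs, abs_of_pos hr]; gcongr
  refine le_antisymm (key hr m) ?_
  have := key (inv_pos.2 hr) (dil r m)
  rw [dil_inv_dil hr] at this
  rwa [inv_mul_eq_div, le_div_iff₀' hr] at this

lemma kgauge_dil {L r : ℝ} (hL : 0 < L) (hr : 0 < r) (m : Pt d) :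
    kgauge L (dil r m) = r * kgauge L m := by
  rw [kgauge, kgauge, ← dil_kinv, gauge1_dil hL hr, gauge1_dil hL hr,
    mul_max_of_nonneg _ _ hr.le]

lemma isOpen_iff_kgauge {L : ℝ} (hL : 1 ≤ L) (u : Set (Pt d)) :
    IsOpen u ↔ ∀ x ∈ u, ∃ ε > 0, ∀ y, kgauge L (kmul (kinv x) y) < ε → y ∈ u := by
  have hL0 : 0 < L := by linarith
  constructor
  · intro hu x hx
    have hc : Continuous (fun m => kmul x m : Pt d → Pt d) := by fun_prop
    have h0 : (0 : Pt d) ∈ (fun m => kmul x m) ⁻¹' u := by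
      simpa [kmul] using hx
    obtain ⟨η, hη, hηu⟩ := Metric.isOpen_iff.1 (hu.preimage hc) 0 h0
    refine ⟨min 1 (η / L), by positivity, fun y hy => ?_⟩
    set ε := min 1 (η / L)
    have hε0 : 0 < ε := by positivity
    have hε1 : ε ≤ 1 := min_le_left _ _
    have hε2 : L * ε ≤ η := (le_div_iff₀' hL0).1 (min_le_right _ _)
    obtain ⟨a1, a2, a3⟩ := (gauge1_lt_iff hL0 hε0.le _).1 ((le_max_left _ _).trans_lt hy)
    have hεη : ε ≤ η := (le_mul_of_one_le_left hε0.le hL).trans hε2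
    have : kmul (kinv x) y ∈ Metric.ball 0 η := by
      rw [mem_ball_zero_iff, Prod.norm_def, Prod.norm_def]
      refine max_lt ?_ (max_lt ?_ ?_)
      · rw [Real.norm_eq_abs]; nlinarith
      · refine a2.trans_le (le_trans ?_ hε2)
        gcongr
        calc ε ^ 3 ≤ ε ^ 1 := pow_le_pow_of_le_one hε0.le hε1 (by norm_num)
          _ = ε := pow_one ε
      · linarith
    have := hηu this
    simpa only [Set.mem_preimage, ← kmul_assoc, kmul_kinv_self, zero_kmul] using this
  · intro h
    rw [isOpen_iff_mem_nhds]
    intro x hx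
    obtain ⟨ε, hε, hy⟩ := h x hx
    have hc : Continuous fun y => kgauge L (kmul (kinv x) y) :=
      (continuous_kgauge L).comp (by fun_prop)
    refine Filter.mem_of_superset ((isOpen_lt hc continuous_const).mem_nhds
      (x := x) ?_) hy
    simpa [kinv_kmul_self, kgauge_zero] using hε

/-- The left-invariant kinetic distance. -/
def kdist (L : ℝ) (z m : Pt d) : ℝ := kgauge L (kmul (kinv z) m)

lemma kdist_self (L : ℝ) (z : Pt d) : kdist L z z = 0 := by
  rw [kdist, kinv_kmul_self, kgauge_zero]

lemma kdist_comm (L : ℝ) (z m : Pt d) : kdist L z m = kdist L m z := by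
  rw [kdist, kdist, ← kgauge_kinv, kinv_kmul, kinv_kinv]

lemma kdist_triangle {L : ℝ} (hL : 1 ≤ L) (x y z : Pt d) :
    kdist L x z ≤ kdist L x y + kdist L y z := by
  have := kgauge_kmul_le hL (kmul (kinv x) y) (kmul (kinv y) z)
  rwa [kmul_assoc, ← kmul_assoc y, kmul_kinv_self, zero_kmul] at this

lemma kdist_kmul_left (L : ℝ) (a x y : Pt d) : kdist L (kmul a x) (kmul a y) = kdist L x y := by
  rw [kdist, kdist, kinv_kmul, kmul_assoc, ← kmul_assoc (kinv a), kinv_kmul_self, zero_kmul]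

lemma kdist_zero_right (L : ℝ) (m : Pt d) : kdist L m 0 = kgauge L m := by
  rw [kdist_comm, kdist, kinv_zero, zero_kmul]

/-- The kinetic group, with the left-invariant distance given by `kgauge L`. -/
def Kin (d : ℕ) (_ : ℝ) : Type := Pt d

variable {L : ℝ}

instance : Group (Kin d L) :=
  letI : Mul (Kin d L) := ⟨fun a b => kmul (d := d) a b⟩
  letI : Inv (Kin d L) := ⟨kinv (d := d)⟩
  letI : One (Kin d L) := ⟨(0 : Pt d)⟩
  Group.ofLeftAxioms kmul_assoc zero_kmul kinv_kmul_self

instance [hL : Fact (1 ≤ L)] : PseudoMetricSpace (Kin d L) :=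
  letI : TopologicalSpace (Kin d L) := inferInstanceAs (TopologicalSpace (Pt d))
  PseudoMetricSpace.ofDistTopology (kdist (d := d) L) (kdist_self (d := d) L)
    (kdist_comm (d := d) L) (kdist_triangle (d := d) hL.out) (isOpen_iff_kgauge (d := d) hL.out)

lemma Kin.dist_one [Fact (1 ≤ L)] (m : Kin d L) : dist m 1 = kgauge (d := d) L m :=
  kdist_zero_right (d := d) L m

instance : MeasureSpace (Kin d L) := inferInstanceAs (MeasureSpace (Pt d))

variable [hL : Fact (1 ≤ L)]

instance : IsIsometricSMul (Kin d L) (Kin d L) :=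
  ⟨fun a => Isometry.of_dist_eq fun x y => kdist_kmul_left (d := d) L a x y⟩

instance : IsTopologicalGroup (Kin d L) where
  continuous_mul := continuous_kmul (d := d)
  continuous_inv := continuous_kinv (d := d)

instance : LocallyCompactSpace (Kin d L) := inferInstanceAs (LocallyCompactSpace (Pt d))
instance : SecondCountableTopology (Kin d L) := inferInstanceAs (SecondCountableTopology (Pt d))
instance : BorelSpace (Kin d L) := inferInstanceAs (BorelSpace (Pt d))
instance : IsLocallyFiniteMeasure (volume : Measure (Kin d L)) :=
  inferInstanceAs (IsLocallyFiniteMeasure (volume : Measure (Pt d)))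
instance : (volume : Measure (Kin d L)).InnerRegularCompactLTTop :=
  inferInstanceAs (volume : Measure (Pt d)).InnerRegularCompactLTTop
instance : SFinite (volume : Measure (Kin d L)) :=
  inferInstanceAs (SFinite (volume : Measure (Pt d)))
instance : (volume : Measure (Kin d L)).IsMulLeftInvariant :=
  ⟨fun a => (measurePreserving_kmul_left (d := d) a).map_eq⟩
instance : (volume : Measure (Kin d L)).IsMulRightInvariant :=
  ⟨fun a => (measurePreserving_kmul_right (d := d) a).map_eq⟩
instance : (volume : Measure (Kin d L)).IsInvInvariant :=
  ⟨(measurePreserving_kinv (d := d)).map_eq⟩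

/-- The volume of the unit ball of the gauge. -/
def kvol (d : ℕ) (L : ℝ) : ℝ := (volume {m : Pt d | kgauge L m < 1}).toReal

/-- A set containing the unit balls of all gauges, up to a stretching in `y`. -/
def unitBox (d : ℕ) : Set (Pt d) := {m | |m.1| < 1 ∧ ‖m.2.1‖ < 1 ∧ ‖m.2.2‖ < 1}

lemma volume_unitBox_lt_top : volume (unitBox d) < ∞ := by
  refine lt_of_le_of_lt (measure_mono fun m hm => ?_)
    (Metric.isBounded_ball (x := (0 : Pt d)) (r := 1)).measure_lt_top
  rw [mem_ball_zero_iff, Prod.norm_def, Prod.norm_def]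
  exact max_lt hm.1 (max_lt hm.2.1 hm.2.2)

lemma volume_kgauge_lt_one_le {L : ℝ} (hL : 1 ≤ L) :
    volume {m : Pt d | kgauge L m < 1} ≤ ENNReal.ofReal (L ^ d) * volume (unitBox d) := by
  have hL0 : 0 < L := by linarith
  have h := map_stretch (d := d) one_pos (inv_pos.2 hL0) one_pos
  have hm : MeasurableSet (unitBox d) := by
    refine IsOpen.measurableSet ?_
    have h1 : Continuous fun m : Pt d => |m.1| := by fun_prop
    have h2 : Continuous fun m : Pt d => ‖m.2.1‖ := by fun_prop
    have h3 : Continuous fun m : Pt d => ‖m.2.2‖ := by fun_prop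
    exact (isOpen_lt h1 continuous_const).inter
      ((isOpen_lt h2 continuous_const).inter (isOpen_lt h3 continuous_const))
  have h2 := congrArg (fun ν => ν (unitBox d)) h
  rw [Measure.map_apply (by fun_prop) hm, Measure.smul_apply, smul_eq_mul] at h2
  have e : (1 * L⁻¹ ^ d * 1 ^ d : ℝ)⁻¹ = L ^ d := by simp
  rw [e] at h2
  rw [← h2]
  refine measure_mono fun m hm => ?_
  obtain ⟨a1, a2, a3⟩ := (gauge1_lt_iff hL0 zero_le_one m).1 ((le_max_left _ _).trans_lt hm)
  refine ⟨by simpa using a1, ?_, by simpa using a3⟩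
  simp only [norm_smul, norm_inv, Real.norm_eq_abs, abs_of_pos hL0]
  rw [inv_mul_eq_div, div_lt_one hL0]
  simpa using a2

lemma kvol_le {L : ℝ} (hL : 1 ≤ L) : kvol d L ≤ L ^ d * (volume (unitBox d)).toReal := by
  have h := ENNReal.toReal_mono
    (ENNReal.mul_ne_top ENNReal.ofReal_ne_top volume_unitBox_lt_top.ne)
    (volume_kgauge_lt_one_le (d := d) hL)
  rwa [ENNReal.toReal_mul, ENNReal.toReal_ofReal (by positivity)] at h

lemma volume_kgauge_lt_one_ne_top {L : ℝ} (hL : 1 ≤ L) :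
    volume {m : Pt d | kgauge L m < 1} ≠ ∞ :=
  ((volume_kgauge_lt_one_le hL).trans_lt
    (ENNReal.mul_lt_top ENNReal.ofReal_lt_top volume_unitBox_lt_top)).ne

lemma kvol_pos {L : ℝ} (hL : 1 ≤ L) : 0 < kvol d L := by
  have h : IsOpen {m : Pt d | kgauge L m < 1} := isOpen_lt (continuous_kgauge L) continuous_const
  have : (volume : Measure (V d × V d)).IsOpenPosMeasure :=
    Measure.prod.instIsOpenPosMeasure
  have : (volume : Measure (Pt d)).IsOpenPosMeasure := Measure.prod.instIsOpenPosMeasure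
  refine ENNReal.toReal_pos (h.measure_pos volume ⟨0, ?_⟩).ne' (volume_kgauge_lt_one_ne_top hL)
  simp [kgauge_zero]

lemma gauge1_anti {L : ℝ} (hL : 1 ≤ L) (m : Pt d) : gauge1 L m ≤ gauge1 1 m := by
  unfold gauge1
  gcongr

lemma kvol_one_le {L : ℝ} (hL : 1 ≤ L) : kvol d 1 ≤ kvol d L := by
  refine ENNReal.toReal_mono (volume_kgauge_lt_one_ne_top hL) (measure_mono fun m hm => ?_)
  exact lt_of_le_of_lt (max_le_max (gauge1_anti hL _) (gauge1_anti hL _)) hm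

lemma Kin.ballGrowth : BallGrowth (volume : Measure (Kin d L)) (kvol d L) (4 * d + 2) where
  pos := kvol_pos hL.out
  one_le := by omega
  measure_ball z r hr := by
    have hL0 : (0:ℝ) < L := zero_lt_one.trans_le hL.out
    have e1 : (volume : Measure (Kin d L)) (Metric.ball z r) =
        (volume : Measure (Pt d)) {m | kgauge L m < r} := by
      have := (measurePreserving_kmul_left (d := d) (kinv (d := d) z)).measure_preimage
        (isOpen_lt (continuous_kgauge L) continuous_const).measurableSet.nullMeasurableSet
        (s := {m | kgauge L m < r})
      rw [← this]
      congr 1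
      ext m
      rw [Metric.mem_ball, dist_comm]
      rfl
    have e2 := congrArg (fun ν => ν {m : Pt d | kgauge L m < r}) (map_dil (d := d) hr)
    rw [Measure.map_apply (continuous_dil r).measurable
      (isOpen_lt (continuous_kgauge L) continuous_const).measurableSet, Measure.smul_apply,
      smul_eq_mul] at e2
    have e3 : dil r ⁻¹' {m : Pt d | kgauge L m < r} = {m | kgauge L m < 1} := by
      ext m
      simp only [Set.mem_preimage, Set.mem_ofPred_eq, kgauge_dil hL0 hr]
      exact mul_lt_iff_lt_one_right hr
    rw [e3] at e2
    rw [e1, kvol, ENNReal.ofReal_mul ENNReal.toReal_nonneg,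
      ENNReal.ofReal_toReal (volume_kgauge_lt_one_ne_top hL.out), e2, mul_right_comm,
      ← ENNReal.ofReal_mul (by positivity), inv_mul_cancel₀ (by positivity), ENNReal.ofReal_one,
      one_mul]

end Kinetic

section FractionalKernel

variable {d : ℕ}

/-- The second difference `2u(s,y,w) − u(s,y+h,w) − u(s,y−h,w)`. -/
def secDiff (u : Pt d → ℝ) (h : V d) (m : Pt d) : ℝ :=
  2 * u m - u (m.1, m.2.1 + h, m.2.2) - u (m.1, m.2.1 - h, m.2.2)

lemma fracDx_eq (u : Pt d → ℝ) (m : Pt d) :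
    fracDx u m = ∫ h : V d, secDiff u h m * ‖h‖ ^ (-(d : ℝ) - 1 / 3) := rfl

/-- The weight `min(1,|h|^{1/2})|h|^{-d-1/3}`. -/
def fracWeight (h : V d) : ℝ := min 1 (√‖h‖) * ‖h‖ ^ (-(d : ℝ) - 1 / 3)

lemma fracWeight_nonneg (h : V d) : 0 ≤ fracWeight h := by
  unfold fracWeight; positivity

lemma integrable_fracWeight (hd : 1 ≤ d) : Integrable (fracWeight : V d → ℝ) := by
  have : Nonempty (Fin d) := ⟨⟨0, hd⟩⟩
  have : Nontrivial (V d) := inferInstance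
  refine (integrable_fun_norm_addHaar (E := V d) volume
    (f := fun r : ℝ => min 1 (√r) * r ^ (-(d : ℝ) - 1 / 3))).2 ?_
  · rw [finrank_euclideanSpace_fin, ← Set.Ioc_union_Ioi_eq_Ioi zero_le_one, integrableOn_union]
    have e : ∀ r : ℝ, 0 < r → r ^ (d - 1) * r ^ (-(d : ℝ) - 1 / 3) = r ^ (-(4 / 3) : ℝ) := by
      intro r hr
      rw [← Real.rpow_natCast, ← Real.rpow_add hr, Nat.cast_sub hd]
      congr 1; push_cast; ring
    constructor
    · have h1 : IntegrableOn (fun r : ℝ => r ^ (-(5 / 6) : ℝ)) (Set.Ioc 0 1) := by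
        rw [← intervalIntegrable_iff_integrableOn_Ioc_of_le zero_le_one]
        exact intervalIntegral.intervalIntegrable_rpow' (by norm_num)
      refine h1.congr_fun (fun r hr => ?_) measurableSet_Ioc
      have : √r ≤ 1 := Real.sqrt_le_one.2 hr.2
      simp only [smul_eq_mul, min_eq_right this]
      rw [mul_left_comm, e r hr.1, Real.sqrt_eq_rpow, ← Real.rpow_add hr.1]
      norm_num
    · have h1 : IntegrableOn (fun r : ℝ => r ^ (-(4 / 3) : ℝ)) (Set.Ioi 1) :=
        integrableOn_Ioi_rpow_of_lt (by norm_num) one_pos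
      refine h1.congr_fun (fun r hr => ?_) measurableSet_Ioi
      have hr' : (1:ℝ) < r := hr
      have : 1 ≤ √r := Real.one_le_sqrt.2 hr'.le
      simp only [smul_eq_mul, min_eq_left this, one_mul]
      rw [e r (by linarith)]

lemma min_one_le_min_one_sqrt {t : ℝ} (ht : 0 ≤ t) : min 1 t ≤ min 1 (√t) := by
  rcases le_total t 1 with h | h
  · refine le_min (min_le_left _ _) ((min_le_right _ _).trans ?_)
    exact Real.le_sqrt_of_sq_le (by nlinarith)
  · rw [min_eq_left h, min_eq_left (Real.one_le_sqrt.2 h)]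

/-- Lipschitz functions with compact support, with explicit constants. -/
structure LipBump (a : Pt d → ℝ) (K B ρ : ℝ) : Prop where
  K_nonneg : 0 ≤ K
  ρ_nonneg : 0 ≤ ρ
  lip : ∀ m n, |a m - a n| ≤ K * ‖m - n‖
  bdd : ∀ m, |a m| ≤ B
  supp : ∀ m, a m ≠ 0 → ‖m‖ ≤ ρ

variable {a : Pt d → ℝ} {K B ρ : ℝ}

lemma LipBump.B_nonneg (ha : LipBump a K B ρ) : 0 ≤ B := (abs_nonneg _).trans (ha.bdd 0)

lemma LipBump.continuous (ha : LipBump a K B ρ) : Continuous a := by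
  refine (LipschitzWith.of_dist_le_mul (K := ⟨K, ha.K_nonneg⟩) fun m n => ?_).continuous
  rw [Real.dist_eq, dist_eq_norm]
  exact ha.lip m n

lemma LipBump.integrable (ha : LipBump a K B ρ) : Integrable a := by
  refine ha.continuous.integrable_of_hasCompactSupport ?_
  refine HasCompactSupport.intro (isCompact_closedBall 0 ρ) fun m hm => ?_
  by_contra h
  exact hm (by simpa using ha.supp m h)

lemma norm_shift (h : V d) (m : Pt d) :
    ‖((m.1, m.2.1 + h, m.2.2) : Pt d) - m‖ = ‖h‖ := by
  simp [Prod.norm_def]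

lemma norm_shift' (h : V d) (m : Pt d) :
    ‖((m.1, m.2.1 - h, m.2.2) : Pt d) - m‖ = ‖h‖ := by
  simpa [sub_eq_add_neg] using norm_shift (-h) m

lemma LipBump.abs_secDiff_le (ha : LipBump a K B ρ) (h : V d) (m : Pt d) :
    |secDiff a h m| ≤ 2 * K * ‖h‖ := by
  have h1 := ha.lip (m.1, m.2.1 + h, m.2.2) m
  have h2 := ha.lip (m.1, m.2.1 - h, m.2.2) m
  rw [norm_shift, abs_le] at h1
  rw [norm_shift', abs_le] at h2
  rw [secDiff, abs_le]
  constructor <;> linarith [h1.1, h1.2, h2.1, h2.2]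

lemma LipBump.abs_secDiff_le' (ha : LipBump a K B ρ) (h : V d) (m : Pt d) :
    |secDiff a h m| ≤ 4 * B := by
  have h0 := abs_le.1 (ha.bdd m)
  have h1 := abs_le.1 (ha.bdd (m.1, m.2.1 + h, m.2.2))
  have h2 := abs_le.1 (ha.bdd (m.1, m.2.1 - h, m.2.2))
  rw [secDiff, abs_le]
  constructor <;> linarith [h0.1, h0.2, h1.1, h1.2, h2.1, h2.2]

lemma LipBump.abs_secDiff_le_min (ha : LipBump a K B ρ) (h : V d) (m : Pt d) :
    |secDiff a h m| ≤ (2 * K + 4 * B) * min 1 ‖h‖ := by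
  have := ha.K_nonneg
  have := ha.B_nonneg
  rcases le_total ‖h‖ 1 with h1 | h1
  · rw [min_eq_right h1]
    have := ha.abs_secDiff_le h m
    nlinarith [norm_nonneg h]
  · rw [min_eq_left h1]
    linarith [ha.abs_secDiff_le' h m]

lemma continuous_secDiff {u : Pt d → ℝ} (hu : Continuous u) :
    Continuous (fun x : Pt d × V d => secDiff u x.2 x.1) := by
  unfold secDiff; fun_prop

lemma measurable_secDiff_mul {u : Pt d → ℝ} (hu : Continuous u) :
    Measurable (fun x : Pt d × V d => secDiff u x.2 x.1 * ‖x.2‖ ^ (-(d : ℝ) - 1 / 3)) :=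
  (continuous_secDiff hu).measurable.mul (measurable_snd.norm.pow_const _)

lemma LipBump.integrable_secDiff (ha : LipBump a K B ρ) (hd : 1 ≤ d) (m : Pt d) :
    Integrable (fun h : V d => secDiff a h m * ‖h‖ ^ (-(d : ℝ) - 1 / 3)) := by
  have := ha.K_nonneg
  have := ha.B_nonneg
  refine ((integrable_fracWeight hd).const_mul (2 * K + 4 * B)).mono'
    ((measurable_secDiff_mul ha.continuous).comp measurable_prodMk_left).aestronglyMeasurable
    (.of_forall fun h => ?_)
  rw [norm_mul, Real.norm_eq_abs, norm_of_nonneg (by positivity), fracWeight, ← mul_assoc]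
  gcongr
  exact (ha.abs_secDiff_le_min h m).trans
    (mul_le_mul_of_nonneg_left (min_one_le_min_one_sqrt (norm_nonneg h)) (by positivity))

lemma LipBump.abs_fracDx_le (ha : LipBump a K B ρ) (hd : 1 ≤ d) (m : Pt d) :
    |fracDx a m| ≤ (2 * K + 4 * B) * ∫ h : V d, fracWeight h := by
  have := ha.K_nonneg
  have := ha.B_nonneg
  rw [← integral_const_mul, ← Real.norm_eq_abs, fracDx_eq]
  refine norm_integral_le_of_norm_le ((integrable_fracWeight hd).const_mul _)
    (.of_forall fun h => ?_)
  rw [norm_mul, Real.norm_eq_abs, norm_of_nonneg (by positivity), fracWeight, ← mul_assoc]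
  gcongr
  exact (ha.abs_secDiff_le_min h m).trans
    (mul_le_mul_of_nonneg_left (min_one_le_min_one_sqrt (norm_nonneg h)) (by positivity))

lemma LipBump.fracDx_eq_zero (ha : LipBump a K B ρ) {m : Pt d}
    (hm : ρ < |m.1| ∨ ρ < ‖m.2.2‖) : fracDx a m = 0 := by
  have key : ∀ y, a (m.1, y, m.2.2) = 0 := by
    intro y
    by_contra h
    have h1 := ha.supp _ h
    rw [Prod.norm_def, Prod.norm_def, max_le_iff, max_le_iff] at h1
    rcases hm with hm | hm
    · exact absurd h1.1 (not_le.2 hm)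
    · exact absurd h1.2.2 (not_le.2 hm)
  have : ∀ h, secDiff a h m = 0 := by
    intro h
    have := key m.2.1
    simp only [Prod.mk.eta] at this
    rw [secDiff, this, key, key]; simp
  simp [fracDx_eq, this]

lemma LipBump.abs_secDiff_far (ha : LipBump a K B ρ) {m : Pt d} (hm : ρ < ‖m.2.1‖) (h : V d) :
    |secDiff a h m| ≤ B * ((Metric.closedBall (-m.2.1) ρ).indicator 1 h +
      (Metric.closedBall m.2.1 ρ).indicator 1 h) := by
  have hB := ha.B_nonneg
  have key : ∀ y : V d, ρ < ‖y‖ → a (m.1, y, m.2.2) = 0 := by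
    intro y hy
    by_contra h
    have h1 := ha.supp _ h
    rw [Prod.norm_def, Prod.norm_def, max_le_iff, max_le_iff] at h1
    exact absurd h1.2.1 (not_le.2 hy)
  have h0 := key m.2.1 hm
  simp only [Prod.mk.eta] at h0
  have e1 : |a (m.1, m.2.1 + h, m.2.2)| ≤ B * (Metric.closedBall (-m.2.1) ρ).indicator 1 h := by
    by_cases hh : h ∈ Metric.closedBall (-m.2.1) ρ
    · simpa [hh] using ha.bdd _
    · rw [Set.indicator_of_notMem hh, key _ (by
        simpa [dist_eq_norm, add_comm] using hh)]
      simp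
  have e2 : |a (m.1, m.2.1 - h, m.2.2)| ≤ B * (Metric.closedBall m.2.1 ρ).indicator 1 h := by
    by_cases hh : h ∈ Metric.closedBall m.2.1 ρ
    · simpa [hh] using ha.bdd _
    · rw [Set.indicator_of_notMem hh, key _ (by
        simpa [dist_eq_norm, norm_sub_rev] using hh)]
      simp
  rw [secDiff, h0, mul_add, mul_zero, zero_sub]
  rw [abs_le] at *
  constructor <;> linarith [e1.1, e1.2, e2.1, e2.2]

lemma LipBump.exists_decay (ha : LipBump a K B ρ) (hd : 1 ≤ d) :
    ∃ C, 0 ≤ C ∧ ∀ m, |fracDx a m| ≤ C * (1 + ‖m.2.1‖) ^ (-(d : ℝ) - 1 / 3) := by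
  have hK := ha.K_nonneg
  have hB := ha.B_nonneg
  have hρ := ha.ρ_nonneg
  set W := ∫ h : V d, fracWeight h with hW
  have hW0 : 0 ≤ W := integral_nonneg fracWeight_nonneg
  set v := (volume (Metric.closedBall (0 : V d) ρ)).toReal
  have hneg : -(d : ℝ) - 1 / 3 ≤ 0 := by
    have : (0:ℝ) ≤ d := by positivity
    linarith
  set e := -(d : ℝ) - 1 / 3 with he
  have hC1 : 0 ≤ (2 * K + 4 * B) * W * ((2 * ρ + 2) ^ e)⁻¹ := by positivity
  have hC2 : 0 ≤ 2 * B * v * (1 / 2) ^ e := by positivity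
  refine ⟨(2 * K + 4 * B) * W * ((2 * ρ + 2) ^ e)⁻¹ + 2 * B * v * (1 / 2) ^ e, by positivity,
    fun m => ?_⟩
  rw [add_mul]
  rcases le_total ‖m.2.1‖ (2 * ρ + 1) with hm | hm
  · refine (ha.abs_fracDx_le hd m).trans (le_add_of_le_of_nonneg ?_ (by positivity))
    rw [mul_assoc]
    refine le_mul_of_one_le_right (by positivity) ?_
    rw [inv_mul_eq_div, one_le_div (by positivity)]
    exact Real.rpow_le_rpow_of_nonpos (by positivity) (by linarith) hneg
  · refine le_add_of_nonneg_of_le (by positivity) ?_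
    have hmρ : ρ < ‖m.2.1‖ := by linarith
    have hball : ∀ c : V d, volume (Metric.closedBall c ρ) ≠ ∞ := fun c =>
      measure_closedBall_lt_top.ne
    have hind : ∀ c : V d, Integrable ((Metric.closedBall c ρ).indicator (1 : V d → ℝ)) := fun c =>
      (integrable_indicator_iff measurableSet_closedBall).2 (integrableOn_const (hball c))
    have hint : Integrable (fun h : V d => B * ((Metric.closedBall (-m.2.1) ρ).indicator 1 h +
      (Metric.closedBall m.2.1 ρ).indicator 1 h) * ((1 + ‖m.2.1‖) / 2) ^ e) :=
      (((hind _).add (hind _)).const_mul B).mul_const _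
    rw [← Real.norm_eq_abs, fracDx_eq]
    refine (norm_integral_le_of_norm_le hint (.of_forall fun h => ?_)).trans ?_
    · have h1 := ha.abs_secDiff_far hmρ h
      rw [norm_mul, Real.norm_eq_abs, norm_of_nonneg (by positivity)]
      by_cases hh : h ∈ Metric.closedBall (-m.2.1) ρ ∨ h ∈ Metric.closedBall m.2.1 ρ
      · have : (1 + ‖m.2.1‖) / 2 ≤ ‖h‖ := by
          have : ‖m.2.1‖ - ρ ≤ ‖h‖ := by
            rcases hh with hh | hh
            · rw [mem_closedBall_iff_norm] at hh
              have := norm_sub_norm_le (-m.2.1) h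
              rw [norm_sub_rev, norm_neg] at this
              linarith
            · rw [mem_closedBall_iff_norm] at hh
              have := norm_sub_norm_le m.2.1 h
              rw [norm_sub_rev] at this
              linarith
          linarith
        refine mul_le_mul h1 (Real.rpow_le_rpow_of_nonpos (by positivity) this hneg)
          (by positivity) ((abs_nonneg _).trans h1)
      · rw [not_or] at hh
        rw [Set.indicator_of_notMem hh.1, Set.indicator_of_notMem hh.2] at h1 ⊢
        have : |secDiff a h m| = 0 := le_antisymm (by simpa using h1) (abs_nonneg _)
        rw [this]; simp
    · rw [integral_mul_const, integral_const_mul, integral_add (hind _) (hind _),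
        integral_indicator_one measurableSet_closedBall,
        integral_indicator_one measurableSet_closedBall, measureReal_def, measureReal_def,
        Measure.addHaar_closedBall_center _ (-m.2.1), Measure.addHaar_closedBall_center _ m.2.1,
        div_eq_mul_one_div, Real.mul_rpow (by positivity) (by positivity)]
      apply le_of_eq
      ring

lemma measurePreserving_yshift (h : V d) :
    MeasurePreserving (fun m : Pt d => (m.1, m.2.1 + h, m.2.2)) := by
  have := measurePreserving_kinetic (d := d) (c := fun _ _ => (0 : V d)) (.id volume)
    (measurePreserving_add_right volume h) (.id volume) (by fun_prop)
  simpa using this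

lemma measurePreserving_yshift' (h : V d) :
    MeasurePreserving (fun m : Pt d => (m.1, m.2.1 - h, m.2.2)) := by
  simpa [sub_eq_add_neg] using measurePreserving_yshift (-h)

/-- Schur-type bound for the fractional derivative in `L¹`. -/
lemma integrable_uncurry_secDiff {u : Pt d → ℝ} (hd : 1 ≤ d) (hu : Continuous u) {M : ℝ}
    (hM : 0 ≤ M)
    (hb : ∀ h : V d, ∫⁻ m, ENNReal.ofReal |secDiff u h m| ≤ ENNReal.ofReal (M * min 1 √‖h‖)) :
    Integrable (fun x : Pt d × V d => secDiff u x.2 x.1 * ‖x.2‖ ^ (-(d : ℝ) - 1 / 3))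
      (volume.prod volume) ∧
    ∫ m, ‖fracDx u m‖ ≤ M * ∫ h : V d, fracWeight h := by
  have hmeas := measurable_secDiff_mul (d := d) hu
  have hle : (∫⁻ m : Pt d, (∫⁻ h : V d, ENNReal.ofReal ‖secDiff u h m *
      ‖h‖ ^ (-(d : ℝ) - 1 / 3)‖)) ≤ ENNReal.ofReal (M * ∫ h : V d, fracWeight h) := by
    rw [lintegral_lintegral_swap
      (hmeas.norm.ennreal_ofReal.aemeasurable (μ := volume.prod volume)),
      ← integral_const_mul, ofReal_integral_eq_lintegral_ofReal
      ((integrable_fracWeight hd).const_mul M)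
      (.of_forall fun h => mul_nonneg hM (fracWeight_nonneg h))]
    refine lintegral_mono fun h => ?_
    have e : ∀ m : Pt d, ENNReal.ofReal ‖secDiff u h m * ‖h‖ ^ (-(d : ℝ) - 1 / 3)‖ =
        ENNReal.ofReal |secDiff u h m| * ENNReal.ofReal (‖h‖ ^ (-(d : ℝ) - 1 / 3)) := by
      intro m
      rw [norm_mul, ENNReal.ofReal_mul (norm_nonneg _), norm_of_nonneg (r := _ ^ _) (by positivity),
        Real.norm_eq_abs]
    simp_rw [e]
    rw [lintegral_mul_const' _ _ ENNReal.ofReal_ne_top, fracWeight, ← mul_assoc,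
      ENNReal.ofReal_mul (p := M * _) (by positivity)]
    exact mul_le_mul_left (hb h) _
  have hint : Integrable (fun x : Pt d × V d => secDiff u x.2 x.1 *
      ‖x.2‖ ^ (-(d : ℝ) - 1 / 3)) (volume.prod volume) := by
    refine ⟨hmeas.aestronglyMeasurable, ?_⟩
    rw [hasFiniteIntegral_iff_norm, lintegral_prod _ hmeas.norm.ennreal_ofReal.aemeasurable]
    exact hle.trans_lt ENNReal.ofReal_lt_top
  refine ⟨hint, ?_⟩
  have h1 : ∫ m, ‖fracDx u m‖ ≤ ∫ m : Pt d, ∫ h : V d,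
      ‖secDiff u h m * ‖h‖ ^ (-(d : ℝ) - 1 / 3)‖ :=
    integral_mono hint.integral_prod_left.norm hint.norm.integral_prod_left fun m =>
      norm_integral_le_integral_norm _
  refine h1.trans ?_
  have h2 := integral_prod _ hint.norm
  rw [integral_eq_lintegral_of_nonneg_ae (.of_forall fun _ => norm_nonneg _)
    hmeas.norm.aestronglyMeasurable, lintegral_prod _ hmeas.norm.ennreal_ofReal.aemeasurable] at h2
  have h3 : ∫ m : Pt d, ∫ h : V d, ‖secDiff u h m * ‖h‖ ^ (-(d : ℝ) - 1 / 3)‖ = _ := h2.symm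
  rw [h3]
  exact ENNReal.toReal_le_of_le_ofReal (mul_nonneg hM (integral_nonneg fracWeight_nonneg)) hle

end FractionalKernel

section KernelEstimates

variable {d : ℕ} {a : Pt d → ℝ} {K B ρ : ℝ}

lemma two_mul_ofReal (x : ℝ) : 2 * ENNReal.ofReal x = ENNReal.ofReal (2 * x) := by
  rw [ENNReal.ofReal_mul two_pos.le, ENNReal.ofReal_ofNat]

lemma four_mul_ofReal (x : ℝ) : 4 * ENNReal.ofReal x = ENNReal.ofReal (4 * x) := by
  rw [ENNReal.ofReal_mul four_pos.le, ENNReal.ofReal_ofNat]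

lemma lintegral_abs_secDiff_le {u : Pt d → ℝ} (hu : Continuous u) (h : V d) :
    ∫⁻ m, ENNReal.ofReal |secDiff u h m| ≤ 4 * ∫⁻ m, ENNReal.ofReal |u m| := by
  have hm : Measurable fun m => ENNReal.ofReal |u m| := hu.measurable.abs.ennreal_ofReal
  have e1 := (measurePreserving_yshift h).lintegral_comp hm
  have e2 := (measurePreserving_yshift' h).lintegral_comp hm
  calc ∫⁻ m, ENNReal.ofReal |secDiff u h m|
      ≤ ∫⁻ m, (2 * ENNReal.ofReal |u m| + ENNReal.ofReal |u (m.1, m.2.1 + h, m.2.2)| +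
          ENNReal.ofReal |u (m.1, m.2.1 - h, m.2.2)|) := by
        refine lintegral_mono fun m => ?_
        rw [two_mul_ofReal, ← ENNReal.ofReal_add (by positivity) (by positivity),
          ← ENNReal.ofReal_add (by positivity) (by positivity)]
        refine ENNReal.ofReal_le_ofReal ?_
        rw [secDiff]
        refine (abs_sub _ _).trans (add_le_add ((abs_sub _ _).trans ?_) le_rfl)
        rw [abs_mul, abs_two]
    _ = 4 * ∫⁻ m, ENNReal.ofReal |u m| := by
        have m1 : Measurable fun m : Pt d => ENNReal.ofReal |u (m.1, m.2.1 + h, m.2.2)| :=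
          hm.comp (measurePreserving_yshift h).measurable
        have m2 : Measurable fun m : Pt d => ENNReal.ofReal |u (m.1, m.2.1 - h, m.2.2)| :=
          hm.comp (measurePreserving_yshift' h).measurable
        rw [lintegral_add_right _ m2, lintegral_add_right _ m1, lintegral_const_mul _ hm, e1, e2]
        ring

lemma lintegral_le_of_ball {u : Pt d → ℝ} {c r : ℝ} (hc : 0 ≤ c) (hu : ∀ m, |u m| ≤ c)
    (hs : ∀ m, u m ≠ 0 → ‖m‖ ≤ r) :
    ∫⁻ m, ENNReal.ofReal |u m| ≤
      ENNReal.ofReal (c * (volume (Metric.closedBall (0 : Pt d) r)).toReal) := by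
  have hfin : volume (Metric.closedBall (0 : Pt d) r) ≠ ∞ := measure_closedBall_lt_top.ne
  calc ∫⁻ m, ENNReal.ofReal |u m|
      ≤ ∫⁻ m, (Metric.closedBall (0 : Pt d) r).indicator (fun _ => ENNReal.ofReal c) m := by
        refine lintegral_mono fun m => ?_
        by_cases h : u m = 0
        · simp [h]
        · rw [Set.indicator_of_mem (by simpa using hs m h)]
          exact ENNReal.ofReal_le_ofReal (hu m)
    _ = _ := by
        rw [lintegral_indicator_const measurableSet_closedBall, ENNReal.ofReal_mul hc,
          ENNReal.ofReal_toReal hfin]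

/-- The constant bounding second differences of `LipBump` functions in `L¹`. -/
def bumpConst (d : ℕ) (K B ρ : ℝ) : ℝ :=
  (2 * K + 4 * B) * (volume (Metric.closedBall (0 : Pt d) (ρ + 1))).toReal

lemma LipBump.bumpConst_nonneg (ha : LipBump a K B ρ) : 0 ≤ bumpConst d K B ρ := by
  have := ha.K_nonneg
  have := ha.B_nonneg
  unfold bumpConst; positivity

lemma LipBump.lintegral_secDiff_le (ha : LipBump a K B ρ) (h : V d) :
    ∫⁻ m, ENNReal.ofReal |secDiff a h m| ≤
      ENNReal.ofReal (bumpConst d K B ρ * min 1 ‖h‖) := by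
  have hK := ha.K_nonneg
  have hB := ha.B_nonneg
  rcases le_total ‖h‖ 1 with h1 | h1
  · refine (lintegral_le_of_ball (c := (2 * K + 4 * B) * min 1 ‖h‖) (r := ρ + 1) (by positivity)
      (ha.abs_secDiff_le_min h) fun m hm => ?_).trans_eq ?_
    · by_contra hlt
      rw [not_le] at hlt
      have z0 : a m = 0 := by
        by_contra h0
        linarith [ha.supp m h0]
      have z1 : a (m.1, m.2.1 + h, m.2.2) = 0 := by
        by_contra h0
        have e1 := ha.supp _ h0
        have e2 := norm_sub_norm_le m (m.1, m.2.1 + h, m.2.2)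
        rw [norm_sub_rev, norm_shift] at e2
        linarith
      have z2 : a (m.1, m.2.1 - h, m.2.2) = 0 := by
        by_contra h0
        have e1 := ha.supp _ h0
        have e2 := norm_sub_norm_le m (m.1, m.2.1 - h, m.2.2)
        rw [norm_sub_rev, norm_shift'] at e2
        linarith
      exact hm (by rw [secDiff, z0, z1, z2]; simp)
    · rw [bumpConst]; congr 1; ring
  · refine (lintegral_abs_secDiff_le ha.continuous h).trans ?_
    refine (mul_le_mul_right (lintegral_le_of_ball (r := ρ + 1) hB ha.bdd fun m hm =>
      (ha.supp m hm).trans (by linarith)) 4).trans ?_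
    rw [four_mul_ofReal, min_eq_left h1, bumpConst,
      mul_one, ← mul_assoc]
    refine ENNReal.ofReal_le_ofReal (mul_le_mul_of_nonneg_right (by linarith)
      ENNReal.toReal_nonneg)

lemma LipBump.integrable_uncurry (ha : LipBump a K B ρ) (hd : 1 ≤ d) :
    Integrable (fun x : Pt d × V d => secDiff a x.2 x.1 * ‖x.2‖ ^ (-(d : ℝ) - 1 / 3))
      (volume.prod volume) ∧
    ∫ m, ‖fracDx a m‖ ≤ bumpConst d K B ρ * ∫ h : V d, fracWeight h :=
  integrable_uncurry_secDiff hd ha.continuous ha.bumpConst_nonneg fun h =>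
    (ha.lintegral_secDiff_le h).trans (ENNReal.ofReal_le_ofReal
      (mul_le_mul_of_nonneg_left (min_one_le_min_one_sqrt (norm_nonneg h)) ha.bumpConst_nonneg))

lemma LipBump.measurable_fracDx (ha : LipBump a K B ρ) : Measurable (fracDx a) :=
  (measurable_secDiff_mul ha.continuous).stronglyMeasurable.integral_prod_right.measurable

lemma LipBump.integrable_fracDx (ha : LipBump a K B ρ) (hd : 1 ≤ d) : Integrable (fracDx a) :=
  (ha.integrable_uncurry hd).1.integral_prod_left

lemma LipBump.integral_fracDx (ha : LipBump a K B ρ) (hd : 1 ≤ d) : ∫ m, fracDx a m = 0 := by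
  have h1 : ∫ m : Pt d, ∫ h : V d, secDiff a h m * ‖h‖ ^ (-(d : ℝ) - 1 / 3) =
      ∫ h : V d, ∫ m : Pt d, secDiff a h m * ‖h‖ ^ (-(d : ℝ) - 1 / 3) :=
    integral_integral_swap (ha.integrable_uncurry hd).1
  refine h1.trans ?_
  have h2 : ∀ h : V d, ∫ m : Pt d, secDiff a h m = 0 := by
    intro h
    have i1 : Integrable fun m : Pt d => a (m.1, m.2.1 + h, m.2.2) :=
      (measurePreserving_yshift h).integrable_comp_of_integrable ha.integrable
    have i2 : Integrable fun m : Pt d => a (m.1, m.2.1 - h, m.2.2) :=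
      (measurePreserving_yshift' h).integrable_comp_of_integrable ha.integrable
    have e1 : ∫ m : Pt d, a (m.1, m.2.1 + h, m.2.2) = ∫ m, a m := by
      have := integral_map (μ := volume)
        (measurePreserving_yshift (d := d) h).measurable.aemeasurable
        ha.continuous.aestronglyMeasurable
      rw [(measurePreserving_yshift h).map_eq] at this
      exact this.symm
    have e2 : ∫ m : Pt d, a (m.1, m.2.1 - h, m.2.2) = ∫ m, a m := by
      have := integral_map (μ := volume)
        (measurePreserving_yshift' (d := d) h).measurable.aemeasurable
        ha.continuous.aestronglyMeasurable
      rw [(measurePreserving_yshift' h).map_eq] at this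
      exact this.symm
    have i3 : Integrable fun m : Pt d => 2 * a m - a (m.1, m.2.1 + h, m.2.2) :=
      (ha.integrable.const_mul 2).sub i1
    simp only [secDiff]
    rw [integral_sub i3 i2, integral_sub (ha.integrable.const_mul 2) i1, integral_const_mul,
      e1, e2]
    ring
  simp_rw [integral_mul_const, h2]
  simp

lemma LipBump.modulus (ha : LipBump a K B ρ) (hd : 1 ≤ d) {T : Pt d → Pt d} {N : ℝ}
    (hN : 0 ≤ N) (hT : Continuous T) (hTm : MeasurePreserving T)
    (hs : ∀ m h, T (m.1, m.2.1 + h, m.2.2) = ((T m).1, (T m).2.1 + h, (T m).2.2))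
    (h1 : N ≤ 1 → ∀ m, ‖T m - m‖ ≤ (1 + ‖m‖) * N)
    (h2 : N ≤ 1 → ∀ m, ‖T m - m‖ ≤ (1 + ‖T m‖) * N) :
    ∫ m, ‖fracDx a (T m) - fracDx a m‖ ≤ (2 * bumpConst d K B ρ +
      4 * (K * (2 * ρ + 2) * (volume (Metric.closedBall (0 : Pt d) (2 * ρ + 1))).toReal)) *
        (∫ h : V d, fracWeight h) * √N := by
  have hK := ha.K_nonneg
  have hρ := ha.ρ_nonneg
  have hC1 := ha.bumpConst_nonneg
  set C1 := bumpConst d K B ρ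
  set C2 := K * (2 * ρ + 2) * (volume (Metric.closedBall (0 : Pt d) (2 * ρ + 1))).toReal with hC2
  have hC2' : 0 ≤ C2 := by positivity
  set u : Pt d → ℝ := fun m => a (T m) - a m with hu
  have huc : Continuous u := (ha.continuous.comp hT).sub ha.continuous
  have hs' : ∀ m h, T (m.1, m.2.1 - h, m.2.2) = ((T m).1, (T m).2.1 - h, (T m).2.2) := by
    intro m h
    simpa [sub_eq_add_neg] using hs m (-h)
  have hsec : ∀ h m, secDiff u h m = secDiff a h (T m) - secDiff a h m := by
    intro h m
    simp only [secDiff, hu, hs, hs']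
    ring
  have hfr : ∀ m, fracDx a (T m) - fracDx a m = fracDx u m := by
    intro m
    rw [fracDx_eq, fracDx_eq, fracDx_eq,
      ← integral_sub (ha.integrable_secDiff hd _) (ha.integrable_secDiff hd _)]
    refine integral_congr_ae (.of_forall fun h => ?_)
    simp only [hsec, sub_mul]
  simp_rw [hfr]
  have b1 : ∀ h : V d, ∫⁻ m, ENNReal.ofReal |secDiff u h m| ≤
      ENNReal.ofReal (2 * C1 * min 1 ‖h‖) := by
    intro h
    have hm : Measurable fun m => ENNReal.ofReal |secDiff a h m| :=
      ((continuous_secDiff ha.continuous).comp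
        (Continuous.prodMk_left h)).measurable.abs.ennreal_ofReal
    have e := hTm.lintegral_comp hm
    calc ∫⁻ m, ENNReal.ofReal |secDiff u h m|
        ≤ ∫⁻ m, (ENNReal.ofReal |secDiff a h (T m)| + ENNReal.ofReal |secDiff a h m|) := by
          refine lintegral_mono fun m => ?_
          rw [← ENNReal.ofReal_add (by positivity) (by positivity), hsec]
          exact ENNReal.ofReal_le_ofReal (abs_sub _ _)
      _ = 2 * ∫⁻ m, ENNReal.ofReal |secDiff a h m| := by
          rw [lintegral_add_right _ hm, e, two_mul]
      _ ≤ 2 * ENNReal.ofReal (C1 * min 1 ‖h‖) := mul_le_mul_right (ha.lintegral_secDiff_le h) _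
      _ = _ := by
          rw [two_mul_ofReal, mul_assoc]
  have b2 : N ≤ 1 → ∀ h : V d, ∫⁻ m, ENNReal.ofReal |secDiff u h m| ≤
      ENNReal.ofReal (4 * C2 * N) := by
    intro hN1 h
    refine (lintegral_abs_secDiff_le huc h).trans ?_
    have hsupp : ∀ m, u m ≠ 0 → ‖m‖ ≤ 2 * ρ + 1 := by
      intro m hm
      by_contra hlt
      rw [not_le] at hlt
      have z0 : a m = 0 := by
        by_contra h0
        linarith [ha.supp m h0]
      have z1 : a (T m) = 0 := by
        by_contra h0
        have e1 := ha.supp _ h0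
        have e2 := norm_sub_norm_le m (T m)
        rw [norm_sub_rev] at e2
        nlinarith [h2 hN1 m, norm_nonneg (T m)]
      exact hm (by simp [hu, z0, z1])
    have hbd : ∀ m, |u m| ≤ K * (2 * ρ + 2) * N := by
      intro m
      by_cases hm : u m = 0
      · rw [hm, abs_zero]; positivity
      · refine (ha.lip _ _).trans ?_
        rw [mul_assoc]
        refine mul_le_mul_of_nonneg_left ((h1 hN1 m).trans ?_) hK
        have := hsupp m hm
        exact mul_le_mul_of_nonneg_right (by linarith) hN
    refine (mul_le_mul_right (lintegral_le_of_ball (by positivity) hbd hsupp) 4).trans_eq ?_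
    rw [four_mul_ofReal]
    congr 1
    rw [hC2]; ring
  have hM : 0 ≤ (2 * C1 + 4 * C2) * √N := by positivity
  refine ((integrable_uncurry_secDiff hd huc hM fun h => ?_).2).trans_eq (by ring)
  rcases le_total 1 N with hN1 | hN1
  · refine (b1 h).trans (ENNReal.ofReal_le_ofReal ?_)
    have hs1 : 1 ≤ √N := Real.one_le_sqrt.2 hN1
    refine mul_le_mul ?_ (min_one_le_min_one_sqrt (norm_nonneg h)) (by positivity) hM
    nlinarith
  · have hNs : N ≤ √N := Real.le_sqrt_of_sq_le (by nlinarith)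
    rcases le_total ‖h‖ N with hh | hh
    · refine (b1 h).trans (ENNReal.ofReal_le_ofReal ?_)
      have hh1 : √‖h‖ ≤ 1 := Real.sqrt_le_one.2 (hh.trans hN1)
      rw [min_eq_right (hh.trans hN1), min_eq_right hh1]
      calc 2 * C1 * ‖h‖ ≤ (2 * C1 + 4 * C2) * ‖h‖ := by gcongr; linarith
        _ = (2 * C1 + 4 * C2) * (√‖h‖ * √‖h‖) := by rw [Real.mul_self_sqrt (norm_nonneg h)]
        _ ≤ (2 * C1 + 4 * C2) * (√N * √‖h‖) := by gcongr
        _ = _ := by ring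
    · refine (b2 hN1 h).trans (ENNReal.ofReal_le_ofReal ?_)
      have : √N ≤ min 1 √‖h‖ := le_min (Real.sqrt_le_one.2 hN1) (Real.sqrt_le_sqrt hh)
      calc 4 * C2 * N ≤ (2 * C1 + 4 * C2) * N := by gcongr; linarith
        _ = (2 * C1 + 4 * C2) * (√N * √N) := by rw [Real.mul_self_sqrt hN]
        _ ≤ (2 * C1 + 4 * C2) * (√N * min 1 √‖h‖) := by gcongr
        _ = _ := by ring

lemma kgauge_components {g : Pt d} (hg : kgauge 1 g ≤ 1) :
    |g.1| ≤ kgauge 1 g ∧ ‖g.2.1‖ ≤ kgauge 1 g ∧ ‖g.2.2‖ ≤ kgauge 1 g := by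
  have h0 := kgauge_nonneg 1 g
  obtain ⟨a1, a2, a3⟩ := (gauge1_le_iff one_pos h0 g).1 (le_max_left _ _)
  refine ⟨a1.trans (by nlinarith), a2.trans ?_, a3⟩
  rw [one_mul]
  calc kgauge 1 g ^ 3 ≤ kgauge 1 g ^ 1 := pow_le_pow_of_le_one h0 hg (by norm_num)
    _ = _ := pow_one _

lemma norm_kmul_left_sub_le {g : Pt d} (hg : kgauge 1 g ≤ 1) (m : Pt d) :
    ‖kmul g m - m‖ ≤ (1 + ‖m‖) * kgauge 1 g := by
  obtain ⟨g1, g2, g3⟩ := kgauge_components hg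
  have h0 := kgauge_nonneg 1 g
  have hm := norm_nonneg m
  have hms : ‖m.1‖ ≤ ‖m‖ := norm_fst_le m
  have e : kmul g m - m = (g.1, g.2.1 + m.1 • g.2.2, g.2.2) := by
    simp only [kmul, Prod.ext_iff, Prod.fst_sub, Prod.snd_sub]
    refine ⟨by ring, by abel, by abel⟩
  rw [e, Prod.norm_def, Prod.norm_def]
  refine max_le ?_ (max_le ?_ ?_)
  · rw [Real.norm_eq_abs]; nlinarith
  · refine (norm_add_le _ _).trans ?_
    rw [norm_smul]
    have : ‖m.1‖ * ‖g.2.2‖ ≤ ‖m‖ * kgauge 1 g := by gcongr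
    linarith
  · nlinarith

lemma norm_kmul_right_sub_le {g : Pt d} (hg : kgauge 1 g ≤ 1) (m : Pt d) :
    ‖kmul m g - m‖ ≤ (1 + ‖m‖) * kgauge 1 g := by
  obtain ⟨g1, g2, g3⟩ := kgauge_components hg
  have h0 := kgauge_nonneg 1 g
  have hm := norm_nonneg m
  have hms : ‖m.2.2‖ ≤ ‖m‖ := (norm_snd_le m.2).trans (norm_snd_le m)
  have e : kmul m g - m = (g.1, g.2.1 + g.1 • m.2.2, g.2.2) := by
    simp only [kmul, Prod.ext_iff, Prod.fst_sub, Prod.snd_sub]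
    refine ⟨by ring, by abel, by abel⟩
  rw [e, Prod.norm_def, Prod.norm_def]
  refine max_le ?_ (max_le ?_ ?_)
  · rw [Real.norm_eq_abs]; nlinarith
  · refine (norm_add_le _ _).trans ?_
    rw [norm_smul, Real.norm_eq_abs]
    have : |g.1| * ‖m.2.2‖ ≤ kgauge 1 g * ‖m‖ := by gcongr
    linarith
  · nlinarith

lemma sqrt_kgauge_le {m : Pt d} {ρ : ℝ} (hρ : 0 ≤ ρ) (h1 : |m.1| ≤ ρ) (h2 : ‖m.2.2‖ ≤ ρ) :
    √(kgauge 1 m) ≤ (1 + ρ) * (1 + ‖m.2.1‖) ^ (1 / 6 : ℝ) := by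
  have hy : 0 ≤ ‖m.2.1‖ := norm_nonneg _
  set t := (1 + ‖m.2.1‖) ^ (1 / 6 : ℝ) with ht
  have ht1 : 1 ≤ t := Real.one_le_rpow (by linarith) (by norm_num)
  have ht6 : t ^ 6 = 1 + ‖m.2.1‖ := by
    rw [ht, ← Real.rpow_natCast, ← Real.rpow_mul (by positivity)]
    norm_num
  set r := ((1 + ρ) * t) ^ 2 with hr
  have hb : 1 + ρ ≤ (1 + ρ) * t := le_mul_of_one_le_right (by positivity) ht1
  have hr1 : 1 + ρ ≤ r := by
    rw [hr]; nlinarith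
  have hr3 : (1 + ρ) ^ 2 * (1 + ‖m.2.1‖) ≤ r ^ 3 := by
    rw [hr, ← pow_mul, mul_pow, ht6]
    gcongr
    · linarith
    · norm_num
  have hr0 : 0 ≤ r := by positivity
  have key : ∀ m' : Pt d, |m'.1| ≤ ρ → ‖m'.2.2‖ ≤ ρ → ‖m'.2.1‖ ≤ (1 + ρ) ^ 2 * (1 + ‖m.2.1‖) →
      gauge1 1 m' ≤ r := by
    intro m' e1 e2 e3
    refine (gauge1_le_iff one_pos hr0 _).2 ⟨?_, by linarith, by linarith⟩
    nlinarith
  refine Real.sqrt_le_left (by positivity) |>.2 ?_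
  refine max_le (key m h1 h2 (by nlinarith [mul_nonneg hρ hy, mul_nonneg hρ (mul_nonneg hρ hy)]))
    (key _ ?_ ?_ ?_)
  · simpa [kinv] using h1
  · simpa [kinv] using h2
  · refine (norm_add_le _ _).trans ?_
    rw [norm_neg, norm_smul, Real.norm_eq_abs]
    have : |m.1| * ‖m.2.2‖ ≤ ρ * ρ := by gcongr
    nlinarith [mul_nonneg hρ hy, mul_nonneg hρ (mul_nonneg hρ hy)]

lemma integrable_slab_decay (ρ : ℝ) {r : ℝ} (hr : (d : ℝ) < r) :
    Integrable (fun m : Pt d => (Set.Icc (-ρ) ρ).indicator (1 : ℝ → ℝ) m.1 *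
      ((1 + ‖m.2.1‖) ^ (-r) * (Metric.closedBall (0 : V d) ρ).indicator 1 m.2.2)) := by
  have i1 : Integrable ((Set.Icc (-ρ) ρ).indicator (1 : ℝ → ℝ)) :=
    (integrable_indicator_iff measurableSet_Icc).2 (integrableOn_const measure_Icc_lt_top.ne)
  have i2 : Integrable ((Metric.closedBall (0 : V d) ρ).indicator (1 : V d → ℝ)) :=
    (integrable_indicator_iff measurableSet_closedBall).2
      (integrableOn_const measure_closedBall_lt_top.ne)
  have i3 : Integrable (fun y : V d => (1 + ‖y‖) ^ (-r)) :=
    integrable_one_add_norm (by simpa using hr)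
  exact i1.mul_prod (i3.mul_prod i2)

lemma LipBump.exists_pointwise (ha : LipBump a K B ρ) (hd : 1 ≤ d) :
    ∃ C, 0 ≤ C ∧ ∀ m, |fracDx a m| ≤ C * ((Set.Icc (-ρ) ρ).indicator (1 : ℝ → ℝ) m.1 *
      ((1 + ‖m.2.1‖) ^ (-(d : ℝ) - 1 / 3) * (Metric.closedBall (0 : V d) ρ).indicator 1 m.2.2)) := by
  obtain ⟨C, hC, h⟩ := ha.exists_decay hd
  refine ⟨C, hC, fun m => ?_⟩
  by_cases h1 : ρ < |m.1|
  · rw [ha.fracDx_eq_zero (.inl h1), abs_zero]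
    refine mul_nonneg hC (mul_nonneg (Set.indicator_nonneg (fun _ _ => zero_le_one) _)
      (mul_nonneg (by positivity) (Set.indicator_nonneg (fun _ _ => zero_le_one) _)))
  by_cases h2 : ρ < ‖m.2.2‖
  · rw [ha.fracDx_eq_zero (.inr h2), abs_zero]
    refine mul_nonneg hC (mul_nonneg (Set.indicator_nonneg (fun _ _ => zero_le_one) _)
      (mul_nonneg (by positivity) (Set.indicator_nonneg (fun _ _ => zero_le_one) _)))
  rw [Set.indicator_of_mem (Set.mem_Icc.2 (abs_le.1 (not_lt.1 h1))), Set.indicator_of_mem (by simpa using h2)]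
  simpa using h m

instance factOneLeOne : Fact ((1:ℝ) ≤ 1) := ⟨le_rfl⟩

/-- Unfolded form of `DyadicKernel` for the kinetic group. -/
structure KinKernel (A : ℝ) (j : ℤ) (κ : Pt d → ℝ) : Prop where
  meas : Measurable κ
  int : Integrable κ
  zero : ∫ m, κ m = 0
  l1 : ∫ m, ‖κ m‖ ≤ A
  int_moment : Integrable fun m => ‖κ m‖ * √(kgauge 1 m)
  moment : ∫ m, ‖κ m‖ * √(kgauge 1 m) ≤ A * 4 ^ j
  left : ∀ h, ∫ m, ‖κ (kmul h m) - κ m‖ ≤ A * √(kgauge 1 h) / 4 ^ j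
  right : ∀ h, ∫ m, ‖κ (kmul m h) - κ m‖ ≤ A * √(kgauge 1 h) / 4 ^ j

lemma KinKernel.dyadicKernel {A : ℝ} {j : ℤ} {κ : Pt d → ℝ} (h : KinKernel A j κ) :
    DyadicKernel (volume : Measure (Kin d 1)) A j κ := by
  have hdist : ∀ m : Kin d 1, dist m 1 = kgauge (d := d) 1 m := Kin.dist_one
  refine ⟨h.meas, h.int, h.zero, h.l1, ?_, ?_, fun g => ?_, fun g => ?_⟩
  · simp_rw [hdist]; exact h.int_moment
  · simp_rw [hdist]; exact h.moment
  · rw [hdist]; exact h.left g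
  · rw [hdist]; exact h.right g

lemma LipBump.exists_kinKernel_zero (ha : LipBump a K B ρ) (hd : 1 ≤ d) :
    ∃ A, 0 < A ∧ KinKernel A 0 (fracDx a) := by
  have hρ := ha.ρ_nonneg
  obtain ⟨C, hC, hpt⟩ := ha.exists_pointwise hd
  set D : Pt d → ℝ := fun m => (Set.Icc (-ρ) ρ).indicator (1 : ℝ → ℝ) m.1 *
      ((1 + ‖m.2.1‖) ^ (-((d : ℝ) + 1 / 6)) *
        (Metric.closedBall (0 : V d) ρ).indicator 1 m.2.2) with hD
  have hDint : Integrable D := integrable_slab_decay ρ (by linarith)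
  have hmom : ∀ m, ‖fracDx a m‖ * √(kgauge 1 m) ≤ C * (1 + ρ) * D m := by
    intro m
    have h0 := hpt m
    by_cases h1 : ρ < |m.1| ∨ ρ < ‖m.2.2‖
    · rw [ha.fracDx_eq_zero h1, norm_zero, zero_mul]
      refine mul_nonneg (by positivity) (mul_nonneg (Set.indicator_nonneg (fun _ _ => zero_le_one) _)
      (mul_nonneg (by positivity) (Set.indicator_nonneg (fun _ _ => zero_le_one) _)))
    rw [not_or, not_lt, not_lt] at h1
    rw [hD]
    simp only
    rw [Set.indicator_of_mem (Set.mem_Icc.2 (abs_le.1 h1.1)), Set.indicator_of_mem (by simpa using h1.2)] at h0 ⊢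
    simp only [Pi.one_apply, one_mul, mul_one] at h0 ⊢
    have h3 := sqrt_kgauge_le hρ h1.1 h1.2
    have e : (1 + ‖m.2.1‖) ^ (-((d : ℝ) + 1 / 6)) =
        (1 + ‖m.2.1‖) ^ (-(d : ℝ) - 1 / 3) * (1 + ‖m.2.1‖) ^ (1 / 6 : ℝ) := by
      rw [← Real.rpow_add (by positivity)]; congr 1; ring
    rw [e, Real.norm_eq_abs]
    calc _ ≤ (C * (1 + ‖m.2.1‖) ^ (-(d : ℝ) - 1 / 3)) *
          ((1 + ρ) * (1 + ‖m.2.1‖) ^ (1 / 6 : ℝ)) := by gcongr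
      _ = _ := by ring
  have hmint : Integrable (fun m : Pt d => ‖fracDx a m‖ * √(kgauge 1 m)) := by
    refine (hDint.const_mul (C * (1 + ρ))).mono' ?_ (.of_forall fun m => ?_)
    · exact (ha.measurable_fracDx.norm.mul
        ((continuous_kgauge 1).measurable.sqrt)).aestronglyMeasurable
    · rw [norm_of_nonneg (by positivity)]; exact hmom m
  set A1 := ∫ m, ‖fracDx a m‖
  set A2 := ∫ m : Pt d, ‖fracDx a m‖ * √(kgauge 1 m)
  set A3 := (2 * bumpConst d K B ρ +
      4 * (K * (2 * ρ + 2) * (volume (Metric.closedBall (0 : Pt d) (2 * ρ + 1))).toReal)) *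
        (∫ h : V d, fracWeight h)
  have hA1 : 0 ≤ A1 := by positivity
  have hA2 : 0 ≤ A2 := by positivity
  have hA3 : 0 ≤ A3 := by
    have := ha.bumpConst_nonneg
    have := ha.K_nonneg
    have : 0 ≤ ∫ h : V d, fracWeight h := integral_nonneg fracWeight_nonneg
    positivity
  refine ⟨A1 + A2 + A3 + 1, by positivity, ?_⟩
  refine ⟨ha.measurable_fracDx, ha.integrable_fracDx hd, ha.integral_fracDx hd, ?_, ?_, ?_,
    fun h => ?_, fun h => ?_⟩
  · change A1 ≤ _; linarith
  · exact hmint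
  · change A2 ≤ _
    simp only [zpow_zero, mul_one]; linarith
  · rw [zpow_zero, div_one]
    refine (ha.modulus hd (T := fun m => kmul (d := d) h m) (N := kgauge (d := d) 1 h)
      (kgauge_nonneg (d := d) 1 h) (by fun_prop)
      (measurePreserving_kmul_left (d := d) h) ?_ ?_ ?_).trans ?_
    · intro m k
      simp only [kmul, Prod.mk.injEq, true_and, and_true]
      abel
    · intro hN m
      exact norm_kmul_left_sub_le (d := d) hN m
    · intro hN m
      have := norm_kmul_left_sub_le (d := d) (g := kinv (d := d) h)
        (by rwa [kgauge_kinv]) (kmul (d := d) h m)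
      rwa [kgauge_kinv, ← kmul_assoc, kinv_kmul_self, zero_kmul, norm_sub_rev] at this
    · gcongr
      linarith
  · rw [zpow_zero, div_one]
    refine (ha.modulus hd (T := fun m => kmul (d := d) m h) (N := kgauge (d := d) 1 h)
      (kgauge_nonneg (d := d) 1 h) (by fun_prop)
      (measurePreserving_kmul_right (d := d) h) ?_ ?_ ?_).trans ?_
    · intro m k
      simp only [kmul, Prod.mk.injEq, true_and, and_true]
      abel
    · intro hN m
      exact norm_kmul_right_sub_le (d := d) hN m
    · intro hN m
      have := norm_kmul_right_sub_le (d := d) (g := kinv (d := d) h)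
        (by rwa [kgauge_kinv]) (kmul (d := d) m h)
      rw [kgauge_kinv, kmul_assoc, kmul_kinv_self, norm_sub_rev] at this
      simpa [kmul] using this
    · gcongr
      linarith

/-- The `L¹`-normalised dyadic dilate at scale `16 ^ j`. -/
def dyadicDil (κ : Pt d → ℝ) (j : ℤ) (m : Pt d) : ℝ :=
  (((16:ℝ) ^ j)⁻¹) ^ (4 * d + 2) * κ (dil ((16:ℝ) ^ j)⁻¹ m)

lemma integral_dyadicDil (g : Pt d → ℝ) (j : ℤ) : ∫ m, dyadicDil g j m = ∫ m, g m := by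
  have h : (0:ℝ) < ((16:ℝ) ^ j)⁻¹ := by positivity
  simp only [dyadicDil]
  rw [integral_const_mul, integral_comp_dil h, ← mul_assoc, mul_inv_cancel₀ (by positivity),
    one_mul]

lemma norm_dyadicDil (κ : Pt d → ℝ) (j : ℤ) (m : Pt d) :
    ‖dyadicDil κ j m‖ = dyadicDil (fun m => ‖κ m‖) j m := by
  rw [dyadicDil, norm_mul, norm_of_nonneg (by positivity)]; rfl

lemma KinKernel.dyadicDil {κ : Pt d → ℝ} {A : ℝ} (h : KinKernel A 0 κ) (j : ℤ) :
    KinKernel A j (dyadicDil κ j) := by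
  have hr : (0:ℝ) < ((16:ℝ) ^ j)⁻¹ := by positivity
  have hsq : √((16:ℝ) ^ j)⁻¹ = ((4:ℝ) ^ j)⁻¹ := by
    rw [Real.sqrt_eq_iff_mul_self_eq (by positivity) (by positivity), ← mul_inv, ← mul_zpow]
    norm_num
  have hmom : ∀ m : Pt d, ‖_root_.dyadicDil κ j m‖ * √(kgauge 1 m) =
      4 ^ j * _root_.dyadicDil (fun m => ‖κ m‖ * √(kgauge 1 m)) j m := by
    intro m
    rw [norm_dyadicDil, _root_.dyadicDil, _root_.dyadicDil, kgauge_dil one_pos hr,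
      Real.sqrt_mul hr.le, hsq]
    field_simp
  have hmeas : Measurable (_root_.dyadicDil κ j) :=
    ((show Measurable κ from h.meas).comp (continuous_dil _).measurable).const_mul _
  have h0 := h.int_moment
  have h1 := h.moment
  rw [zpow_zero, mul_one] at h1
  refine ⟨hmeas, ?_, ?_, ?_, ?_, ?_, fun g => ?_, fun g => ?_⟩
  · exact (integrable_comp_dil hr (show Integrable κ from h.int)).const_mul _
  · exact (integral_dyadicDil κ j).trans h.zero
  · simp_rw [norm_dyadicDil]
    exact (integral_dyadicDil _ j).trans_le h.l1
  · simp_rw [hmom]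
    exact ((integrable_comp_dil hr (show Integrable (fun m : Pt d => ‖κ m‖ * √(kgauge 1 m))
      from h0)).const_mul _).const_mul _
  · simp_rw [hmom]
    rw [integral_const_mul, mul_comm]
    refine mul_le_mul_of_nonneg_right ?_ (by positivity)
    exact (integral_dyadicDil _ j).trans_le h1
  · have e : ∀ m : Pt d, ‖_root_.dyadicDil κ j (kmul g m) - _root_.dyadicDil κ j m‖ =
        _root_.dyadicDil (fun m => ‖κ (kmul (dil ((16:ℝ) ^ j)⁻¹ g) m) - κ m‖) j m := by
      intro m
      rw [_root_.dyadicDil, _root_.dyadicDil, _root_.dyadicDil, ← mul_sub, norm_mul,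
        norm_of_nonneg (by positivity), dil_kmul]
    have h2 := h.left (dil (d := d) ((16:ℝ) ^ j)⁻¹ g)
    rw [zpow_zero, div_one, kgauge_dil one_pos hr, Real.sqrt_mul hr.le, hsq] at h2
    have e2 : ∫ m : Pt d, ‖_root_.dyadicDil κ j (kmul g m) - _root_.dyadicDil κ j m‖ =
        ∫ m : Pt d, ‖κ (kmul (dil ((16:ℝ) ^ j)⁻¹ g) m) - κ m‖ := by
      simp_rw [e]; exact integral_dyadicDil _ j
    refine (e2.trans_le h2).trans_eq ?_
    field_simp
  · have e : ∀ m : Pt d, ‖_root_.dyadicDil κ j (kmul m g) - _root_.dyadicDil κ j m‖ =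
        _root_.dyadicDil (fun m => ‖κ (kmul m (dil ((16:ℝ) ^ j)⁻¹ g)) - κ m‖) j m := by
      intro m
      rw [_root_.dyadicDil, _root_.dyadicDil, _root_.dyadicDil, ← mul_sub, norm_mul,
        norm_of_nonneg (by positivity), dil_kmul]
    have h2 := h.right (dil (d := d) ((16:ℝ) ^ j)⁻¹ g)
    rw [zpow_zero, div_one, kgauge_dil one_pos hr, Real.sqrt_mul hr.le, hsq] at h2
    have e2 : ∫ m : Pt d, ‖_root_.dyadicDil κ j (kmul m g) - _root_.dyadicDil κ j m‖ =
        ∫ m : Pt d, ‖κ (kmul m (dil ((16:ℝ) ^ j)⁻¹ g)) - κ m‖ := by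
      simp_rw [e]; exact integral_dyadicDil _ j
    refine (e2.trans_le h2).trans_eq ?_
    field_simp

lemma integral_dyadicDil_mul (κ : Pt d → ℝ) (f : Pt d → ℝ) (j : ℤ) (z : Pt d) :
    ∫ m, dyadicDil κ j m * f (kmul z m) = ∫ m, κ m * f (kmul z (dil ((16:ℝ) ^ j) m)) := by
  rw [← integral_dyadicDil (fun m => κ m * f (kmul z (dil ((16:ℝ) ^ j) m))) j]
  refine integral_congr_ae (.of_forall fun m => ?_)
  simp only [dyadicDil]
  rw [dil_dil, mul_inv_cancel₀ (by positivity), dil_one, mul_assoc]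

/-- The singular integral part: sums of dyadic averages against `𝔇a` are bounded on `L^p`. -/
lemma LipBump.exists_sum_dyadic_le (ha : LipBump a K B ρ) (hd : 1 ≤ d) {p : ℝ} (hp : 1 < p) :
    ∃ C, 0 ≤ C ∧ ∀ (s : Finset ℤ) (f : Pt d → ℝ), BddInt volume f →
      ∫ z, |∑ j ∈ s, ∫ m, fracDx a m * f (kmul z (dil ((16:ℝ) ^ j) m))| ^ p ≤
        C * ∫ z, |f z| ^ p := by
  obtain ⟨A, hA, hker⟩ := ha.exists_kinKernel_zero hd
  obtain ⟨C, hC, h⟩ := exists_integral_rpow_sum_dyadic_le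
    (Kin.ballGrowth (d := d) (L := 1)) hA hp
  refine ⟨C, hC, fun s f hf => ?_⟩
  have := h (fun j => _root_.dyadicDil (fracDx a) j) (fun j => (hker.dyadicDil j).dyadicKernel) s f hf
  have e : ∀ z : Pt d, ∑ j ∈ s, ∫ m, fracDx a m * f (kmul z (dil ((16:ℝ) ^ j) m)) =
      ∑ j ∈ s, ∫ m, _root_.dyadicDil (fracDx a) j m * f (kmul z m) := fun z =>
    Finset.sum_congr rfl fun j _ => (integral_dyadicDil_mul _ _ _ _).symm
  simp_rw [e]
  exact this

end KernelEstimates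

section FractionalIntegration

lemma tsum_mul_rpow_le {p : ℝ} (hp : 1 ≤ p) (w f : ℕ → ℝ≥0∞) :
    (∑' k, w k * f k) ^ p ≤ (∑' k, w k) ^ (p - 1) * ∑' k, w k * f k ^ p := by
  have hp0 : 0 < p := by linarith
  have h : ∑' k, w k * f k ≤ ((∑' k, w k) ^ (p - 1) * ∑' k, w k * f k ^ p) ^ p⁻¹ := by
    rw [ENNReal.tsum_eq_iSup_sum]
    refine iSup_le fun s => (ENNReal.inner_le_weight_mul_Lp_of_nonneg s hp w f).trans ?_
    rw [ENNReal.mul_rpow_of_nonneg _ _ (inv_nonneg.2 hp0.le), ← ENNReal.rpow_mul,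
      show (p - 1) * p⁻¹ = 1 - p⁻¹ by field_simp]
    have : 0 ≤ 1 - p⁻¹ := sub_nonneg.2 (inv_le_one_of_one_le₀ hp)
    exact mul_le_mul' (ENNReal.rpow_le_rpow (ENNReal.sum_le_tsum s) this)
      (ENNReal.rpow_le_rpow (ENNReal.sum_le_tsum s) (inv_nonneg.2 hp0.le))
  refine (ENNReal.rpow_le_rpow h hp0.le).trans_eq ?_
  rw [ENNReal.rpow_inv_rpow hp0.ne']

variable {d : ℕ} {a : Pt d → ℝ} {K B ρ : ℝ}

lemma lintegral_kmul_dil {r : ℝ} (hr : 0 < r) (z : Pt d) {F : Pt d → ℝ≥0∞} (hF : Measurable F) :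
    ∫⁻ m, F (kmul z (dil r m)) = ENNReal.ofReal (r ^ (4 * d + 2))⁻¹ * ∫⁻ m, F m := by
  have h1 : Measurable fun m => F (kmul z m) := hF.comp (by fun_prop : Continuous _).measurable
  have h2 := (lintegral_map (μ := volume) h1 (continuous_dil (d := d) r).measurable).symm
  rw [map_dil hr, lintegral_smul_measure, (measurePreserving_kmul_left z).lintegral_comp hF] at h2
  simpa using h2

lemma lintegral_indicator_kgauge {L r R : ℝ} (hL : 1 ≤ L) (hR : 0 < R) (z : Pt d)
    {g : Pt d → ℝ≥0∞} (hg : Measurable g) :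
    ∫⁻ m, {m : Pt d | kgauge L m < r}.indicator 1 m * g (kmul z (dil R m)) =
      ENNReal.ofReal (R ^ (4 * d + 2))⁻¹ * ∫⁻ y in {y | kdist L y z < r * R}, g y := by
  have hmeas : MeasurableSet {y : Pt d | kdist L y z < r * R} := by
    have : Continuous fun y : Pt d => kdist L y z := (continuous_kgauge L).comp (by fun_prop)
    exact (isOpen_lt this continuous_const).measurableSet
  rw [← lintegral_indicator hmeas, ← lintegral_kmul_dil hR z (hg.indicator hmeas)]
  refine lintegral_congr fun m => ?_
  have : kmul z (dil R m) ∈ {y : Pt d | kdist L y z < r * R} ↔ m ∈ {m : Pt d | kgauge L m < r} := by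
    rw [Set.mem_ofPred_eq, Set.mem_ofPred_eq, kdist_comm, kdist, ← kmul_assoc, kinv_kmul_self,
      zero_kmul, kgauge_dil (by linarith) hR, mul_comm, mul_lt_mul_iff_left₀ hR]
  by_cases hm : m ∈ {m : Pt d | kgauge L m < r}
  · rw [Set.indicator_of_mem hm, Set.indicator_of_mem (this.2 hm), Pi.one_apply, one_mul]
  · rw [Set.indicator_of_notMem hm, Set.indicator_of_notMem (this.not.2 hm), zero_mul]

lemma hardy_littlewood_sobolev_kdist {L : ℝ} (hL : 1 ≤ L) {f : Pt d → ℝ} (hf : BddInt volume f)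
    (hf0 : ∀ x, 0 ≤ f x) {p q r : ℝ} (hq : 1 < q) (hqQ : q < (4 * d + 2 : ℕ))
    (hpq : 1 / q = 1 / p + 1 / (4 * d + 2 : ℕ)) (hp : 0 < p) (hr : 0 < r) (s : Finset ℤ) :
    ∫⁻ z : Pt d, ENNReal.ofReal ((∑ j ∈ s, r * 16 ^ j * ((∫ y in {y | kdist L y z < r * 16 ^ j}, f y) /
        (kvol d L * (r * 16 ^ j) ^ (4 * d + 2)))) ^ p) ≤
      ENNReal.ofReal (hlsConst p q (4 * d + 2) * kvol d L ^ (-(p / (4 * d + 2 : ℕ))) *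
        (∫ y, f y ^ q) ^ (p / q)) := by
  have : Fact (1 ≤ L) := ⟨hL⟩
  exact (Kin.ballGrowth (d := d) (L := L)).hardy_littlewood_sobolev hf hf0 hq hqQ hpq hp hr s

/-- A slab `|s| ≤ ρ`, `‖w‖ ≤ ρ` with decay in `y` is covered by gauge balls of growing
anisotropy. -/
lemma exists_kgauge_lt (hρ : 0 ≤ ρ) {m : Pt d} (h1 : |m.1| ≤ ρ) (h2 : ‖m.2.2‖ ≤ ρ) :
    ∃ k : ℕ, kgauge (8 ^ k) m < ρ + 3 ∧
      (1 + ‖m.2.1‖) ^ (-(d : ℝ) - 1 / 3) ≤ (1 / 2) ^ k * ((8 ^ k) ^ d)⁻¹ := by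
  have hy := norm_nonneg m.2.1
  obtain ⟨n, hn1, hn2⟩ := exists_nat_pow_near (x := 1 + ‖m.2.1‖) (y := 8) (by linarith) (by norm_num)
  refine ⟨n, ?_, ?_⟩
  · have h8 : (1:ℝ) ≤ 8 ^ n := one_le_pow₀ (by norm_num)
    have key : ∀ m' : Pt d, |m'.1| ≤ ρ → ‖m'.2.2‖ ≤ ρ → ‖m'.2.1‖ ≤ 8 * 8 ^ n + ρ ^ 2 →
        gauge1 (8 ^ n) m' < ρ + 3 := by
      intro m' e1 e2 e3
      refine (gauge1_lt_iff (by positivity) (by linarith) _).2 ⟨by nlinarith, ?_, by linarith⟩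
      refine e3.trans_lt ?_
      have : ρ ^ 2 ≤ 8 ^ n * ρ ^ 2 := le_mul_of_one_le_left (by positivity) h8
      have h3 : 0 ≤ ρ ^ 3 := by positivity
      have : 8 ^ n * (8 + ρ ^ 2) < 8 ^ n * (ρ + 3) ^ 3 :=
        mul_lt_mul_of_pos_left (by nlinarith) (by positivity)
      linarith
    rw [pow_succ] at hn2
    refine max_lt (key m h1 h2 (by nlinarith)) (key _ (by simpa [kinv] using h1)
      (by simpa [kinv] using h2) ?_)
    refine (norm_add_le _ _).trans ?_
    rw [norm_neg, norm_smul, Real.norm_eq_abs]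
    have : |m.1| * ‖m.2.2‖ ≤ ρ * ρ := by gcongr
    nlinarith
  · calc (1 + ‖m.2.1‖) ^ (-(d : ℝ) - 1 / 3) ≤ ((8:ℝ) ^ n) ^ (-(d : ℝ) - 1 / 3) :=
          Real.rpow_le_rpow_of_nonpos (by positivity) hn1
            (by have : (0:ℝ) ≤ d := by positivity
                linarith)
      _ = (1 / 2) ^ n * ((8 ^ n) ^ d)⁻¹ := by
          have e8 : ((8:ℝ) ^ n) ^ (-(1 / 3) : ℝ) = (1 / 2) ^ n := by
            rw [← Real.rpow_natCast, ← Real.rpow_mul (by norm_num), mul_comm, Real.rpow_mul (by norm_num),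
              Real.rpow_natCast]
            congr 1
            rw [show (8:ℝ) = 2 ^ (3:ℝ) by norm_num, ← Real.rpow_mul (by norm_num)]
            norm_num
          rw [sub_eq_add_neg, Real.rpow_add (by positivity), e8, Real.rpow_neg (by positivity),
            Real.rpow_natCast, mul_comm]

lemma LipBump.exists_ofReal_fracDx_le (ha : LipBump a K B ρ) (hd : 1 ≤ d) :
    ∃ C, 0 ≤ C ∧ ∀ m, ENNReal.ofReal |fracDx a m| ≤
      ∑' k : ℕ, ENNReal.ofReal (C * ((1 / 2) ^ k * ((8 ^ k) ^ d)⁻¹)) *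
        {m : Pt d | kgauge (8 ^ k) m < ρ + 3}.indicator 1 m := by
  obtain ⟨C, hC, h⟩ := ha.exists_pointwise hd
  refine ⟨C, hC, fun m => ?_⟩
  by_cases h0 : ρ < |m.1| ∨ ρ < ‖m.2.2‖
  · simp [ha.fracDx_eq_zero h0]
  rw [not_or, not_lt, not_lt] at h0
  obtain ⟨k, hk1, hk2⟩ := exists_kgauge_lt ha.ρ_nonneg h0.1 h0.2
  refine le_trans ?_ (ENNReal.le_tsum k)
  rw [Set.indicator_of_mem (by exact hk1), Pi.one_apply, mul_one]
  refine ENNReal.ofReal_le_ofReal ((h m).trans (mul_le_mul_of_nonneg_left ?_ hC))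
  rw [Set.indicator_of_mem (Set.mem_Icc.2 (abs_le.1 h0.1)),
    Set.indicator_of_mem (by simpa using h0.2)]
  simpa using hk2

lemma BddInt.abs {α : Type*} [MeasurableSpace α] {μ : Measure α} {f : α → ℝ} (hf : BddInt μ f) :
    BddInt μ fun x => |f x| where
  meas := hf.meas.abs
  int := hf.int.abs
  bdd := by simpa using hf.bdd

/-- The sum over scales of the averages over gauge balls. -/
def ballSum (L r : ℝ) (s : Finset ℤ) (g : Pt d → ℝ) (z : Pt d) : ℝ≥0∞ :=
  ∑ j ∈ s, ENNReal.ofReal ((16:ℝ) ^ j) * ∫⁻ m, {m : Pt d | kgauge L m < r}.indicator 1 m *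
    ENNReal.ofReal |g (kmul z (dil ((16:ℝ) ^ j) m))|

lemma measurable_ballSum (L r : ℝ) (s : Finset ℤ) {g : Pt d → ℝ} (hg : Measurable g) :
    Measurable (ballSum L r s g) := by
  refine Finset.measurable_sum _ fun j _ => Measurable.const_mul ?_ _
  have hm : MeasurableSet {m : Pt d | kgauge L m < r} :=
    (isOpen_lt (continuous_kgauge L) continuous_const).measurableSet
  have h1 : Measurable fun x : Pt d × Pt d =>
      {m : Pt d | kgauge L m < r}.indicator (1 : Pt d → ℝ≥0∞) x.2 :=
    (measurable_one.indicator hm).comp measurable_snd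
  have h2 : Measurable fun x : Pt d × Pt d => ENNReal.ofReal |g (kmul x.1 (dil ((16:ℝ) ^ j) x.2))| :=
    (hg.comp (by fun_prop : Continuous fun x : Pt d × Pt d =>
      kmul x.1 (dil ((16:ℝ) ^ j) x.2)).measurable).abs.ennreal_ofReal
  exact (h1.mul h2).lintegral_prod_right'

lemma ballSum_eq {L r : ℝ} (hL : 1 ≤ L) (hr : 0 < r) (s : Finset ℤ) {g : Pt d → ℝ}
    (hg : BddInt volume g) (z : Pt d) :
    ballSum L r s g z = ENNReal.ofReal (kvol d L * r ^ (4 * d + 1)) *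
      ENNReal.ofReal (∑ j ∈ s, r * 16 ^ j * ((∫ y in {y | kdist L y z < r * 16 ^ j}, |g y|) /
        (kvol d L * (r * 16 ^ j) ^ (4 * d + 2)))) := by
  have hv := kvol_pos (d := d) hL
  have hI : ∀ j : ℤ, 0 ≤ ∫ y in {y | kdist L y z < r * 16 ^ j}, |g y| := fun j => by positivity
  rw [ballSum, ← ENNReal.ofReal_mul (by positivity), Finset.mul_sum,
    ENNReal.ofReal_sum_of_nonneg fun j _ => by have := hI j; positivity]
  refine Finset.sum_congr rfl fun j _ => ?_
  have hR : (0:ℝ) < 16 ^ j := by positivity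
  rw [lintegral_indicator_kgauge (g := fun y => ENNReal.ofReal |g y|) hL hR z
    hg.meas.abs.ennreal_ofReal, ← ofReal_integral_eq_lintegral_ofReal hg.int.abs.integrableOn
      (.of_forall fun y => abs_nonneg _), ← ENNReal.ofReal_mul (by positivity),
    ← ENNReal.ofReal_mul (by positivity)]
  congr 1
  rw [mul_pow, pow_succ r (4 * d + 1)]
  field_simp

lemma lintegral_ballSum_le {L r : ℝ} (hL : 1 ≤ L) (hr : 0 < r) {p q : ℝ} (hq : 1 < q)
    (hqQ : q < (4 * d + 2 : ℕ)) (hpq : 1 / q = 1 / p + 1 / (4 * d + 2 : ℕ)) (hp : 0 < p)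
    (s : Finset ℤ) {g : Pt d → ℝ} (hg : BddInt volume g) :
    ∫⁻ z, ballSum L r s g z ^ p ≤ ENNReal.ofReal (kvol d L * r ^ (4 * d + 1)) ^ p *
      ENNReal.ofReal (hlsConst p q (4 * d + 2) * kvol d 1 ^ (-(p / (4 * d + 2 : ℕ))) *
        (∫ y, |g y| ^ q) ^ (p / q)) := by
  have hv := kvol_pos (d := d) hL
  have hv1 := kvol_pos (d := d) le_rfl
  have hH : 0 ≤ hlsConst p q (4 * d + 2) := by
    have hQ : (0:ℝ) < (4 * d + 2 : ℕ) := by positivity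
    have h0 := hedbergConst_nonneg (θ := q / (4 * d + 2 : ℕ)) (by positivity)
      ((div_lt_one hQ).2 hqQ)
    have : 0 < q - 1 := by linarith
    unfold hlsConst
    positivity
  simp_rw [ballSum_eq hL hr s hg, ENNReal.mul_rpow_of_nonneg _ _ hp.le]
  rw [lintegral_const_mul' _ _ (by simp [hp.le])]
  refine mul_le_mul' le_rfl ?_
  have h := hardy_littlewood_sobolev_kdist hL hg.abs (fun y => abs_nonneg _) hq hqQ hpq hp hr s
  refine (le_of_eq ?_).trans (h.trans (ENNReal.ofReal_le_ofReal ?_))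
  · refine lintegral_congr fun z => ?_
    rw [ENNReal.ofReal_rpow_of_nonneg _ hp.le]
    refine Finset.sum_nonneg fun j _ => ?_
    have : 0 ≤ ∫ y in {y | kdist L y z < r * 16 ^ j}, |g y| := by positivity
    positivity
  · have hI : 0 ≤ ∫ y, |g y| ^ q := by positivity
    have : kvol d L ^ (-(p / (4 * d + 2 : ℕ))) ≤ kvol d 1 ^ (-(p / (4 * d + 2 : ℕ))) :=
      Real.rpow_le_rpow_of_nonpos hv1 (kvol_one_le hL)
        (neg_nonpos.2 (by positivity))
    gcongr

/-- The fractional integral part: weighted sums of dyadic averages against `𝔇a` map `L^q`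
to `L^p`. -/
lemma LipBump.exists_sum_dyadic_rpow_le (ha : LipBump a K B ρ) (hd : 1 ≤ d) {p q : ℝ} (hp : 1 < p)
    (hq : 1 < q) (hqQ : q < (4 * d + 2 : ℕ)) (hpq : 1 / q = 1 / p + 1 / (4 * d + 2 : ℕ)) :
    ∃ C, 0 ≤ C ∧ ∀ (s : Finset ℤ) (g : Pt d → ℝ), BddInt volume g →
      ∫⁻ z, ENNReal.ofReal |∑ j ∈ s, (16:ℝ) ^ j *
          ∫ m, fracDx a m * g (kmul z (dil ((16:ℝ) ^ j) m))| ^ p ≤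
        ENNReal.ofReal (C * (∫ z, |g z| ^ q) ^ (p / q)) := by
  obtain ⟨C, hC, hbd⟩ := ha.exists_ofReal_fracDx_le hd
  have hr : 0 < ρ + 3 := by linarith [ha.ρ_nonneg]
  have hp0 : 0 < p := by linarith
  set v := (volume (unitBox d)).toReal with hv
  set M := C * v * (ρ + 3) ^ (4 * d + 1) with hM
  have hM0 : 0 ≤ M := by positivity
  have hH : 0 ≤ hlsConst p q (4 * d + 2) := by
    have hQ : (0:ℝ) < (4 * d + 2 : ℕ) := by positivity
    have h0 := hedbergConst_nonneg (θ := q / (4 * d + 2 : ℕ)) (by positivity)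
      ((div_lt_one hQ).2 hqQ)
    have : 0 < q - 1 := by linarith
    unfold hlsConst
    positivity
  have hk1 := kvol_pos (d := d) le_rfl
  set H := hlsConst p q (4 * d + 2) * kvol d 1 ^ (-(p / (4 * d + 2 : ℕ)))
  have hH0 : 0 ≤ H := by positivity
  have hw : ∑' k : ℕ, ENNReal.ofReal ((1 / 2) ^ k) = 2 := by
    rw [← ENNReal.ofReal_tsum_of_nonneg (fun k => by positivity) summable_geometric_two,
      tsum_geometric_two, ENNReal.ofReal_ofNat]
  refine ⟨2 ^ (p - 1) * (2 * (M ^ p * H)), by positivity, fun s g hg => ?_⟩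
  set N := (∫ z, |g z| ^ q) ^ (p / q)
  have hN : 0 ≤ N := by positivity
  have hpt : ∀ z, ENNReal.ofReal |∑ j ∈ s, (16:ℝ) ^ j *
      ∫ m, fracDx a m * g (kmul z (dil ((16:ℝ) ^ j) m))| ≤
      ∑' k : ℕ, ENNReal.ofReal ((1 / 2) ^ k) *
        (ENNReal.ofReal (C * ((8 ^ k) ^ d)⁻¹) * ballSum (8 ^ k) (ρ + 3) s g z) := by
    intro z
    have hsum : ENNReal.ofReal |∑ j ∈ s, (16:ℝ) ^ j *
        ∫ m, fracDx a m * g (kmul z (dil ((16:ℝ) ^ j) m))| ≤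
        ∑ j ∈ s, ENNReal.ofReal ((16:ℝ) ^ j) * ∫⁻ m, ENNReal.ofReal |fracDx a m| *
          ENNReal.ofReal |g (kmul z (dil ((16:ℝ) ^ j) m))| := by
      refine (ENNReal.ofReal_le_ofReal (Finset.abs_sum_le_sum_abs _ _)).trans ?_
      rw [ENNReal.ofReal_sum_of_nonneg fun _ _ => abs_nonneg _]
      refine Finset.sum_le_sum fun j _ => ?_
      rw [abs_mul, abs_of_pos (by positivity : (0:ℝ) < 16 ^ j), ENNReal.ofReal_mul (by positivity)]
      refine mul_le_mul' le_rfl ?_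
      rw [← Real.enorm_eq_ofReal_abs]
      refine (enorm_integral_le_lintegral_enorm _).trans_eq (lintegral_congr fun m => ?_)
      rw [enorm_mul, Real.enorm_eq_ofReal_abs, Real.enorm_eq_ofReal_abs]
    refine hsum.trans ?_
    have hj : ∀ j ∈ s, ENNReal.ofReal ((16:ℝ) ^ j) * ∫⁻ m, ENNReal.ofReal |fracDx a m| *
        ENNReal.ofReal |g (kmul z (dil ((16:ℝ) ^ j) m))| ≤
        ∑' k : ℕ, ENNReal.ofReal (C * ((1 / 2) ^ k * ((8 ^ k) ^ d)⁻¹)) *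
          (ENNReal.ofReal ((16:ℝ) ^ j) * ∫⁻ m, {m : Pt d | kgauge (8 ^ k) m < ρ + 3}.indicator 1 m *
            ENNReal.ofReal |g (kmul z (dil ((16:ℝ) ^ j) m))|) := by
      intro j _
      have hgm : Measurable fun m : Pt d => ENNReal.ofReal |g (kmul z (dil ((16:ℝ) ^ j) m))| :=
        (hg.meas.comp (by fun_prop : Continuous fun m : Pt d =>
          kmul z (dil ((16:ℝ) ^ j) m)).measurable).abs.ennreal_ofReal
      have him : ∀ k : ℕ, Measurable fun m : Pt d =>
          {m : Pt d | kgauge (8 ^ k) m < ρ + 3}.indicator (1 : Pt d → ℝ≥0∞) m *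
            ENNReal.ofReal |g (kmul z (dil ((16:ℝ) ^ j) m))| := fun k =>
        (measurable_one.indicator
          (isOpen_lt (continuous_kgauge _) continuous_const).measurableSet).mul hgm
      calc _ ≤ ENNReal.ofReal ((16:ℝ) ^ j) * ∫⁻ m,
            ∑' k : ℕ, ENNReal.ofReal (C * ((1 / 2) ^ k * ((8 ^ k) ^ d)⁻¹)) *
              ({m : Pt d | kgauge (8 ^ k) m < ρ + 3}.indicator 1 m *
                ENNReal.ofReal |g (kmul z (dil ((16:ℝ) ^ j) m))|) := by
            refine mul_le_mul' le_rfl (lintegral_mono fun m => ?_)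
            refine (mul_le_mul' (hbd m) le_rfl).trans_eq ?_
            rw [← ENNReal.tsum_mul_right]
            exact tsum_congr fun k => mul_assoc _ _ _
        _ = _ := by
            rw [lintegral_tsum fun k => ((him k).const_mul _).aemeasurable, ← ENNReal.tsum_mul_left]
            refine tsum_congr fun k => ?_
            rw [lintegral_const_mul _ (him k)]
            ring
    refine (Finset.sum_le_sum hj).trans_eq ?_
    rw [← Summable.tsum_finsetSum fun _ _ => ENNReal.summable]
    refine tsum_congr fun k => ?_
    rw [← Finset.mul_sum, ballSum, ← mul_assoc (ENNReal.ofReal ((1 / 2) ^ k)),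
      ← ENNReal.ofReal_mul (by positivity)]
    congr 2
    ring
  have hk : ∀ k : ℕ, ∫⁻ z, (ENNReal.ofReal (C * ((8 ^ k) ^ d)⁻¹) *
      ballSum (8 ^ k) (ρ + 3) s g z) ^ p ≤ ENNReal.ofReal (M ^ p * (H * N)) := by
    intro k
    have h8 : (1:ℝ) ≤ 8 ^ k := one_le_pow₀ (by norm_num)
    have hkv := kvol_pos (d := d) h8
    simp_rw [ENNReal.mul_rpow_of_nonneg _ _ hp0.le]
    rw [lintegral_const_mul' _ _ (by simp [hp0.le])]
    refine (mul_le_mul' le_rfl (lintegral_ballSum_le h8 hr hq hqQ hpq hp0 s hg)).trans ?_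
    rw [← mul_assoc, ← ENNReal.mul_rpow_of_nonneg _ _ hp0.le, ← ENNReal.ofReal_mul (by positivity),
      ENNReal.ofReal_rpow_of_nonneg (by positivity) hp0.le, ← ENNReal.ofReal_mul (by positivity)]
    refine ENNReal.ofReal_le_ofReal (mul_le_mul_of_nonneg_right
      (Real.rpow_le_rpow (by positivity) ?_ hp0.le) (by positivity))
    calc C * ((8 ^ k) ^ d)⁻¹ * (kvol d (8 ^ k) * (ρ + 3) ^ (4 * d + 1))
        ≤ C * ((8 ^ k) ^ d)⁻¹ * (((8 ^ k) ^ d * v) * (ρ + 3) ^ (4 * d + 1)) := by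
          gcongr
          exact kvol_le h8
      _ = M := by rw [hM]; field_simp
  have hbm : ∀ k : ℕ, Measurable fun z => (ENNReal.ofReal (C * ((8 ^ k) ^ d)⁻¹) *
      ballSum (8 ^ k) (ρ + 3) s g z) ^ p := fun k =>
    ((measurable_ballSum _ _ s hg.meas).const_mul _).pow_const p
  calc _ ≤ ∫⁻ z, (∑' k : ℕ, ENNReal.ofReal ((1 / 2) ^ k)) ^ (p - 1) *
        ∑' k : ℕ, ENNReal.ofReal ((1 / 2) ^ k) *
          (ENNReal.ofReal (C * ((8 ^ k) ^ d)⁻¹) * ballSum (8 ^ k) (ρ + 3) s g z) ^ p :=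
        lintegral_mono fun z => (ENNReal.rpow_le_rpow (hpt z) hp0.le).trans
          (tsum_mul_rpow_le hp.le _ _)
    _ = 2 ^ (p - 1) * ∑' k : ℕ, ENNReal.ofReal ((1 / 2) ^ k) * ∫⁻ z,
          (ENNReal.ofReal (C * ((8 ^ k) ^ d)⁻¹) * ballSum (8 ^ k) (ρ + 3) s g z) ^ p := by
        rw [hw, lintegral_const_mul' _ _ (by simp),
          lintegral_tsum fun k => ((hbm k).const_mul _).aemeasurable]
        congr 1
        exact tsum_congr fun k => lintegral_const_mul _ (hbm k)
    _ ≤ 2 ^ (p - 1) * ∑' k : ℕ, ENNReal.ofReal ((1 / 2) ^ k) * ENNReal.ofReal (M ^ p * (H * N)) :=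
        mul_le_mul' le_rfl (ENNReal.tsum_le_tsum fun k => mul_le_mul' le_rfl (hk k))
    _ = _ := by
        rw [ENNReal.tsum_mul_right, hw, two_mul_ofReal, ← ENNReal.ofReal_ofNat 2,
          ENNReal.ofReal_rpow_of_pos two_pos, ← ENNReal.ofReal_mul (by positivity)]
        congr 1
        ring

end FractionalIntegration

section KineticAverages

variable {d : ℕ}

/-- The average `z ↦ ∫ a(m) g(z ∘ δ_R m) dm`. -/
def kavg (a g : Pt d → ℝ) (R : ℝ) (z : Pt d) : ℝ := ∫ m, a m * g (kmul z (dil R m))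

lemma continuous_kmul_dil (R : ℝ) :
    Continuous (fun x : Pt d × Pt d => kmul x.1 (dil R x.2)) := by
  fun_prop

lemma integrable_mul_kmul_dil {a g : Pt d → ℝ} (ha : Integrable a) (hg : BddInt volume g)
    (R : ℝ) (z : Pt d) : Integrable (fun m => a m * g (kmul z (dil R m))) := by
  obtain ⟨B, hB⟩ := hg.bdd
  refine ha.mul_bdd (c := B)
    (hg.meas.comp
      ((continuous_kmul_dil R).comp (Continuous.prodMk_right z)).measurable).aestronglyMeasurable
    (.of_forall fun m => ?_)
  exact hB _

lemma BddInt.kavg {a g : Pt d → ℝ} (hm : Measurable a) (ha : Integrable a)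
    (hg : BddInt volume g) (R : ℝ) : BddInt volume (kavg a g R) := by
  obtain ⟨B, hB⟩ := hg.bdd
  have hmeas : Measurable (fun x : Pt d × Pt d => a x.2 * g (kmul x.1 (dil R x.2))) :=
    (hm.comp measurable_snd).mul (hg.meas.comp (continuous_kmul_dil R).measurable)
  refine ⟨hmeas.stronglyMeasurable.integral_prod_right.measurable, ?_, B * ∫ m, |a m|, fun z => ?_⟩
  · have : Integrable (fun x : Pt d × Pt d => a x.2 * g (kmul x.1 (dil R x.2)))
        (volume.prod volume) := by
      refine (integrable_prod_iff' hmeas.aestronglyMeasurable).2 ⟨.of_forall fun m => ?_, ?_⟩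
      · exact ((measurePreserving_kmul_right (dil R m)).integrable_comp_of_integrable
          hg.int).const_mul (a m)
      · have e : ∀ m, ∫ z, ‖a m * g (kmul z (dil R m))‖ = |a m| * ∫ z, |g z| := by
          intro m
          simp only [norm_mul, Real.norm_eq_abs, integral_const_mul]
          congr 1
          have h := (measurePreserving_kmul_right (dil R m)).map_eq
          conv_rhs => rw [← h]
          rw [integral_map (measurePreserving_kmul_right (dil R m)).aemeasurable]
          rw [h]; exact hg.meas.abs.aestronglyMeasurable
        simp only [e]
        exact ha.abs.mul_const _
    exact this.integral_prod_left
  · rw [← integral_const_mul, ← Real.norm_eq_abs]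
    refine norm_integral_le_of_norm_le (ha.abs.const_mul _) (.of_forall fun m => ?_)
    rw [norm_mul, Real.norm_eq_abs, Real.norm_eq_abs, mul_comm B]
    exact mul_le_mul_of_nonneg_left (hB _) (abs_nonneg _)

/-- Absolute convergence of the integral defining `𝔇_x u` at the point `z`. -/
def FracAt (u : Pt d → ℝ) (z : Pt d) : Prop :=
  Integrable (fun h : V d => secDiff u h z * ‖h‖ ^ (-(d : ℝ) - 1 / 3))

lemma FracAt.add {u w : Pt d → ℝ} {z : Pt d} (hu : FracAt u z) (hw : FracAt w z) :
    FracAt (fun m => u m + w m) z ∧ fracDx (fun m => u m + w m) z = fracDx u z + fracDx w z := by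
  have e : (fun h : V d => secDiff (fun m => u m + w m) h z * ‖h‖ ^ (-(d : ℝ) - 1 / 3)) =
      fun h => secDiff u h z * ‖h‖ ^ (-(d : ℝ) - 1 / 3) +
        secDiff w h z * ‖h‖ ^ (-(d : ℝ) - 1 / 3) := by
    ext h; simp only [secDiff]; ring
  refine ⟨?_, ?_⟩
  · rw [FracAt, e]; exact Integrable.add hu hw
  · rw [fracDx_eq, e]; exact integral_add hu hw

lemma FracAt.const_mul {u : Pt d → ℝ} {z : Pt d} (hu : FracAt u z) (c : ℝ) :
    FracAt (fun m => c * u m) z ∧ fracDx (fun m => c * u m) z = c * fracDx u z := by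
  have e : (fun h : V d => secDiff (fun m => c * u m) h z * ‖h‖ ^ (-(d : ℝ) - 1 / 3)) =
      fun h => c * (secDiff u h z * ‖h‖ ^ (-(d : ℝ) - 1 / 3)) := by
    ext h; simp only [secDiff]; ring
  refine ⟨?_, ?_⟩
  · rw [FracAt, e]; exact Integrable.const_mul hu c
  · rw [fracDx_eq, e, integral_const_mul]; rfl

lemma FracAt.sub {u w : Pt d → ℝ} {z : Pt d} (hu : FracAt u z) (hw : FracAt w z) :
    FracAt (fun m => u m - w m) z ∧ fracDx (fun m => u m - w m) z = fracDx u z - fracDx w z := by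
  obtain ⟨h1, h2⟩ := hw.const_mul (-1)
  obtain ⟨h3, h4⟩ := hu.add h1
  have e : (fun m => u m - w m) = fun m => u m + -1 * w m := by ext m; ring
  rw [e]
  exact ⟨h3, by rw [h4, h2]; ring⟩

lemma FracAt.sum {ι : Type*} {u : ι → Pt d → ℝ} {z : Pt d} (s : Finset ι)
    (hu : ∀ i ∈ s, FracAt (u i) z) :
    FracAt (fun m => ∑ i ∈ s, u i m) z ∧
      fracDx (fun m => ∑ i ∈ s, u i m) z = ∑ i ∈ s, fracDx (u i) z := by
  have e : (fun h : V d => secDiff (fun m => ∑ i ∈ s, u i m) h z * ‖h‖ ^ (-(d : ℝ) - 1 / 3)) =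
      fun h => ∑ i ∈ s, secDiff (u i) h z * ‖h‖ ^ (-(d : ℝ) - 1 / 3) := by
    ext h; simp only [secDiff, ← Finset.sum_mul, Finset.sum_sub_distrib, Finset.mul_sum]
  refine ⟨?_, ?_⟩
  · rw [FracAt, e]; exact integrable_finsetSum _ hu
  · rw [fracDx_eq, e]; exact integral_finsetSum _ hu

lemma kmul_yshift (z n : Pt d) (h : V d) :
    kmul (z.1, z.2.1 + h, z.2.2) n =
      ((kmul z n).1, (kmul z n).2.1 + h, (kmul z n).2.2) := by
  simp only [kmul, Prod.mk.injEq, true_and, and_true]; abel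

lemma kmul_yshift' (z n : Pt d) (h : V d) :
    kmul (z.1, z.2.1 - h, z.2.2) n =
      ((kmul z n).1, (kmul z n).2.1 - h, (kmul z n).2.2) := by
  simpa only [sub_eq_add_neg] using kmul_yshift z n (-h)

lemma kmul_yshift_dil {R : ℝ} (hR : 0 < R) (z m : Pt d) (h : V d) :
    kmul (z.1, z.2.1 + h, z.2.2) (dil R m) =
      kmul z (dil R (m.1, m.2.1 + (R ^ 3)⁻¹ • h, m.2.2)) := by
  have : R ^ 3 ≠ 0 := (pow_pos hR 3).ne'
  simp only [kmul, dil, Prod.mk.injEq, true_and, and_true, smul_add, smul_smul,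
    mul_inv_cancel₀ this, one_smul]
  abel

lemma kavg_yshift {a g : Pt d → ℝ} {R : ℝ} (hR : 0 < R) (h : V d)
    (hm : Measurable a) (hg : BddInt volume g) (z : Pt d) :
    kavg a g R (z.1, z.2.1 + h, z.2.2) =
      ∫ m : Pt d, a (m.1, m.2.1 - (R ^ 3)⁻¹ • h, m.2.2) * g (kmul z (dil R m)) := by
  have hs := measurePreserving_yshift (d := d) ((R ^ 3)⁻¹ • h)
  have hmeas : Measurable fun m : Pt d =>
      a (m.1, m.2.1 - (R ^ 3)⁻¹ • h, m.2.2) * g (kmul z (dil R m)) :=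
    (hm.comp (measurePreserving_yshift' _).measurable).mul
      (hg.meas.comp ((continuous_kmul_dil R).comp (Continuous.prodMk_right z)).measurable)
  rw [← hs.map_eq, integral_map hs.aemeasurable hmeas.aestronglyMeasurable, kavg]
  refine integral_congr_ae (.of_forall fun m => ?_)
  simp only [add_sub_cancel_right, kmul_yshift_dil hR]

lemma secDiff_kavg {a g : Pt d → ℝ} {R : ℝ} (hR : 0 < R) (h : V d)
    (hm : Measurable a) (ha : Integrable a) (hg : BddInt volume g) (z : Pt d) :
    secDiff (kavg a g R) h z =
      ∫ m : Pt d, secDiff a ((R ^ 3)⁻¹ • h) m * g (kmul z (dil R m)) := by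
  have h1 := kavg_yshift hR h hm hg z
  have h2 := kavg_yshift hR (-h) hm hg z
  simp only [smul_neg, ← sub_eq_add_neg, sub_neg_eq_add] at h2
  have i0 := (integrable_mul_kmul_dil ha hg R z).const_mul 2
  have i1 := integrable_mul_kmul_dil
    ((measurePreserving_yshift ((R ^ 3)⁻¹ • h)).integrable_comp_of_integrable ha) hg R z
  have i2 := integrable_mul_kmul_dil
    ((measurePreserving_yshift' ((R ^ 3)⁻¹ • h)).integrable_comp_of_integrable ha) hg R z
  simp only [Function.comp_apply] at i1 i2
  rw [secDiff, h1, h2, kavg, ← integral_const_mul, ← integral_sub i0 i2]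
  refine (integral_sub (i0.sub i2) i1).symm.trans (integral_congr_ae (.of_forall fun m => ?_))
  simp only [secDiff, Pi.sub_apply]
  ring

variable {a g : Pt d → ℝ} {K B ρ : ℝ}

/-- The fractional derivative of an average is the average against the fractional derivative. -/
lemma LipBump.fracDx_kavg (ha : LipBump a K B ρ) (hd : 1 ≤ d) (hg : BddInt volume g) {R : ℝ}
    (hR : 0 < R) (z : Pt d) :
    FracAt (kavg a g R) z ∧ fracDx (kavg a g R) z = R⁻¹ * kavg (fracDx a) g R z := by
  have hR3 : 0 < R ^ 3 := pow_pos hR 3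
  obtain ⟨M, hM⟩ := hg.bdd
  have hG : Measurable fun m => g (kmul z (dil R m)) :=
    hg.meas.comp ((continuous_kmul_dil R).comp (Continuous.prodMk_right z)).measurable
  have hint : Integrable (fun x : Pt d × V d =>
      (secDiff a x.2 x.1 * ‖x.2‖ ^ (-(d : ℝ) - 1 / 3)) * g (kmul z (dil R x.1)))
      (volume.prod volume) :=
    (ha.integrable_uncurry hd).1.mul_bdd (c := M) (hG.comp measurable_fst).aestronglyMeasurable
      (.of_forall fun x => hM _)
  set Ψ : V d → ℝ := fun k => ∫ m : Pt d,
    (secDiff a k m * ‖k‖ ^ (-(d : ℝ) - 1 / 3)) * g (kmul z (dil R m)) with hΨ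
  have hΨi : Integrable Ψ := hint.integral_prod_right
  have hΨe : ∫ k, Ψ k = kavg (fracDx a) g R z := by
    have := integral_integral_swap (f := fun (m : Pt d) (k : V d) =>
      (secDiff a k m * ‖k‖ ^ (-(d : ℝ) - 1 / 3)) * g (kmul z (dil R m))) hint
    refine this.symm.trans (integral_congr_ae (.of_forall fun m => ?_))
    simp only [integral_mul_const, fracDx_eq]
  have e : (fun h : V d => secDiff (kavg a g R) h z * ‖h‖ ^ (-(d : ℝ) - 1 / 3)) =
      fun h => (R ^ 3) ^ (-(d : ℝ) - 1 / 3) * Ψ ((R ^ 3)⁻¹ • h) := by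
    ext h
    rw [secDiff_kavg hR h ha.continuous.measurable ha.integrable hg, hΨ]
    simp only [mul_right_comm _ (‖(R ^ 3)⁻¹ • h‖ ^ (-(d : ℝ) - 1 / 3)), integral_mul_const]
    have : ‖h‖ ^ (-(d : ℝ) - 1 / 3) = (R ^ 3) ^ (-(d : ℝ) - 1 / 3) *
        ‖(R ^ 3)⁻¹ • h‖ ^ (-(d : ℝ) - 1 / 3) := by
      rw [norm_smul, Real.norm_of_nonneg (inv_pos.2 hR3).le,
        Real.mul_rpow (inv_pos.2 hR3).le (norm_nonneg _), ← mul_assoc,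
        ← Real.mul_rpow hR3.le (inv_pos.2 hR3).le, mul_inv_cancel₀ hR3.ne', Real.one_rpow, one_mul]
    rw [this]; ring
  refine ⟨?_, ?_⟩
  · rw [FracAt, e]
    exact ((integrable_comp_smul_iff volume Ψ (inv_pos.2 hR3).ne').2 hΨi).const_mul _
  · rw [fracDx_eq, e, integral_const_mul, Measure.integral_comp_smul, hΨe, smul_eq_mul,
      finrank_euclideanSpace_fin, inv_pow, inv_inv, abs_of_pos (pow_pos hR3 d), ← mul_assoc,
      ← Real.rpow_natCast (R ^ 3) d, ← Real.rpow_add hR3, ← Real.rpow_natCast R 3,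
      ← Real.rpow_mul hR.le, ← Real.rpow_neg_one]
    congr 2
    push_cast; ring

lemma tendsto_kavg {φ f : Pt d → ℝ} (hφ : Integrable φ) (hφ1 : ∫ m, φ m = 1)
    (hf : BddInt volume f) (hfc : Continuous f) {R : ℕ → ℝ}
    (hR : Filter.Tendsto R Filter.atTop (nhds 0)) (z : Pt d) :
    Filter.Tendsto (fun N => kavg φ f (R N) z) Filter.atTop (nhds (f z)) := by
  obtain ⟨M, hM⟩ := hf.bdd
  have h := tendsto_integral_of_dominated_convergence (μ := (volume : Measure (Pt d)))
    (F := fun N m => φ m * f (kmul z (dil (R N) m)))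
    (f := fun m => φ m * f z) (fun m => |φ m| * M) (fun N =>
      (integrable_mul_kmul_dil hφ hf (R N) z).aestronglyMeasurable) (hφ.abs.mul_const _)
    (fun N => .of_forall fun m => ?_) (.of_forall fun m => ?_)
  · rw [integral_mul_const, hφ1, one_mul] at h
    exact h
  · rw [norm_mul, Real.norm_eq_abs, Real.norm_eq_abs]
    exact mul_le_mul_of_nonneg_left (hM _) (abs_nonneg _)
  · have hc : Continuous fun r : ℝ => φ m * f (kmul z (dil r m)) := by
      have : Continuous fun r : ℝ => kmul z (dil r m) := by unfold kmul dil; fun_prop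
      exact continuous_const.mul (hfc.comp this)
    have h0 : kmul z (dil 0 m) = z := by simp [kmul, dil]
    have := (hc.tendsto 0).comp hR
    rwa [h0] at this

lemma secDiff_kavg_right {φ f : Pt d → ℝ} (hφ : Integrable φ) (hf : BddInt volume f) (R : ℝ)
    (h : V d) (z : Pt d) :
    secDiff (kavg φ f R) h z = ∫ m, φ m * secDiff f h (kmul z (dil R m)) := by
  have i0 := (integrable_mul_kmul_dil hφ hf R z).const_mul 2
  have i1 := integrable_mul_kmul_dil hφ hf R (z.1, z.2.1 + h, z.2.2)
  have i2 := integrable_mul_kmul_dil hφ hf R (z.1, z.2.1 - h, z.2.2)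
  rw [secDiff, kavg, kavg, kavg, ← integral_const_mul, ← integral_sub i0 i1]
  refine (integral_sub (i0.sub i1) i2).symm.trans (integral_congr_ae (.of_forall fun m => ?_))
  simp only [secDiff, Pi.sub_apply, kmul_yshift, kmul_yshift']
  ring

lemma tendsto_fracDx_kavg {φ f : Pt d → ℝ} (hd : 1 ≤ d) (hm : Measurable φ) (hφ : Integrable φ)
    (hφ1 : ∫ m, φ m = 1) (hf : BddInt volume f) (hfc : Continuous f) {c : ℝ} (hc : 0 ≤ c)
    (hs : ∀ h m, |secDiff f h m| ≤ c * min 1 ‖h‖) {R : ℕ → ℝ}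
    (hR : Filter.Tendsto R Filter.atTop (nhds 0)) (z : Pt d) :
    Filter.Tendsto (fun N => fracDx (kavg φ f (R N)) z) Filter.atTop (nhds (fracDx f z)) := by
  refine tendsto_integral_of_dominated_convergence
    (fun h : V d => (∫ m, |φ m|) * c * fracWeight h) (fun N => ?_)
    ((integrable_fracWeight hd).const_mul _) (fun N => .of_forall fun h => ?_)
    (.of_forall fun h => ?_)
  · have hk : Measurable (kavg φ f (R N)) := (BddInt.kavg hm hφ hf (R N)).meas
    have : Measurable fun h : V d => secDiff (kavg φ f (R N)) h z := by
      unfold secDiff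
      exact (measurable_const.sub (hk.comp (by fun_prop))).sub (hk.comp (by fun_prop))
    exact (this.mul (measurable_norm.pow_const _)).aestronglyMeasurable
  · have hb : |secDiff (kavg φ f (R N)) h z| ≤ (∫ m, |φ m|) * c * min 1 √‖h‖ := by
      rw [secDiff_kavg_right hφ hf, mul_assoc, ← integral_mul_const, ← Real.norm_eq_abs]
      refine norm_integral_le_of_norm_le (hφ.abs.mul_const _) (.of_forall fun m => ?_)
      rw [norm_mul, Real.norm_eq_abs, Real.norm_eq_abs]
      exact mul_le_mul_of_nonneg_left ((hs _ _).trans (mul_le_mul_of_nonneg_left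
        (min_one_le_min_one_sqrt (norm_nonneg h)) hc)) (abs_nonneg _)
    change ‖secDiff (kavg φ f (R N)) h z * _‖ ≤ _
    rw [norm_mul, Real.norm_eq_abs, Real.norm_of_nonneg (by positivity), fracWeight, ← mul_assoc]
    exact mul_le_mul_of_nonneg_right hb (by positivity)
  · have t := tendsto_kavg hφ hφ1 hf hfc hR
    exact ((((t z).const_mul 2).sub (t _)).sub (t _)).mul_const _

lemma LipBump.tendsto_fracDx_kavg_atTop {φ : Pt d → ℝ} (ha : LipBump φ K B ρ) (hd : 1 ≤ d)
    (hg : BddInt volume g) {R : ℕ → ℝ} (hR0 : ∀ N, 0 < R N)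
    (hR : Filter.Tendsto R Filter.atTop Filter.atTop) (z : Pt d) :
    Filter.Tendsto (fun N => fracDx (kavg φ g (R N)) z) Filter.atTop (nhds 0) := by
  obtain ⟨M, hM⟩ := hg.bdd
  have hi : Filter.Tendsto (fun N => (R N)⁻¹ * (M * ∫ m, |fracDx φ m|)) Filter.atTop (nhds 0) := by
    simpa using (tendsto_inv_atTop_zero.comp hR).mul_const (M * ∫ m, |fracDx φ m|)
  refine squeeze_zero_norm (fun N => ?_) hi
  rw [(ha.fracDx_kavg hd hg (hR0 N) z).2, norm_mul, Real.norm_of_nonneg (inv_pos.2 (hR0 N)).le]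
  refine mul_le_mul_of_nonneg_left ?_ (inv_pos.2 (hR0 N)).le
  rw [kavg, ← integral_const_mul]
  refine norm_integral_le_of_norm_le ((ha.integrable_fracDx hd).abs.const_mul _)
    (.of_forall fun m => ?_)
  rw [norm_mul, Real.norm_eq_abs, Real.norm_eq_abs, mul_comm M]
  exact mul_le_mul_of_nonneg_left (hM _) (abs_nonneg _)

end KineticAverages

section Transport

variable {d : ℕ}

/-- The `i`-th velocity direction. -/
def wdir (i : Fin d) : Pt d := (0, 0, EuclideanSpace.single i 1)

/-- The `i`-th position direction. -/
def ydir (i : Fin d) : Pt d := (0, EuclideanSpace.single i 1, 0)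

/-- The transport field `∂_s + w·∇_y` applied to `u`. -/
def transp (u : Pt d → ℝ) (m : Pt d) : ℝ := fderiv ℝ u m (1, m.2.2, 0)

lemma map_pt (L : Pt d →L[ℝ] ℝ) (α : ℝ) (y w : V d) :
    L (α, y, w) = α * L (1, 0, 0) + ∑ i, y i * L (ydir i) + ∑ i, w i * L (wdir i) := by
  have hy := (EuclideanSpace.basisFun (Fin d) ℝ).sum_repr y
  have hw := (EuclideanSpace.basisFun (Fin d) ℝ).sum_repr w
  simp only [EuclideanSpace.basisFun_repr, EuclideanSpace.basisFun_apply] at hy hw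
  have e : (α, y, w) = α • ((1, 0, 0) : Pt d) + ∑ i, y i • ydir i + ∑ i, w i • wdir i := by
    refine Prod.ext ?_ (Prod.ext ?_ ?_)
    · simp [ydir, wdir, Prod.fst_sum]
    · simp [ydir, wdir, Prod.fst_sum, Prod.snd_sum, hy]
    · simp [ydir, wdir, Prod.snd_sum, hw]
  rw [e]
  simp only [map_add, map_sum, map_smul, smul_eq_mul]

lemma isAddHaarMeasure_pt : (volume : Measure (Pt d)).IsAddHaarMeasure := by
  have : (volume : Measure (V d × V d)).IsAddHaarMeasure :=
    Measure.prod.instIsAddHaarMeasure (volume : Measure (V d)) (volume : Measure (V d))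
  exact Measure.prod.instIsAddHaarMeasure (volume : Measure ℝ) (volume : Measure (V d × V d))

/-- Smooth functions with compact support. -/
structure TestFn (u : Pt d → ℝ) : Prop where
  smooth : ContDiff ℝ (⊤ : ℕ∞) u
  supp : HasCompactSupport u

lemma smooth_fderiv_apply {u : Pt d → ℝ} (hu : ContDiff ℝ (⊤ : ℕ∞) u) {v : Pt d → Pt d}
    (hv : ContDiff ℝ (⊤ : ℕ∞) v) : ContDiff ℝ (⊤ : ℕ∞) (fun m => fderiv ℝ u m (v m)) :=
  (hu.fderiv_right (m := (⊤ : ℕ∞)) (by simp)).clm_apply hv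

lemma smooth_transp {u : Pt d → ℝ} (hu : ContDiff ℝ (⊤ : ℕ∞) u) :
    ContDiff ℝ (⊤ : ℕ∞) (transp u) :=
  smooth_fderiv_apply hu (by fun_prop)

lemma smooth_wcoord (i : Fin d) : ContDiff ℝ (⊤ : ℕ∞) (fun m : Pt d => m.2.2 i) :=
  (EuclideanSpace.proj i : V d →L[ℝ] ℝ).contDiff.comp
    (contDiff_snd.comp contDiff_snd)

lemma smooth_ycoord (i : Fin d) : ContDiff ℝ (⊤ : ℕ∞) (fun m : Pt d => m.2.1 i) :=
  (EuclideanSpace.proj i : V d →L[ℝ] ℝ).contDiff.comp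
    (contDiff_fst.comp contDiff_snd)

namespace TestFn

variable {u w : Pt d → ℝ}

lemma fderiv_apply (hu : TestFn u) {v : Pt d → Pt d} (hv : ContDiff ℝ (⊤ : ℕ∞) v) :
    TestFn (fun m => fderiv ℝ u m (v m)) :=
  ⟨smooth_fderiv_apply hu.smooth hv,
    (hu.supp.fderiv (𝕜 := ℝ)).mono fun m hm h0 => hm (by simp [h0])⟩

lemma transp (hu : TestFn u) : TestFn (transp u) := hu.fderiv_apply (by fun_prop)

lemma dir (hu : TestFn u) (v : Pt d) : TestFn (fun m => fderiv ℝ u m v) :=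
  hu.fderiv_apply contDiff_const

lemma mul (hu : TestFn u) (hw : ContDiff ℝ (⊤ : ℕ∞) w) : TestFn (fun m => u m * w m) :=
  ⟨hu.smooth.mul hw, hu.supp.mul_right⟩

lemma add (hu : TestFn u) (hw : TestFn w) : TestFn (fun m => u m + w m) :=
  ⟨hu.smooth.add hw.smooth, hu.supp.add hw.supp⟩

lemma sub (hu : TestFn u) (hw : TestFn w) : TestFn (fun m => u m - w m) :=
  ⟨hu.smooth.sub hw.smooth, hu.supp.sub hw.supp⟩

lemma zero : TestFn (fun _ : Pt d => (0 : ℝ)) :=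
  ⟨contDiff_const, HasCompactSupport.zero⟩

lemma sum {ι : Type*} {f : ι → Pt d → ℝ} (s : Finset ι) (h : ∀ i, TestFn (f i)) :
    TestFn (fun m => ∑ i ∈ s, f i m) := by
  classical
  induction s using Finset.induction_on with
  | empty => simpa using TestFn.zero
  | insert i s hi ih => simpa only [Finset.sum_insert hi] using (h i).add ih

lemma integrable (hu : TestFn u) : Integrable u :=
  hu.smooth.continuous.integrable_of_hasCompactSupport hu.supp

lemma integrable_mul (hu : TestFn u) (hw : ContDiff ℝ (⊤ : ℕ∞) w) :
    Integrable (fun m => u m * w m) := (hu.mul hw).integrable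

/-- Integration by parts in a fixed direction. -/
lemma integral_mul_dir (hu : TestFn u) (hw : ContDiff ℝ (⊤ : ℕ∞) w) (v : Pt d) :
    ∫ m, u m * fderiv ℝ w m v = -∫ m, fderiv ℝ u m v * w m :=
  have := isAddHaarMeasure_pt (d := d)
  integral_mul_fderiv_eq_neg_fderiv_mul_of_integrable ((hu.dir v).integrable_mul hw)
    (hu.integrable_mul (smooth_fderiv_apply hw contDiff_const)) (hu.integrable_mul hw)
    (fun _ _ => hu.smooth.differentiable (by simp) _) (fun _ _ => hw.differentiable (by simp) _)

lemma transp_eq (u : Pt d → ℝ) (m : Pt d) :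
    _root_.transp u m = fderiv ℝ u m (1, 0, 0) + ∑ i, m.2.2 i * fderiv ℝ u m (ydir i) := by
  rw [_root_.transp, map_pt]; simp

lemma fderiv_mul_wcoord (hu : TestFn u) (i : Fin d) (m : Pt d) :
    fderiv ℝ (fun m => u m * m.2.2 i) m (ydir i) = fderiv ℝ u m (ydir i) * m.2.2 i := by
  have h1 := (hu.smooth.differentiable (by simp) m).hasFDerivAt
  have h2 := ((EuclideanSpace.proj i : V d →L[ℝ] ℝ).comp
    ((ContinuousLinearMap.snd ℝ (V d) (V d)).comp
      (ContinuousLinearMap.snd ℝ ℝ (V d × V d)))).hasFDerivAt (x := m)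
  have h3 := (h1.mul h2).fderiv
  change fderiv ℝ (fun m => u m * m.2.2 i) m = _ at h3
  rw [h3]
  simp [ydir, mul_comm]

/-- Integration by parts for the transport field. -/
lemma integral_mul_transp (hu : TestFn u) (hw : ContDiff ℝ (⊤ : ℕ∞) w) :
    ∫ m, u m * _root_.transp w m = -∫ m, _root_.transp u m * w m := by
  have hD : ∀ v, ContDiff ℝ (⊤ : ℕ∞) (fun m => fderiv ℝ w m v) := fun v =>
    smooth_fderiv_apply hw contDiff_const
  have e1 : ∀ m, u m * _root_.transp w m = u m * fderiv ℝ w m (1, 0, 0) +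
      ∑ i, u m * m.2.2 i * fderiv ℝ w m (ydir i) := by
    intro m; rw [transp_eq, mul_add, Finset.mul_sum]; simp only [mul_assoc]
  have e2 : ∀ m, _root_.transp u m * w m = fderiv ℝ u m (1, 0, 0) * w m +
      ∑ i, fderiv ℝ u m (ydir i) * m.2.2 i * w m := by
    intro m; rw [transp_eq, add_mul, Finset.sum_mul]
    congr 1; refine Finset.sum_congr rfl fun i _ => ?_; ring
  simp only [e1, e2]
  rw [integral_add (hu.integrable_mul (hD _))
      (integrable_finsetSum _ fun i _ => (hu.mul (smooth_wcoord i)).integrable_mul (hD _)),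
    integral_add ((hu.dir _).integrable_mul hw)
      (integrable_finsetSum _ fun i _ => ((hu.dir _).mul (smooth_wcoord i)).integrable_mul hw),
    integral_finsetSum _ fun i _ => (hu.mul (smooth_wcoord i)).integrable_mul (hD _),
    integral_finsetSum _ fun i _ => ((hu.dir _).mul (smooth_wcoord i)).integrable_mul hw,
    hu.integral_mul_dir hw, neg_add, ← Finset.sum_neg_distrib]
  congr 1
  refine Finset.sum_congr rfl fun i _ => ?_
  rw [(hu.mul (smooth_wcoord i)).integral_mul_dir hw]
  simp only [hu.fderiv_mul_wcoord]

end TestFn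

/-- The commutator of a velocity derivative with transport is a position derivative. -/
lemma commutator_wdir_transp {F : Pt d → ℝ} (hF : ContDiff ℝ (⊤ : ℕ∞) F) (i : Fin d) (m : Pt d) :
    fderiv ℝ (transp F) m (wdir i) - transp (fun n => fderiv ℝ F n (wdir i)) m =
      fderiv ℝ F m (ydir i) := by
  have hD : ContDiff ℝ (⊤ : ℕ∞) (fderiv ℝ F) := hF.fderiv_right (m := (⊤ : ℕ∞)) (by simp)
  have h1 := (hD.differentiable (by simp) m).hasFDerivAt
  set A : Pt d →L[ℝ] Pt d := (ContinuousLinearMap.inr ℝ ℝ (V d × V d)).comp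
    ((ContinuousLinearMap.inl ℝ (V d) (V d)).comp ((ContinuousLinearMap.snd ℝ (V d) (V d)).comp
      (ContinuousLinearMap.snd ℝ ℝ (V d × V d)))) with hA
  have h2 : HasFDerivAt (fun n : Pt d => ((1, n.2.2, 0) : Pt d)) A m := by
    have := (A.hasFDerivAt (x := m)).const_add ((1, 0, 0) : Pt d)
    refine this.congr_of_eventuallyEq (.of_forall fun n => ?_)
    simp [hA]
  have h3 : fderiv ℝ (transp F) m = _ := (h1.clm_apply h2).fderiv
  have h4 : fderiv ℝ (fun n => fderiv ℝ F n (wdir i)) m = _ :=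
    (h1.clm_apply (hasFDerivAt_const (wdir i) m)).fderiv
  have hs : IsSymmSndFDerivAt ℝ F m := hF.contDiffAt.isSymmSndFDerivAt
    (by simp only [minSmoothness_of_isRCLikeNormedField]; exact WithTop.coe_le_coe.2 le_top)
  have hs' := hs.eq (wdir i) (1, m.2.2, 0)
  rw [transp, h3, h4]
  simp only [_root_.add_apply, ContinuousLinearMap.comp_apply,
    ContinuousLinearMap.flip_apply, hs', _root_.zero_apply, map_zero, zero_add]
  simp [hA, wdir, ydir]

/-- The coefficient `3y_i - 2s w_i`. -/
def ccoef (i : Fin d) (m : Pt d) : ℝ := 3 * m.2.1 i - 2 * m.1 * m.2.2 i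

lemma smooth_ccoef (i : Fin d) : ContDiff ℝ (⊤ : ℕ∞) (ccoef i) :=
  (contDiff_const.mul (smooth_ycoord i)).sub ((contDiff_const.mul contDiff_fst).mul
    (smooth_wcoord i))

/-- The kernel paired with velocity derivatives. -/
def gradKer (φ : Pt d → ℝ) (i : Fin d) (m : Pt d) : ℝ :=
  φ m * m.2.2 i + transp (fun n => φ n * ccoef i n) m

/-- The kernel paired with the transport derivative. -/
def transpKer (φ : Pt d → ℝ) (m : Pt d) : ℝ :=
  φ m * (2 * m.1) - ∑ i, fderiv ℝ (fun n => φ n * ccoef i n) m (wdir i)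

variable {φ F : Pt d → ℝ}

lemma TestFn.gradKer (hφ : TestFn φ) (i : Fin d) : TestFn (gradKer φ i) :=
  (hφ.mul (smooth_wcoord i)).add (hφ.mul (smooth_ccoef i)).transp

lemma TestFn.transpKer (hφ : TestFn φ) : TestFn (transpKer φ) :=
  (hφ.mul (contDiff_const.mul contDiff_fst)).sub
    (TestFn.sum _ fun i => (hφ.mul (smooth_ccoef i)).dir _)

lemma fderiv_euler (hF : ContDiff ℝ (⊤ : ℕ∞) F) (m : Pt d) :
    fderiv ℝ F m (2 * m.1, (3 : ℝ) • m.2.1, m.2.2) = 2 * m.1 * transp F m +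
      ∑ i, m.2.2 i * fderiv ℝ F m (wdir i) +
      ∑ i, ccoef i m * (fderiv ℝ (transp F) m (wdir i) -
        transp (fun n => fderiv ℝ F n (wdir i)) m) := by
  simp only [commutator_wdir_transp hF]
  simp only [TestFn.transp_eq, ccoef, sub_mul, Finset.sum_sub_distrib]
  rw [map_pt]
  simp only [PiLp.smul_apply, smul_eq_mul, mul_add, Finset.mul_sum, mul_assoc]
  ring

/-- Hörmander-type representation of the dilation generator. -/
lemma TestFn.integral_mul_euler (hφ : TestFn φ) (hF : ContDiff ℝ (⊤ : ℕ∞) F) :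
    ∫ m, φ m * fderiv ℝ F m (2 * m.1, (3 : ℝ) • m.2.1, m.2.2) =
      (∑ i, ∫ m, _root_.gradKer φ i m * fderiv ℝ F m (wdir i)) +
        ∫ m, _root_.transpKer φ m * _root_.transp F m := by
  have hW : ∀ i : Fin d, ContDiff ℝ (⊤ : ℕ∞) (fun m => fderiv ℝ F m (wdir i)) := fun i =>
    smooth_fderiv_apply hF contDiff_const
  have hX := smooth_transp hF
  have hc := fun i : Fin d => hφ.mul (smooth_ccoef i)
  have h2 : TestFn fun m => φ m * (2 * m.1) := hφ.mul (contDiff_const.mul contDiff_fst)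
  have hw := fun i : Fin d => hφ.mul (smooth_wcoord i)
  have hXW := fun i : Fin d => smooth_transp (hW i)
  have hWX : ∀ i : Fin d, ContDiff ℝ (⊤ : ℕ∞) (fun m => fderiv ℝ (_root_.transp F) m (wdir i)) :=
    fun i => smooth_fderiv_apply hX contDiff_const
  have e : ∀ m, φ m * fderiv ℝ F m (2 * m.1, (3 : ℝ) • m.2.1, m.2.2) =
      φ m * (2 * m.1) * _root_.transp F m + ∑ i, (φ m * m.2.2 i * fderiv ℝ F m (wdir i) +
        (φ m * ccoef i m * fderiv ℝ (_root_.transp F) m (wdir i) -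
        φ m * ccoef i m * _root_.transp (fun n => fderiv ℝ F n (wdir i)) m)) := by
    intro m
    rw [fderiv_euler hF, mul_add, mul_add, Finset.mul_sum, Finset.mul_sum, add_assoc,
      ← Finset.sum_add_distrib]
    congr 1
    · ring
    · refine Finset.sum_congr rfl fun i _ => ?_; ring
  have i1 := h2.integrable_mul hX
  have i2 := fun i => (hw i).integrable_mul (hW i)
  have i3 := fun i => (hc i).integrable_mul (hWX i)
  have i4 := fun i => (hc i).integrable_mul (hXW i)
  have i5 := fun i => ((hc i).dir (wdir i)).integrable_mul hX
  have i6 := fun i => ((hc i).transp).integrable_mul (hW i)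
  have eL : ∫ m, φ m * fderiv ℝ F m (2 * m.1, (3 : ℝ) • m.2.1, m.2.2) =
      (∫ m, φ m * (2 * m.1) * _root_.transp F m) +
      ∑ i, ((∫ m, φ m * m.2.2 i * fderiv ℝ F m (wdir i)) +
        (-(∫ m, fderiv ℝ (fun n => φ n * ccoef i n) m (wdir i) * _root_.transp F m) +
        ∫ m, _root_.transp (fun n => φ n * ccoef i n) m * fderiv ℝ F m (wdir i))) := by
    simp only [e]
    refine (integral_add i1
      (integrable_finsetSum _ fun i _ => (i2 i).add ((i3 i).sub (i4 i)))).trans ?_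
    congr 1
    refine (integral_finsetSum _ fun i _ => (i2 i).add ((i3 i).sub (i4 i))).trans ?_
    refine Finset.sum_congr rfl fun i _ => ?_
    refine (integral_add (i2 i) ((i3 i).sub (i4 i))).trans ?_
    congr 1
    refine (integral_sub (i3 i) (i4 i)).trans ?_
    rw [(hc i).integral_mul_dir hX, (hc i).integral_mul_transp (hW i)]
    ring
  have eG : ∀ i, ∫ m, _root_.gradKer φ i m * fderiv ℝ F m (wdir i) =
      (∫ m, φ m * m.2.2 i * fderiv ℝ F m (wdir i)) +
      ∫ m, _root_.transp (fun n => φ n * ccoef i n) m * fderiv ℝ F m (wdir i) := by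
    intro i
    simp only [_root_.gradKer, add_mul]
    exact integral_add (i2 i) (i6 i)
  have eT : ∫ m, _root_.transpKer φ m * _root_.transp F m =
      (∫ m, φ m * (2 * m.1) * _root_.transp F m) -
      ∑ i, ∫ m, fderiv ℝ (fun n => φ n * ccoef i n) m (wdir i) * _root_.transp F m := by
    simp only [_root_.transpKer, sub_mul, Finset.sum_mul]
    rw [integral_sub i1 (integrable_finsetSum _ fun i _ => i5 i),
      integral_finsetSum _ fun i _ => i5 i]
  rw [eL, eT]
  simp only [eG, Finset.sum_add_distrib, Finset.sum_neg_distrib]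
  ring

lemma TestFn.exists_lipBump {u : Pt d → ℝ} (hu : TestFn u) : ∃ K B ρ, LipBump u K B ρ := by
  obtain ⟨K, hK⟩ := hu.smooth.lipschitzWith_of_hasCompactSupport hu.supp (by simp)
  obtain ⟨B, hB⟩ := hu.smooth.continuous.bounded_above_of_compact_support hu.supp
  obtain ⟨ρ, hρ⟩ := hu.supp.isCompact.isBounded.subset_closedBall 0
  refine ⟨K, B, max ρ 0, K.2, le_max_right _ _, fun m n => ?_, hB, fun m hm => ?_⟩
  · simpa only [dist_eq_norm, Real.norm_eq_abs] using hK.dist_le_mul m n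
  · have := hρ (subset_tsupport _ hm)
    rw [mem_closedBall_zero_iff] at this
    exact this.trans (le_max_left _ _)

end Transport

section AveragedKernels

variable {d : ℕ} {a g : Pt d → ℝ} {K B ρ : ℝ}

lemma norm_dil_inv_sub_le {r : ℝ} (hr : 1 ≤ r) (m n : Pt d) :
    ‖dil r⁻¹ m - dil r⁻¹ n‖ ≤ ‖m - n‖ := by
  have h0 : 0 ≤ r⁻¹ := by positivity
  have h1 : r⁻¹ ≤ 1 := inv_le_one_of_one_le₀ hr
  have hk : ∀ k : ℕ, 0 ≤ r⁻¹ ^ k ∧ r⁻¹ ^ k ≤ 1 := fun k => ⟨by positivity, pow_le_one₀ h0 h1⟩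
  simp only [dil, Prod.norm_def, Prod.fst_sub, Prod.snd_sub, ← mul_sub, ← smul_sub, norm_smul,
    norm_mul, norm_pow, Real.norm_of_nonneg h0]
  refine max_le_max ?_ (max_le_max ?_ ?_)
  · exact mul_le_of_le_one_left (norm_nonneg _) (hk 2).2
  · exact mul_le_of_le_one_left (norm_nonneg _) (hk 3).2
  · exact mul_le_of_le_one_left (norm_nonneg _) h1

lemma norm_dil_le {r : ℝ} (hr : 1 ≤ r) (m : Pt d) : ‖dil r m‖ ≤ r ^ 3 * ‖m‖ := by
  have h0 : 0 ≤ r := by linarith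
  simp only [dil, Prod.norm_def, norm_smul, norm_mul, norm_pow, Real.norm_of_nonneg h0,
    mul_max_of_nonneg _ _ (pow_nonneg h0 3)]
  refine max_le_max ?_ (max_le_max le_rfl ?_)
  · exact mul_le_mul_of_nonneg_right (pow_le_pow_right₀ hr (by norm_num)) (norm_nonneg _)
  · exact mul_le_mul_of_nonneg_right (le_self_pow₀ hr (by norm_num)) (norm_nonneg _)

/-- The superposition `∫₁¹⁶ c(r) a(δ_{1/r} m) dr` of dilated kernels. -/
def avgKer (c : ℝ → ℝ) (a : Pt d → ℝ) (m : Pt d) : ℝ :=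
  ∫ r in Set.Ioc (1 : ℝ) 16, c r * a (dil r⁻¹ m)

lemma measurable_dil_inv : Measurable (fun x : ℝ × Pt d => dil x.1⁻¹ x.2) := by
  have : Continuous (fun x : ℝ × Pt d => dil x.1 x.2) := by unfold dil; fun_prop
  exact this.measurable.comp (measurable_fst.inv.prodMk measurable_snd)

variable {c : ℝ → ℝ}

lemma LipBump.integrableOn_dil_inv (ha : LipBump a K B ρ) (hc : Measurable c)
    (hc1 : ∀ r ∈ Set.Ioc (1 : ℝ) 16, |c r| ≤ 1) (m : Pt d) :
    IntegrableOn (fun r => c r * a (dil r⁻¹ m)) (Set.Ioc (1 : ℝ) 16) := by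
  refine Measure.integrableOn_of_bounded (M := B) (by simp)
    (hc.mul (ha.continuous.measurable.comp
      (measurable_dil_inv.comp measurable_prodMk_right))).aestronglyMeasurable ?_
  refine (ae_restrict_iff' measurableSet_Ioc).2 (.of_forall fun r hr => ?_)
  rw [norm_mul, Real.norm_eq_abs, Real.norm_eq_abs]
  simpa using mul_le_mul (hc1 r hr) (ha.bdd _) (abs_nonneg _) zero_le_one

lemma LipBump.avgKer (ha : LipBump a K B ρ) (hc : Measurable c)
    (hc1 : ∀ r ∈ Set.Ioc (1 : ℝ) 16, |c r| ≤ 1) :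
    LipBump (avgKer c a) (15 * K) (15 * B) (16 ^ 3 * ρ) := by
  have hK := ha.K_nonneg
  have hv : (volume : Measure ℝ).real (Set.Ioc (1 : ℝ) 16) = 15 := by simp; norm_num
  have hlt : (volume : Measure ℝ) (Set.Ioc (1 : ℝ) 16) < ∞ := by simp
  refine ⟨by positivity, mul_nonneg (by norm_num) ha.ρ_nonneg, fun m n => ?_, fun m => ?_,
    fun m hm => ?_⟩
  · rw [_root_.avgKer, _root_.avgKer,
      ← integral_sub (ha.integrableOn_dil_inv hc hc1 m) (ha.integrableOn_dil_inv hc hc1 n)]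
    have e : 15 * K * ‖m - n‖ = K * ‖m - n‖ * (volume : Measure ℝ).real (Set.Ioc (1 : ℝ) 16) := by
      rw [hv]; ring
    rw [e, ← Real.norm_eq_abs]
    refine norm_setIntegral_le_of_norm_le_const hlt fun r hr => ?_
    rw [← mul_sub, norm_mul, Real.norm_eq_abs, Real.norm_eq_abs]
    have := mul_le_mul (hc1 r hr) ((ha.lip (dil r⁻¹ m) (dil r⁻¹ n)).trans
      (mul_le_mul_of_nonneg_left (norm_dil_inv_sub_le hr.1.le m n) hK)) (abs_nonneg _) zero_le_one
    rwa [one_mul] at this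
  · rw [_root_.avgKer, show 15 * B = B * (volume : Measure ℝ).real (Set.Ioc (1 : ℝ) 16) by
      rw [hv]; ring, ← Real.norm_eq_abs]
    refine norm_setIntegral_le_of_norm_le_const hlt fun r hr => ?_
    rw [norm_mul, Real.norm_eq_abs, Real.norm_eq_abs]
    simpa using mul_le_mul (hc1 r hr) (ha.bdd _) (abs_nonneg _) zero_le_one
  · by_contra hcon
    refine hm (setIntegral_eq_zero_of_forall_eq_zero fun r hr => ?_)
    have hr0 : 0 < r := by linarith [hr.1]
    by_contra h0
    have h1 := ha.supp (dil r⁻¹ m) (fun h => h0 (by rw [h, mul_zero]))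
    have h2 := norm_dil_le hr.1.le (dil r⁻¹ m)
    rw [dil_dil, mul_inv_cancel₀ hr0.ne', dil_one] at h2
    refine hcon (h2.trans (mul_le_mul ?_ h1 (norm_nonneg _) (by norm_num)))
    exact pow_le_pow_left₀ hr0.le hr.2 3

lemma mul_kavg_mul {r : ℝ} (hr : 0 < r) (R : ℝ) (z : Pt d) :
    r ^ (4 * d + 2) * kavg a g (R * r) z = ∫ m, a (dil r⁻¹ m) * g (kmul z (dil R m)) := by
  have h := integral_comp_dil hr (fun m => a (dil r⁻¹ m) * g (kmul z (dil R m)))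
  simp only [dil_inv_dil hr, dil_dil] at h
  rw [kavg, h, mul_inv_cancel_left₀ (pow_pos hr _).ne']

/-- Superposing averages at comparable scales amounts to averaging the kernel. -/
lemma LipBump.integral_mul_kavg (ha : LipBump a K B ρ) (hc : Measurable c)
    (hc1 : ∀ r ∈ Set.Ioc (1 : ℝ) 16, |c r| ≤ 1) (hg : BddInt volume g) (R : ℝ) (z : Pt d) :
    ∫ r in Set.Ioc (1 : ℝ) 16, c r * (r ^ (4 * d + 2) * kavg a g (R * r) z) =
      kavg (_root_.avgKer c a) g R z := by
  obtain ⟨M, hM⟩ := hg.bdd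
  have hG : Measurable fun m => g (kmul z (dil R m)) :=
    hg.meas.comp ((continuous_kmul_dil R).comp (Continuous.prodMk_right z)).measurable
  have hmeas : Measurable (fun x : ℝ × Pt d =>
      c x.1 * a (dil x.1⁻¹ x.2) * g (kmul z (dil R x.2))) :=
    ((hc.comp measurable_fst).mul (ha.continuous.measurable.comp measurable_dil_inv)).mul
      (hG.comp measurable_snd)
  have hint : Integrable (fun x : ℝ × Pt d =>
      c x.1 * a (dil x.1⁻¹ x.2) * g (kmul z (dil R x.2)))
      ((volume.restrict (Set.Ioc (1 : ℝ) 16)).prod volume) := by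
    have h1 : Integrable (fun _ : ℝ => (1 : ℝ)) (volume.restrict (Set.Ioc (1 : ℝ) 16)) := by
      simp
    have h2 : Integrable ((Metric.closedBall (0 : Pt d) (16 ^ 3 * ρ)).indicator
        fun _ => B * M) := by
      refine IntegrableOn.integrable_indicator ?_ measurableSet_closedBall
      exact integrableOn_const measure_closedBall_lt_top.ne
    refine (h1.mul_prod h2).mono' hmeas.aestronglyMeasurable ?_
    have hae : ∀ᵐ x ∂((volume.restrict (Set.Ioc (1 : ℝ) 16)).prod (volume : Measure (Pt d))),
        x.1 ∈ Set.Ioc (1 : ℝ) 16 :=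
      Measure.quasiMeasurePreserving_fst.ae (ae_restrict_mem measurableSet_Ioc)
    filter_upwards [hae] with x hx
    have hr0 : 0 < x.1 := by linarith [hx.1]
    by_cases h0 : a (dil x.1⁻¹ x.2) = 0
    · rw [h0, mul_zero, zero_mul, norm_zero, one_mul]
      refine Set.indicator_nonneg (fun _ _ => ?_) _
      exact mul_nonneg ha.B_nonneg ((abs_nonneg _).trans (hM 0))
    · have h1 := ha.supp _ h0
      have h2 := norm_dil_le hx.1.le (dil x.1⁻¹ x.2)
      rw [dil_dil, mul_inv_cancel₀ hr0.ne', dil_one] at h2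
      have h3 : x.2 ∈ Metric.closedBall (0 : Pt d) (16 ^ 3 * ρ) := by
        rw [mem_closedBall_zero_iff]
        exact h2.trans (mul_le_mul (pow_le_pow_left₀ hr0.le hx.2 3) h1 (norm_nonneg _)
          (by norm_num))
      rw [Set.indicator_of_mem h3, one_mul, norm_mul, norm_mul, Real.norm_eq_abs,
        Real.norm_eq_abs, Real.norm_eq_abs]
      refine mul_le_mul ?_ (hM _) (abs_nonneg _) ha.B_nonneg
      simpa using mul_le_mul (hc1 _ hx) (ha.bdd _) (abs_nonneg _) zero_le_one
  have hswap := integral_integral_swap (f := fun (r : ℝ) (m : Pt d) =>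
    c r * a (dil r⁻¹ m) * g (kmul z (dil R m))) hint
  refine (setIntegral_congr_fun measurableSet_Ioc fun r hr => ?_).trans (hswap.trans ?_)
  · have hr0 : 0 < r := by linarith [hr.1]
    simp only [mul_kavg_mul hr0, mul_assoc, integral_const_mul]
  · refine integral_congr_ae (.of_forall fun m => ?_)
    simp only [integral_mul_const, _root_.avgKer]

end AveragedKernels

section Representation

variable {d : ℕ} {φ f : Pt d → ℝ}

lemma hasDerivAt_kmul_dil (z m : Pt d) (r : ℝ) :
    HasDerivAt (fun r => kmul z (dil r m)) (2 * r * m.1,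
      (3 * r ^ 2) • m.2.1 + (2 * r * m.1) • z.2.2, m.2.2) r := by
  have h2 : HasDerivAt (fun r : ℝ => r ^ 2 * m.1) (2 * r * m.1) r := by
    simpa using (hasDerivAt_pow 2 r).mul_const m.1
  have h3 : HasDerivAt (fun r : ℝ => r ^ 3 • m.2.1) ((3 * r ^ 2) • m.2.1) r := by
    simpa using (hasDerivAt_pow 3 r).smul_const m.2.1
  have h1 : HasDerivAt (fun r : ℝ => r • m.2.2) m.2.2 r := by
    simpa using (hasDerivAt_id r).smul_const m.2.2
  have e2 := (h3.const_add z.2.1).add (h2.smul_const z.2.2)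
  exact (h2.const_add z.1).prodMk (e2.prodMk (h1.const_add z.2.2))

/-- The linear part of `m ↦ z ∘ δ_r m`. -/
lemma fderiv_comp_kmul_dil (hf : Differentiable ℝ f) (r : ℝ) (z m u : Pt d) :
    fderiv ℝ (fun m => f (kmul z (dil r m))) m u = fderiv ℝ f (kmul z (dil r m))
      (r ^ 2 * u.1, r ^ 3 • u.2.1 + (r ^ 2 * u.1) • z.2.2, r • u.2.2) := by
  have hd : Differentiable ℝ (fun m => kmul z (dil r m)) := by
    unfold kmul dil; fun_prop
  have h1 : HasDerivAt (fun t : ℝ => kmul z (dil r (m + t • u)))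
      (r ^ 2 * u.1, r ^ 3 • u.2.1 + (r ^ 2 * u.1) • z.2.2, r • u.2.2) 0 := by
    have e : (fun t : ℝ => kmul z (dil r (m + t • u))) = fun t : ℝ => kmul z (dil r m) +
        t • ((r ^ 2 * u.1, r ^ 3 • u.2.1 + (r ^ 2 * u.1) • z.2.2, r • u.2.2) : Pt d) := by
      ext1 t
      simp only [kmul, dil, Prod.fst_add, Prod.snd_add, Prod.smul_fst, Prod.smul_snd, Prod.mk_add_mk,
        Prod.smul_mk, smul_eq_mul, Prod.mk.injEq]
      refine ⟨by ring, by module, by module⟩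
    have e' : ∀ p w : Pt d, HasDerivAt (fun t : ℝ => p + t • w) w 0 := fun p w => by
      simpa using ((hasDerivAt_id (0 : ℝ)).smul_const w).const_add p
    rw [e]
    exact e' _ _
  have h2 : HasDerivAt (fun t : ℝ => kmul z (dil r (m + t • u)))
      (fderiv ℝ (fun m => kmul z (dil r m)) m u) 0 := by
    have h3 : HasDerivAt (fun t : ℝ => m + t • u) u 0 := by
      simpa using ((hasDerivAt_id (0 : ℝ)).smul_const u).const_add m
    have h4 : HasFDerivAt (fun m => kmul z (dil r m)) (fderiv ℝ (fun m => kmul z (dil r m)) m)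
        (m + (0 : ℝ) • u) := by simpa using (hd m).hasFDerivAt
    exact h4.comp_hasDerivAt 0 h3
  have h5 := fderiv_comp (𝕜 := ℝ) m (g := f) (f := fun m => kmul z (dil r m)) (hf _) (hd m)
  change fderiv ℝ (f ∘ fun m => kmul z (dil r m)) m u = _
  rw [h5, ContinuousLinearMap.comp_apply, h2.unique h1]

lemma smooth_comp_kmul_dil (hf : ContDiff ℝ (⊤ : ℕ∞) f) (r : ℝ) (z : Pt d) :
    ContDiff ℝ (⊤ : ℕ∞) (fun m => f (kmul z (dil r m))) := by
  refine hf.comp ?_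
  unfold kmul dil; fun_prop

lemma fderiv_wdir_comp_kmul_dil (hf : Differentiable ℝ f) (r : ℝ) (z m : Pt d) (i : Fin d) :
    fderiv ℝ (fun m => f (kmul z (dil r m))) m (wdir i) =
      r * fderiv ℝ f (kmul z (dil r m)) (wdir i) := by
  rw [fderiv_comp_kmul_dil hf, show ∀ w, r * fderiv ℝ f (kmul z (dil r m)) w =
    fderiv ℝ f (kmul z (dil r m)) (r • w) from fun w => by rw [map_smul, smul_eq_mul]]
  simp [wdir]

lemma transp_comp_kmul_dil (hf : Differentiable ℝ f) (r : ℝ) (z m : Pt d) :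
    transp (fun m => f (kmul z (dil r m))) m = r ^ 2 * transp f (kmul z (dil r m)) := by
  rw [transp, transp, fderiv_comp_kmul_dil hf, show ∀ w, r ^ 2 * fderiv ℝ f (kmul z (dil r m)) w =
    fderiv ℝ f (kmul z (dil r m)) (r ^ 2 • w) from fun w => by rw [map_smul, smul_eq_mul]]
  congr 1
  simp only [kmul, dil, Prod.smul_mk, smul_eq_mul, mul_one, smul_zero, Prod.mk.injEq, true_and,
    and_true]
  module

lemma fderiv_euler_comp_kmul_dil (hf : Differentiable ℝ f) (r : ℝ) (z m : Pt d) :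
    fderiv ℝ (fun m => f (kmul z (dil r m))) m (2 * m.1, (3 : ℝ) • m.2.1, m.2.2) =
      r * fderiv ℝ f (kmul z (dil r m)) (2 * r * m.1,
        (3 * r ^ 2) • m.2.1 + (2 * r * m.1) • z.2.2, m.2.2) := by
  rw [fderiv_comp_kmul_dil hf, show ∀ w, r * fderiv ℝ f (kmul z (dil r m)) w =
    fderiv ℝ f (kmul z (dil r m)) (r • w) from fun w => by rw [map_smul, smul_eq_mul]]
  congr 1
  simp only [Prod.smul_mk, smul_eq_mul, Prod.mk.injEq, and_true]
  refine ⟨by ring, by module⟩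

/-- Differentiation of averages in the scale. -/
lemma TestFn.hasDerivAt_kavg (hφ : TestFn φ) (hf : ContDiff ℝ (⊤ : ℕ∞) f) {L : ℝ}
    (hL : ∀ m, ‖fderiv ℝ f m‖ ≤ L) (z : Pt d) (r : ℝ) :
    HasDerivAt (fun r => kavg φ f r z) (∫ m, φ m * fderiv ℝ f (kmul z (dil r m)) (2 * r * m.1,
      (3 * r ^ 2) • m.2.1 + (2 * r * m.1) • z.2.2, m.2.2)) r := by
  have hL0 : 0 ≤ L := (norm_nonneg _).trans (hL 0)
  have hfd : Continuous (fderiv ℝ f) := hf.continuous_fderiv (by simp)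
  set c : ℝ := |r| + 1 with hc
  have hc0 : 0 ≤ c := by positivity
  have hF : ∀ x : ℝ, Continuous fun m => φ m * f (kmul z (dil x m)) := fun x =>
    hφ.smooth.continuous.mul (smooth_comp_kmul_dil hf x z).continuous
  refine (hasDerivAt_integral_of_dominated_loc_of_deriv_le (μ := (volume : Measure (Pt d)))
    (F := fun x m => φ m * f (kmul z (dil x m)))
    (F' := fun x m => φ m * fderiv ℝ f (kmul z (dil x m)) (2 * x * m.1,
      (3 * x ^ 2) • m.2.1 + (2 * x * m.1) • z.2.2, m.2.2))
    (bound := fun m => |φ m| * (L * ((2 * c + 3 * c ^ 2 + 2 * c * ‖z‖ + 1) * ‖m‖)))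
    (s := Metric.ball r 1) (Metric.ball_mem_nhds r one_pos)
    (.of_forall fun x => (hF x).aestronglyMeasurable) ?_ ?_ (.of_forall fun m x hx => ?_) ?_
    (.of_forall fun m x hx => ?_)).2
  · exact hφ.integrable_mul (smooth_comp_kmul_dil hf r z)
  · refine Continuous.aestronglyMeasurable ?_
    refine hφ.smooth.continuous.mul ((hfd.comp ?_).clm_apply ?_)
    · exact (continuous_kmul_dil r).comp (Continuous.prodMk_right z)
    · fun_prop
  · have hxc : |x| ≤ c := by
      have := abs_sub_abs_le_abs_sub x r
      rw [Metric.mem_ball, Real.dist_eq] at hx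
      rw [hc]; linarith
    rw [norm_mul, Real.norm_eq_abs]
    refine mul_le_mul_of_nonneg_left ?_ (abs_nonneg _)
    refine (ContinuousLinearMap.le_opNorm _ _).trans (mul_le_mul (hL _) ?_ (norm_nonneg _) hL0)
    have n1 : ‖m.1‖ ≤ ‖m‖ := norm_fst_le m
    have n2 : ‖m.2.1‖ ≤ ‖m‖ := (norm_fst_le m.2).trans (norm_snd_le m)
    have n3 : ‖m.2.2‖ ≤ ‖m‖ := (norm_snd_le m.2).trans (norm_snd_le m)
    have n4 : ‖z.2.2‖ ≤ ‖z‖ := (norm_snd_le z.2).trans (norm_snd_le z)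
    have hm0 := norm_nonneg m
    have hz0 := norm_nonneg z
    have q1 : ‖2 * x * m.1‖ ≤ 2 * c * ‖m‖ := by
      rw [norm_mul, norm_mul, Real.norm_eq_abs x]
      norm_num
      gcongr
      exact n1
    have q2 : ‖(3 * x ^ 2) • m.2.1‖ ≤ 3 * c ^ 2 * ‖m‖ := by
      rw [norm_smul, norm_mul, norm_pow, Real.norm_eq_abs x]
      norm_num
      rw [← sq_abs x]
      gcongr
    have q3 : ‖(2 * x * m.1) • z.2.2‖ ≤ 2 * c * ‖m‖ * ‖z‖ := by
      rw [norm_smul]; gcongr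
    have q4 := norm_add_le ((3 * x ^ 2) • m.2.1) ((2 * x * m.1) • z.2.2)
    have p1 : 0 ≤ c * ‖m‖ := by positivity
    have p2 : 0 ≤ c ^ 2 * ‖m‖ := by positivity
    have p3 : 0 ≤ c * ‖m‖ * ‖z‖ := by positivity
    refine max_le ?_ (max_le ?_ ?_)
    · change ‖2 * x * m.1‖ ≤ _; nlinarith
    · change ‖(3 * x ^ 2) • m.2.1 + (2 * x * m.1) • z.2.2‖ ≤ _; nlinarith
    · change ‖m.2.2‖ ≤ _; nlinarith
  · refine Continuous.integrable_of_hasCompactSupport ?_ ?_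
    · have := hφ.smooth.continuous
      fun_prop
    · exact (hφ.supp.comp_left (g := fun t : ℝ => |t|) abs_zero).mul_right
  · have h := (hf.differentiable (by simp) (kmul z (dil x m))).hasFDerivAt
    exact (h.comp_hasDerivAt x (hasDerivAt_kmul_dil z m x)).const_mul (φ m)

/-- The scale derivative of an average in terms of velocity gradient and the source. -/
lemma TestFn.scale_deriv_eq (hφ : TestFn φ) (hf : ContDiff ℝ (⊤ : ℕ∞) f) {P : Fin d → Pt d → ℝ}
    {S : Pt d → ℝ} (hP : ∀ i, ContDiff ℝ (⊤ : ℕ∞) (P i)) (hS : ContDiff ℝ (⊤ : ℕ∞) S)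
    (heq : ∀ n, _root_.transp f n = ∑ i, fderiv ℝ (P i) n (wdir i) + S n) (z : Pt d)
    {r : ℝ} (hr : 0 < r) :
    ∫ m, φ m * fderiv ℝ f (kmul z (dil r m)) (2 * r * m.1,
      (3 * r ^ 2) • m.2.1 + (2 * r * m.1) • z.2.2, m.2.2) =
    ∑ i, kavg (_root_.gradKer φ i) (fun n => fderiv ℝ f n (wdir i)) r z -
    ∑ i, kavg (fun m => fderiv ℝ (_root_.transpKer φ) m (wdir i)) (P i) r z +
    r * kavg (_root_.transpKer φ) S r z := by
  have hfd : Differentiable ℝ f := hf.differentiable (by simp)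
  have hT := hφ.transpKer
  have h := hφ.integral_mul_euler (smooth_comp_kmul_dil hf r z)
  simp only [fderiv_euler_comp_kmul_dil hfd, fderiv_wdir_comp_kmul_dil hfd,
    transp_comp_kmul_dil hfd] at h
  have hpull : ∀ u w : Pt d → ℝ, ∫ m, u m * (r * w m) = r * ∫ m, u m * w m := fun u w => by
    simp only [mul_left_comm _ r, integral_const_mul]
  rw [hpull, Finset.sum_congr rfl fun i _ => hpull _ _, ← Finset.mul_sum] at h
  have iP : ∀ i, Integrable (fun m => _root_.transpKer φ m *
      (r * fderiv ℝ (P i) (kmul z (dil r m)) (wdir i))) := by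
    intro i
    have := hT.integrable_mul (smooth_fderiv_apply (smooth_comp_kmul_dil (hP i) r z)
      (contDiff_const (c := wdir i)))
    simpa only [fderiv_wdir_comp_kmul_dil ((hP i).differentiable (by simp))] using this
  have iS : Integrable (fun m => _root_.transpKer φ m * S (kmul z (dil r m))) :=
    hT.integrable_mul (smooth_comp_kmul_dil hS r z)
  have e3 : ∫ m, _root_.transpKer φ m * (r ^ 2 * _root_.transp f (kmul z (dil r m))) =
      r * (-∑ i, kavg (fun m => fderiv ℝ (_root_.transpKer φ) m (wdir i)) (P i) r z +
        r * kavg (_root_.transpKer φ) S r z) := by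
    have e4 : ∀ m, _root_.transpKer φ m * (r ^ 2 * _root_.transp f (kmul z (dil r m))) =
        r * (∑ i, _root_.transpKer φ m * (r * fderiv ℝ (P i) (kmul z (dil r m)) (wdir i)) +
          r * (_root_.transpKer φ m * S (kmul z (dil r m)))) := by
      intro m
      rw [heq, ← Finset.mul_sum, ← Finset.mul_sum]
      ring
    simp only [e4, integral_const_mul]
    rw [integral_add (integrable_finsetSum _ fun i _ => iP i) (iS.const_mul r),
      integral_finsetSum _ fun i _ => iP i, integral_const_mul, ← Finset.sum_neg_distrib]
    congr 2
    refine Finset.sum_congr rfl fun i _ => ?_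
    have := hT.integral_mul_dir (smooth_comp_kmul_dil (hP i) r z) (wdir i)
    simp only [fderiv_wdir_comp_kmul_dil ((hP i).differentiable (by simp))] at this
    exact this
  rw [e3] at h
  refine mul_left_cancel₀ hr.ne' (h.trans ?_)
  simp only [kavg]
  ring

end Representation

section TwoScale

variable {d : ℕ} {a g φ : Pt d → ℝ}

lemma LipBump.continuous_kavg {K B ρ : ℝ} (ha : LipBump a K B ρ) (hg : BddInt volume g)
    (hgc : Continuous g) (z : Pt d) : Continuous fun r => kavg a g r z := by
  obtain ⟨M, hM⟩ := hg.bdd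
  have hc : ∀ r, Continuous fun m => g (kmul z (dil r m)) := fun r =>
    hgc.comp ((continuous_kmul_dil r).comp (Continuous.prodMk_right z))
  refine continuous_of_dominated (F := fun r m => a m * g (kmul z (dil r m)))
    (bound := fun m => |a m| * M)
    (fun r => (ha.continuous.mul (hc r)).aestronglyMeasurable) (fun r => .of_forall fun m => ?_)
    (ha.integrable.abs.mul_const M) (.of_forall fun m => ?_)
  · rw [norm_mul, Real.norm_eq_abs, Real.norm_eq_abs]
    exact mul_le_mul_of_nonneg_left (hM _) (abs_nonneg _)
  · refine continuous_const.mul (hgc.comp ?_)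
    unfold kmul dil
    fun_prop

lemma measurable_inv_pow (k : ℕ) : Measurable fun r : ℝ => (r ^ k)⁻¹ :=
  (measurable_id.pow_const k).inv

lemma measurable_mul_inv_pow (k : ℕ) : Measurable fun r : ℝ => r * (r ^ k)⁻¹ :=
  measurable_id.mul (measurable_inv_pow k)

lemma LipBump.integral_kavg {K B ρ : ℝ} (ha : LipBump a K B ρ) (hg : BddInt volume g) (R : ℝ)
    (z : Pt d) : ∫ r in Set.Ioc (1 : ℝ) 16, kavg a g (R * r) z =
      kavg (_root_.avgKer (fun r => (r ^ (4 * d + 2))⁻¹) a) g R z := by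
  rw [← ha.integral_mul_kavg (measurable_inv_pow _) (fun r hr => ?_) hg R z]
  · refine setIntegral_congr_fun measurableSet_Ioc fun r hr => ?_
    have hr0 : 0 < r := by linarith [hr.1]
    change _ = (r ^ (4 * d + 2))⁻¹ * (r ^ (4 * d + 2) * kavg a g (R * r) z)
    rw [inv_mul_cancel_left₀ (pow_pos hr0 _).ne']
  · have hr1 : 1 ≤ r ^ (4 * d + 2) := one_le_pow₀ hr.1.le
    rw [abs_of_nonneg (by positivity)]
    exact inv_le_one_of_one_le₀ hr1

lemma LipBump.integral_id_mul_kavg {K B ρ : ℝ} (ha : LipBump a K B ρ) (hg : BddInt volume g)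
    (R : ℝ) (z : Pt d) : ∫ r in Set.Ioc (1 : ℝ) 16, r * kavg a g (R * r) z =
      kavg (_root_.avgKer (fun r => r * (r ^ (4 * d + 2))⁻¹) a) g R z := by
  rw [← ha.integral_mul_kavg (measurable_mul_inv_pow _) (fun r hr => ?_) hg R z]
  · refine setIntegral_congr_fun measurableSet_Ioc fun r hr => ?_
    have hr0 : 0 < r := by linarith [hr.1]
    change _ = r * (r ^ (4 * d + 2))⁻¹ * (r ^ (4 * d + 2) * kavg a g (R * r) z)
    rw [mul_assoc, inv_mul_cancel_left₀ (pow_pos hr0 _).ne']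
  · have hr0 : 0 < r := by linarith [hr.1]
    have hr1 : r ≤ r ^ (4 * d + 2) := le_self_pow₀ hr.1.le (by omega)
    rw [abs_of_nonneg (by positivity), ← div_eq_mul_inv]
    exact div_le_one_of_le₀ hr1 (by positivity)

/-- The kernels of the two-scale representation. -/
lemma TestFn.kavg_sub_kavg (hφ : TestFn φ) {f S : Pt d → ℝ} {P : Fin d → Pt d → ℝ} {L : ℝ}
    (hf : ContDiff ℝ (⊤ : ℕ∞) f) (hL : ∀ m, ‖fderiv ℝ f m‖ ≤ L)
    (hW : ∀ i, BddInt volume fun n => fderiv ℝ f n (wdir i))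
    (hP : ∀ i, ContDiff ℝ (⊤ : ℕ∞) (P i)) (hP' : ∀ i, BddInt volume (P i))
    (hS : ContDiff ℝ (⊤ : ℕ∞) S) (hS' : BddInt volume S)
    (heq : ∀ n, _root_.transp f n = ∑ i, fderiv ℝ (P i) n (wdir i) + S n) (z : Pt d)
    {R : ℝ} (hR : 0 < R) :
    kavg φ f (16 * R) z - kavg φ f R z =
      R * (∑ i, kavg (avgKer (fun r => (r ^ (4 * d + 2))⁻¹) (_root_.gradKer φ i))
          (fun n => fderiv ℝ f n (wdir i)) R z -
        ∑ i, kavg (avgKer (fun r => (r ^ (4 * d + 2))⁻¹)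
          (fun m => fderiv ℝ (_root_.transpKer φ) m (wdir i))) (P i) R z) +
      R ^ 2 * kavg (avgKer (fun r => r * (r ^ (4 * d + 2))⁻¹) (_root_.transpKer φ)) S R z := by
  have hWc : ∀ i, Continuous fun n => fderiv ℝ f n (wdir i) := fun i =>
    (smooth_fderiv_apply hf (contDiff_const (c := wdir i))).continuous
  have cont : ∀ {u w : Pt d → ℝ}, TestFn u → BddInt volume w → Continuous w →
      Continuous fun r => kavg u w (R * r) z := fun hu hw hwc => by
    obtain ⟨K, B, ρ, hb⟩ := hu.exists_lipBump
    exact (hb.continuous_kavg hw hwc z).comp (continuous_const_mul R)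
  have c1 := fun i => cont (hφ.gradKer i) (hW i) (hWc i)
  have c2 := fun i => cont (hφ.transpKer.dir (wdir i)) (hP' i) (hP i).continuous
  have c3 : Continuous fun r => r * kavg (_root_.transpKer φ) S (R * r) z :=
    continuous_id.mul (cont hφ.transpKer hS' hS.continuous)
  have hD : ∀ r ∈ Set.uIcc (1 : ℝ) 16, HasDerivAt (fun r => kavg φ f (R * r) z)
      (R * (∑ i, kavg (_root_.gradKer φ i) (fun n => fderiv ℝ f n (wdir i)) (R * r) z -
        ∑ i, kavg (fun m => fderiv ℝ (_root_.transpKer φ) m (wdir i)) (P i) (R * r) z) +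
        R ^ 2 * (r * kavg (_root_.transpKer φ) S (R * r) z)) r := by
    intro r hr
    rw [Set.uIcc_of_le (by norm_num)] at hr
    have hr0 : 0 < R * r := mul_pos hR (by linarith [hr.1])
    have h := hφ.hasDerivAt_kavg hf hL z (R * r)
    rw [hφ.scale_deriv_eq hf hP hS heq z hr0] at h
    have h2 : HasDerivAt (fun r : ℝ => R * r) R r := by
      simpa using (hasDerivAt_id r).const_mul R
    refine (h.comp r h2).congr_deriv ?_
    ring
  let A : ℝ → ℝ := fun r =>
    ∑ i, kavg (_root_.gradKer φ i) (fun n => fderiv ℝ f n (wdir i)) (R * r) z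
  let B : ℝ → ℝ := fun r =>
    ∑ i, kavg (fun m => fderiv ℝ (_root_.transpKer φ) m (wdir i)) (P i) (R * r) z
  have cA : Continuous A := continuous_finsetSum Finset.univ fun i _ => c1 i
  have cB : Continuous B := continuous_finsetSum Finset.univ fun i _ => c2 i
  have c12 : Continuous fun r => R * (A r - B r) := continuous_const.mul (cA.sub cB)
  have c4 : Continuous fun r => R ^ 2 * (r * kavg (_root_.transpKer φ) S (R * r) z) :=
    continuous_const.mul c3
  have hI : ∀ {w : ℝ → ℝ}, Continuous w → IntegrableOn w (Set.Ioc (1 : ℝ) 16) := fun hw =>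
    hw.integrableOn_Ioc
  have h := intervalIntegral.integral_eq_sub_of_hasDerivAt hD
    ((c12.add c4).intervalIntegrable 1 16)
  rw [mul_one, mul_comm R 16] at h
  rw [← h, intervalIntegral.integral_of_le (by norm_num)]
  refine (integral_add (hI c12) (hI c4)).trans ?_
  rw [integral_const_mul, integral_const_mul, integral_sub (hI cA) (hI cB),
    integral_finsetSum _ fun i _ => hI (c1 i), integral_finsetSum _ fun i _ => hI (c2 i)]
  have k : ∀ {u w : Pt d → ℝ}, TestFn u → BddInt volume w →
      ∫ r in Set.Ioc (1 : ℝ) 16, kavg u w (R * r) z =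
      kavg (avgKer (fun r => (r ^ (4 * d + 2))⁻¹) u) w R z := fun hu hw => by
    obtain ⟨K, B, ρ, hb⟩ := hu.exists_lipBump
    exact hb.integral_kavg hw R z
  obtain ⟨K, B, ρ, hb⟩ := hφ.transpKer.exists_lipBump
  rw [hb.integral_id_mul_kavg hS' R z, Finset.sum_congr rfl fun i _ => k (hφ.gradKer i) (hW i),
    Finset.sum_congr rfl fun i _ => k (hφ.transpKer.dir (wdir i)) (hP' i)]

lemma exists_testFn (d : ℕ) : ∃ φ : Pt d → ℝ, TestFn φ ∧ ∫ m, φ m = 1 := by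
  have := isAddHaarMeasure_pt (d := d)
  let β : ContDiffBump (0 : Pt d) := ⟨1, 2, one_pos, by norm_num⟩
  exact ⟨β.normed volume, ⟨β.contDiff_normed, β.hasCompactSupport_normed⟩, β.integral_normed⟩

/-- Two-scale representation of averages of solutions of the kinetic equation. -/
lemma exists_representation (d : ℕ) : ∃ (φ e : Pt d → ℝ) (a b : Fin d → Pt d → ℝ),
    (∃ K B ρ, LipBump φ K B ρ) ∧ (∫ m, φ m = 1) ∧ (∃ K B ρ, LipBump e K B ρ) ∧
    (∀ i, ∃ K B ρ, LipBump (a i) K B ρ) ∧ (∀ i, ∃ K B ρ, LipBump (b i) K B ρ) ∧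
    ∀ (f S : Pt d → ℝ) (P : Fin d → Pt d → ℝ) (L : ℝ), ContDiff ℝ (⊤ : ℕ∞) f →
      (∀ m, ‖fderiv ℝ f m‖ ≤ L) → (∀ i, BddInt volume fun n => fderiv ℝ f n (wdir i)) →
      (∀ i, ContDiff ℝ (⊤ : ℕ∞) (P i)) → (∀ i, BddInt volume (P i)) →
      ContDiff ℝ (⊤ : ℕ∞) S → BddInt volume S →
      (∀ n, transp f n = ∑ i, fderiv ℝ (P i) n (wdir i) + S n) → ∀ (z : Pt d) (R : ℝ), 0 < R →
      kavg φ f (16 * R) z - kavg φ f R z =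
        R * (∑ i, kavg (a i) (fun n => fderiv ℝ f n (wdir i)) R z - ∑ i, kavg (b i) (P i) R z) +
        R ^ 2 * kavg e S R z := by
  obtain ⟨φ, hφ, h1⟩ := exists_testFn d
  have hc : ∀ r ∈ Set.Ioc (1 : ℝ) 16, |(r ^ (4 * d + 2))⁻¹| ≤ 1 := fun r hr => by
    rw [abs_of_nonneg (by have := hr.1; positivity)]
    exact inv_le_one_of_one_le₀ (one_le_pow₀ hr.1.le)
  have hc' : ∀ r ∈ Set.Ioc (1 : ℝ) 16, |r * (r ^ (4 * d + 2))⁻¹| ≤ 1 := fun r hr => by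
    have hr0 : 0 < r := by linarith [hr.1]
    rw [abs_of_nonneg (by positivity), ← div_eq_mul_inv]
    exact div_le_one_of_le₀ (le_self_pow₀ hr.1.le (by omega)) (by positivity)
  have hA : ∀ {u : Pt d → ℝ}, TestFn u →
      ∃ K B ρ, LipBump (avgKer (fun r => (r ^ (4 * d + 2))⁻¹) u) K B ρ := fun hu => by
    obtain ⟨K, B, ρ, hb⟩ := hu.exists_lipBump
    exact ⟨_, _, _, hb.avgKer (measurable_inv_pow _) hc⟩
  obtain ⟨K, B, ρ, hb⟩ := hφ.transpKer.exists_lipBump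
  exact ⟨φ, _, _, _, hφ.exists_lipBump, h1,
    ⟨_, _, _, hb.avgKer (measurable_mul_inv_pow _) hc'⟩,
    fun i => hA (hφ.gradKer i), fun i => hA (hφ.transpKer.dir (wdir i)),
    fun f S P L hf hL hW hP hP' hS hS' heq z R hR =>
      hφ.kavg_sub_kavg hf hL hW hP hP' hS hS' heq z hR⟩

end TwoScale

section AdditiveEstimate

variable {d : ℕ} {a g : Pt d → ℝ} {K B ρ : ℝ}

lemma eLpNorm_ofReal_eq {X : Type*} [MeasurableSpace X] (μ : Measure X) (u : X → ℝ) {p : ℝ}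
    (hp : 0 < p) :
    eLpNorm u (ENNReal.ofReal p) μ = (∫⁻ x, ENNReal.ofReal |u x| ^ p ∂μ) ^ (1 / p) := by
  rw [eLpNorm_eq_lintegral_rpow_enorm_toReal (ENNReal.ofReal_pos.2 hp).ne' ENNReal.ofReal_ne_top,
    ENNReal.toReal_ofReal hp.le]
  simp only [← ofReal_norm, Real.norm_eq_abs]

lemma BddInt.eLpNorm_eq {u : Pt d → ℝ} (hu : BddInt volume u) {p : ℝ} (hp : 1 ≤ p) :
    eLpNorm u (ENNReal.ofReal p) volume = ENNReal.ofReal ((∫ x, |u x| ^ p) ^ (1 / p)) := by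
  have hp0 : 0 < p := by linarith
  rw [eLpNorm_ofReal_eq volume u hp0, ← ENNReal.ofReal_rpow_of_nonneg
    (integral_nonneg fun x => by positivity) (by positivity), ← ofReal_integral_rpow hu hp]
  simp only [ENNReal.ofReal_rpow_of_nonneg (abs_nonneg _) hp0.le]

lemma BddInt.add {X : Type*} [MeasurableSpace X] {μ : Measure X} {u w : X → ℝ}
    (hu : BddInt μ u) (hw : BddInt μ w) : BddInt μ (fun x => u x + w x) := by
  obtain ⟨M, hM⟩ := hu.bdd
  obtain ⟨N, hN⟩ := hw.bdd
  exact ⟨hu.meas.add hw.meas, hu.int.add hw.int, M + N, fun x =>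
    (abs_add_le _ _).trans (add_le_add (hM x) (hN x))⟩

lemma BddInt.sum {X ι : Type*} [MeasurableSpace X] {μ : Measure X} {u : ι → X → ℝ}
    (s : Finset ι) (hu : ∀ i ∈ s, BddInt μ (u i)) : BddInt μ (fun x => ∑ i ∈ s, u i x) := by
  classical
  induction s using Finset.induction_on with
  | empty => exact ⟨by simp, by simp, 0, by simp⟩
  | insert i s hi ih =>
    simp only [Finset.sum_insert hi]
    exact (hu i (Finset.mem_insert_self _ _)).add
      (ih fun j hj => hu j (Finset.mem_insert_of_mem hj))

lemma LipBump.bddInt_kavg_fracDx (ha : LipBump a K B ρ) (hd : 1 ≤ d) (hg : BddInt volume g)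
    (R : ℝ) : BddInt volume (kavg (fracDx a) g R) :=
  BddInt.kavg ha.measurable_fracDx (ha.integrable_fracDx hd) hg R

lemma LipBump.exists_eLpNorm_sum_le (ha : LipBump a K B ρ) (hd : 1 ≤ d) {p : ℝ} (hp : 1 < p) :
    ∃ C : ℝ, 0 ≤ C ∧ ∀ (s : Finset ℤ) (g : Pt d → ℝ), BddInt volume g →
      eLpNorm (fun z => ∑ j ∈ s, kavg (fracDx a) g ((16 : ℝ) ^ j) z) (ENNReal.ofReal p) volume ≤
        ENNReal.ofReal C * eLpNorm g (ENNReal.ofReal p) volume := by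
  have hp0 : 0 < p := by linarith
  obtain ⟨C, hC, h⟩ := ha.exists_sum_dyadic_le hd hp
  refine ⟨C ^ (1 / p), by positivity, fun s g hg => ?_⟩
  have hI : 0 ≤ ∫ x, |g x| ^ p := integral_nonneg fun x => by positivity
  rw [(BddInt.sum s fun j _ => ha.bddInt_kavg_fracDx hd hg _).eLpNorm_eq hp.le,
    hg.eLpNorm_eq hp.le, ← ENNReal.ofReal_mul (by positivity), ← Real.mul_rpow hC hI]
  exact ENNReal.ofReal_le_ofReal (Real.rpow_le_rpow (integral_nonneg fun x => by positivity)
    (h s g hg) (by positivity))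

lemma LipBump.exists_eLpNorm_weighted_sum_le (ha : LipBump a K B ρ) (hd : 1 ≤ d) {p q : ℝ}
    (hp : 1 < p) (hq : 1 < q) (hqQ : q < (4 * d + 2 : ℕ))
    (hpq : 1 / q = 1 / p + 1 / (4 * d + 2 : ℕ)) :
    ∃ C : ℝ, 0 ≤ C ∧ ∀ (s : Finset ℤ) (g : Pt d → ℝ), BddInt volume g →
      eLpNorm (fun z => ∑ j ∈ s, (16 : ℝ) ^ j * kavg (fracDx a) g ((16 : ℝ) ^ j) z)
        (ENNReal.ofReal p) volume ≤ ENNReal.ofReal C * eLpNorm g (ENNReal.ofReal q) volume := by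
  have hp0 : 0 < p := by linarith
  obtain ⟨C, hC, h⟩ := ha.exists_sum_dyadic_rpow_le hd hp hq hqQ hpq
  refine ⟨C ^ (1 / p), by positivity, fun s g hg => ?_⟩
  have hI : 0 ≤ ∫ x, |g x| ^ q := integral_nonneg fun x => by positivity
  rw [eLpNorm_ofReal_eq _ _ hp0, hg.eLpNorm_eq hq.le, ← ENNReal.ofReal_mul (by positivity)]
  refine (ENNReal.rpow_le_rpow (h s g hg) (by positivity)).trans_eq ?_
  rw [ENNReal.ofReal_rpow_of_nonneg (by positivity) (by positivity),
    Real.mul_rpow hC (by positivity), ← Real.rpow_mul hI]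
  congr 3
  field_simp

lemma sum_Ico_neg_sub (u : ℤ → ℝ) (N : ℕ) :
    ∑ j ∈ Finset.Ico (-N : ℤ) N, (u (j + 1) - u j) = u N - u (-N) := by
  induction N with
  | zero => simp
  | succ N ih =>
    have e : Finset.Ico (-(N + 1 : ℕ) : ℤ) (N + 1 : ℕ) =
        insert (-(N + 1 : ℤ)) (insert (N : ℤ) (Finset.Ico (-N : ℤ) N)) := by
      ext j; simp only [Finset.mem_Ico, Finset.mem_insert]; omega
    rw [e, Finset.sum_insert (by simp only [Finset.mem_Ico, Finset.mem_insert]; omega),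
      Finset.sum_insert (by simp), ih]
    have : -(N + 1 : ℤ) + 1 = -N := by ring
    rw [this]
    push_cast
    ring

lemma exists_eLpNorm_fracDx_le (hd : 1 ≤ d) {p q : ℝ} (hp : 1 < p) (hq : 1 < q)
    (hqQ : q < (4 * d + 2 : ℕ)) (hpq : 1 / q = 1 / p + 1 / (4 * d + 2 : ℕ)) :
    ∃ C : ℝ, 0 ≤ C ∧ ∀ (f S : Pt d → ℝ) (P : Fin d → Pt d → ℝ) (L c : ℝ) (X Y : ℝ≥0∞),
      ContDiff ℝ (⊤ : ℕ∞) f → BddInt volume f → (∀ m, ‖fderiv ℝ f m‖ ≤ L) → 0 ≤ c →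
      (∀ h m, |secDiff f h m| ≤ c * min 1 ‖h‖) →
      (∀ i, BddInt volume fun n => fderiv ℝ f n (wdir i)) →
      (∀ i, ContDiff ℝ (⊤ : ℕ∞) (P i)) → (∀ i, BddInt volume (P i)) →
      ContDiff ℝ (⊤ : ℕ∞) S → BddInt volume S →
      (∀ n, transp f n = ∑ i, fderiv ℝ (P i) n (wdir i) + S n) →
      (∀ i, eLpNorm (fun n => fderiv ℝ f n (wdir i)) (ENNReal.ofReal p) volume ≤ X) →
      (∀ i, eLpNorm (P i) (ENNReal.ofReal p) volume ≤ Y) →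
      eLpNorm (fracDx f) (ENNReal.ofReal p) volume ≤
        ENNReal.ofReal C * (X + Y + eLpNorm S (ENNReal.ofReal q) volume) := by
  obtain ⟨φ, e, a, b, ⟨K, B, ρ, hφ⟩, hφ1, ⟨K', B', ρ', he⟩, ha, hb, hrep⟩ :=
    exists_representation d
  choose Ka Ba ρa ha using ha
  choose Kb Bb ρb hb using hb
  choose Ca hCa hCa' using fun i => (ha i).exists_eLpNorm_sum_le hd hp
  choose Cb hCb hCb' using fun i => (hb i).exists_eLpNorm_sum_le hd hp
  obtain ⟨Ce, hCe, hCe'⟩ := he.exists_eLpNorm_weighted_sum_le hd hp hq hqQ hpq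
  have hp1 : 1 ≤ ENNReal.ofReal p := by
    rw [← ENNReal.ofReal_one]; exact ENNReal.ofReal_le_ofReal hp.le
  have sa : 0 ≤ ∑ i, Ca i := Finset.sum_nonneg fun i _ => hCa i
  have sb : 0 ≤ ∑ i, Cb i := Finset.sum_nonneg fun i _ => hCb i
  refine ⟨∑ i, Ca i + ∑ i, Cb i + Ce, by positivity, ?_⟩
  intro f S P L c X Y hf hf' hL hc hs hW hP hP' hS hS' heq hX hY
  let U : ℕ → Pt d → ℝ := fun N z =>
    (∑ i, ∑ j ∈ Finset.Ico (-N : ℤ) N,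
      kavg (fracDx (a i)) (fun n => fderiv ℝ f n (wdir i)) ((16 : ℝ) ^ j) z) -
    (∑ i, ∑ j ∈ Finset.Ico (-N : ℤ) N, kavg (fracDx (b i)) (P i) ((16 : ℝ) ^ j) z) +
    ∑ j ∈ Finset.Ico (-N : ℤ) N, (16 : ℝ) ^ j * kavg (fracDx e) S ((16 : ℝ) ^ j) z
  have step : ∀ (R : ℝ) (z : Pt d), 0 < R →
      fracDx (kavg φ f (16 * R)) z - fracDx (kavg φ f R) z =
        ∑ i, kavg (fracDx (a i)) (fun n => fderiv ℝ f n (wdir i)) R z -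
        ∑ i, kavg (fracDx (b i)) (P i) R z + R * kavg (fracDx e) S R z := by
    intro R z hR
    have k1 := hφ.fracDx_kavg hd hf' (R := 16 * R) (by positivity) z
    have k2 := hφ.fracDx_kavg hd hf' hR z
    have ka := fun i => (ha i).fracDx_kavg hd (hW i) hR z
    have kb := fun i => (hb i).fracDx_kavg hd (hP' i) hR z
    have ke := he.fracDx_kavg hd hS' hR z
    have qa := FracAt.sum Finset.univ fun i _ => (ka i).1
    have qb := FracAt.sum Finset.univ fun i _ => (kb i).1
    have qab := qa.1.sub qb.1
    have qabR := qab.1.const_mul R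
    have qe := ke.1.const_mul (R ^ 2)
    rw [← (k1.1.sub k2.1).2]
    have e1 := funext fun z => hrep f S P L hf hL hW hP hP' hS hS' heq z R hR
    rw [e1, (qabR.1.add qe.1).2, qabR.2, qab.2, qa.2, qb.2, qe.2, ke.2]
    simp only [(ka _).2, (kb _).2, ← Finset.mul_sum]
    field_simp
  have hU : ∀ N z, U N z = fracDx (kavg φ f ((16 : ℝ) ^ N)) z -
      fracDx (kavg φ f ((16 : ℝ)⁻¹ ^ N)) z := by
    intro N z
    have h := sum_Ico_neg_sub (fun j => fracDx (kavg φ f ((16 : ℝ) ^ j)) z) N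
    rw [zpow_natCast, zpow_neg, zpow_natCast, ← inv_pow] at h
    rw [← h]
    have e1 : ∀ j : ℤ, (16 : ℝ) ^ (j + 1) = 16 * 16 ^ j := fun j => by
      rw [zpow_add_one₀ (by norm_num), mul_comm]
    simp only [e1, step _ _ (zpow_pos (by norm_num : (0 : ℝ) < 16) _), Finset.sum_add_distrib,
      Finset.sum_sub_distrib, U]
    congr 2 <;> exact Finset.sum_comm
  have hlim : ∀ z, Filter.Tendsto (fun N => U N z) Filter.atTop (nhds (-fracDx f z)) := by
    intro z
    have t1 := hφ.tendsto_fracDx_kavg_atTop hd hf' (R := fun N => (16 : ℝ) ^ N)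
      (fun N => by positivity) (tendsto_pow_atTop_atTop_of_one_lt (by norm_num)) z
    have t2 := tendsto_fracDx_kavg hd hφ.continuous.measurable hφ.integrable hφ1 hf'
      hf.continuous hc hs (R := fun N => (16 : ℝ)⁻¹ ^ N)
      (tendsto_pow_atTop_nhds_zero_of_lt_one (by norm_num) (by norm_num)) z
    simp only [hU]
    simpa using t1.sub t2
  have ma : ∀ N : ℕ, ∀ i, BddInt volume fun z => ∑ j ∈ Finset.Ico (-N : ℤ) N,
      kavg (fracDx (a i)) (fun n => fderiv ℝ f n (wdir i)) ((16 : ℝ) ^ j) z := fun N i =>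
    BddInt.sum _ fun j _ => (ha i).bddInt_kavg_fracDx hd (hW i) _
  have mb : ∀ N : ℕ, ∀ i, BddInt volume fun z => ∑ j ∈ Finset.Ico (-N : ℤ) N,
      kavg (fracDx (b i)) (P i) ((16 : ℝ) ^ j) z := fun N i =>
    BddInt.sum _ fun j _ => (hb i).bddInt_kavg_fracDx hd (hP' i) _
  have me : ∀ N : ℕ, Measurable fun z => ∑ j ∈ Finset.Ico (-N : ℤ) N,
      (16 : ℝ) ^ j * kavg (fracDx e) S ((16 : ℝ) ^ j) z := fun N =>
    Finset.measurable_sum _ fun j _ =>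
      (he.bddInt_kavg_fracDx hd hS' _).meas.const_mul _
  have sma := fun N => (BddInt.sum Finset.univ fun i _ => ma N i).meas.aestronglyMeasurable
    (μ := volume)
  have smb := fun N => (BddInt.sum Finset.univ fun i _ => mb N i).meas.aestronglyMeasurable
    (μ := volume)
  have sme := fun N => (me N).aestronglyMeasurable (μ := volume)
  have hUm : ∀ N, AEStronglyMeasurable (U N) volume := fun N =>
    ((sma N).sub (smb N)).add (sme N)
  have hbound : ∀ N, eLpNorm (U N) (ENNReal.ofReal p) volume ≤
      ENNReal.ofReal (∑ i, Ca i + ∑ i, Cb i + Ce) *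
        (X + Y + eLpNorm S (ENNReal.ofReal q) volume) := by
    intro N
    have b1 : eLpNorm (fun z => ∑ i, ∑ j ∈ Finset.Ico (-N : ℤ) N,
        kavg (fracDx (a i)) (fun n => fderiv ℝ f n (wdir i)) ((16 : ℝ) ^ j) z)
        (ENNReal.ofReal p) volume ≤ ENNReal.ofReal (∑ i, Ca i) * X := by
      rw [ENNReal.ofReal_sum_of_nonneg fun i _ => hCa i, Finset.sum_mul]
      have := eLpNorm_sum_le (s := Finset.univ) (μ := volume)
        (fun i _ => (ma N i).meas.aestronglyMeasurable) hp1
      simp only [Finset.sum_fn] at this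
      refine this.trans (Finset.sum_le_sum fun i _ => (hCa' i _ _ (hW i)).trans ?_)
      gcongr
      exact hX i
    have b2 : eLpNorm (fun z => ∑ i, ∑ j ∈ Finset.Ico (-N : ℤ) N,
        kavg (fracDx (b i)) (P i) ((16 : ℝ) ^ j) z)
        (ENNReal.ofReal p) volume ≤ ENNReal.ofReal (∑ i, Cb i) * Y := by
      rw [ENNReal.ofReal_sum_of_nonneg fun i _ => hCb i, Finset.sum_mul]
      have := eLpNorm_sum_le (s := Finset.univ) (μ := volume)
        (fun i _ => (mb N i).meas.aestronglyMeasurable) hp1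
      simp only [Finset.sum_fn] at this
      refine this.trans (Finset.sum_le_sum fun i _ => (hCb' i _ _ (hP' i)).trans ?_)
      gcongr
      exact hY i
    have b3 := hCe' (Finset.Ico (-N : ℤ) N) S hS'
    refine (eLpNorm_add_le ((sma N).sub (smb N)) (sme N) hp1).trans ?_
    refine (add_le_add ((eLpNorm_sub_le (sma N) (smb N) hp1).trans (add_le_add b1 b2)) b3).trans ?_
    rw [mul_add, mul_add]
    gcongr <;> linarith
  have hneg : eLpNorm (fracDx f) (ENNReal.ofReal p) volume =
      eLpNorm (fun z => -fracDx f z) (ENNReal.ofReal p) volume :=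
    (eLpNorm_neg (fracDx f) _ volume).symm
  rw [hneg]
  refine (Lp.eLpNorm_lim_le_liminf_eLpNorm hUm _ (.of_forall hlim)).trans ?_
  refine (Filter.liminf_le_liminf (.of_forall hbound)).trans_eq ?_
  exact Filter.liminf_const _

end AdditiveEstimate

section SchwartzData

variable {d : ℕ}

lemma SchwartzMap.bddInt (f : SchwartzMap (Pt d) ℝ) : BddInt volume (⇑f) := by
  have := isAddHaarMeasure_pt (d := d)
  exact ⟨f.continuous.measurable, f.integrable, SchwartzMap.seminorm ℝ 0 0 f,
    f.norm_le_seminorm ℝ⟩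

lemma SchwartzMap.norm_fderiv_le (f : SchwartzMap (Pt d) ℝ) (m : Pt d) :
    ‖fderiv ℝ f m‖ ≤ SchwartzMap.seminorm ℝ 0 0 (SchwartzMap.fderivCLM ℝ (Pt d) ℝ f) :=
  (SchwartzMap.fderivCLM ℝ (Pt d) ℝ f).norm_le_seminorm ℝ m

lemma SchwartzMap.bddInt_fderiv_apply (f : SchwartzMap (Pt d) ℝ) (w : Pt d) :
    BddInt volume fun n => fderiv ℝ f n w :=
  (SchwartzMap.evalCLM ℝ (Pt d) ℝ w (SchwartzMap.fderivCLM ℝ (Pt d) ℝ f)).bddInt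

lemma SchwartzMap.exists_abs_secDiff_le (f : SchwartzMap (Pt d) ℝ) :
    ∃ c, 0 ≤ c ∧ ∀ h m, |secDiff f h m| ≤ c * min 1 ‖h‖ := by
  set M := SchwartzMap.seminorm ℝ 0 0 f
  set L := SchwartzMap.seminorm ℝ 0 0 (SchwartzMap.fderivCLM ℝ (Pt d) ℝ f)
  have hM : 0 ≤ M := apply_nonneg _ _
  have hL : 0 ≤ L := apply_nonneg _ _
  have hb : ∀ m, |f m| ≤ M := f.norm_le_seminorm ℝ
  have hlip : ∀ m n : Pt d, |f m - f n| ≤ L * ‖m - n‖ := fun m n =>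
    convex_univ.norm_image_sub_le_of_norm_fderiv_le (𝕜 := ℝ) (fun x _ => f.differentiableAt)
      (fun x _ => f.norm_fderiv_le x) (Set.mem_univ n) (Set.mem_univ m)
  refine ⟨4 * M + 2 * L, by positivity, fun h m => ?_⟩
  have a1 := hlip m (m.1, m.2.1 + h, m.2.2)
  have a2 := hlip m (m.1, m.2.1 - h, m.2.2)
  have e1 : ‖m - (m.1, m.2.1 + h, m.2.2)‖ = ‖h‖ := by
    simp [Prod.norm_def]
  have e2 : ‖m - (m.1, m.2.1 - h, m.2.2)‖ = ‖h‖ := by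
    simp [Prod.norm_def]
  rw [e1] at a1
  rw [e2] at a2
  have b0 := hb m
  have b1 := hb (m.1, m.2.1 + h, m.2.2)
  have b2 := hb (m.1, m.2.1 - h, m.2.2)
  have hh := norm_nonneg h
  rw [abs_le] at a1 a2 b0 b1 b2
  rw [mul_min_of_nonneg _ _ (by positivity), le_min_iff, secDiff]
  constructor
  · rw [abs_le]; constructor <;> linarith
  · have := mul_nonneg hM hh
    rw [abs_le]; constructor <;> linarith

/-- The velocity gradient as a continuous linear function of the differential. -/
def gradVCLM (d : ℕ) : (Pt d →L[ℝ] ℝ) →L[ℝ] V d :=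
  ((EuclideanSpace.equiv (Fin d) ℝ).symm : (Fin d → ℝ) →L[ℝ] V d).comp
    (ContinuousLinearMap.pi fun i => ContinuousLinearMap.apply ℝ ℝ (wdir i : Pt d))

lemma gradV_eq_schwartz (f : SchwartzMap (Pt d) ℝ) : gradV (⇑f) =
    ⇑((SchwartzMap.fderivCLM ℝ (Pt d) ℝ f).postcompCLM (gradVCLM d)) := rfl

lemma gradV_apply (u : Pt d → ℝ) (z : Pt d) (i : Fin d) :
    gradV u z i = fderiv ℝ u z (wdir i) := rfl

/-- The additive transfer-of-regularity estimate. -/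
lemma exists_additive_estimate (hd : 1 ≤ d) {p q : ℝ} (hp : 1 < p) (hq : 1 < q)
    (hqQ : q < (4 * d + 2 : ℕ)) (hpq : 1 / q = 1 / p + 1 / (4 * d + 2 : ℕ)) :
    ∃ C : ℝ, 0 ≤ C ∧ ∀ (f : SchwartzMap (Pt d) ℝ) (S0 : SchwartzMap (Pt d) (V d))
      (S1 : SchwartzMap (Pt d) ℝ),
      (∀ z : Pt d, fderiv ℝ (⇑f) z (1, z.2.2, 0) =
        (∑ i : Fin d, fderiv ℝ (⇑S0) z (0, 0, EuclideanSpace.single i 1) i) + S1 z) →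
      eLpNorm (fracDx (⇑f)) (ENNReal.ofReal p) volume ≤ ENNReal.ofReal C *
        (eLpNorm (gradV (⇑f)) (ENNReal.ofReal p) volume +
          eLpNorm (⇑S0) (ENNReal.ofReal p) volume + eLpNorm (⇑S1) (ENNReal.ofReal q) volume) := by
  obtain ⟨C, hC, h⟩ := exists_eLpNorm_fracDx_le hd hp hq hqQ hpq
  refine ⟨C, hC, fun f S0 S1 heq => ?_⟩
  obtain ⟨c, hc, hs⟩ := f.exists_abs_secDiff_le
  let P : Fin d → SchwartzMap (Pt d) ℝ := fun i =>
    S0.postcompCLM (EuclideanSpace.proj i : V d →L[ℝ] ℝ)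
  have hP : ∀ i z, P i z = S0 z i := fun i z => rfl
  have hfd : ∀ i z w, fderiv ℝ (P i) z w = fderiv ℝ S0 z w i := by
    intro i z w
    have := ((EuclideanSpace.proj i : V d →L[ℝ] ℝ).hasFDerivAt.comp z
      (S0.differentiableAt (x := z)).hasFDerivAt).fderiv
    change fderiv ℝ ((EuclideanSpace.proj i : V d →L[ℝ] ℝ) ∘ S0) z w = _
    rw [this]; rfl
  refine h f S1 (fun i => P i) _ c _ _ (f.smooth _) f.bddInt f.norm_fderiv_le hc hs
    (fun i => f.bddInt_fderiv_apply _) (fun i => (P i).smooth _) (fun i => (P i).bddInt)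
    (S1.smooth _) S1.bddInt (fun n => ?_) (fun i => ?_) (fun i => ?_)
  · simp only [hfd]; exact heq n
  · refine eLpNorm_mono fun z => ?_
    rw [← gradV_apply]
    exact PiLp.norm_apply_le _ _
  · refine eLpNorm_mono fun z => ?_
    rw [hP]
    exact PiLp.norm_apply_le _ _

end SchwartzData

section Scaling

variable {d : ℕ}

/-- The dilation `(t,x,v) ↦ (λt, λx, v)`. -/
def txDil (d : ℕ) {r : ℝ} (hr : 0 < r) : Pt d ≃L[ℝ] Pt d :=
  (ContinuousLinearEquiv.smulLeft (Units.mk0 r hr.ne')).prodCongr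
    ((ContinuousLinearEquiv.smulLeft (Units.mk0 r hr.ne')).prodCongr
      (ContinuousLinearEquiv.refl ℝ (V d)))

lemma txDil_apply {r : ℝ} (hr : 0 < r) (z : Pt d) :
    txDil d hr z = (r * z.1, r • z.2.1, z.2.2) := rfl

lemma eLpNorm_comp_txDil {E : Type*} [NormedAddCommGroup E] {r : ℝ} (hr : 0 < r) (g : Pt d → E)
    {p : ℝ} (hp : 0 < p) :
    eLpNorm (fun z => g (txDil d hr z)) (ENNReal.ofReal p) volume =
      ENNReal.ofReal (r ^ (-((d : ℝ) + 1) / p)) * eLpNorm g (ENNReal.ofReal p) volume := by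
  have hm : Measure.map (txDil d hr) volume =
      ENNReal.ofReal (r ^ (d + 1))⁻¹ • (volume : Measure (Pt d)) := by
    have := map_stretch (d := d) hr hr one_pos
    rw [one_pow, mul_one, ← pow_succ'] at this
    rw [← this]
    congr 1
    ext1 z
    rw [txDil_apply, one_smul]
  have h := (txDil d hr).toHomeomorph.measurableEmbedding.eLpNorm_map_measure (g := g)
    (p := ENNReal.ofReal p) (μ := volume)
  change eLpNorm g _ (Measure.map (txDil d hr) volume) = eLpNorm (fun z => g (txDil d hr z)) _ _ at h
  rw [← h, hm, eLpNorm_smul_measure_of_ne_top ENNReal.ofReal_ne_top, smul_eq_mul,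
    ENNReal.toReal_div, ENNReal.toReal_one, ENNReal.toReal_ofReal hp.le, ENNReal.ofReal_rpow_of_pos (by positivity)]
  congr 2
  rw [← Real.rpow_natCast, ← Real.rpow_neg hr.le, ← Real.rpow_mul hr.le]
  congr 1
  push_cast
  ring

lemma fracDx_comp_txDil {r : ℝ} (hr : 0 < r) (u : Pt d → ℝ) (z : Pt d) :
    fracDx (fun z => u (txDil d hr z)) z = r ^ ((1 : ℝ) / 3) * fracDx u (txDil d hr z) := by
  have h := Measure.integral_comp_smul (volume : Measure (V d))
    (fun h => secDiff u h (txDil d hr z) * ‖h‖ ^ (-(d : ℝ) - 1 / 3)) r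
  rw [fracDx_eq, fracDx_eq]
  have e : ∀ h : V d, secDiff (fun z => u (txDil d hr z)) h z * ‖h‖ ^ (-(d : ℝ) - 1 / 3) =
      r ^ ((d : ℝ) + 1 / 3) *
        (secDiff u (r • h) (txDil d hr z) * ‖r • h‖ ^ (-(d : ℝ) - 1 / 3)) := by
    intro h
    rw [norm_smul, Real.norm_of_nonneg hr.le, Real.mul_rpow hr.le (norm_nonneg _)]
    have e1 : r ^ ((d : ℝ) + 1 / 3) * r ^ (-(d : ℝ) - 1 / 3) = 1 := by
      rw [← Real.rpow_add hr]
      convert Real.rpow_zero r using 2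
      ring
    have e2 : secDiff (fun z => u (txDil d hr z)) h z = secDiff u (r • h) (txDil d hr z) := by
      simp only [secDiff, txDil_apply, smul_add, smul_sub]
    rw [e2]
    linear_combination -(secDiff u (r • h) (txDil d hr z) * ‖h‖ ^ (-(d : ℝ) - 1 / 3)) * e1
  simp only [e]
  rw [integral_const_mul, h, finrank_euclideanSpace_fin, abs_of_pos (by positivity), smul_eq_mul,
    ← mul_assoc, Real.rpow_add hr, Real.rpow_natCast]
  congr 1
  field_simp

lemma fderiv_comp_txDil {E : Type*} [NormedAddCommGroup E] [NormedSpace ℝ E] {r : ℝ} (hr : 0 < r)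
    (g : SchwartzMap (Pt d) E) (z w : Pt d) :
    fderiv ℝ (fun z => g (txDil d hr z)) z w = fderiv ℝ g (txDil d hr z) (txDil d hr w) := by
  have := ((g.differentiableAt (x := txDil d hr z)).hasFDerivAt.comp z
    (txDil d hr).hasFDerivAt).fderiv
  change fderiv ℝ (g ∘ txDil d hr) z w = _
  rw [this]; rfl

end Scaling

section Optimization

lemma div_rpow_mul_right {a b : ℝ} (ha : 0 < a) (hb : 0 < b) (s : ℝ) :
    (a / b) ^ s * b = a ^ s * b ^ (1 - s) := by
  rw [Real.div_rpow ha.le hb.le, Real.rpow_sub hb, Real.rpow_one]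
  field_simp

lemma div_rpow_neg_mul_left {a b : ℝ} (ha : 0 < a) (hb : 0 < b) (s : ℝ) :
    (a / b) ^ (-s) * a = a ^ (1 - s) * b ^ s := by
  rw [Real.rpow_neg (by positivity), Real.div_rpow ha.le hb.le, Real.rpow_sub ha, Real.rpow_one]
  field_simp

lemma le_of_forall_scale_of_pos {X C A B D θ : ℝ} (hC : 0 ≤ C) (hA : 0 < A) (hB : 0 < B)
    (hD : 0 < D) (h0 : 0 < θ) (h1 : θ < 1)
    (h : ∀ r : ℝ, 0 < r → X ≤ C * (r ^ (-(1 / 3) : ℝ) * A + r ^ ((2 : ℝ) / 3) * B +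
      r ^ ((1 - θ) / (3 * θ)) * D)) :
    X ≤ 2 * C * (A ^ ((2 : ℝ) / 3) * B ^ ((1 : ℝ) / 3) + A ^ (1 - θ) * D ^ θ) := by
  have hx : 0 < A / B := by positivity
  have hy : 0 < (A / D) ^ (3 * θ) := by positivity
  set r := min (A / B) ((A / D) ^ (3 * θ)) with hr
  have hr0 : 0 < r := lt_min hx hy
  have e1 : r ^ ((2 : ℝ) / 3) * B ≤ A ^ ((2 : ℝ) / 3) * B ^ ((1 : ℝ) / 3) := by
    have := div_rpow_mul_right hA hB (2 / 3)
    rw [show (1 : ℝ) - 2 / 3 = 1 / 3 by norm_num] at this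
    rw [← this]
    gcongr
    exact min_le_left _ _
  have e2 : r ^ ((1 - θ) / (3 * θ)) * D ≤ A ^ (1 - θ) * D ^ θ := by
    have := div_rpow_mul_right hA hD (1 - θ)
    rw [_root_.sub_sub_cancel] at this
    rw [← this, show 1 - θ = 3 * θ * ((1 - θ) / (3 * θ)) by field_simp, Real.rpow_mul (by positivity),
      show 3 * θ * ((1 - θ) / (3 * θ)) = 1 - θ by field_simp]
    have : 0 ≤ (1 - θ) / (3 * θ) := div_nonneg (by linarith) (by linarith)
    gcongr
    exact min_le_right _ _
  have e3 : r ^ (-(1 / 3) : ℝ) * A ≤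
      A ^ ((2 : ℝ) / 3) * B ^ ((1 : ℝ) / 3) + A ^ (1 - θ) * D ^ θ := by
    rcases min_choice (A / B) ((A / D) ^ (3 * θ)) with hc | hc
    · have := div_rpow_neg_mul_left hA hB (1 / 3)
      rw [show (1 : ℝ) - 1 / 3 = 2 / 3 by norm_num] at this
      rw [hr, hc, this]
      exact le_add_of_nonneg_right (by positivity)
    · rw [hr, hc, ← Real.rpow_mul (by positivity), show 3 * θ * (-(1 / 3)) = -θ by ring,
        div_rpow_neg_mul_left hA hD]
      exact le_add_of_nonneg_left (by positivity)
  calc X ≤ _ := h r hr0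
    _ ≤ C * (2 * (A ^ ((2 : ℝ) / 3) * B ^ ((1 : ℝ) / 3) + A ^ (1 - θ) * D ^ θ)) := by
        gcongr; linarith
    _ = _ := by ring

/-- Optimising an additive one-parameter family of bounds gives a multiplicative one. -/
lemma le_of_forall_scale {X C A B D θ : ℝ} (hC : 0 ≤ C) (hA : 0 ≤ A) (hB : 0 ≤ B)
    (hD : 0 ≤ D) (h0 : 0 < θ) (h1 : θ < 1)
    (h : ∀ r : ℝ, 0 < r → X ≤ C * (r ^ (-(1 / 3) : ℝ) * A + r ^ ((2 : ℝ) / 3) * B +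
      r ^ ((1 - θ) / (3 * θ)) * D)) :
    X ≤ 2 * C * (A ^ ((2 : ℝ) / 3) * B ^ ((1 : ℝ) / 3) + A ^ (1 - θ) * D ^ θ) := by
  have hcont : Filter.Tendsto (fun ε : ℝ => 2 * C * ((A + ε) ^ ((2 : ℝ) / 3) *
      (B + ε) ^ ((1 : ℝ) / 3) + (A + ε) ^ (1 - θ) * (D + ε) ^ θ)) (nhdsWithin 0 (Set.Ioi 0))
      (nhds (2 * C * ((A + 0) ^ ((2 : ℝ) / 3) * (B + 0) ^ ((1 : ℝ) / 3) +
        (A + 0) ^ (1 - θ) * (D + 0) ^ θ))) := by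
    refine (Continuous.tendsto ?_ 0).mono_left nhdsWithin_le_nhds
    have hs : ∀ (a s : ℝ), 0 ≤ s → Continuous fun ε : ℝ => (a + ε) ^ s := fun a s hs =>
      (continuous_const.add continuous_id).rpow_const fun _ => Or.inr hs
    have := hs A (2 / 3) (by norm_num)
    have := hs B (1 / 3) (by norm_num)
    have := hs A (1 - θ) (by linarith)
    have := hs D θ h0.le
    fun_prop
  simp only [add_zero] at hcont
  refine ge_of_tendsto hcont ?_
  filter_upwards [self_mem_nhdsWithin] with ε (hε : 0 < ε)
  refine le_of_forall_scale_of_pos hC (by linarith) (by linarith) (by linarith) h0 h1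
    fun r hr => (h r hr).trans ?_
  gcongr <;> linarith

end Optimization

section Main

variable {d : ℕ}

/-- The additive estimate applied to the dilates `f(λt, λx, v)`. -/
lemma exists_scaled_estimate (hd : 1 ≤ d) {p q : ℝ} (hp : 1 < p) (hq : 1 < q)
    (hqQ : q < (4 * d + 2 : ℕ)) (hpq : 1 / q = 1 / p + 1 / (4 * d + 2 : ℕ)) :
    ∃ C : ℝ, 0 ≤ C ∧ ∀ (f : SchwartzMap (Pt d) ℝ) (S0 : SchwartzMap (Pt d) (V d))
      (S1 : SchwartzMap (Pt d) ℝ),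
      (∀ z : Pt d, fderiv ℝ (⇑f) z (1, z.2.2, 0) =
        (∑ i : Fin d, fderiv ℝ (⇑S0) z (0, 0, EuclideanSpace.single i 1) i) + S1 z) →
      ∀ r : ℝ, 0 < r → (eLpNorm (fracDx (⇑f)) (ENNReal.ofReal p) volume).toReal ≤ C *
        (r ^ (-(1 / 3) : ℝ) * (eLpNorm (gradV (⇑f)) (ENNReal.ofReal p) volume).toReal +
          r ^ ((2 : ℝ) / 3) * (eLpNorm (⇑S0) (ENNReal.ofReal p) volume).toReal +
          r ^ ((2 : ℝ) / 3 - ((d : ℝ) + 1) / (4 * d + 2)) *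
            (eLpNorm (⇑S1) (ENNReal.ofReal q) volume).toReal) := by
  have := isAddHaarMeasure_pt (d := d)
  obtain ⟨C, hC, h⟩ := exists_additive_estimate hd hp hq hqQ hpq
  refine ⟨C, hC, fun f S0 S1 heq r hr => ?_⟩
  have hp0 : 0 < p := by linarith
  have hq0 : 0 < q := by linarith
  set f' := SchwartzMap.compCLMOfContinuousLinearEquiv ℝ (txDil d hr) f
  set S0' := r • SchwartzMap.compCLMOfContinuousLinearEquiv ℝ (txDil d hr) S0
  set S1' := r • SchwartzMap.compCLMOfContinuousLinearEquiv ℝ (txDil d hr) S1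
  have cf : ⇑f' = fun z => f (txDil d hr z) := rfl
  have c0 : ⇑S0' = r • fun z => S0 (txDil d hr z) := rfl
  have c1 : ⇑S1' = r • fun z => S1 (txDil d hr z) := rfl
  have hw : ∀ i, txDil d hr (0, 0, EuclideanSpace.single i 1) =
      (0, 0, EuclideanSpace.single i 1) := fun i => by
    rw [txDil_apply]; simp
  have hdiff : ∀ z, DifferentiableAt ℝ (fun z => S0 (txDil d hr z)) z := fun z =>
    (SchwartzMap.compCLMOfContinuousLinearEquiv ℝ (txDil d hr) S0).differentiableAt
  have hmain := h f' S0' S1' fun z => by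
    have h0 : ∀ i, fderiv ℝ (⇑S0') z (0, 0, EuclideanSpace.single i 1) i =
        r * fderiv ℝ S0 (txDil d hr z) (0, 0, EuclideanSpace.single i 1) i := fun i => by
      rw [c0, fderiv_const_smul (hdiff z), smul_apply, fderiv_comp_txDil, hw]
      rfl
    have h1 : txDil d hr (1, z.2.2, 0) = r • (1, (txDil d hr z).2.2, 0) := by
      rw [txDil_apply, txDil_apply]; simp
    rw [cf, fderiv_comp_txDil, h1, map_smul, heq, c1]
    simp only [h0]
    rw [← Finset.mul_sum, smul_add]
    rfl
  have hG : gradV (⇑f') = fun z => gradV (⇑f) (txDil d hr z) := by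
    funext z
    ext i
    rw [gradV_apply, gradV_apply, cf, fderiv_comp_txDil]
    congr 1
    exact hw i
  have hF : fracDx (⇑f') = r ^ ((1 : ℝ) / 3) • fun z => fracDx (⇑f) (txDil d hr z) := by
    funext z
    rw [cf, fracDx_comp_txDil]; rfl
  have fA : eLpNorm (gradV (⇑f)) (ENNReal.ofReal p) volume ≠ ⊤ := by
    rw [gradV_eq_schwartz]; exact (SchwartzMap.eLpNorm_lt_top _ _ _).ne
  have fB : eLpNorm (⇑S0) (ENNReal.ofReal p) volume ≠ ⊤ := (SchwartzMap.eLpNorm_lt_top _ _ _).ne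
  have fD : eLpNorm (⇑S1) (ENNReal.ofReal q) volume ≠ ⊤ := (SchwartzMap.eLpNorm_lt_top _ _ _).ne
  rw [hF, hG, c0, c1, eLpNorm_const_smul, eLpNorm_const_smul, eLpNorm_const_smul,
    eLpNorm_comp_txDil hr _ hp0, eLpNorm_comp_txDil hr _ hp0, eLpNorm_comp_txDil hr _ hp0,
    eLpNorm_comp_txDil hr _ hq0] at hmain
  have hmain' := ENNReal.toReal_mono (by finiteness) hmain
  rw [ENNReal.toReal_mul, ENNReal.toReal_mul, ENNReal.toReal_mul, ENNReal.toReal_add (by finiteness)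
    (by finiteness), ENNReal.toReal_add (by finiteness) (by finiteness), ENNReal.toReal_mul,
    ENNReal.toReal_mul, ENNReal.toReal_mul, ENNReal.toReal_mul, ENNReal.toReal_mul,
    ENNReal.toReal_ofReal hC, toReal_enorm, toReal_enorm,
    ENNReal.toReal_ofReal (by positivity), ENNReal.toReal_ofReal (by positivity),
    Real.norm_of_nonneg hr.le, Real.norm_of_nonneg (by positivity)] at hmain'
  generalize (eLpNorm (fracDx (⇑f)) (ENNReal.ofReal p) volume).toReal = X at *
  generalize (eLpNorm (gradV (⇑f)) (ENNReal.ofReal p) volume).toReal = A at *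
  generalize (eLpNorm (⇑S0) (ENNReal.ofReal p) volume).toReal = B at *
  generalize (eLpNorm (⇑S1) (ENNReal.ofReal q) volume).toReal = D at *
  set a := r ^ (-((d : ℝ) + 1) / p)
  set c := r ^ ((1 : ℝ) / 3)
  have ha : 0 < a := by positivity
  have hc : 0 < c := by positivity
  have t1 : r ^ (-(1 / 3) : ℝ) * c = 1 := by
    rw [← Real.rpow_add hr]; norm_num
  have t2 : r ^ ((2 : ℝ) / 3) * c = r := by
    rw [← Real.rpow_add hr]; norm_num
  have t3 : r ^ ((2 : ℝ) / 3 - ((d : ℝ) + 1) / (4 * d + 2)) * (c * a) =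
      r * r ^ (-((d : ℝ) + 1) / q) := by
    have e : ∀ s : ℝ, r * r ^ s = r ^ (1 + s) := fun s => by rw [Real.rpow_add hr, Real.rpow_one]
    rw [← Real.rpow_add hr, ← Real.rpow_add hr, e]
    congr 1
    rw [div_eq_mul_one_div _ q, hpq]
    push_cast
    ring
  refine le_of_mul_le_mul_left (a := c * a) ?_ (by positivity)
  calc c * a * X = c * (a * X) := by ring
    _ ≤ _ := hmain'
    _ = _ := by
      linear_combination (-(C * a * A)) * t1 - C * a * B * t2 - C * D * t3

end Main

/-- **Corollary 4.3: multiplicative, scale-invariant transfer-of-regularity estimate.**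
Let `Q = 4d+2`, `p ∈ (Q/(Q−1), ∞)` and `1/q = 1/p + 1/Q`. There is `C = C(d,p) > 0` such
that for every Schwartz `f` with `(∂_t + v·∇_x) f = ∇_v · S₀ + S₁`, `S₀, S₁` Schwartz,
`‖𝔇_x f‖_{L^p} ≤ C (‖∇_v f‖_{L^p}^{2/3} ‖S₀‖_{L^p}^{1/3}
  + ‖∇_v f‖_{L^p}^{(5d+1)/(3(3d+1))} ‖S₁‖_{L^q}^{2(2d+1)/(3(3d+1))})`. -/
theorem statement19 (d : ℕ) (hd : 1 ≤ d) (p q : ℝ)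
    (hp : (4 * (d : ℝ) + 2) / (4 * (d : ℝ) + 1) < p)
    (hq : 1 / q = 1 / p + 1 / (4 * (d : ℝ) + 2)) :
    ∃ C : ℝ, 0 < C ∧
      ∀ (f : SchwartzMap (Pt d) ℝ) (S0 : SchwartzMap (Pt d) (V d))
        (S1 : SchwartzMap (Pt d) ℝ),
        (∀ z : Pt d, fderiv ℝ (⇑f) z (1, z.2.2, 0) =
          (∑ i : Fin d, fderiv ℝ (⇑S0) z (0, 0, EuclideanSpace.single i 1) i) + S1 z) →
        (eLpNorm (fracDx (⇑f)) (ENNReal.ofReal p) volume).toReal ≤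
          C * ((eLpNorm (gradV (⇑f)) (ENNReal.ofReal p) volume).toReal ^ ((2 : ℝ) / 3) *
                (eLpNorm (⇑S0) (ENNReal.ofReal p) volume).toReal ^ ((1 : ℝ) / 3) +
              (eLpNorm (gradV (⇑f)) (ENNReal.ofReal p) volume).toReal ^
                  ((5 * (d : ℝ) + 1) / (3 * (3 * (d : ℝ) + 1))) *
                (eLpNorm (⇑S1) (ENNReal.ofReal q) volume).toReal ^
                  ((2 * (2 * (d : ℝ) + 1)) / (3 * (3 * (d : ℝ) + 1)))) := by
  have hd0 : (0 : ℝ) ≤ d := d.cast_nonneg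
  have hQ : ((4 * d + 2 : ℕ) : ℝ) = 4 * (d : ℝ) + 2 := by push_cast; ring
  have hp1 : 1 < p := lt_trans (by rw [one_lt_div (by positivity)]; linarith) hp
  have hp0 : 0 < p := by linarith
  have hq0 : 0 < 1 / q := by rw [hq]; positivity
  have hq0' : 0 < q := one_div_pos.mp hq0
  have hq1 : 1 < q := by
    have h1 : 1 / p < (4 * (d : ℝ) + 1) / (4 * d + 2) := by
      rw [← one_div_div (4 * (d : ℝ) + 2)]
      exact one_div_lt_one_div_of_lt (by positivity) hp
    have h2 : (4 * (d : ℝ) + 1) / (4 * d + 2) + 1 / (4 * d + 2) = 1 := by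
      field_simp; ring
    rw [← one_div_lt_one_div hq0' one_pos, hq, one_div_one]
    linarith
  have hqQ : q < (4 * d + 2 : ℕ) := by
    rw [hQ, ← one_div_lt_one_div (by positivity) hq0', hq]
    exact lt_add_of_pos_left _ (by positivity)
  obtain ⟨C, hC, h⟩ := exists_scaled_estimate hd hp1 hq1 hqQ (by rw [hQ]; exact hq)
  refine ⟨2 * C + 1, by positivity, fun f S0 S1 heq => ?_⟩
  have e1 : (5 * (d : ℝ) + 1) / (3 * (3 * (d : ℝ) + 1)) =
      1 - 2 * (2 * (d : ℝ) + 1) / (3 * (3 * (d : ℝ) + 1)) := by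
    field_simp; ring
  have hlt : 2 * (2 * (d : ℝ) + 1) / (3 * (3 * (d : ℝ) + 1)) < 1 := by
    rw [div_lt_one (by positivity)]; linarith
  have e2 : (2 : ℝ) / 3 - ((d : ℝ) + 1) / (4 * d + 2) =
      (1 - 2 * (2 * (d : ℝ) + 1) / (3 * (3 * (d : ℝ) + 1))) /
        (3 * (2 * (2 * (d : ℝ) + 1) / (3 * (3 * (d : ℝ) + 1)))) := by
    field_simp; ring
  have hs := h f S0 S1 heq
  rw [e2] at hs
  rw [e1]
  refine (le_of_forall_scale hC toReal_nonneg toReal_nonneg toReal_nonneg (by positivity) hlt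
    hs).trans ?_
  refine mul_le_mul_of_nonneg_right (by linarith) ?_
  positivity
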